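/- There exists a fiber bundle over the 6-sphere S⁶ with fiber the 2-sphere S² whose total space Z is simply connected and has trivial fifth homotopy group, i.e. π₅(Z, z) is the trivial group for every basepoint z ∈ Z. -/

import Mathlib

/-- The unit sphere `Sⁿ ⊂ ℝⁿ⁺¹` with the subspace topology. -/
abbrev unitSphere (n : ℕ) : Type :=
  Metric.sphere (0 : EuclideanSpace ℝ (Fin (n + 1))) 1

/-- `p : Z → B` is a fiber bundle with fiber `F`: it is continuous and locally trivial. -/
def IsFiberBundleWithFiber (F : Type*) [TopologicalSpace F] {Z B : Type*}
    [TopologicalSpace Z] [TopologicalSpace B] (p : Z → B) : Prop :=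
  Continuous p ∧ ∀ b : B, ∃ U : Set B, IsOpen U ∧ b ∈ U ∧
    ∃ φ : (p ⁻¹' U) ≃ₜ (U × F), ∀ z : p ⁻¹' U, ((φ z).1 : B) = p (z : Z)

namespace S6
open Set Topology Module
open scoped unitInterval

/-- A space that is a retract of a `k`-dimensional real vector space. -/
def CubeLike (k : ℕ) (X : Type) [TopologicalSpace X] : Prop :=
  ∃ (V : Type) (_ : NormedAddCommGroup V) (_ : NormedSpace ℝ V) (_ : FiniteDimensional ℝ V)
    (i : C(X, V)) (r : C(V, X)), finrank ℝ V = k ∧ ∀ x, r (i x) = x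

theorem cubeLike_I : CubeLike 1 I :=
  ⟨ℝ, inferInstance, inferInstance, inferInstance, ⟨Subtype.val, continuous_subtype_val⟩,
    ⟨projIcc 0 1 zero_le_one, continuous_projIcc⟩, by simp, fun x => by
      simp⟩

theorem cubeLike_pi (n : ℕ) : CubeLike n (Fin n → I) :=
  ⟨Fin n → ℝ, inferInstance, inferInstance, inferInstance,
    ⟨fun x i => x i, by fun_prop⟩,
    ⟨fun x i => projIcc 0 1 zero_le_one (x i), by
      refine continuous_pi fun i => continuous_projIcc.comp (continuous_apply i)⟩,
    by simp, fun x => by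
      funext i; simp⟩

theorem CubeLike.prod {k l : ℕ} {X Y : Type} [TopologicalSpace X] [TopologicalSpace Y]
    (hX : CubeLike k X) (hY : CubeLike l Y) : CubeLike (k + l) (X × Y) := by
  obtain ⟨V, _, _, _, i, r, hd, h⟩ := hX
  obtain ⟨W, _, _, _, i', r', hd', h'⟩ := hY
  refine ⟨V × W, inferInstance, inferInstance, inferInstance, i.prodMap i', r.prodMap r', ?_, ?_⟩
  · simp [hd, hd']
  · rintro ⟨x, y⟩; simp [h, h']

theorem sphere_lemma {k : ℕ} {X E : Type} [TopologicalSpace X] [CompactSpace X]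
    [NormedAddCommGroup E] [NormedSpace ℝ E] [FiniteDimensional ℝ E]
    (hX : CubeLike k X) (hk : k + 1 < finrank ℝ E) (v : C(X, E)) (hv : ∀ x, v x ≠ 0)
    (w : E) (hw : w ≠ 0) :
    ∃ H : C(I × X, E), (∀ z, H z ≠ 0) ∧ (∀ x, H (0, x) = v x) ∧ (∀ x, H (1, x) = w) ∧
      ∀ x, v x = w → ∀ s, H (s, x) = w := by
  obtain ⟨V, _, _, _, i, r, hd, hir⟩ := hX
  obtain ⟨ε, hε, hεw, hεv⟩ : ∃ ε > 0, ε ≤ ‖w‖ ∧ ∀ x, ε ≤ ‖v x‖ := by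
    by_cases hne : Nonempty X
    · obtain ⟨x0, -, hx0⟩ := isCompact_univ.exists_isMinOn (univ_nonempty (α := X))
        (f := fun x => ‖v x‖) (by fun_prop)
      refine ⟨min ‖w‖ ‖v x0‖, lt_min (norm_pos_iff.2 hw) (norm_pos_iff.2 (hv x0)),
        min_le_left _ _, fun x => (min_le_right _ _).trans (hx0 (mem_univ x))⟩
    · exact ⟨‖w‖, norm_pos_iff.2 hw, le_rfl, fun x => (hne ⟨x⟩).elim⟩
  obtain ⟨p0, hp0, hp0v, -⟩ := (show Continuous (fun y => v (r y)) by fun_prop).exists_contDiff_approx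
    (1 : ℕ∞) (ε := fun _ => ε / 4) continuous_const (fun _ => by positivity)
  have hdense : Dense (range (fun z : ℝ × V => z.1 • w - p0 z.2))ᶜ := by
    apply ContDiff.dense_compl_range_of_finrank_lt_finrank
    · have : ContDiff ℝ 1 p0 := by exact_mod_cast hp0
      fun_prop
    · simp [hd]; omega
  obtain ⟨c, hc, hcε⟩ := hdense.exists_dist_lt (0 : E) (ε := ε / 4) (by positivity)
  set p : X → E := fun x => p0 (i x) + c with hp
  have hpc : Continuous p := by
    have := hp0.continuous
    fun_prop
  have hpw : ∀ x (t : ℝ), p x ≠ t • w := by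
    intro x t h
    apply hc
    refine ⟨(t, i x), ?_⟩
    simp only [hp] at h
    simp only
    rw [← h]; abel
  have hpv : ∀ x, ‖p x - v x‖ < ε / 2 := by
    intro x
    have h1 := hp0v (i x)
    rw [hir, dist_eq_norm] at h1
    rw [dist_zero_left] at hcε
    calc ‖p x - v x‖ = ‖(p0 (i x) - v x) + c‖ := by congr 1; simp only [hp]; abel
      _ ≤ _ := norm_add_le _ _
      _ < ε / 2 := by linarith
  set θ : X → ℝ := fun x => min 1 (‖v x - w‖ / (ε / 2)) with hθ
  have hθc : Continuous θ := by fun_prop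
  have hθ0 : ∀ x, 0 ≤ θ x := fun x => le_min zero_le_one (by positivity)
  have hθ1 : ∀ x, θ x ≤ 1 := fun x => min_le_left _ _
  set u : X → E := fun x => w + θ x • (p x - w) with hu
  have huc : Continuous u := by fun_prop
  have hball : ∀ (z a b : E), ε ≤ ‖z‖ → ‖a - z‖ < ε → ‖b - z‖ < ε → ∀ t : ℝ, 0 ≤ t → t ≤ 1 →
      a + t • (b - a) ≠ 0 := by
    intro z a b hz ha hb t ht0 ht1 h
    have := (convex_ball z ε) (x := a) (by simpa [dist_eq_norm] using ha) (y := b)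
      (by simpa [dist_eq_norm] using hb) (a := 1 - t) (b := t) (by linarith) ht0 (by ring)
    have h2 : (1 - t) • a + t • b = 0 := by rw [← h]; module
    rw [h2] at this
    simp at this
    linarith
  have seg1 : ∀ x (t : ℝ), 0 ≤ t → t ≤ 1 → v x + t • (u x - v x) ≠ 0 := by
    intro x t ht0 ht1
    by_cases h : ‖v x - w‖ < ε / 2
    · refine hball w _ _ hεw (by linarith) ?_ t ht0 ht1
      have : u x - w = θ x • (p x - w) := by simp [hu]
      rw [this, norm_smul, Real.norm_of_nonneg (hθ0 x)]
      have h3 : ‖p x - w‖ < ε := by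
        calc ‖p x - w‖ = ‖(p x - v x) + (v x - w)‖ := by congr 1; abel
          _ ≤ _ := norm_add_le _ _
          _ < ε := by linarith [hpv x]
      calc θ x * ‖p x - w‖ ≤ 1 * ‖p x - w‖ := by gcongr; exact hθ1 x
        _ < ε := by linarith
    · have : θ x = 1 := by
        simp only [hθ]
        apply min_eq_left
        rw [le_div_iff₀ (by positivity)]; linarith
      have hux : u x = p x := by simp [hu, this]
      refine hball (v x) _ _ (hεv x) (by simpa using hε) ?_ t ht0 ht1
      rw [hux]; linarith [hpv x]
  have seg2 : ∀ x (t : ℝ), w + t • (u x - w) ≠ 0 := by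
    intro x t h
    have h1 : w + (t * θ x) • (p x - w) = 0 := by
      rw [← h]; simp only [hu]; module
    by_cases h0 : t * θ x = 0
    · rw [h0] at h1; simp at h1; exact hw h1
    · apply hpw x ((t * θ x)⁻¹ * (t * θ x - 1))
      have : (t * θ x) • p x = (t * θ x - 1) • w := by
        have : (t * θ x) • p x - (t * θ x - 1) • w = w + (t * θ x) • (p x - w) := by module
        rw [h1] at this
        exact sub_eq_zero.1 this
      rw [mul_smul, ← this, smul_smul, inv_mul_cancel₀ h0, one_smul]
  refine ⟨⟨fun z => (1 - max (2 * (z.1 : ℝ) - 1) 0) • (v z.2 + (min (2 * (z.1 : ℝ)) 1) • (u z.2 - v z.2)) +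
    max (2 * (z.1 : ℝ) - 1) 0 • w, by fun_prop⟩, ?_, ?_, ?_, ?_⟩
  · rintro ⟨s, x⟩
    simp only [ContinuousMap.coe_mk]
    rcases le_total (2 * (s : ℝ)) 1 with h | h
    · rw [min_eq_left h, max_eq_right (by linarith)]
      simpa using seg1 x (2 * s) (by have := s.2.1; linarith) h
    · rw [min_eq_right h, max_eq_left (by linarith)]
      have := seg2 x (2 - 2 * s)
      convert this using 1
      module
  · intro x; simp
  · intro x; simp; norm_num
  · intro x hx s
    have h1 : u x = w := by simp [hu, hθ, hx]
    simp only [ContinuousMap.coe_mk, hx, h1]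
    module

end S6

namespace S6
open Set Topology Module
open scoped unitInterval

theorem hlp {E B X : Type} [TopologicalSpace E] [TopologicalSpace B] [TopologicalSpace X]
    [CompactSpace X] (p : E → B) (hp : Continuous p) (U : Set (B × B)) (hU : IsOpen U)
    (hd : ∀ b, (b, b) ∈ U) (T : E × B → E)
    (hT : ContinuousOn T {z | (p z.1, z.2) ∈ U})
    (hpT : ∀ e b, (p e, b) ∈ U → p (T (e, b)) = b) (hTe : ∀ e, T (e, p e) = e)
    (f : C(X, E)) (H : C(I × X, B)) (h0 : ∀ x, H (0, x) = p (f x)) :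
    ∃ L : C(I × X, E), (∀ x, L (0, x) = f x) ∧ (∀ z, p (L z) = H z) ∧
      (∀ x, (∀ s, H (s, x) = H (0, x)) → ∀ s, L (s, x) = f x) ∧
      ∀ x y, f x = f y → (∀ s, H (s, x) = H (s, y)) → ∀ s, L (s, x) = L (s, y) := by
  -- uniform constant
  obtain ⟨δ, hδ, hδU⟩ : ∃ δ : ℝ, 0 < δ ∧ ∀ (s s' : I) (x : X), |(s : ℝ) - s'| < δ →
      (H (s, x), H (s', x)) ∈ U := by
    set K : Set (I × I × X) := {z | (H (z.1, z.2.2), H (z.2.1, z.2.2)) ∉ U} with hK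
    have hKc : IsClosed K := by
      have : K = (fun z : I × I × X => (H (z.1, z.2.2), H (z.2.1, z.2.2))) ⁻¹' Uᶜ := rfl
      rw [this]
      exact hU.isClosed_compl.preimage (by fun_prop)
    by_cases hne : K.Nonempty
    · obtain ⟨z, hz, hm⟩ := hKc.isCompact.exists_isMinOn hne
        (f := fun z => |(z.1 : ℝ) - z.2.1|) (by fun_prop)
      refine ⟨|(z.1 : ℝ) - z.2.1|, ?_, ?_⟩
      · rw [abs_pos, sub_ne_zero]
        intro h
        apply hz
        rw [Subtype.ext h]
        exact hd _
      · intro s s' x hs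
        by_contra hc
        exact absurd (hm (show (s, s', x) ∈ K from hc)) (not_le.2 hs)
    · refine ⟨1, one_pos, fun s s' x _ => ?_⟩
      by_contra hc
      exact hne ⟨(s, s', x), hc⟩
  obtain ⟨N, hN⟩ := exists_nat_gt (1 / δ)
  have hNpos : (0 : ℝ) < N := lt_trans (by positivity) hN
  let c : ℕ → I → I := fun j s => projIcc 0 1 zero_le_one (min (s : ℝ) (j / N))
  have hcc : ∀ j, Continuous (c j) := fun j => continuous_projIcc.comp (by fun_prop)
  have hcv : ∀ j s, ((c j s : I) : ℝ) = min (s : ℝ) (j / N) := by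
    intro j s
    have : min (s : ℝ) (j / N) ∈ Icc (0 : ℝ) 1 :=
      ⟨le_min s.2.1 (by positivity), (min_le_left _ _).trans s.2.2⟩
    simp only [c]
    rw [projIcc_of_mem _ this]
  have hc0 : ∀ s, c 0 s = 0 := fun s => by
    apply Subtype.ext; rw [hcv]; simpa using s.2.1
  have hcz : ∀ j, c j 0 = 0 := fun j => by
    apply Subtype.ext; rw [hcv]; simp; positivity
  have hcN : ∀ s, c N s = s := fun s => by
    apply Subtype.ext; rw [hcv, div_self hNpos.ne']; simpa using s.2.2
  have hstep : ∀ j s x, (H (c j s, x), H (c (j + 1) s, x)) ∈ U := by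
    intro j s x
    apply hδU
    rw [hcv, hcv]
    have h1 : ((j + 1 : ℕ) : ℝ) / N = j / N + 1 / N := by push_cast; ring
    have h2 : 1 / (N : ℝ) < δ := by
      rw [div_lt_iff₀ hNpos]; rw [div_lt_iff₀ hδ] at hN; linarith
    rw [h1]
    have h3 : 0 < 1 / (N : ℝ) := by positivity
    rw [abs_lt]
    rcases le_total (s : ℝ) (j / N) with h | h
    · rw [min_eq_left h, min_eq_left (by linarith)]; constructor <;> linarith
    · rw [min_eq_right h]
      rcases le_total (s : ℝ) (j / N + 1 / N) with h' | h'
      · rw [min_eq_left h']; constructor <;> linarith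
      · rw [min_eq_right h']; constructor <;> linarith
  have main : ∀ j : ℕ, ∃ L : C(I × X, E), (∀ x, L (0, x) = f x) ∧
      (∀ s x, p (L (s, x)) = H (c j s, x)) ∧
      (∀ x, (∀ s, H (s, x) = H (0, x)) → ∀ s, L (s, x) = f x) ∧
      ∀ x y, f x = f y → (∀ s, H (s, x) = H (s, y)) → ∀ s, L (s, x) = L (s, y) := by
    intro j
    induction j with
    | zero =>
      refine ⟨⟨fun z => f z.2, by fun_prop⟩, fun x => rfl, fun s x => ?_, fun x _ s => rfl,
        fun x y h _ s => h⟩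
      simp [hc0, h0]
    | succ j ih =>
      obtain ⟨L, h1, h2, h3, h4⟩ := ih
      refine ⟨⟨fun z => T (L z, H (c (j + 1) z.1, z.2)), ?_⟩, ?_, ?_, ?_, ?_⟩
      · have := hcc (j + 1)
        refine hT.comp_continuous (by fun_prop) ?_
        rintro ⟨s, x⟩
        simp only [mem_setOf_eq, h2]
        exact hstep j s x
      · intro x
        simp only [ContinuousMap.coe_mk, hcz, h1, h0, hTe]
      · intro s x
        simp only [ContinuousMap.coe_mk]
        apply hpT
        rw [h2]
        exact hstep j s x
      · intro x hx s
        simp only [ContinuousMap.coe_mk, h3 x hx s]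
        rw [hx, h0, hTe]
      · intro x y hxy hH s
        simp only [ContinuousMap.coe_mk, h4 x y hxy hH s, hH]
  obtain ⟨L, h1, h2, h3, h4⟩ := main N
  refine ⟨L, h1, ?_, h3, h4⟩
  rintro ⟨s, x⟩
  rw [h2, hcN]

end S6

set_option linter.unusedSectionVars false
set_option linter.unusedVariables false
set_option linter.deprecated false

namespace S6
open Set Topology Module Matrix
open scoped unitInterval

theorem joinedIn_of_homotopy {X Y : Type} [TopologicalSpace X] [TopologicalSpace Y]
    {S : Set C(X, Y)} {f g : C(X, Y)} (H : C(I × X, Y)) (h0 : ∀ x, H (0, x) = f x)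
    (h1 : ∀ x, H (1, x) = g x) (hS : ∀ t, H.curry t ∈ S) : JoinedIn S f g :=
  ⟨⟨H.curry, ContinuousMap.ext h0, ContinuousMap.ext h1⟩, hS⟩

theorem homotopy_of_joinedIn {X Y : Type} [TopologicalSpace X] [TopologicalSpace Y]
    [LocallyCompactSpace X] {S : Set C(X, Y)} {f g : C(X, Y)} (h : JoinedIn S f g) :
    ∃ H : C(I × X, Y), (∀ x, H (0, x) = f x) ∧ (∀ x, H (1, x) = g x) ∧
      ∀ t, H.curry t ∈ S := by
  obtain ⟨γ, hγ⟩ := h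
  refine ⟨ContinuousMap.uncurry γ.toContinuousMap, fun x => ?_, fun x => ?_, fun t => ?_⟩
  · simp
  · simp
  · have : (ContinuousMap.uncurry γ.toContinuousMap).curry t = γ t := by ext x; rfl
    rw [this]; exact hγ t

section Compress
variable {ι K : Type} [Fintype ι] [DecidableEq ι] [NormedDivisionRing K] [NormedAlgebra ℝ K]
  [StarRing K] [ContinuousStar K]

/-- `M` is the identity outside of `s × s`. -/
def Supp (s : Finset ι) (M : Matrix ι ι K) : Prop :=
  ∀ i j, (i ∉ s ∨ j ∉ s) → M i j = (1 : Matrix ι ι K) i j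

theorem Supp.mul {s : Finset ι} {M N : Matrix ι ι K} (hM : Supp s M) (hN : Supp s N) :
    Supp s (M * N) := by
  intro i j h
  rcases h with h | h
  · have : (M * N) i j = ((1 : Matrix ι ι K) * N) i j := by
      rw [Matrix.mul_apply, Matrix.mul_apply]
      exact Finset.sum_congr rfl fun l _ => by rw [hM i l (Or.inl h)]
    rw [this, one_mul]; exact hN i j (Or.inl h)
  · have : (M * N) i j = (M * (1 : Matrix ι ι K)) i j := by
      rw [Matrix.mul_apply, Matrix.mul_apply]
      exact Finset.sum_congr rfl fun l _ => by rw [hN l j (Or.inr h)]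
    rw [this, mul_one]; exact hM i j (Or.inr h)

theorem isUnit_one_add_vecMulVec (u φ : ι → K) (h : 1 + φ ⬝ᵥ u ≠ 0) :
    IsUnit (1 + vecMulVec u φ) := by
  set d := (1 + φ ⬝ᵥ u)⁻¹ with hd
  have h1 : d * (1 + φ ⬝ᵥ u) = 1 := inv_mul_cancel₀ h
  have h2 : (1 + φ ⬝ᵥ u) * d = 1 := mul_inv_cancel₀ h
  refine ⟨⟨1 + vecMulVec u φ, 1 - vecMulVec u (d • φ), ?_, ?_⟩, rfl⟩
  · rw [mul_sub, add_mul _ _ (vecMulVec _ _), mul_one, one_mul, vecMulVec_mul_vecMulVec]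
    have : vecMulVec u (d • φ) + vecMulVec u ((φ ⬝ᵥ u) • d • φ) = vecMulVec u φ := by
      rw [← vecMulVec_add, ← one_smul K (d • φ), smul_smul, smul_smul,
        ← add_smul, one_mul, ← one_add_mul, h2, one_smul]
    rw [add_sub_assoc, this.symm]; abel
  · rw [mul_add, sub_mul _ _ (vecMulVec _ _), mul_one, one_mul, vecMulVec_mul_vecMulVec]
    have : vecMulVec u (d • φ) + vecMulVec u ((d • φ ⬝ᵥ u) • φ) = vecMulVec u φ := by
      rw [← vecMulVec_add, ← add_smul, smul_dotProduct, smul_eq_mul, ← mul_one_add, h1, one_smul]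
    rw [← sub_eq_zero] at this
    rw [← sub_eq_zero, ← neg_eq_zero, ← this]; abel

/-- sum of squares of norms -/
noncomputable def nsq (v : ι → K) : ℝ := ∑ i, ‖v i‖ ^ 2

theorem nsq_pos {v : ι → K} (h : v ≠ 0) : 0 < nsq v := by
  obtain ⟨i, hi⟩ := Function.ne_iff.1 h
  refine Finset.sum_pos' (fun _ _ => by positivity) ⟨i, Finset.mem_univ _, ?_⟩
  have : 0 < ‖v i‖ := norm_pos_iff.2 hi
  positivity

/-- dual functional -/
noncomputable def dual (v : ι → K) : ι → K := fun i => (nsq v)⁻¹ • star (v i)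

theorem dual_dot (hK : ∀ a : K, star a * a = algebraMap ℝ K (‖a‖ ^ 2)) {v : ι → K} (h : v ≠ 0) :
    dual v ⬝ᵥ v = 1 := by
  have : dual v ⬝ᵥ v = (nsq v)⁻¹ • ∑ i, algebraMap ℝ K (‖v i‖ ^ 2) := by
    rw [dotProduct, Finset.smul_sum]
    exact Finset.sum_congr rfl fun i _ => by simp only [dual]; rw [smul_mul_assoc, hK]
  rw [this, ← map_sum, Algebra.smul_def, ← map_mul]
  have : (nsq v)⁻¹ * ∑ i, ‖v i‖ ^ 2 = 1 := inv_mul_cancel₀ (nsq_pos h).ne'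
  rw [this, map_one]


theorem Supp.one (s : Finset ι) : Supp s (1 : Matrix ι ι K) := fun _ _ _ => rfl

theorem Supp.one_add_vecMulVec {s : Finset ι} {u φ : ι → K} (hu : ∀ i, i ∉ s → u i = 0)
    (hφ : ∀ i, i ∉ s → φ i = 0) : Supp s (1 + vecMulVec u φ) := by
  rintro i j (h | h)
  · simp [vecMulVec_apply, hu i h]
  · simp [vecMulVec_apply, hφ j h]

theorem Supp.mono {s t : Finset ι} (h : s ⊆ t) {M : Matrix ι ι K} (hM : Supp s M) : Supp t M := by
  rintro i j (hi | hj)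
  · exact hM i j (Or.inl fun h' => hi (h h'))
  · exact hM i j (Or.inr fun h' => hj (h h'))

theorem continuousOn_dual : ContinuousOn (dual : (ι → K) → ι → K) {v | v ≠ 0} := by
  unfold dual
  refine continuousOn_pi.2 fun i => ContinuousOn.smul ?_ (by fun_prop)
  refine ContinuousOn.inv₀ ?_ fun v hv => (nsq_pos hv).ne'
  unfold nsq
  fun_prop

/-- invertible matrices supported in `t` -/
abbrev GLs (K : Type) [NormedDivisionRing K] (t : Finset ι) : Type := {M : Matrix ι ι K // IsUnit M ∧ Supp t M}

/-- nonzero vectors supported in `t` -/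
abbrev NZs (K : Type) [NormedDivisionRing K] (t : Finset ι) : Type := {v : ι → K // v ≠ 0 ∧ ∀ i, i ∉ t → v i = 0}

variable [FiniteDimensional ℝ K]

theorem compress_step (hK : ∀ a : K, star a * a = algebraMap ℝ K (‖a‖ ^ 2))
    {X : Type} [TopologicalSpace X] [CompactSpace X] {k : ℕ}
    (hX : CubeLike k X) (s : Finset ι) (a : ι) (ha : a ∉ s)
    (hk : k + 1 < finrank ℝ K * (s.card + 1)) (f : C(X, Matrix ι ι K))
    (hf : ∀ x, IsUnit (f x)) (hfs : ∀ x, Supp (insert a s) (f x)) :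
    ∃ g : C(X, Matrix ι ι K), JoinedIn {h : C(X, Matrix ι ι K) | ∀ x, IsUnit (h x) ∧
      (Supp s (f x) → h x = f x)} f g ∧ ∀ x, Supp s (g x) := by
  set t := insert a s with ht
  have hat : a ∈ t := Finset.mem_insert_self a s
  let ext : (t → K) → (ι → K) := fun v i => if h : i ∈ t then v ⟨i, h⟩ else 0
  have hext : Continuous ext := by
    refine continuous_pi fun i => ?_
    by_cases h : i ∈ t
    · simp only [ext, h, dif_pos]; fun_prop
    · simp only [ext, h, dif_neg, not_false_eq_true]; fun_prop
  have hext0 : ∀ v, v ≠ 0 → ext v ≠ 0 := by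
    intro v hv h
    apply hv
    funext i
    have := congrFun h i
    simpa [ext] using this
  have hcol : ∀ M : Matrix ι ι K, IsUnit M → (fun i => M i a) ≠ 0 := by
    intro M hM h
    obtain ⟨u, rfl⟩ := hM
    have h1 : ((u⁻¹ : (Matrix ι ι K)ˣ) : Matrix ι ι K) * (u : Matrix ι ι K) = 1 := by simp
    have h2 := congrFun (congrFun h1 a) a
    rw [Matrix.mul_apply] at h2
    simp only [Matrix.one_apply_eq] at h2
    rw [Finset.sum_eq_zero] at h2
    · exact zero_ne_one h2
    · intro j _
      have := congrFun h j
      simp only [Pi.zero_apply] at this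
      rw [this, mul_zero]
  have hrest : ∀ v : ι → K, (∀ i, i ∉ t → v i = 0) → ext (fun i => v i) = v := by
    intro v hv
    funext i
    by_cases h : i ∈ t
    · simp [ext, h]
    · simp [ext, h, hv i h]
  -- column homotopy
  let v : C(X, t → K) := ⟨fun x i => f x i a, by fun_prop⟩
  have hvext : ∀ x, ext (v x) = fun i => f x i a := by
    intro x
    refine hrest (fun i => f x i a) ?_
    intro i hi
    rw [hfs x i a (Or.inl hi), Matrix.one_apply_ne]
    rintro rfl; exact hi hat
  have hv0 : ∀ x, v x ≠ 0 := by
    intro x h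
    apply hcol _ (hf x)
    rw [← hvext, h]
    funext i; simp [ext]
  let w : t → K := fun i => (1 : Matrix ι ι K) i a
  have hw0 : w ≠ 0 := by
    intro h
    have := congrFun h ⟨a, hat⟩
    simp [w] at this
  have hrank : k + 1 < finrank ℝ (t → K) := by
    rw [Module.finrank_pi_fintype]
    simp only [Finset.sum_const, Finset.card_univ, smul_eq_mul]
    rw [Fintype.card_coe, ht, Finset.card_insert_of_notMem ha, mul_comm]
    exact hk
  obtain ⟨H, hH0, hHa, hHb, hHst⟩ := sphere_lemma hX hrank v hv0 w hw0
  -- transport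
  let p : GLs K t → NZs K t := fun M => ⟨fun i => M.1 i a, hcol _ M.2.1, fun i hi => by
    change M.1 i a = 0
    rw [M.2.2 i a (Or.inl hi), Matrix.one_apply_ne]
    rintro rfl; exact hi hat⟩
  have hp : Continuous p := by
    refine Continuous.subtype_mk ?_ _
    exact continuous_pi fun i => continuous_subtype_val.matrix_elem i a
  let U : Set (NZs K t × NZs K t) := {z | dual z.1.1 ⬝ᵥ z.2.1 ≠ 0}
  have hdc : Continuous fun b : NZs K t => dual b.1 :=
    continuousOn_dual.comp_continuous continuous_subtype_val fun b => b.2.1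
  have hU : IsOpen U := by
    refine isOpen_ne_fun ?_ continuous_const
    exact (hdc.comp continuous_fst).dotProduct (continuous_subtype_val.comp continuous_snd)
  have hd : ∀ b, (b, b) ∈ U := by
    intro b
    simp only [U, Set.mem_ofPred_eq, dual_dot hK b.2.1]
    exact one_ne_zero
  let Xm : NZs K t → NZs K t → Matrix ι ι K := fun b b' => 1 + vecMulVec (b'.1 - b.1) (dual b.1)
  have hXu : ∀ b b', (b, b') ∈ U → IsUnit (Xm b b') := by
    intro b b' h
    apply isUnit_one_add_vecMulVec
    rw [dotProduct_sub, dual_dot hK b.2.1]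
    simpa [U] using h
  have hXs : ∀ b b', Supp t (Xm b b') := by
    intro b b'
    apply Supp.one_add_vecMulVec
    · intro i hi; simp [b.2.2 i hi, b'.2.2 i hi]
    · intro i hi; simp [dual, b.2.2 i hi]
  classical
  let T : GLs K t × NZs K t → GLs K t := fun z => if h : (p z.1, z.2) ∈ U then
    ⟨Xm (p z.1) z.2 * z.1.1, (hXu _ _ h).mul z.1.2.1, (hXs _ _).mul z.1.2.2⟩ else z.1
  have hTc : ContinuousOn T {z | (p z.1, z.2) ∈ U} := by
    rw [(⟨rfl⟩ : Topology.IsInducing (Subtype.val : GLs K t → _)).continuousOn_iff]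
    have : Continuous fun z : GLs K t × NZs K t => Xm (p z.1) z.2 * z.1.1 := by
      refine Continuous.mul ?_ (by fun_prop)
      refine continuous_const.add ?_
      refine Continuous.matrix_vecMulVec ?_ ?_
      · fun_prop
      · exact hdc.comp (hp.comp continuous_fst)
    refine this.continuousOn.congr ?_
    intro z hz
    have hz' : (p z.1, z.2) ∈ U := hz
    simp only [Function.comp, T, dif_pos hz']
  have hpT : ∀ e b, (p e, b) ∈ U → p (T (e, b)) = b := by
    intro e b h
    apply Subtype.ext
    simp only [T, dif_pos h]
    have h1 : (fun i => (Xm (p e) b * e.1) i a) = Xm (p e) b *ᵥ (p e).1 := by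
      funext i; rfl
    simp only [p] at h1 ⊢
    rw [h1]
    simp only [Xm]
    rw [add_mulVec, one_mulVec, vecMulVec_mulVec]
    have := dual_dot hK (p e).2.1
    simp only [p] at this
    rw [this]
    simp
  have hTe : ∀ e, T (e, p e) = e := by
    intro e
    apply Subtype.ext
    simp only [T, dif_pos (hd (p e)), Xm]
    simp
  let f' : C(X, GLs K t) := ⟨fun x => ⟨f x, hf x, hfs x⟩, by
    refine Continuous.subtype_mk ?_ _; fun_prop⟩
  let H' : C(I × X, NZs K t) := ⟨fun z => ⟨ext (H z), hext0 _ (hH0 z), fun i hi => by simp [ext, hi]⟩, by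
    refine Continuous.subtype_mk ?_ _; fun_prop⟩
  obtain ⟨L, hL0, hLp, hLst, -⟩ := hlp p hp U hU hd T hTc hpT hTe f' H' (by
    intro x
    apply Subtype.ext
    change ext (H (0, x)) = _
    rw [hHa, hvext]; rfl)
  have hL1 : ∀ x i, (L (1, x)).1 i a = (1 : Matrix ι ι K) i a := by
    intro x i
    have h1 := congrArg Subtype.val (hLp (1, x))
    have h2 := congrFun h1 i
    change (L (1, x)).1 i a = ext (H (1, x)) i at h2
    rw [h2, hHb]
    by_cases h : i ∈ t
    · simp [ext, h, w]
    · simp only [ext, h, dif_neg, not_false_eq_true]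
      rw [Matrix.one_apply_ne]; rintro rfl; exact h hat
  have hLs : ∀ x, Supp s (f x) → ∀ τ, (L (τ, x)).1 = f x := by
    intro x hx τ
    have hvw : v x = w := by
      funext i
      exact hx i a (Or.inr ha)
    have := hLst x (by
      intro τ'
      apply Subtype.ext
      change ext (H (τ', x)) = ext (H (0, x))
      rw [hHst x hvw, hHst x hvw]) τ
    rw [this]; rfl
  let m : C(X, Matrix ι ι K) := ⟨fun x => (L (1, x)).1, by fun_prop⟩
  -- row
  let ρ : ℝ → X → ι → K := fun τ x j => τ • (m x a j - (1 : Matrix ι ι K) a j)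
  let R : ℝ → X → Matrix ι ι K := fun τ x => m x * (1 + vecMulVec (Pi.single a (-1)) (ρ τ x))
  have hRc : Continuous fun z : ℝ × X => R z.1 z.2 := by
    refine Continuous.mul (by fun_prop) (continuous_const.add ?_)
    refine Continuous.matrix_vecMulVec (by fun_prop) ?_
    refine continuous_pi fun j => ?_
    fun_prop
  have hRu : ∀ τ x, IsUnit (R τ x) := by
    intro τ x
    refine (L (1, x)).2.1.mul (isUnit_one_add_vecMulVec _ _ ?_)
    have : m x a a = 1 := (hL1 x a).trans (by simp)
    simp [ρ, this]
  have hR : ∀ τ x i j, R τ x i j = m x i j - (1 : Matrix ι ι K) i a * ρ τ x j := by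
    intro τ x i j
    have hma : m x *ᵥ Pi.single a (-1) = fun i => -(1 : Matrix ι ι K) i a := by
      funext i
      have h3 : m x i a = (1 : Matrix ι ι K) i a := hL1 x i
      simp [h3]
    simp only [R]
    rw [mul_add, mul_one, Matrix.mul_vecMulVec, hma]
    simp [vecMulVec_apply, sub_eq_add_neg]
  let g : C(X, Matrix ι ι K) := ⟨fun x => R 1 x, hRc.comp (by fun_prop : Continuous fun x : X => ((1 : ℝ), x))⟩
  refine ⟨g, ?_, ?_⟩
  · refine JoinedIn.trans (y := m) ?_ ?_
    · refine joinedIn_of_homotopy ⟨fun z => (L z).1, by fun_prop⟩ (fun x => ?_) (fun x => rfl) ?_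
      · change (L (0, x)).1 = f x
        rw [hL0]; rfl
      · intro τ x
        exact ⟨(L (τ, x)).2.1, fun hx => hLs x hx τ⟩
    · refine joinedIn_of_homotopy ⟨fun z => R z.1 z.2,
        hRc.comp (by fun_prop : Continuous fun z : I × X => ((z.1 : ℝ), z.2))⟩
        (fun x => ?_) (fun x => rfl) ?_
      · ext i j
        change R ((0 : I) : ℝ) x i j = _
        rw [hR]; simp [ρ]
      · intro τ x
        refine ⟨hRu _ _, fun hx => ?_⟩
        ext i j
        change R (τ : ℝ) x i j = _
        have h4 : m x = f x := hLs x hx 1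
        rw [hR]
        simp only [ρ]
        rw [h4, hx a j (Or.inl ha)]
        simp
  · intro x i j hij
    change R 1 x i j = _
    rw [hR]
    by_cases hia : i = a
    · subst hia
      simp [ρ]
    · rw [Matrix.one_apply_ne hia, zero_mul, sub_zero]
      by_cases hja : j = a
      · subst hja; exact hL1 x i
      · refine (L (1, x)).2.2 i j ?_
        rcases hij with h | h
        · left; simp [ht, hia, h]
        · right; simp [ht, hja, h]

theorem compress (hK : ∀ a : K, star a * a = algebraMap ℝ K (‖a‖ ^ 2))
    {X : Type} [TopologicalSpace X] [CompactSpace X] {k : ℕ}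
    (hX : CubeLike k X) (s : Finset ι)
    (hk : k + 1 < finrank ℝ K * (s.card + 1)) (f : C(X, Matrix ι ι K))
    (hf : ∀ x, IsUnit (f x)) :
    ∃ g : C(X, Matrix ι ι K), JoinedIn {h : C(X, Matrix ι ι K) | ∀ x, IsUnit (h x) ∧
      (Supp s (f x) → h x = f x)} f g ∧ ∀ x, Supp s (g x) := by
  suffices h : ∀ t : Finset ι, ∀ f : C(X, Matrix ι ι K), (∀ x, IsUnit (f x)) →
      (∀ x, Supp (t ∪ s) (f x)) → ∃ g : C(X, Matrix ι ι K), JoinedIn {h : C(X, Matrix ι ι K) |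
        ∀ x, IsUnit (h x) ∧ (Supp s (f x) → h x = f x)} f g ∧ ∀ x, Supp s (g x) by
    refine h Finset.univ f hf fun x i j hij => ?_
    simp at hij
  intro t
  induction t using Finset.induction_on with
  | empty =>
    intro f hf hfs
    refine ⟨f, JoinedIn.refl fun x => ⟨hf x, fun _ => rfl⟩, fun x => by simpa using hfs x⟩
  | insert a t hat ih =>
    intro f hf hfs
    rw [Finset.insert_union] at hfs
    by_cases ha : a ∈ t ∪ s
    · rw [Finset.insert_eq_of_mem ha] at hfs
      exact ih f hf hfs
    · obtain ⟨g, hfg, hg⟩ := compress_step hK hX (t ∪ s) a ha (hk.trans_le (by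
        gcongr; exact Finset.subset_union_right)) f hf hfs
      obtain ⟨g', hgg', hg'⟩ := ih g (fun x => (hfg.target_mem x).1) hg
      refine ⟨g', JoinedIn.trans (hfg.mono ?_) (hgg'.mono ?_), hg'⟩
      · intro h hh x
        exact ⟨(hh x).1, fun hx => (hh x).2 (hx.mono Finset.subset_union_right)⟩
      · intro h hh x
        refine ⟨(hh x).1, fun hx => ?_⟩
        have h1 := (hfg.target_mem x).2 (hx.mono Finset.subset_union_right)
        rw [(hh x).2 (by rw [h1]; exact hx), h1]

end Compress
end S6

set_option linter.unusedSectionVars false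
set_option linter.unusedVariables false
set_option linter.deprecated false

namespace S6
open Set Topology Module Matrix
open scoped unitInterval

/-- finite dimensional real topological star algebras with a faithful positive functional -/
class GA (A : Type) [Ring A] [Algebra ℝ A] [StarRing A] [TopologicalSpace A] : Prop extends
    StarModule ℝ A, IsTopologicalRing A, ContinuousSMul ℝ A, ContinuousStar A, T2Space A,
    Module.Finite ℝ A where
  good : ∃ τ : A →ₗ[ℝ] ℝ, ∀ a, a ≠ 0 → 0 < τ (star a * a)

instance {A J : Type} [Ring A] [Algebra ℝ A] [StarRing A] [TopologicalSpace A] [GA A]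
    [Fintype J] [DecidableEq J] : GA (Matrix J J A) where
  star_smul := star_smul
  good := by
    obtain ⟨τ, hτ⟩ := GA.good (A := A)
    refine ⟨∑ j, τ.comp (Matrix.entryLinearMap ℝ A j j), fun M hM => ?_⟩
    have hnn : ∀ a, 0 ≤ τ (star a * a) := by
      intro a
      by_cases h : a = 0
      · simp [h]
      · exact (hτ a h).le
    have : (∑ j, τ.comp (Matrix.entryLinearMap ℝ A j j)) (star M * M) =
        ∑ j, ∑ i, τ (star (M i j) * M i j) := by
      simp [Matrix.mul_apply, LinearMap.sum_apply, Matrix.star_apply]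
    rw [this]
    have : ∃ i j, M i j ≠ 0 := by
      by_contra h
      push Not at h
      exact hM (by ext i j; exact h i j)
    obtain ⟨i, j, hij⟩ := this
    refine Finset.sum_pos' (fun j _ => Finset.sum_nonneg fun i _ => hnn _)
      ⟨j, Finset.mem_univ _, ?_⟩
    exact Finset.sum_pos' (fun i _ => hnn _) ⟨i, Finset.mem_univ _, hτ _ hij⟩

variable (A : Type) [Ring A] [Algebra ℝ A] [StarRing A] [TopologicalSpace A] [GA A]

/-- coordinate space -/
abbrev VA : Type := Fin (finrank ℝ A) → ℝ

/-- coordinates -/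
noncomputable def coordA : A ≃ₗ[ℝ] VA A := (Module.finBasis ℝ A).equivFun

theorem coordA_cont : Continuous (coordA A) := LinearMap.continuous_of_finiteDimensional (coordA A).toLinearMap

theorem coordA_symm_cont : Continuous (coordA A).symm :=
  LinearMap.continuous_of_finiteDimensional (coordA A).symm.toLinearMap

/-- regular representation -/
noncomputable def reg : A →ₐ[ℝ] (VA A →L[ℝ] VA A) :=
  (Module.End.toContinuousLinearMap (𝕜 := ℝ) (VA A)).toAlgHom.comp
    (((coordA A).conjAlgEquiv ℝ).toAlgHom.comp (Algebra.lmul ℝ A))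

variable {A}

theorem reg_apply (a : A) (v : VA A) : reg A a v = coordA A (a * (coordA A).symm v) := rfl

theorem reg_injective : Function.Injective (reg A) := by
  intro a b h
  have := congrArg (fun T => T (coordA A 1)) h
  simpa [reg_apply] using this

theorem reg_emb : IsClosedEmbedding (reg A) :=
  LinearMap.isClosedEmbedding_of_injective (f := (reg A).toLinearMap)
    (LinearMap.ker_eq_bot.2 reg_injective)

theorem reg_cont : Continuous (reg A) := reg_emb.continuous

theorem isUnit_of_ker {a : A} (h : ∀ v, a * v = 0 → v = 0) : IsUnit a := by
  have hinj : Function.Injective (Algebra.lmul ℝ A a) := by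
    rw [injective_iff_map_eq_zero]
    exact h
  have hs := LinearMap.injective_iff_surjective.1 hinj
  obtain ⟨b, hb⟩ := hs 1
  have hb' : a * b = 1 := hb
  have hba : b * a = 1 := by
    have : a * (b * a - 1) = 0 := by rw [mul_sub, ← mul_assoc, hb']; simp
    exact sub_eq_zero.1 (h _ this)
  exact ⟨⟨a, b, hb', hba⟩, rfl⟩

theorem isUnit_of_reg {a : A} (h : IsUnit (reg A a)) : IsUnit a := by
  apply isUnit_of_ker
  intro v hv
  obtain ⟨u, hu⟩ := h
  have h1 : reg A a * reg A v = 0 := by rw [← map_mul, hv, map_zero]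
  rw [← hu] at h1
  have h2 : reg A v = 0 := by simpa using h1
  exact reg_injective (by rw [h2, map_zero])

theorem isOpen_units : IsOpen {a : A | IsUnit a} := by
  have : {a : A | IsUnit a} = reg A ⁻¹' {x | IsUnit x} := by
    ext a
    exact ⟨fun h => IsUnit.map (reg A) h, isUnit_of_reg⟩
  rw [this]
  exact Units.isOpen.preimage reg_cont

theorem reg_inverse {a : A} (h : IsUnit a) : reg A (Ring.inverse a) = Ring.inverse (reg A a) := by
  obtain ⟨u, rfl⟩ := h
  rw [Ring.inverse_unit]
  have : reg A (u : A) = ((Units.map (reg A : A →* (VA A →L[ℝ] VA A)) u : (VA A →L[ℝ] VA A)ˣ) : VA A →L[ℝ] VA A) := rfl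
  rw [this, Ring.inverse_unit]
  rfl

theorem continuousOn_inverse : ContinuousOn (Ring.inverse : A → A) {a | IsUnit a} := by
  rw [reg_emb.isInducing.continuousOn_iff]
  have : ContinuousOn (fun a => Ring.inverse (reg A a)) {a | IsUnit a} := by
    intro a ha
    obtain ⟨u, hu⟩ := IsUnit.map (reg A) ha
    have h1 := NormedRing.inverse_continuousAt u
    rw [hu] at h1
    exact (ContinuousAt.comp (f := reg A) (x := a) h1 reg_cont.continuousAt).continuousWithinAt
  exact this.congr fun a ha => reg_inverse ha

theorem nhds_reg {W : Set A} (hW : W ∈ 𝓝 (0 : A)) : ∃ ε > 0, ∀ a, ‖reg A a‖ < ε → a ∈ W := by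
  rw [reg_emb.isInducing.nhds_eq_comap, map_zero, Filter.mem_comap] at hW
  obtain ⟨t, ht, htW⟩ := hW
  obtain ⟨ε, hε, h⟩ := Metric.mem_nhds_iff.1 ht
  exact ⟨ε, hε, fun a ha => htW (h (by simpa using ha))⟩

theorem nhds_coord {W : Set A} (hW : W ∈ 𝓝 (0 : A)) : ∃ ε > 0, ∀ a, ‖coordA A a‖ < ε → a ∈ W := by
  have h1 : (coordA A).symm ⁻¹' W ∈ 𝓝 (0 : VA A) := by
    apply (coordA_symm_cont A).continuousAt
    simpa using hW
  obtain ⟨ε, hε, h⟩ := Metric.mem_nhds_iff.1 h1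
  refine ⟨ε, hε, fun a ha => ?_⟩
  have := h (show coordA A a ∈ Metric.ball 0 ε by simpa using ha)
  simpa using this

/-- uniform neighbourhood of invertibility -/
theorem unif_unit {Y : Type} [TopologicalSpace Y] [CompactSpace Y] (F : C(Y, A))
    (hF : ∀ y, IsUnit (F y)) : ∃ ε > 0, ∀ y a, ‖coordA A a‖ < ε → IsUnit (F y + a) := by
  have hO : IsOpen {z : A × Y | IsUnit (F z.2 + z.1)} :=
    isOpen_units.preimage (f := fun z : A × Y => F z.2 + z.1) (by fun_prop)
  obtain ⟨u, v, hu, hv, h0, hsub, huv⟩ := generalized_tube_lemma (isCompact_singleton (x := (0 : A)))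
    (isCompact_univ (X := Y)) hO (by
      rintro ⟨a, y⟩ ⟨ha, -⟩
      have : a = 0 := ha
      subst this
      simpa using hF y)
  obtain ⟨ε, hε, h⟩ := nhds_coord (hu.mem_nhds (h0 rfl))
  refine ⟨ε, hε, fun y a ha => ?_⟩
  exact huv (show (a, y) ∈ u ×ˢ v from ⟨h a ha, hsub (mem_univ y)⟩)

/-- uniform positivity -/
theorem unif_pos (τ : A →ₗ[ℝ] ℝ) (hτ : ∀ a, a ≠ 0 → 0 < τ (star a * a)) :
    ∃ ε > 0, ∀ a, ‖reg A a‖ < ε → ∀ v, |τ (star v * (a * v))| ≤ (1 / 4) * τ (star v * v) := by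
  have hτc : Continuous τ := LinearMap.continuous_of_finiteDimensional τ
  set S : Set A := (coordA A).symm '' Metric.sphere 0 1 with hS
  have hSc : IsCompact S := (isCompact_sphere _ _).image (coordA_symm_cont A)
  have hO : IsOpen {z : A × A | |τ (star z.2 * (z.1 * z.2))| < (1 / 4) * τ (star z.2 * z.2)} :=
    isOpen_lt (by fun_prop) (by fun_prop)
  obtain ⟨u, w, hu, hw, h0, hsub, huw⟩ := generalized_tube_lemma (isCompact_singleton (x := (0 : A)))
    hSc hO (by
      rintro ⟨a, y⟩ ⟨ha, hy⟩
      have : a = 0 := ha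
      subst this
      obtain ⟨y', hy', rfl⟩ := hy
      have hne : (coordA A).symm y' ≠ 0 := by
        intro h
        have : y' = 0 := by simpa using h
        subst this
        simp at hy'
      have := hτ _ hne
      simpa using this)
  obtain ⟨ε, hε, h⟩ := nhds_reg (hu.mem_nhds (h0 rfl))
  refine ⟨ε, hε, fun a ha v => ?_⟩
  by_cases hv : v = 0
  · simp [hv]
  have hcv : 0 < ‖coordA A v‖ := by
    rw [norm_pos_iff]; simpa using hv
  set v' : A := ‖coordA A v‖⁻¹ • v with hv'
  have hv'S : v' ∈ S := by
    refine ⟨coordA A v', ?_, by simp⟩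
    simp only [hv', map_smul, mem_sphere_iff_norm, sub_zero, norm_smul, norm_inv, norm_norm]
    exact inv_mul_cancel₀ hcv.ne'
  have h1 : |τ (star v' * (a * v'))| < (1 / 4) * τ (star v' * v') :=
    huw (show (a, v') ∈ u ×ˢ w from ⟨h a ha, hsub hv'S⟩)
  have hvv : v = ‖coordA A v‖ • v' := by
    rw [hv', smul_smul, mul_inv_cancel₀ hcv.ne', one_smul]
  rw [hvv]
  simp only [star_smul, star_trivial, smul_mul_assoc, mul_smul_comm, map_smul, smul_eq_mul]
  rw [abs_mul, abs_mul, abs_norm]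
  calc _ = ‖coordA A v‖ * ‖coordA A v‖ * |τ (star v' * (a * v'))| := by ring
    _ ≤ ‖coordA A v‖ * ‖coordA A v‖ * ((1 / 4) * τ (star v' * v')) := by gcongr
    _ = _ := by ring

end S6

set_option linter.unusedSectionVars false
set_option linter.unusedVariables false
set_option linter.deprecated false

namespace S6
open Set Topology Module Matrix
open scoped unitInterval

/-- fibrewise maps preserve `JoinedIn` -/
theorem joinedIn_fib {Z Y Y' : Type} [TopologicalSpace Z] [LocallyCompactSpace Z]
    [TopologicalSpace Y] [TopologicalSpace Y'] (Φ : C(Z × Y, Y')) {S : Set C(Z, Y)}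
    {S' : Set C(Z, Y')} {f g : C(Z, Y)} (h : JoinedIn S f g)
    (hS : ∀ k ∈ S, Φ.comp ((ContinuousMap.id Z).prodMk k) ∈ S') :
    JoinedIn S' (Φ.comp ((ContinuousMap.id Z).prodMk f))
      (Φ.comp ((ContinuousMap.id Z).prodMk g)) := by
  obtain ⟨H, h0, h1, h2⟩ := homotopy_of_joinedIn h
  refine joinedIn_of_homotopy ⟨fun z => Φ (z.2, H z), by fun_prop⟩ ?_ ?_ ?_
  · intro x; simp [h0]
  · intro x; simp [h1]
  · intro t
    exact hS _ (h2 t)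

section
variable {A : Type} [Ring A] [Algebra ℝ A] [StarRing A] [TopologicalSpace A] [GA A]
variable {B : Type} [Ring B] [Algebra ℝ B] [StarRing B] [TopologicalSpace B] [GA B]
variable {X : Type} [TopologicalSpace X] [CompactSpace X] [T2Space X]

/-- self adjoint elements anticommuting with `G` -/
def Lsub (G : Set A) : Submodule ℝ A where
  carrier := {a | star a = a ∧ ∀ g ∈ G, g * a = -(a * g)}
  add_mem' := by
    rintro a b ⟨ha, ha'⟩ ⟨hb, hb'⟩
    refine ⟨by rw [star_add, ha, hb], fun g hg => ?_⟩
    rw [mul_add, add_mul, ha' g hg, hb' g hg]; abel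
  zero_mem' := ⟨star_zero _, fun g _ => by simp⟩
  smul_mem' := by
    rintro r a ⟨ha, ha'⟩
    refine ⟨by rw [star_smul, ha, star_trivial], fun g hg => ?_⟩
    rw [mul_smul_comm, ha' g hg, smul_mul_assoc, smul_neg]

theorem mem_Lsub {G : Set A} {a : A} :
    a ∈ Lsub G ↔ star a = a ∧ ∀ g ∈ G, g * a = -(a * g) := Iff.rfl

/-- the pencil `cos(πt) e + sin(πt) b(x)` -/
noncomputable def pencil (e : A) (b : C(X, A)) : C(X × I, A) :=
  ⟨fun z => Real.cos (Real.pi * z.2) • e + Real.sin (Real.pi * z.2) • b z.1, by fun_prop⟩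

theorem pencil_apply (e : A) (b : C(X, A)) (x : X) (t : I) : pencil e b (x, t) =
  Real.cos (Real.pi * t) • e + Real.sin (Real.pi * t) • b x := rfl

/-- admissible maps -/
def Adm (G : Set A) (e : A) (ψ : C(X, A)) (N : Set X) : Set C(X × I, A) :=
  {F | (∀ z, F z ∈ Lsub G ∧ IsUnit (F z)) ∧ (∀ x, F (x, 0) = e) ∧ (∀ x, F (x, 1) = -e) ∧
    ∀ x ∈ N, ∀ t, F (x, t) = pencil e ψ (x, t)}

theorem Adm_mono {G : Set A} {e : A} {ψ : C(X, A)} {N N' : Set X} (h : N' ⊆ N) :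
    Adm G e ψ N ⊆ Adm G e ψ N' :=
  fun F ⟨h1, h2, h3, h4⟩ => ⟨h1, h2, h3, fun x hx => h4 x (h hx)⟩

/-- stabilization -/
noncomputable def stab (J : Type) [Fintype J] [DecidableEq J] (j0 : J) (e : A) (ψ : C(X, A))
    (F : C(X × I, A)) : C(X × I, Matrix J J A) :=
  ⟨fun z => Matrix.diagonal (fun j => if j = j0 then F z else pencil e ψ z), by
    refine Continuous.matrix_diagonal (continuous_pi fun j => ?_)
    by_cases h : j = j0
    · simp only [h, if_true]; fun_prop
    · simp only [h, if_false]; fun_prop⟩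

theorem stab_apply {J : Type} [Fintype J] [DecidableEq J] (j0 : J) (e : A) (ψ : C(X, A))
    (F : C(X × I, A)) (z : X × I) : stab J j0 e ψ F z =
    Matrix.diagonal (fun j => if j = j0 then F z else pencil e ψ z) := rfl

/-- scalar matrices -/
noncomputable def sc (J : Type) [Fintype J] [DecidableEq J] : A →⋆ₐ[ℝ] Matrix J J A where
  toFun a := Matrix.diagonal (fun _ => a)
  map_one' := Matrix.diagonal_one
  map_mul' a b := by simp [Matrix.diagonal_mul_diagonal]
  map_zero' := Matrix.diagonal_zero
  map_add' a b := by simp [Matrix.diagonal_add]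
  commutes' r := by
    ext i j
    simp [Matrix.algebraMap_matrix_apply, Matrix.diagonal_apply]
  map_star' a := by
    rw [Matrix.star_eq_conjTranspose, Matrix.diagonal_conjTranspose]; rfl

theorem sc_apply {J : Type} [Fintype J] [DecidableEq J] (a : A) :
    sc J a = Matrix.diagonal (fun _ => a) := rfl

/-- flattening -/
noncomputable def cmp (J J1 : Type) [Fintype J] [DecidableEq J] [Fintype J1] [DecidableEq J1] :
    Matrix J J (Matrix J1 J1 A) →⋆ₐ[ℝ] Matrix (J × J1) (J × J1) A :=
  { (Matrix.compAlgEquiv J J1 A ℝ).toAlgHom with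
    map_star' := fun M => by
      ext ⟨i, i'⟩ ⟨j, j'⟩
      simp [Matrix.comp_apply, Matrix.star_apply] }

theorem cmp_apply {J J1 : Type} [Fintype J] [DecidableEq J] [Fintype J1] [DecidableEq J1]
    (M : Matrix J J (Matrix J1 J1 A)) (i j : J × J1) :
    cmp J J1 M i j = M i.1 j.1 i.2 j.2 := rfl

theorem cmp_diag {J J1 : Type} [Fintype J] [DecidableEq J] [Fintype J1] [DecidableEq J1]
    (d : J → J1 → A) : cmp J J1 (Matrix.diagonal fun j => Matrix.diagonal (d j)) =
      Matrix.diagonal (fun p : J × J1 => d p.1 p.2) := by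
  ext ⟨i, i'⟩ ⟨j, j'⟩
  rw [cmp_apply]
  simp only [Matrix.diagonal_apply, Prod.mk.injEq]
  by_cases h : i = j <;> by_cases h' : i' = j' <;> simp [h, h', Matrix.diagonal_apply]

theorem cmp_sc {J J1 : Type} [Fintype J] [DecidableEq J] [Fintype J1] [DecidableEq J1] (a : A) :
    cmp J J1 (sc J (sc J1 a)) = sc (J × J1) a := cmp_diag _

theorem sah_cont (θ : A →⋆ₐ[ℝ] B) : Continuous θ :=
  LinearMap.continuous_of_finiteDimensional (θ : A →ₐ[ℝ] B).toLinearMap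

/-- star algebra homs as continuous maps -/
noncomputable def sahC (θ : A →⋆ₐ[ℝ] B) : C(A, B) := ⟨θ, sah_cont θ⟩

theorem sahC_apply (θ : A →⋆ₐ[ℝ] B) (a : A) : sahC θ a = θ a := rfl

theorem Lsub_map (θ : A →⋆ₐ[ℝ] B) {G : Set A} {a : A} (ha : a ∈ Lsub G) : θ a ∈ Lsub (θ '' G) := by
  refine ⟨by rw [← map_star, ha.1], ?_⟩
  rintro _ ⟨g, hg, rfl⟩
  rw [← map_mul, ha.2 g hg, map_neg, map_mul]

theorem pencil_map (θ : A →⋆ₐ[ℝ] B) (e : A) (b : C(X, A)) :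
    (sahC θ).comp (pencil e b) = pencil (θ e) ((sahC θ).comp b) := by
  ext z
  simp [pencil, sahC_apply]

theorem Adm_map (θ : A →⋆ₐ[ℝ] B) {G : Set A} {e : A} {ψ : C(X, A)} {N : Set X}
    {F : C(X × I, A)} (hF : F ∈ Adm G e ψ N) :
    (sahC θ).comp F ∈ Adm (θ '' G) (θ e) ((sahC θ).comp ψ) N := by
  obtain ⟨h1, h2, h3, h4⟩ := hF
  refine ⟨fun z => ⟨Lsub_map θ (h1 z).1, (h1 z).2.map θ⟩, fun x => ?_, fun x => ?_, fun x hx t => ?_⟩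
  · simp [sahC_apply, h2]
  · simp [sahC_apply, h3]
  · rw [← pencil_map]; simp [h4 x hx]

theorem joined_map (θ : A →⋆ₐ[ℝ] B) {G : Set A} {e : A} {ψ : C(X, A)} {N : Set X}
    {F F' : C(X × I, A)} (h : JoinedIn (Adm G e ψ N) F F') :
    JoinedIn (Adm (θ '' G) (θ e) ((sahC θ).comp ψ) N) ((sahC θ).comp F) ((sahC θ).comp F') :=
  joinedIn_fib ((sahC θ).comp ContinuousMap.snd) h fun k hk => Adm_map θ hk

/-- involution data -/
structure SD (G : Set A) (e : A) (ψ : C(X, A)) (U : A) : Prop where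
  e2 : e * e = 1
  eL : e ∈ Lsub G
  p2 : ∀ x, ψ x * ψ x = 1
  pL : ∀ x, ψ x ∈ Lsub G
  ep : ∀ x, e * ψ x = -(ψ x * e)
  u1 : star U * U = 1
  u2 : U * star U = 1
  ue : U * e = -(e * U)
  up : ∀ x, U * ψ x = ψ x * U
  uG : ∀ g ∈ G, U * g = g * U

theorem SD.map {G : Set A} {e : A} {ψ : C(X, A)} {U : A} (h : SD G e ψ U) (θ : A →⋆ₐ[ℝ] B) :
    SD (θ '' G) (θ e) ((sahC θ).comp ψ) (θ U) where
  e2 := by rw [← map_mul, h.e2, map_one]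
  eL := Lsub_map θ h.eL
  p2 x := by
    change θ (ψ x) * θ (ψ x) = 1
    rw [← map_mul, h.p2, map_one]
  pL x := Lsub_map θ (h.pL x)
  ep x := by
    change θ e * θ (ψ x) = -(θ (ψ x) * θ e)
    rw [← map_mul, h.ep, map_neg, map_mul]
  u1 := by rw [← map_star, ← map_mul, h.u1, map_one]
  u2 := by rw [← map_star, ← map_mul, h.u2, map_one]
  ue := by rw [← map_mul, h.ue, map_neg, map_mul]
  up x := by
    change θ U * θ (ψ x) = θ (ψ x) * θ U
    rw [← map_mul, h.up, map_mul]
  uG := by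
    rintro _ ⟨g, hg, rfl⟩
    rw [← map_mul, h.uG g hg, map_mul]

theorem pencil_sq {G : Set A} {e : A} {ψ : C(X, A)} {U : A} (h : SD G e ψ U) (z : X × I) :
    pencil e ψ z * pencil e ψ z = 1 := by
  obtain ⟨x, t⟩ := z
  rw [pencil_apply]
  simp only [add_mul, mul_add, smul_mul_assoc, mul_smul_comm, h.e2, h.p2, h.ep, smul_smul]
  have := Real.cos_sq_add_sin_sq (Real.pi * t)
  calc _ = (Real.cos (Real.pi * t) ^ 2 + Real.sin (Real.pi * t) ^ 2) • (1 : A) := by module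
    _ = 1 := by rw [this, one_smul]

theorem pencil_L {G : Set A} {e : A} {ψ : C(X, A)} {U : A} (h : SD G e ψ U) (z : X × I) :
    pencil e ψ z ∈ Lsub G :=
  (Lsub G).add_mem ((Lsub G).smul_mem _ h.eL) ((Lsub G).smul_mem _ (h.pL _))

theorem pencil_mem {G : Set A} {e : A} {ψ : C(X, A)} {U : A} (h : SD G e ψ U) (N : Set X) :
    pencil e ψ ∈ Adm G e ψ N := by
  refine ⟨fun z => ⟨pencil_L h z, ?_⟩, fun x => ?_, fun x => ?_, fun _ _ _ => rfl⟩
  · exact ⟨⟨_, _, pencil_sq h z, pencil_sq h z⟩, rfl⟩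
  · simp [pencil_apply]
  · simp [pencil_apply]

theorem isUnit_diagonal {J : Type} [Fintype J] [DecidableEq J] {d : J → A}
    (h : ∀ j, IsUnit (d j)) : IsUnit (Matrix.diagonal d) := by
  choose u hu using h
  refine ⟨⟨Matrix.diagonal d, Matrix.diagonal fun j => ((u j)⁻¹ : Aˣ), ?_, ?_⟩, rfl⟩
  · rw [Matrix.diagonal_mul_diagonal]; simp [← hu]
  · rw [Matrix.diagonal_mul_diagonal]; simp [← hu]

theorem diagonal_L {J : Type} [Fintype J] [DecidableEq J] {G : Set A} {d : J → A}
    (h : ∀ j, d j ∈ Lsub G) : Matrix.diagonal d ∈ Lsub (sc J '' G) := by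
  refine ⟨?_, ?_⟩
  · rw [Matrix.star_eq_conjTranspose, Matrix.diagonal_conjTranspose]
    congr 1; funext j; exact (h j).1
  · rintro _ ⟨g, hg, rfl⟩
    rw [sc_apply, Matrix.diagonal_mul_diagonal, Matrix.diagonal_mul_diagonal]
    ext i j
    simp only [Matrix.diagonal_apply, Matrix.neg_apply]
    split_ifs
    · exact (h i).2 g hg
    · simp

theorem stab_mem {J : Type} [Fintype J] [DecidableEq J] (j0 : J) {G : Set A} {e : A} {ψ : C(X, A)}
    {U : A} (h : SD G e ψ U) {N : Set X} {F : C(X × I, A)} (hF : F ∈ Adm G e ψ N) :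
    stab J j0 e ψ F ∈ Adm (sc J '' G) (sc J e) ((sahC (sc J)).comp ψ) N := by
  have hp := pencil_mem h N
  obtain ⟨h1, h2, h3, h4⟩ := hF
  obtain ⟨k1, k2, k3, -⟩ := hp
  refine ⟨fun z => ⟨?_, ?_⟩, fun x => ?_, fun x => ?_, fun x hx t => ?_⟩
  · apply diagonal_L; intro j; split_ifs
    exacts [(h1 z).1, (k1 z).1]
  · apply isUnit_diagonal; intro j; split_ifs
    exacts [(h1 z).2, (k1 z).2]
  · rw [stab_apply, sc_apply]; simp [h2, k2]
  · rw [stab_apply, sc_apply, Matrix.diagonal_neg]; simp [h3, k3]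
  · rw [← pencil_map]
    rw [stab_apply, h4 x hx t]
    simp [sahC_apply, sc_apply]

theorem joined_stab {J : Type} [Fintype J] [DecidableEq J] (j0 : J) {G : Set A} {e : A}
    {ψ : C(X, A)} {U : A} (h : SD G e ψ U) {N : Set X} {F F' : C(X × I, A)}
    (hF : JoinedIn (Adm G e ψ N) F F') :
    JoinedIn (Adm (sc J '' G) (sc J e) ((sahC (sc J)).comp ψ) N) (stab J j0 e ψ F)
      (stab J j0 e ψ F') := by
  refine joinedIn_fib ⟨fun z : (X × I) × A =>
    Matrix.diagonal (fun j => if j = j0 then z.2 else pencil e ψ z.1), ?_⟩ hF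
    fun k hk => stab_mem j0 h hk
  refine Continuous.matrix_diagonal (continuous_pi fun j => ?_)
  by_cases h : j = j0
  · simp only [h, if_true]; fun_prop
  · simp only [h, if_false]; fun_prop

/-- conclusion of the step theorem -/
def Concl (G : Set A) (e : A) (ψ : C(X, A)) (K : Set X) (F : C(X × I, A)) : Prop :=
  ∃ (J : Type) (_ : Fintype J) (_ : DecidableEq J) (j0 : J) (N : Set X) (H : C(X, Matrix J J A)),
    IsOpen N ∧ K ⊆ N ∧ (∀ x, H x ∈ Lsub (sc J '' insert e G) ∧ IsUnit (H x)) ∧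
    (∀ x ∈ N, H x = sc J (ψ x)) ∧
    JoinedIn (Adm (sc J '' G) (sc J e) ((sahC (sc J)).comp ψ) N) (stab J j0 e ψ F)
      (pencil (sc J e) H)

theorem Concl.of_joined {G : Set A} {e : A} {ψ : C(X, A)} {U : A} (h : SD G e ψ U)
    {K N : Set X} (hN : IsOpen N) (hK : K ⊆ N) {F F' : C(X × I, A)}
    (hF : JoinedIn (Adm G e ψ N) F F') (hc : Concl G e ψ K F') : Concl G e ψ K F := by
  obtain ⟨J, _, _, j0, N', H, h1, h2, h3, h4, h5⟩ := hc
  refine ⟨J, _, _, j0, N ∩ N', H, hN.inter h1, subset_inter hK h2, h3, fun x hx => h4 x hx.2, ?_⟩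
  exact ((joined_stab j0 h hF).mono (Adm_mono inter_subset_left)).trans
    (h5.mono (Adm_mono inter_subset_right))

theorem Concl.of_mat {J1 : Type} [Fintype J1] [DecidableEq J1] (j1 : J1) {G : Set A} {e : A}
    {ψ : C(X, A)} {K : Set X} {F : C(X × I, A)}
    (hc : Concl (sc J1 '' G) (sc J1 e) ((sahC (sc J1)).comp ψ) K (stab J1 j1 e ψ F)) :
    Concl G e ψ K F := by
  obtain ⟨J, _, _, j0, N', H, h1, h2, h3, h4, h5⟩ := hc
  have him : ∀ S : Set A, cmp J J1 '' (sc J '' (sc J1 '' S)) = sc (J × J1) '' S := by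
    intro S
    rw [image_image, image_image]
    exact image_congr fun a _ => cmp_sc a
  refine ⟨J × J1, inferInstance, inferInstance, (j0, j1), N', (sahC (cmp J J1)).comp H, h1, h2,
    fun x => ⟨?_, ?_⟩, fun x hx => ?_, ?_⟩
  · have := Lsub_map (cmp J J1) (h3 x).1
    rw [← image_insert_eq, him] at this
    exact this
  · exact (h3 x).2.map (cmp J J1)
  · change cmp J J1 (H x) = _
    rw [h4 x hx]
    exact cmp_sc _
  · have := joined_map (cmp J J1) h5
    rw [him, cmp_sc, pencil_map, cmp_sc] at this
    convert this using 1
    · congr 1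
      ext x : 1
      exact (cmp_sc (ψ x)).symm
    · ext z : 1
      simp only [ContinuousMap.comp_apply, sahC_apply, stab_apply]
      have hp : pencil (sc J1 e) ((sahC (sc J1)).comp ψ) z =
          Matrix.diagonal (fun _ => pencil e ψ z) := by
        rw [← pencil_map]; rfl
      rw [hp]
      have : (fun j => if j = j0 then Matrix.diagonal fun j => if j = j1 then F z else pencil e ψ z
        else Matrix.diagonal fun _ => pencil e ψ z) = fun j => Matrix.diagonal
          (fun j' : J1 => if (j, j') = (j0, j1) then F z else pencil e ψ z) := by
        funext j
        by_cases hj : j = j0 <;> simp [hj]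
      rw [this, cmp_diag]
end
end S6

set_option linter.unusedSectionVars false
set_option linter.unusedVariables false
set_option linter.deprecated false

namespace S6
open Set Topology Module Matrix
open scoped unitInterval

theorem red_ker {A : Type} [Ring A] [Algebra ℝ A] (e ψ r0 r1 r2 : A) (c s p q ς : ℝ)
    (hcs : c ^ 2 + s ^ 2 = 1) (hpq : p ^ 2 + q ^ 2 = 1)
    (e2 : e * e = 1) (p2 : ψ * ψ = 1) (ep : e * ψ = -(ψ * e)) (r : A)
    (hr : r = (c ^ 2) • r0 + (c * s) • r1 + (s ^ 2) • r2)
    (hu : ∀ v, (c • e + s • ψ + r) * v = 0 → v = 0)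
    (hcase : ς = 1 ∨ (q • r0 = 0 ∧ q • r1 = 0 ∧ q • r2 = 0)) (v0 vb vc vd : A)
    (h0 : (c • e + s • ψ + p ^ 2 • r) * v0 + (p * q * c) • (r * vb) + (p * q * s) • (r * vc)
      + (p * q * s) • (r * vd) = 0)
    (hb : (p * q * c) • (r * v0) + (c • e + s • ψ + q ^ 2 • r0) * vb
      + (q ^ 2 / 2) • (r1 * vc) + ((ς * s) • e + (q ^ 2 / 2) • r1) * vd = 0)
    (hc : (p * q * s) • (r * v0) + (q ^ 2 / 2) • (r1 * vb) + (c • e + s • ψ + q ^ 2 • r2) * vc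
      + ((ς * s) • ψ + q ^ 2 • r2) * vd = 0)
    (hd : (p * q * s) • (r * v0) + ((ς * s) • e + (q ^ 2 / 2) • r1) * vb
      + ((ς * s) • ψ + q ^ 2 • r2) * vc + (-(c • e) + s • ψ + q ^ 2 • r2) * vd = 0) :
    v0 = 0 ∧ vb = 0 ∧ vc = 0 ∧ vd = 0 := by
  have e2' : ∀ v, e * (e * v) = v := fun v => by rw [← mul_assoc, e2, one_mul]
  have p2' : ∀ v, ψ * (ψ * v) = v := fun v => by rw [← mul_assoc, p2, one_mul]
  have ep' : ∀ v, e * (ψ * v) = -(ψ * (e * v)) := fun v => by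
    rw [← mul_assoc, ep, neg_mul, mul_assoc]
  have hg : ∀ v, (c • e + s • ψ) * v = 0 → v = 0 := by
    intro v hv
    have : (c • e + s • ψ) * ((c • e + s • ψ) * v) = (c ^ 2 + s ^ 2) • v := by
      simp only [add_mul, mul_add, smul_mul_assoc, mul_smul_comm, e2', p2', ep']; module
    rw [hv, mul_zero, hcs, one_smul] at this
    exact this.symm
  have hg' : ∀ v, (-(c • e) + s • ψ) * v = 0 → v = 0 := by
    intro v hv
    have : (-(c • e) + s • ψ) * ((-(c • e) + s • ψ) * v) = (c ^ 2 + s ^ 2) • v := by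
      simp only [add_mul, mul_add, smul_mul_assoc, mul_smul_comm, e2', p2', ep', neg_mul, mul_neg]
      module
    rw [hv, mul_zero, hcs, one_smul] at this
    exact this.symm
  rcases hcase with hς | ⟨q0, q1, q2⟩
  · subst hς
    have hw : s • vb = c • (vc + vd) := by
      have h1 : e * (s • vb - c • (vc + vd)) = 0 := by
        have := sub_eq_zero_of_eq (hd.trans hc.symm)
        rw [← this]
        simp only [add_mul, mul_add, mul_sub, smul_mul_assoc, mul_smul_comm, neg_mul]
        module
      have h2 := e2' (s • vb - c • (vc + vd))
      rw [h1, mul_zero] at h2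
      exact (sub_eq_zero.1 h2.symm)
    set w := vc + vd with hwd
    have hvd : vd = w - vc := by rw [hwd]; abel
    set ζ := c • vb + s • w with hζ
    have hvb : vb = c • ζ := by
      have : c • ζ = (c ^ 2 + s ^ 2) • vb := by
        rw [hζ]; linear_combination (norm := module) (-s) • hw
      rw [this, hcs, one_smul]
    have hwz : w = s • ζ := by
      have : s • ζ = (c ^ 2 + s ^ 2) • w := by
        rw [hζ]; linear_combination (norm := module) c • hw
      rw [this, hcs, one_smul]
    clear_value ζ w
    subst hvd
    subst hvb
    subst hwz
    have A0 : (c • e + s • ψ + p ^ 2 • r) * v0 + (p * q) • (r * ζ) = 0 := by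
      have : (p * q) • (r * ζ) = ((c ^ 2 + s ^ 2) * (p * q)) • (r * ζ) := by rw [hcs, one_mul]
      rw [this, ← h0]
      simp only [add_mul, mul_add, mul_sub, smul_mul_assoc, mul_smul_comm, neg_mul]
      module
    have A1 : (p * q) • (r * v0) + (c • e + s • ψ + q ^ 2 • r) * ζ = 0 := by
      have h3 : c • (((p * q * c) • (r * v0) + (c • e + s • ψ + q ^ 2 • r0) * (c • ζ)
        + (q ^ 2 / 2) • (r1 * vc) + ((1 * s) • e + (q ^ 2 / 2) • r1) * (s • ζ - vc)))
        + s • ((p * q * s) • (r * v0) + (q ^ 2 / 2) • (r1 * (c • ζ)) +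
          (c • e + s • ψ + q ^ 2 • r2) * vc
          + ((1 * s) • ψ + q ^ 2 • r2) * (s • ζ - vc)) = 0 := by
        rw [hb, hc]; simp
      have h4 : (p * q) • (r * v0) + (c • e + s • ψ + q ^ 2 • r) * ζ =
          ((c ^ 2 + s ^ 2) * (p * q)) • (r * v0) +
          ((c ^ 2 + s ^ 2) • (c • e + s • ψ) + q ^ 2 • r) * ζ := by
        rw [hcs, one_mul, one_smul]
      rw [h4, ← h3]
      have h5 : r * ζ = (c ^ 2) • (r0 * ζ) + (c * s) • (r1 * ζ) + (s ^ 2) • (r2 * ζ) := by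
        rw [hr]; simp only [add_mul, smul_mul_assoc]
      simp only [add_mul, mul_add, mul_sub, smul_mul_assoc, mul_smul_comm, neg_mul, h5, smul_add]
      module
    have hy : p • v0 + q • ζ = 0 := by
      apply hu
      have : p • ((c • e + s • ψ + p ^ 2 • r) * v0 + (p * q) • (r * ζ)) +
        q • ((p * q) • (r * v0) + (c • e + s • ψ + q ^ 2 • r) * ζ) = 0 := by rw [A0, A1]; simp
      rw [← this]
      have h6 : (c • e + s • ψ + r) = (c • e + s • ψ + (p ^ 2 + q ^ 2) • r) := by
        rw [hpq, one_smul]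
      rw [h6]
      simp only [add_mul, mul_add, mul_sub, smul_mul_assoc, mul_smul_comm, neg_mul, smul_add]
      module
    have hz : q • v0 - p • ζ = 0 := by
      apply hg
      have : q • ((c • e + s • ψ + p ^ 2 • r) * v0 + (p * q) • (r * ζ)) -
        p • ((p * q) • (r * v0) + (c • e + s • ψ + q ^ 2 • r) * ζ) = 0 := by rw [A0, A1]; simp
      rw [← this]
      simp only [add_mul, mul_add, mul_sub, smul_mul_assoc, mul_smul_comm, neg_mul, smul_add]
      module
    have hv0 : v0 = 0 := by
      have : (p ^ 2 + q ^ 2) • v0 = 0 := by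
        linear_combination (norm := module) p • hy + q • hz
      rwa [hpq, one_smul] at this
    have hζ0 : ζ = 0 := by
      have : (p ^ 2 + q ^ 2) • ζ = 0 := by
        linear_combination (norm := module) q • hy - p • hz
      rwa [hpq, one_smul] at this
    subst hv0
    rw [hζ0] at hb hc
    have k1 : c • vc = 0 := by
      have : e * (c • vc) = 0 := by
        rw [← hc]
        simp only [add_mul, mul_add, mul_sub, smul_mul_assoc, mul_smul_comm, neg_mul, smul_add,
          smul_zero, mul_zero, zero_sub, mul_neg]
        module
      rw [← e2' (c • vc), this, mul_zero]
    have k2 : s • vc = 0 := by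
      have : e * (s • vc) = 0 := by
        rw [← neg_eq_zero, ← hb]
        simp only [add_mul, mul_add, mul_sub, smul_mul_assoc, mul_smul_comm, neg_mul, smul_add,
          smul_zero, mul_zero, zero_sub, mul_neg]
        module
      rw [← e2' (s • vc), this, mul_zero]
    have k3 : vc = 0 := by
      have : (c ^ 2 + s ^ 2) • vc = 0 := by
        linear_combination (norm := module) c • k1 + s • k2
      rwa [hcs, one_smul] at this
    simp [hζ0, k3]
  · have qq : ∀ x : A, q • x = 0 → ∀ v, q • (x * v) = 0 := by
      intro x hx v; rw [← smul_mul_assoc, hx, zero_mul]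
    have qr : q • r = 0 := by
      rw [hr]; linear_combination (norm := module) (c ^ 2) • q0 + (c * s) • q1 + (s ^ 2) • q2
    have hv0 : v0 = 0 := by
      apply hu
      have h6 : (c • e + s • ψ + r) = (c • e + s • ψ + (p ^ 2 + q ^ 2) • r) := by
        rw [hpq, one_smul]
      rw [h6, ← h0]
      simp only [add_mul, mul_add, mul_sub, smul_mul_assoc, mul_smul_comm, neg_mul, smul_add]
      linear_combination (norm := module) q • qq r qr v0 - (p * c) • qq r qr vb - (p * s) • qq r qr vc
        - (p * s) • qq r qr vd
    subst hv0
    have kb : (c • e + s • ψ) * vb + (ς * s) • (e * vd) = 0 := by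
      rw [← hb]
      simp only [add_mul, smul_mul_assoc, mul_zero, smul_zero]
      linear_combination (norm := module) (-q) • qq r0 q0 vb - (q / 2) • qq r1 q1 vc -
        (q / 2) • qq r1 q1 vd
    have kc : (c • e + s • ψ) * vc + (ς * s) • (ψ * vd) = 0 := by
      rw [← hc]
      simp only [add_mul, smul_mul_assoc, mul_zero, smul_zero]
      linear_combination (norm := module) (-(q / 2)) • qq r1 q1 vb - q • qq r2 q2 vc -
        q • qq r2 q2 vd
    have kd : (ς * s) • (e * vb) + (ς * s) • (ψ * vc) + (-(c • e) + s • ψ) * vd = 0 := by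
      rw [← hd]
      simp only [add_mul, smul_mul_assoc, mul_zero, smul_zero]
      linear_combination (norm := module) (-(q / 2)) • qq r1 q1 vb - q • qq r2 q2 vc -
        q • qq r2 q2 vd
    have gg : ∀ v, (c • e + s • ψ) * ((c • e + s • ψ) * v) = v := by
      intro v
      have : (c • e + s • ψ) * ((c • e + s • ψ) * v) = (c ^ 2 + s ^ 2) • v := by
        simp only [add_mul, mul_add, smul_mul_assoc, mul_smul_comm, e2', p2', ep']; module
      rw [this, hcs, one_smul]
    have jb : vb = -((ς * s) • ((c • e + s • ψ) * (e * vd))) := by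
      have := gg vb
      rw [eq_neg_of_add_eq_zero_left kb] at this
      rw [← this, mul_neg, mul_smul_comm]
    have jc : vc = -((ς * s) • ((c • e + s • ψ) * (ψ * vd))) := by
      have := gg vc
      rw [eq_neg_of_add_eq_zero_left kc] at this
      rw [← this, mul_neg, mul_smul_comm]
    have hvd : vd = 0 := by
      apply hg'
      rw [← kd, jb, jc]
      simp only [add_mul, mul_add, smul_mul_assoc, mul_smul_comm, e2', p2', ep', neg_mul, mul_neg,
        smul_add, smul_neg]
      module
    subst hvd
    refine ⟨rfl, ?_, ?_, rfl⟩
    · rw [jb]; simp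
    · rw [jc]; simp

end S6

set_option linter.unusedSectionVars false
set_option linter.unusedVariables false
set_option linter.deprecated false

namespace S6
open Set Topology Module Matrix
open scoped unitInterval

section
variable {A : Type} [Ring A] [Algebra ℝ A] [StarRing A] [TopologicalSpace A] [GA A]
variable {B : Type} [Ring B] [Algebra ℝ B] [StarRing B] [TopologicalSpace B] [GA B]
variable {X : Type} [TopologicalSpace X] [CompactSpace X] [T2Space X]

/-- cosine -/
noncomputable def cc (t : I) : ℝ := Real.cos (Real.pi * t)
/-- sine -/
noncomputable def ss (t : I) : ℝ := Real.sin (Real.pi * t)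

theorem cs1 (t : I) : cc t ^ 2 + ss t ^ 2 = 1 := Real.cos_sq_add_sin_sq _
theorem cc_cont : Continuous cc := by unfold cc; fun_prop
theorem ss_cont : Continuous ss := by unfold ss; fun_prop
theorem ss_zero : ss 0 = 0 := by simp [ss]
theorem ss_one : ss 1 = 0 := by simp [ss]
theorem cc_zero : cc 0 = 1 := by simp [cc]
theorem cc_one : cc 1 = -1 := by simp [cc]

/-- homogeneous polynomials of degree `m` in `cos, sin` divisible by `sin` -/
def PP (m : ℕ) (L : Submodule ℝ A) (N : Set X) (r : X × I → A) : Prop :=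
  ∃ a : ℕ → C(X, A), (∀ i x, a i x ∈ L ∧ (x ∈ N → a i x = 0)) ∧ ∀ x t, r (x, t) =
    ∑ i ∈ Finset.range m, (cc t ^ (m - 1 - i) * ss t ^ (i + 1)) • a i x

theorem PP.add {m : ℕ} {L : Submodule ℝ A} {N : Set X} {r r' : X × I → A} (h : PP m L N r)
    (h' : PP m L N r') : PP m L N (fun z => r z + r' z) := by
  obtain ⟨a, ha, hr⟩ := h
  obtain ⟨b, hb, hr'⟩ := h'
  refine ⟨fun i => a i + b i, fun i x => ⟨L.add_mem (ha i x).1 (hb i x).1, fun hx => ?_⟩, fun x t => ?_⟩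
  · simp [(ha i x).2 hx, (hb i x).2 hx]
  · simp [hr, hr', smul_add, Finset.sum_add_distrib]

theorem PP.congr {m : ℕ} {L : Submodule ℝ A} {N : Set X} {r r' : X × I → A} (h : PP m L N r)
    (h' : ∀ z, r' z = r z) : PP m L N r' := by
  have : r' = r := funext h'
  rwa [this]

theorem PP.mono {m : ℕ} {L : Submodule ℝ A} {N N' : Set X} {r : X × I → A} (h : PP m L N r)
    (h' : N' ⊆ N) : PP m L N' r := by
  obtain ⟨a, ha, hr⟩ := h
  exact ⟨a, fun i x => ⟨(ha i x).1, fun hx => (ha i x).2 (h' hx)⟩, hr⟩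

theorem PP.lin {m : ℕ} {L : Submodule ℝ A} {N : Set X} {r : X × I → A} (h : PP m L N r)
    (T : A →ₗ[ℝ] B) {L' : Submodule ℝ B} (hT : ∀ a ∈ L, T a ∈ L') :
    PP m L' N (fun z => T (r z)) := by
  obtain ⟨a, ha, hr⟩ := h
  refine ⟨fun i => ⟨fun x => T (a i x), ?_⟩, fun i x => ⟨hT _ (ha i x).1, fun hx => ?_⟩, fun x t => ?_⟩
  · exact (LinearMap.continuous_of_finiteDimensional T).comp (a i).continuous
  · simp [(ha i x).2 hx]
  · simp [hr]

theorem PP.one {L : Submodule ℝ A} {N : Set X} (a : C(X, A)) (ha : ∀ x, a x ∈ L)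
    (hN : ∀ x ∈ N, a x = 0) : PP 1 L N (fun z => ss z.2 • a z.1) :=
  ⟨fun _ => a, fun i x => ⟨ha x, hN x⟩, fun x t => by simp⟩

theorem PP.single {m : ℕ} {L : Submodule ℝ A} {N : Set X} (i : ℕ) (hi : i < m) (a : C(X, A))
    (ha : ∀ x, a x ∈ L) (hN : ∀ x ∈ N, a x = 0) :
    PP m L N (fun z => (cc z.2 ^ (m - 1 - i) * ss z.2 ^ (i + 1)) • a z.1) := by
  refine ⟨fun j => if j = i then a else 0, fun j x => ?_, fun x t => ?_⟩
  · by_cases h : j = i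
    · simpa [h] using ⟨ha x, hN x⟩
    · simp [h]
  · rw [Finset.sum_eq_single i]
    · simp
    · intro j _ hj; simp [hj]
    · intro h; simp at h; omega

theorem PP.zero {m : ℕ} {L : Submodule ℝ A} {N : Set X} : PP m L N (fun _ => 0) :=
  ⟨fun _ => 0, fun i x => ⟨by simp, fun _ => rfl⟩, fun x t => by simp⟩

theorem PP.sum {m : ℕ} {L : Submodule ℝ A} {N : Set X} {ι : Type} (S : Finset ι)
    (r : ι → X × I → A) (h : ∀ i ∈ S, PP m L N (r i)) : PP m L N (fun z => ∑ i ∈ S, r i z) := by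
  classical
  induction S using Finset.induction_on with
  | empty => simpa using PP.zero
  | insert a S ha ih =>
    simp only [Finset.sum_insert ha]
    exact (h a (by simp)).add (ih fun i hi => h i (by simp [hi]))

theorem PP.raise {m : ℕ} {L : Submodule ℝ A} {N : Set X} {r : X × I → A} (h : PP m L N r) :
    PP (m + 2) L N r := by
  obtain ⟨a, ha, hr⟩ := h
  have key : PP (m + 2) L N (fun z : X × I => ∑ i ∈ Finset.range m,
      ((cc z.2 ^ (m + 2 - 1 - i) * ss z.2 ^ (i + 1)) • a i z.1 +
        (cc z.2 ^ (m + 2 - 1 - (i + 2)) * ss z.2 ^ (i + 2 + 1)) • a i z.1)) := by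
    refine PP.sum _ _ fun i hi => ?_
    have hi' : i < m := by simpa using hi
    exact (PP.single i (by omega) (a i) (fun x => (ha i x).1) (fun x => (ha i x).2)).add
      (PP.single (i + 2) (by omega) (a i) (fun x => (ha i x).1) (fun x => (ha i x).2))
  refine key.congr fun z => ?_
  obtain ⟨x, t⟩ := z
  rw [hr]
  refine Finset.sum_congr rfl fun i hi => ?_
  have hi' : i < m := by simpa using hi
  obtain ⟨d, rfl⟩ : ∃ d, m = i + d + 1 := ⟨m - i - 1, by omega⟩
  rw [← add_smul]
  congr 1
  have e1 : i + d + 1 - 1 - i = d := by omega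
  have e2 : i + d + 1 + 2 - 1 - i = d + 2 := by omega
  have e3 : i + d + 1 + 2 - 1 - (i + 2) = d := by omega
  simp only [e1, e2, e3]
  have := cs1 t
  linear_combination (-(cc t ^ d * ss t ^ (i + 1))) * this

theorem PP.raises {m : ℕ} (k : ℕ) {L : Submodule ℝ A} {N : Set X} {r : X × I → A} (h : PP m L N r) :
    PP (m + 2 * k) L N r := by
  induction k with
  | zero => exact h
  | succ k ih => exact ih.raise

/-- tensor with a real matrix -/
noncomputable def tens {J : Type} [Fintype J] [DecidableEq J] (S : Matrix J J ℝ) :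
    A →ₗ[ℝ] Matrix J J A where
  toFun v := Matrix.of fun i j => S i j • v
  map_add' v w := by ext; simp
  map_smul' c v := by ext i j; exact smul_comm _ _ _

theorem tens_apply {J : Type} [Fintype J] [DecidableEq J] (S : Matrix J J ℝ) (v : A) (i j : J) :
    tens S v i j = S i j • v := rfl

theorem tens_L {J : Type} [Fintype J] [DecidableEq J] {S : Matrix J J ℝ} (hS : Sᵀ = S) {G : Set A}
    {v : A} (hv : v ∈ Lsub G) : tens S v ∈ Lsub (sc J '' G) := by
  refine ⟨?_, ?_⟩
  · ext i j
    rw [Matrix.star_apply, tens_apply, tens_apply, star_smul, hv.1, star_trivial]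
    congr 1
    exact congrFun (congrFun hS i) j
  · rintro _ ⟨g, hg, rfl⟩
    ext i j
    rw [sc_apply, Matrix.diagonal_mul, Matrix.neg_apply, Matrix.mul_diagonal, tens_apply,
      mul_smul_comm, hv.2 g hg, smul_mul_assoc, smul_neg]

/-- conjugation -/
noncomputable def cj (V : A) : A →ₗ[ℝ] A where
  toFun v := V * v * star V
  map_add' v w := by simp [mul_add, add_mul]
  map_smul' c v := by simp

theorem cj_apply (V v : A) : cj V v = V * v * star V := rfl

theorem cj_L {V : A} {G : Set A} (h1 : star V * V = 1) (hG : ∀ g ∈ G, V * g = g * V)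
    (h2 : V * star V = 1)
    {v : A} (hv : v ∈ Lsub G) : cj V v ∈ Lsub G := by
  refine ⟨by simp [cj_apply, hv.1, mul_assoc], fun g hg => ?_⟩
  have k : star V * g = g * star V := by
    calc star V * g = star V * (g * V) * star V := by rw [mul_assoc, mul_assoc, h2, mul_one]
      _ = g * star V := by rw [← hG g hg, ← mul_assoc, h1, one_mul]
  calc g * (V * v * star V) = V * (g * v) * star V := by rw [← mul_assoc, ← mul_assoc, ← hG g hg]; simp [mul_assoc]
    _ = - (V * v * (g * star V)) := by rw [hv.2 g hg]; simp [mul_assoc]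
    _ = _ := by rw [← k]; simp [cj_apply, mul_assoc]

theorem cj_unit {V v : A} (h1 : star V * V = 1) (h2 : V * star V = 1) (hv : IsUnit v) :
    IsUnit (cj V v) :=
  (IsUnit.mul (⟨⟨V, star V, h2, h1⟩, rfl⟩ : IsUnit V) hv).mul ⟨⟨star V, V, h1, h2⟩, rfl⟩

/-- sines matrices used in the reduction -/
def S0 : Matrix (Fin 4) (Fin 4) ℝ := !![1,0,0,0; 0,0,0,0; 0,0,0,0; 0,0,0,0]
def S0b : Matrix (Fin 4) (Fin 4) ℝ := !![0,1,0,0; 1,0,0,0; 0,0,0,0; 0,0,0,0]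
def S0c : Matrix (Fin 4) (Fin 4) ℝ := !![0,0,1,1; 0,0,0,0; 1,0,0,0; 1,0,0,0]
def Sb : Matrix (Fin 4) (Fin 4) ℝ := !![0,0,0,0; 0,1,0,0; 0,0,0,0; 0,0,0,0]
noncomputable def Sbc : Matrix (Fin 4) (Fin 4) ℝ :=
  !![0,0,0,0; 0,0,1/2,1/2; 0,1/2,0,0; 0,1/2,0,0]
def Scc : Matrix (Fin 4) (Fin 4) ℝ := !![0,0,0,0; 0,0,0,0; 0,0,1,1; 0,0,1,1]
def Sbd : Matrix (Fin 4) (Fin 4) ℝ := !![0,0,0,0; 0,0,0,1; 0,0,0,0; 0,1,0,0]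
def Scd : Matrix (Fin 4) (Fin 4) ℝ := !![0,0,0,0; 0,0,0,0; 0,0,0,1; 0,0,1,0]
def SD4 : Matrix (Fin 4) (Fin 4) ℝ := !![1,0,0,0; 0,1,0,0; 0,0,1,0; 0,0,0,-1]

theorem Ssym : S0ᵀ = S0 ∧ S0bᵀ = S0b ∧ S0cᵀ = S0c ∧ Sbᵀ = Sb ∧ Sbcᵀ = Sbc ∧ Sccᵀ = Scc ∧
    Sbdᵀ = Sbd ∧ Scdᵀ = Scd ∧ SD4ᵀ = SD4 := by
  refine ⟨?_, ?_, ?_, ?_, ?_, ?_, ?_, ?_, ?_⟩ <;> ext i j <;> fin_cases i <;> fin_cases j <;> rfl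

/-- the diagonal part -/
noncomputable def Md (e ψ : A) (c s : ℝ) : Matrix (Fin 4) (Fin 4) A :=
  tens SD4 (c • e) + tens 1 (s • ψ)

/-- the perturbation part -/
noncomputable def Mr (e ψ r r0 r1 r2 : A) (c s p q o : ℝ) : Matrix (Fin 4) (Fin 4) A :=
  p ^ 2 • tens S0 r + (p * q * c) • tens S0b r + (p * q * s) • tens S0c r +
  (q ^ 2 • tens Sb r0 + q ^ 2 • tens Sbc r1 + q ^ 2 • tens Scc r2) +
  (tens Sbd ((o * s) • e) + tens Scd ((o * s) • ψ))

theorem M_unit (e ψ r0 r1 r2 : A) (c s p q o : ℝ)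
    (hcs : c ^ 2 + s ^ 2 = 1) (hpq : p ^ 2 + q ^ 2 = 1)
    (e2 : e * e = 1) (p2 : ψ * ψ = 1) (ep : e * ψ = -(ψ * e)) (r : A)
    (hr : r = (c ^ 2) • r0 + (c * s) • r1 + (s ^ 2) • r2)
    (hu : IsUnit (c • e + s • ψ + r))
    (hcase : o = 1 ∨ (q • r0 = 0 ∧ q • r1 = 0 ∧ q • r2 = 0)) :
    IsUnit (Md e ψ c s + Mr e ψ r r0 r1 r2 c s p q o) := by
  apply isUnit_of_ker
  intro v hv
  have hu' : ∀ v, (c • e + s • ψ + r) * v = 0 → v = 0 := fun v hv => by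
    simpa using hu.mul_right_eq_zero.1 hv
  ext i k
  have h := fun i => congrFun (congrFun hv i) k
  have h0 := h 0
  have hb := h 1
  have hc := h 2
  have hd := h 3
  simp only [Matrix.mul_apply, Fin.sum_univ_four, Md, Mr, Matrix.add_apply, Matrix.smul_apply,
    tens_apply, S0, S0b, S0c, Sb, Sbc, Scc, Sbd, Scd, SD4] at h0 hb hc hd
  simp [add_mul, smul_smul] at h0 hb hc hd
  have := red_ker e ψ r0 r1 r2 c s p q o hcs hpq e2 p2 ep r hr hu' hcase (v 0 k) (v 1 k) (v 2 k)
    (v 3 k) ?_ ?_ ?_ ?_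
  · obtain ⟨h1, h2, h3, h4⟩ := this
    fin_cases i <;> assumption
  · rw [← h0]; simp only [add_mul, smul_mul_assoc]
  · rw [← hb]; simp only [add_mul, smul_mul_assoc]; module
  · rw [← hc]; simp only [add_mul, smul_mul_assoc]; module
  · rw [← hd]; simp only [add_mul, smul_mul_assoc, neg_mul]; module

end
end S6

set_option linter.unusedSectionVars false
set_option linter.unusedVariables false
set_option linter.deprecated false

namespace S6
open Set Topology Module Matrix
open scoped unitInterval

section
variable {A : Type} [Ring A] [Algebra ℝ A] [StarRing A] [TopologicalSpace A] [GA A]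
variable {X : Type} [TopologicalSpace X] [CompactSpace X] [T2Space X]

/-- diag(1,1,1,U) -/
def V4 (U : A) : Matrix (Fin 4) (Fin 4) A := Matrix.diagonal ![1, 1, 1, U]

theorem V4_star (U : A) : star (V4 U) = Matrix.diagonal ![1, 1, 1, star U] := by
  rw [V4, Matrix.star_eq_conjTranspose, Matrix.diagonal_conjTranspose]
  congr 1; funext j; fin_cases j <;> simp

theorem V4_1 {U : A} (h : star U * U = 1) : star (V4 U) * V4 U = 1 := by
  rw [V4_star, V4, Matrix.diagonal_mul_diagonal, ← Matrix.diagonal_one]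
  congr 1; funext j; fin_cases j <;> simp [h]

theorem V4_2 {U : A} (h : U * star U = 1) : V4 U * star (V4 U) = 1 := by
  rw [V4_star, V4, Matrix.diagonal_mul_diagonal, ← Matrix.diagonal_one]
  congr 1; funext j; fin_cases j <;> simp [h]

theorem V4_comm {U g : A} (h : U * g = g * U) : V4 U * sc (Fin 4) g = sc (Fin 4) g * V4 U := by
  rw [V4, sc_apply, Matrix.diagonal_mul_diagonal, Matrix.diagonal_mul_diagonal]
  congr 1; funext j; fin_cases j <;> simp [h]

theorem cj_Md {e ψ U : A} (u2 : U * star U = 1) (ue : U * e = -(e * U)) (up : U * ψ = ψ * U)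
    (c s : ℝ) : cj (V4 U) (Md e ψ c s) = sc (Fin 4) (c • e + s • ψ) := by
  have h1 : U * e * star U = -e := by rw [ue, neg_mul, mul_assoc, u2, mul_one]
  have h2 : U * ψ * star U = ψ := by rw [up, mul_assoc, u2, mul_one]
  rw [cj_apply, V4_star, V4]
  ext i j
  rw [Matrix.mul_diagonal, Matrix.diagonal_mul, sc_apply]
  fin_cases i <;> fin_cases j <;>
    simp [Md, tens_apply, SD4, Matrix.one_apply, Matrix.diagonal_apply, mul_add, add_mul, h1, h2]

theorem cj_E0 {U r : A} : cj (V4 U) (tens S0 r) = tens S0 r := by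
  rw [cj_apply, V4_star, V4]
  ext i j
  rw [Matrix.mul_diagonal, Matrix.diagonal_mul]
  fin_cases i <;> fin_cases j <;> simp [tens_apply, S0]

theorem tens_cont {J Y : Type} [Fintype J] [DecidableEq J] [TopologicalSpace Y]
    (S : Matrix J J ℝ) {f : Y → A} (hf : Continuous f) : Continuous fun y => tens S (f y) :=
  Continuous.comp (g := (tens S : A →ₗ[ℝ] Matrix J J A))
    (LinearMap.continuous_of_finiteDimensional (tens S : A →ₗ[ℝ] Matrix J J A)) hf

theorem Md_cont {Y : Type} [TopologicalSpace Y] {e ψ : Y → A} {c s : Y → ℝ} (he : Continuous e)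
    (hψ : Continuous ψ) (hc : Continuous c) (hs : Continuous s) :
    Continuous fun y => Md (e y) (ψ y) (c y) (s y) := by
  unfold Md
  have h7 := tens_cont SD4 (f := fun y => (c y) • e y) (by fun_prop)
  have h8 := tens_cont (1 : Matrix (Fin 4) (Fin 4) ℝ) (f := fun y => (s y) • ψ y) (by fun_prop)
  exact h7.add h8

theorem Mr_cont {Y : Type} [TopologicalSpace Y] {e ψ r r0 r1 r2 : Y → A} {c s p q o : Y → ℝ}
    (he : Continuous e) (hψ : Continuous ψ) (hr : Continuous r) (hr0 : Continuous r0)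
    (hr1 : Continuous r1) (hr2 : Continuous r2)
    (hc : Continuous c) (hs : Continuous s) (hp : Continuous p) (hq : Continuous q)
    (ho : Continuous o) :
    Continuous fun y => Mr (e y) (ψ y) (r y) (r0 y) (r1 y) (r2 y) (c y) (s y) (p y) (q y) (o y) := by
  unfold Mr
  have h1 := tens_cont S0 hr
  have h2 := tens_cont S0b hr
  have h3 := tens_cont S0c hr
  have h4 := tens_cont Sb hr0
  have h5 := tens_cont Sbc hr1
  have h6 := tens_cont Scc hr2
  have h7 := tens_cont Sbd (f := fun y => (o y * s y) • e y) (by fun_prop)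
  have h8 := tens_cont Scd (f := fun y => (o y * s y) • ψ y) (by fun_prop)
  fun_prop

theorem Md_L {G : Set A} {e ψ : A} (he : e ∈ Lsub G) (hψ : ψ ∈ Lsub G) (c s : ℝ) :
    Md e ψ c s ∈ Lsub (sc (Fin 4) '' G) := by
  obtain ⟨s1, s2, s3, s4, s5, s6, s7, s8, s9⟩ := Ssym
  exact Submodule.add_mem _ (tens_L s9 (Submodule.smul_mem _ _ he))
    (tens_L (by simp) (Submodule.smul_mem _ _ hψ))

theorem Mr_L {G : Set A} {e ψ r r0 r1 r2 : A} (he : e ∈ Lsub G) (hψ : ψ ∈ Lsub G)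
    (hr : r ∈ Lsub G) (hr0 : r0 ∈ Lsub G) (hr1 : r1 ∈ Lsub G) (hr2 : r2 ∈ Lsub G)
    (c s p q o : ℝ) :
    Mr e ψ r r0 r1 r2 c s p q o ∈ Lsub (sc (Fin 4) '' G) := by
  obtain ⟨s1, s2, s3, s4, s5, s6, s7, s8, s9⟩ := Ssym
  unfold Mr
  refine Submodule.add_mem _ (Submodule.add_mem _ (Submodule.add_mem _ (Submodule.add_mem _ ?_ ?_) ?_)
    (Submodule.add_mem _ (Submodule.add_mem _ ?_ ?_) ?_)) (Submodule.add_mem _ ?_ ?_)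
  · exact Submodule.smul_mem _ _ (tens_L s1 hr)
  · exact Submodule.smul_mem _ _ (tens_L s2 hr)
  · exact Submodule.smul_mem _ _ (tens_L s3 hr)
  · exact Submodule.smul_mem _ _ (tens_L s4 hr0)
  · exact Submodule.smul_mem _ _ (tens_L s5 hr1)
  · exact Submodule.smul_mem _ _ (tens_L s6 hr2)
  · exact tens_L s7 (Submodule.smul_mem _ _ he)
  · exact tens_L s8 (Submodule.smul_mem _ _ hψ)

theorem Mr_zero (e ψ : A) (c s p q o : ℝ) (h : o * s = 0) : Mr e ψ 0 0 0 0 c s p q o = 0 := by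
  simp [Mr, h]

set_option maxHeartbeats 400000 in
theorem PP.red {G : Set A} {e : A} {ψ : C(X, A)} {U : A} (h : SD G e ψ U) {K N : Set X}
    (hKc : IsClosed K) (hN : IsOpen N) (hK : K ⊆ N) {F : C(X × I, A)} (hF : F ∈ Adm G e ψ N)
    {k : ℕ} (hP : PP (2 * k + 1 + 2) (Lsub G) N (fun z => F z - pencil e ψ z)) :
    ∃ (N' : Set X) (F' : C(X × I, Matrix (Fin 4) (Fin 4) A)), IsOpen N' ∧ K ⊆ N' ∧
      JoinedIn (Adm (sc (Fin 4) '' G) (sc (Fin 4) e) ((sahC (sc (Fin 4))).comp ψ) N')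
        (stab (Fin 4) 0 e ψ F) F' ∧
      PP (2 * k + 1) (Lsub (sc (Fin 4) '' G)) N'
        (fun z => F' z - pencil (sc (Fin 4) e) ((sahC (sc (Fin 4))).comp ψ) z) := by
  obtain ⟨N', hN'o, hKN', hN'N⟩ := normal_exists_closure_subset hKc hN hK
  obtain ⟨o, ho0, ho1, hoI⟩ := exists_continuous_zero_one_of_isClosed isClosed_closure
    hN.isClosed_compl (disjoint_compl_right_iff_subset.2 hN'N)
  replace ho0 : ∀ x ∈ N', o x = 0 := fun x hx => ho0 (subset_closure hx)
  replace ho1 : ∀ x, x ∉ N → o x = 1 := fun x hx => ho1 hx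
  replace hN'N : N' ⊆ N := subset_closure.trans hN'N
  obtain ⟨a, ha, hr⟩ := hP
  set m := 2 * k + 1 with hm
  let r0 : C(X × I, A) := ⟨fun z => ∑ i ∈ Finset.range m,
    (cc z.2 ^ (m - 1 - i) * ss z.2 ^ (i + 1)) • a i z.1, by
      have := cc_cont; have := ss_cont; fun_prop⟩
  let r1 : C(X × I, A) := ⟨fun z => ss z.2 ^ m • a m z.1, by
      have := cc_cont; have := ss_cont; fun_prop⟩
  let r2 : C(X × I, A) := ⟨fun z => ss z.2 ^ m • a (m + 1) z.1, by
      have := cc_cont; have := ss_cont; fun_prop⟩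
  let r : C(X × I, A) := F - pencil e ψ
  have hrr : ∀ z, r z = (cc z.2 ^ 2) • r0 z + (cc z.2 * ss z.2) • r1 z + (ss z.2 ^ 2) • r2 z := by
    rintro ⟨x, t⟩
    refine (hr x t).trans ?_
    rw [Finset.sum_range_succ, Finset.sum_range_succ]
    congr 1
    · congr 1
      · simp only [r0, ContinuousMap.coe_mk, Finset.smul_sum, smul_smul]
        refine Finset.sum_congr rfl fun i hi => ?_
        have hi' : i < m := by simpa using hi
        congr 1
        have : m + 2 - 1 - i = (m - 1 - i) + 2 := by omega
        rw [this]; ring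
      · simp only [r1, ContinuousMap.coe_mk, smul_smul]
        congr 1
        have : m + 2 - 1 - m = 1 := by omega
        rw [this]; ring
    · simp only [r2, ContinuousMap.coe_mk, smul_smul]
      congr 1
      have : m + 2 - 1 - (m + 1) = 0 := by omega
      rw [this]; ring
  have rN : ∀ x ∈ N, ∀ t, r0 (x, t) = 0 ∧ r1 (x, t) = 0 ∧ r2 (x, t) = 0 := by
    intro x hx t
    simp only [r0, r1, r2, ContinuousMap.coe_mk, (ha _ x).2 hx, smul_zero, Finset.sum_const_zero,
      and_self]
  have rs : ∀ x t, ss t = 0 → r0 (x, t) = 0 ∧ r1 (x, t) = 0 ∧ r2 (x, t) = 0 := by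
    intro x t ht
    have hm0 : m ≠ 0 := by omega
    simp [r0, r1, r2, ht, hm0]
  have rL : ∀ z, r0 z ∈ Lsub G ∧ r1 z ∈ Lsub G ∧ r2 z ∈ Lsub G := by
    intro z
    refine ⟨?_, Submodule.smul_mem _ _ (ha _ _).1, Submodule.smul_mem _ _ (ha _ _).1⟩
    change ∑ i ∈ Finset.range m, (cc z.2 ^ (m - 1 - i) * ss z.2 ^ (i + 1)) • a i z.1 ∈ Lsub G
    exact (Submodule.sum_mem _ fun i _ => Submodule.smul_mem _ _ (ha i z.1).1)
  have rL' : ∀ z, r z ∈ Lsub G := fun z => Submodule.sub_mem _ (hF.1 z).1 (pencil_L h z)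
  have hps : ∀ z : X × I, pencil e ψ z = cc z.2 • e + ss z.2 • ψ z.1 := fun z => rfl
  obtain ⟨M, hM⟩ : ∃ M : (X × I) × (ℝ × ℝ × ℝ) → Matrix (Fin 4) (Fin 4) A, ∀ z p q u,
    M (z, p, q, u) = cj (V4 U) (Md e (ψ z.1) (cc z.2) (ss z.2) + Mr e (ψ z.1) (r z) (r0 z) (r1 z)
      (r2 z) (cc z.2) (ss z.2) p q (u * o z.1)) :=
    ⟨fun y => cj (V4 U) (Md e (ψ y.1.1) (cc y.1.2) (ss y.1.2) + Mr e (ψ y.1.1) (r y.1) (r0 y.1)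
      (r1 y.1) (r2 y.1) (cc y.1.2) (ss y.1.2) y.2.1 y.2.2.1 (y.2.2.2 * o y.1.1)), fun _ _ _ _ => rfl⟩
  have hMc : Continuous M := by
    have hM' : M = fun y => cj (V4 U) (Md e (ψ y.1.1) (cc y.1.2) (ss y.1.2) +
      Mr e (ψ y.1.1) (r y.1) (r0 y.1)
      (r1 y.1) (r2 y.1) (cc y.1.2) (ss y.1.2) y.2.1 y.2.2.1 (y.2.2.2 * o y.1.1)) :=
      funext fun y => hM y.1 y.2.1 y.2.2.1 y.2.2.2
    have hcj := LinearMap.continuous_of_finiteDimensional (cj (V4 U))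
    have c1 : Continuous fun y : (X × I) × (ℝ × ℝ × ℝ) => cc y.1.2 := cc_cont.comp (by fun_prop)
    have c2 : Continuous fun y : (X × I) × (ℝ × ℝ × ℝ) => ss y.1.2 := ss_cont.comp (by fun_prop)
    have c3 : Continuous fun y : (X × I) × (ℝ × ℝ × ℝ) => e := by fun_prop
    have c4 : Continuous fun y : (X × I) × (ℝ × ℝ × ℝ) => ψ y.1.1 := by fun_prop
    have c5 : Continuous fun y : (X × I) × (ℝ × ℝ × ℝ) => r y.1 := by fun_prop
    have c6 : Continuous fun y : (X × I) × (ℝ × ℝ × ℝ) => r0 y.1 := by fun_prop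
    have c7 : Continuous fun y : (X × I) × (ℝ × ℝ × ℝ) => r1 y.1 := by fun_prop
    have c8 : Continuous fun y : (X × I) × (ℝ × ℝ × ℝ) => r2 y.1 := by fun_prop
    have c9 : Continuous fun y : (X × I) × (ℝ × ℝ × ℝ) => y.2.1 := by fun_prop
    have c10 : Continuous fun y : (X × I) × (ℝ × ℝ × ℝ) => y.2.2.1 := by fun_prop
    have c11 : Continuous fun y : (X × I) × (ℝ × ℝ × ℝ) => y.2.2.2 * o y.1.1 := by fun_prop
    rw [hM']
    exact hcj.comp ((Md_cont c3 c4 c1 c2).add (Mr_cont c3 c4 c5 c6 c7 c8 c1 c2 c9 c10 c11))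
  have hV1 := V4_1 h.u1
  have hV2 := V4_2 h.u2
  have hVG : ∀ g ∈ sc (Fin 4) '' G, V4 U * g = g * V4 U := by
    rintro _ ⟨g, hg, rfl⟩; exact V4_comm (h.uG g hg)
  have hbase : ∀ z p q u, r0 z = 0 → r1 z = 0 → r2 z = 0 → u * o z.1 * ss z.2 = 0 →
      M (z, p, q, u) = sc (Fin 4) (pencil e ψ z) := by
    intro z p q u h0 h1 h2 h3
    have hr0 : r z = 0 := by rw [hrr, h0, h1, h2]; simp
    rw [hM, h0, h1, h2, hr0, Mr_zero _ _ _ _ _ _ _ h3, add_zero, cj_Md h.u2 h.ue (h.up _), hps]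
  have hpen : ∀ z, pencil (sc (Fin 4) e) ((sahC (sc (Fin 4))).comp ψ) z =
      sc (Fin 4) (pencil e ψ z) := by
    intro z; rw [← pencil_map]; rfl
  have hadm : ∀ p q u : ℝ, p ^ 2 + q ^ 2 = 1 → (q = 0 ∨ u = 1) →
      (⟨fun z => M (z, p, q, u), by fun_prop⟩ : C(X × I, _)) ∈
        Adm (sc (Fin 4) '' G) (sc (Fin 4) e) ((sahC (sc (Fin 4))).comp ψ) N' := by
    intro p q u hpq hqu
    refine ⟨fun z => ⟨?_, ?_⟩, fun x => ?_, fun x => ?_, fun x hx t => ?_⟩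
    · change M (z, p, q, u) ∈ _
      rw [hM]
      exact cj_L hV1 hVG hV2 (Submodule.add_mem _ (Md_L h.eL (h.pL _) _ _)
        (Mr_L h.eL (h.pL _) (rL' z) (rL z).1 (rL z).2.1 (rL z).2.2 _ _ _ _ _))
    · change IsUnit (M (z, p, q, u))
      rw [hM]
      refine cj_unit hV1 hV2 (M_unit _ _ _ _ _ _ _ _ _ _ (cs1 _) hpq h.e2 (h.p2 _) (h.ep _) _
        (hrr z) ?_ ?_)
      · rw [← hps]
        have : pencil e ψ z + r z = F z := by simp [r]
        rw [this]; exact (hF.1 z).2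
      · by_cases hz : z.1 ∈ N
        · right
          obtain ⟨h1, h2, h3⟩ := rN z.1 hz z.2
          change q • r0 (z.1, z.2) = 0 ∧ q • r1 (z.1, z.2) = 0 ∧ q • r2 (z.1, z.2) = 0
          rw [h1, h2, h3]; simp
        · rcases hqu with rfl | rfl
          · right; simp
          · left; rw [ho1 _ hz]; simp
    · obtain ⟨h1, h2, h3⟩ := rs x 0 ss_zero
      change M ((x, 0), p, q, u) = _
      rw [hbase _ _ _ _ h1 h2 h3 (by simp [ss_zero])]
      simp [hps, ss_zero, cc_zero]
    · obtain ⟨h1, h2, h3⟩ := rs x 1 ss_one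
      change M ((x, 1), p, q, u) = _
      rw [hbase _ _ _ _ h1 h2 h3 (by simp [ss_one])]
      simp [hps, ss_one, cc_one]
    · obtain ⟨h1, h2, h3⟩ := rN x (hN'N hx) t
      change M ((x, t), p, q, u) = _
      rw [hbase _ _ _ _ h1 h2 h3 (by simp [ho0 x hx]), hpen]
  refine ⟨N', ⟨fun z => M (z, 0, 1, 1), by fun_prop⟩, hN'o, hKN', ?_, ?_⟩
  · have j1 := joinedIn_of_homotopy (X := X × I)
      (S := Adm (sc (Fin 4) '' G) (sc (Fin 4) e) ((sahC (sc (Fin 4))).comp ψ) N')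
      (f := stab (Fin 4) 0 e ψ F) (g := ⟨fun z => M (z, 1, 0, 1), by fun_prop⟩)
      ⟨fun w : I × (X × I) => M (w.2, 1, 0, (w.1 : ℝ)), by fun_prop⟩ ?_ ?_ ?_
    · have j2 := joinedIn_of_homotopy (X := X × I)
        (S := Adm (sc (Fin 4) '' G) (sc (Fin 4) e) ((sahC (sc (Fin 4))).comp ψ) N')
        (f := ⟨fun z => M (z, 1, 0, 1), by fun_prop⟩) (g := ⟨fun z => M (z, 0, 1, 1), by fun_prop⟩)
        ⟨fun w : I × (X × I) => M (w.2, Real.cos (Real.pi / 2 * w.1), Real.sin (Real.pi / 2 * w.1), 1),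
          by fun_prop⟩ ?_ ?_ ?_
      · exact j1.trans j2
      · intro z
        change M (z, Real.cos (Real.pi / 2 * (0 : ℝ)), Real.sin (Real.pi / 2 * (0 : ℝ)), 1)
          = M (z, 1, 0, 1)
        rw [mul_zero, Real.cos_zero, Real.sin_zero]
      · intro z
        change M (z, Real.cos (Real.pi / 2 * (1 : ℝ)), Real.sin (Real.pi / 2 * (1 : ℝ)), 1)
          = M (z, 0, 1, 1)
        rw [mul_one, Real.cos_pi_div_two, Real.sin_pi_div_two]
      · intro t
        exact hadm (Real.cos (Real.pi / 2 * t)) (Real.sin (Real.pi / 2 * t)) 1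
          (Real.cos_sq_add_sin_sq _) (Or.inr rfl)
    · intro z
      change M (z, 1, 0, 0) = _
      rw [hM, Mr, stab_apply, map_add, cj_Md h.u2 h.ue (h.up _)]
      simp only [zero_mul, mul_zero, zero_smul, map_zero, add_zero, one_pow, one_smul, ne_eq,
        OfNat.ofNat_ne_zero, not_false_eq_true, zero_pow]
      rw [cj_E0, ← hps, sc_apply]
      ext i j
      fin_cases i <;> fin_cases j <;> simp [tens_apply, S0, r]
    · intro z; rfl
    · intro t
      exact hadm 1 0 (t : ℝ) (by norm_num) (Or.inl rfl)
  · obtain ⟨s1, s2, s3, s4, s5, s6, s7, s8, s9⟩ := Ssym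
    have hcL : ∀ {S : Matrix (Fin 4) (Fin 4) ℝ}, Sᵀ = S → ∀ v ∈ Lsub G,
        ((cj (V4 U)).comp (tens S)) v ∈ Lsub (sc (Fin 4) '' G) := fun hS v hv =>
      cj_L hV1 hVG hV2 (tens_L hS hv)
    have p0 : PP m (Lsub G) N' r0 := ⟨a, fun i x => ⟨(ha i x).1, fun hx => (ha i x).2 (hN'N hx)⟩,
      fun x t => rfl⟩
    have p1 : PP m (Lsub G) N' r1 := (PP.single (m - 1) (by omega) (a m) (fun x => (ha m x).1)
      (fun x hx => (ha m x).2 (hN'N hx))).congr fun z => by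
        have : m - 1 + 1 = m := by omega
        simp [r1, this]
    have p2 : PP m (Lsub G) N' r2 := (PP.single (m - 1) (by omega) (a (m + 1)) (fun x => (ha _ x).1)
      (fun x hx => (ha _ x).2 (hN'N hx))).congr fun z => by
        have : m - 1 + 1 = m := by omega
        simp [r2, this]
    have hm1 : m = 1 + 2 * k := by omega
    have pe : PP m (Lsub G) N' (fun z : X × I => (o z.1 * ss z.2) • e) := by
      rw [hm1]
      refine ((PP.one ⟨fun x => o x • e, by fun_prop⟩ (fun x => Submodule.smul_mem _ _ h.eL)
        (fun x hx => by simp [ho0 x hx])).raises k).congr fun z => ?_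
      simp [smul_smul, mul_comm]
    have pp : PP m (Lsub G) N' (fun z : X × I => (o z.1 * ss z.2) • ψ z.1) := by
      rw [hm1]
      refine ((PP.one ⟨fun x => o x • ψ x, by fun_prop⟩ (fun x => Submodule.smul_mem _ _ (h.pL x))
        (fun x hx => by simp [ho0 x hx])).raises k).congr fun z => ?_
      simp [smul_smul, mul_comm]
    refine ((((p0.lin _ (hcL s4)).add (p1.lin _ (hcL s5))).add (p2.lin _ (hcL s6))).add
      ((pe.lin _ (hcL s7)).add (pp.lin _ (hcL s8)))).congr fun z => ?_
    rw [hpen]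
    change M (z, 0, 1, 1) - _ = _
    rw [hM, Mr, map_add, cj_Md h.u2 h.ue (h.up _), ← hps]
    simp only [zero_mul, mul_zero, zero_smul, map_zero, add_zero, one_pow, one_smul, ne_eq,
        OfNat.ofNat_ne_zero, not_false_eq_true, zero_pow, zero_add, map_add, one_mul,
        LinearMap.comp_apply, add_sub_cancel_left]

end
end S6

set_option linter.unusedSectionVars false
set_option linter.unusedVariables false
set_option linter.deprecated false

namespace S6
open Set Topology Module Matrix
open scoped unitInterval

section
variable {A : Type} [Ring A] [Algebra ℝ A] [StarRing A] [TopologicalSpace A] [GA A]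
variable {X : Type} [TopologicalSpace X] [CompactSpace X] [T2Space X]

/-- no real eigenvalues -/
def NR (k : A) : Prop := ∀ l : ℝ, IsUnit (l • (1 : A) + k)

theorem smul_isUnit {l : ℝ} (hl : l ≠ 0) {a : A} (h : IsUnit a) : IsUnit (l • a) := by
  obtain ⟨u, rfl⟩ := h
  refine ⟨⟨l • (u : A), l⁻¹ • ((u⁻¹ : Aˣ) : A), ?_, ?_⟩, rfl⟩ <;>
  simp [smul_smul, hl]

theorem NR.lin {k : A} (h : NR k) {c s : ℝ} (hcs : c ≠ 0 ∨ s ≠ 0) :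
    IsUnit (c • (1 : A) + s • k) := by
  by_cases hs : s = 0
  · subst hs
    rw [zero_smul, add_zero]
    exact smul_isUnit (by simpa using hcs) isUnit_one
  · have : c • (1 : A) + s • k = s • ((c / s) • (1 : A) + k) := by
      rw [smul_add, smul_smul]; congr 2; field_simp
    rw [this]
    exact smul_isUnit hs (h _)

theorem NR.unit {k : A} (h : NR k) : IsUnit k := by simpa using h 0

/-- Newton iteration -/
noncomputable def nK (k : A) : A := (1 / 2 : ℝ) • (k - Ring.inverse k)

theorem NR.path {k : A} (h : NR k) {u : ℝ} (h0 : 0 ≤ u) (h1 : u ≤ 1 / 2) :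
    NR ((1 - u) • k - u • Ring.inverse k) := by
  intro l
  have hk := h.unit
  set ki := Ring.inverse k with hki
  have e1 : ki * k = 1 := Ring.inverse_mul_cancel _ hk
  have e2 : k * ki = 1 := Ring.mul_inverse_cancel _ hk
  have hd : 0 ≤ l ^ 2 + 4 * (1 - u) * u := by nlinarith [sq_nonneg l]
  set d := Real.sqrt (l ^ 2 + 4 * (1 - u) * u) with hdd
  have hd2 : d ^ 2 = l ^ 2 + 4 * (1 - u) * u := Real.sq_sqrt hd
  have h1u : (1 - u) ≠ 0 := by linarith
  have key : l • (1 : A) + ((1 - u) • k - u • ki) =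
      ((((1 - u) • (1 : A)) * ki) * (((l + d) / (2 * (1 - u))) • (1 : A) + k)) *
        (((l - d) / (2 * (1 - u))) • (1 : A) + k) := by
    have hp : ((l + d) / (2 * (1 - u))) * ((l - d) / (2 * (1 - u))) = -u / (1 - u) := by
      field_simp; linear_combination -hd2
    have hs : ((l + d) / (2 * (1 - u))) + ((l - d) / (2 * (1 - u))) = l / (1 - u) := by
      field_simp; ring
    set y := ((l + d) / (2 * (1 - u)))
    set z := ((l - d) / (2 * (1 - u)))
    simp only [smul_mul_assoc, one_mul, mul_add, add_mul, mul_smul_comm, mul_one, e1, smul_add,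
      smul_smul]
    have : l = (1 - u) * (y + z) := by rw [hs]; field_simp
    have h5 : u = -((1 - u) * (y * z)) := by rw [hp]; field_simp
    calc l • (1 : A) + ((1 - u) • k - u • ki) =
        ((1 - u) * (y + z)) • (1 : A) + ((1 - u) • k - (-((1 - u) * (y * z))) • ki) := by
          rw [← this, ← h5]
      _ = _ := by module
  rw [key]
  refine IsUnit.mul (IsUnit.mul (IsUnit.mul (smul_isUnit h1u isUnit_one) ?_) (h _)) (h _)
  exact ⟨⟨ki, k, e1, e2⟩, rfl⟩

theorem NR.nK {k : A} (h : NR k) : NR (nK k) := by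
  have := h.path (u := 1 / 2) (by norm_num) (by norm_num)
  convert this using 1
  rw [S6.nK, smul_sub]; norm_num

/-- rotated element -/
noncomputable def om (t : ℝ) (k : A) : A :=
  (Real.cos (Real.pi * t) • k - Real.sin (Real.pi * t) • (1 : A)) *
    Ring.inverse (Real.cos (Real.pi * t) • (1 : A) + Real.sin (Real.pi * t) • k)

theorem cs_ne (θ : ℝ) : Real.cos θ ≠ 0 ∨ Real.sin θ ≠ 0 := by
  by_contra h
  push Not at h
  have := Real.cos_sq_add_sin_sq θ
  rw [h.1, h.2] at this; norm_num at this

theorem om_pair {k : A} (h : NR k) (t : ℝ) : om t k + om (t + 1 / 2) k = (2 : ℝ) • om (2 * t) (nK k) := by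
  have a1 : Real.pi * (t + 1 / 2) = Real.pi * t + Real.pi / 2 := by ring
  have a2 : Real.pi * (2 * t) = 2 * (Real.pi * t) := by ring
  unfold om
  rw [a1, a2, Real.cos_add_pi_div_two, Real.sin_add_pi_div_two, Real.cos_two_mul', Real.sin_two_mul]
  have hne := cs_ne (Real.pi * t)
  set c := Real.cos (Real.pi * t) with hc
  set s := Real.sin (Real.pi * t) with hs
  have hR : IsUnit ((c ^ 2 - s ^ 2) • (1 : A) + (2 * s * c) • nK k) := by
    have := (h.nK).lin (cs_ne (2 * (Real.pi * t)))
    rwa [Real.cos_two_mul', Real.sin_two_mul] at this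
  have hP : IsUnit (c • (1 : A) + s • k) := h.lin hne
  have hQ : IsUnit (-s • (1 : A) + c • k) := h.lin (by rcases hne with h | h <;> simp [h])
  have hk := h.unit
  have hki : Ring.inverse k * k = 1 := Ring.inverse_mul_cancel _ hk
  have hk2 : k * Ring.inverse k = 1 := Ring.mul_inverse_cancel _ hk
  unfold nK at *
  set ki := Ring.inverse k
  set P := c • (1 : A) + s • k with hPd
  set Q := -s • (1 : A) + c • k with hQd
  set R := (c ^ 2 - s ^ 2) • (1 : A) + (2 * s * c) • ((1 / 2 : ℝ) • (k - ki)) with hRd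
  have PQ : Commute P Q := by
    change P * Q = Q * P
    simp only [hPd, hQd, mul_add, add_mul, smul_mul_assoc, mul_smul_comm, one_mul, mul_one]
    module
  have Pi : Commute P (Ring.inverse P) := by
    change _ = _
    rw [Ring.mul_inverse_cancel _ hP, Ring.inverse_mul_cancel _ hP]
  have RK : R * k = P * Q := by
    simp only [hRd, hPd, hQd, mul_add, add_mul, smul_mul_assoc, mul_smul_comm, one_mul, mul_one,
      sub_mul, hki]
    module
  have hn : (c ^ 2 - s ^ 2) • ((1 / 2 : ℝ) • (k - ki)) - (2 * s * c) • (1 : A) =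
      ((1 / 2 : ℝ) • (Q * Q - P * P)) * ki := by
    simp only [hPd, hQd, mul_add, add_mul, smul_mul_assoc, mul_smul_comm, one_mul, mul_one,
      sub_mul, mul_assoc, hk2]
    module
  have cQi : P * Ring.inverse Q = Ring.inverse Q * P := by
    calc P * Ring.inverse Q = Ring.inverse Q * Q * P * Ring.inverse Q := by
          rw [Ring.inverse_mul_cancel _ hQ, one_mul]
      _ = Ring.inverse Q * (P * Q) * Ring.inverse Q := by rw [PQ.eq, ← mul_assoc]
      _ = Ring.inverse Q * P := by
          rw [mul_assoc, mul_assoc, Ring.mul_inverse_cancel _ hQ, mul_one]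
  have cPi : Q * Ring.inverse P = Ring.inverse P * Q := by
    calc Q * Ring.inverse P = Ring.inverse P * P * Q * Ring.inverse P := by
          rw [Ring.inverse_mul_cancel _ hP, one_mul]
      _ = Ring.inverse P * (Q * P) * Ring.inverse P := by rw [← PQ.eq, ← mul_assoc]
      _ = Ring.inverse P * Q := by
          rw [mul_assoc, mul_assoc, Ring.mul_inverse_cancel _ hP, mul_one]
  have hRi : Ring.inverse R = k * (Ring.inverse Q * Ring.inverse P) := by
    have : R * (k * (Ring.inverse Q * Ring.inverse P)) = 1 := by
      rw [← mul_assoc, RK, mul_assoc, ← mul_assoc Q, Ring.mul_inverse_cancel _ hQ, one_mul,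
        Ring.mul_inverse_cancel _ hP]
    calc Ring.inverse R = Ring.inverse R * (R * (k * (Ring.inverse Q * Ring.inverse P))) := by
          rw [this, mul_one]
      _ = _ := by rw [← mul_assoc, Ring.inverse_mul_cancel _ hR, one_mul]
  have f1 : Q * Q * (Ring.inverse Q * Ring.inverse P) = Q * Ring.inverse P := by
    rw [mul_assoc, ← mul_assoc Q (Ring.inverse Q), Ring.mul_inverse_cancel _ hQ, one_mul]
  have f2 : P * P * (Ring.inverse Q * Ring.inverse P) = P * Ring.inverse Q := by
    rw [mul_assoc, ← mul_assoc P (Ring.inverse Q), cQi, mul_assoc (Ring.inverse Q),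
      Ring.mul_inverse_cancel _ hP, mul_one, cQi]
  have g1 : c • k - s • (1 : A) = Q := by rw [hQd]; module
  have g2 : (-s) • k - c • (1 : A) = -P := by rw [hPd]; module
  rw [g1, g2, hn, hRi, mul_assoc, ← mul_assoc ki, hki, one_mul, smul_mul_assoc, sub_mul, f1, f2, neg_mul]
  module

theorem om_zero {k : A} : om 0 k = k := by simp [om]

theorem newton_avg (n : ℕ) : ∀ {k : A}, NR k → nK^[n] k =
    ((1 / 2 : ℝ) ^ n) • ∑ j ∈ Finset.range (2 ^ n), om ((j : ℝ) / 2 ^ n) k := by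
  induction n with
  | zero => intro k _; simp [om_zero]
  | succ n ih =>
    intro k h
    rw [Function.iterate_succ_apply, ih h.nK, pow_succ 2 n, mul_two, Finset.sum_range_add,
      ← Finset.sum_add_distrib]
    have : ∀ j ∈ Finset.range (2 ^ n), (om ((j : ℝ) / 2 ^ (n + 1)) k +
        om (((2 ^ n + j : ℕ) : ℝ) / 2 ^ (n + 1)) k) = (2 : ℝ) • om ((j : ℝ) / 2 ^ n) (nK k) := by
      intro j _
      have h1 : ((2 ^ n + j : ℕ) : ℝ) / 2 ^ (n + 1) = (j : ℝ) / 2 ^ (n + 1) + 1 / 2 := by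
        push_cast; field_simp; ring
      have h2 : (j : ℝ) / 2 ^ n = 2 * ((j : ℝ) / 2 ^ (n + 1)) := by field_simp; ring
      rw [h1, h2, om_pair h]
    rw [Finset.sum_congr rfl this, ← Finset.smul_sum, smul_smul]
    congr 1
    ring

theorem nK_diff (n : ℕ) {k : A} (h : NR k) : nK^[n] k - nK^[n + 1] k =
    ((1 / 2 : ℝ) ^ (n + 1)) • ∑ j ∈ Finset.range (2 ^ n),
      (om ((j : ℝ) / 2 ^ n) k - om ((j : ℝ) / 2 ^ n + 1 / 2 ^ (n + 1)) k) := by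
  rw [newton_avg n h, newton_avg (n + 1) h]
  have key : ∀ (m : ℕ) (f : ℕ → A), ∑ j ∈ Finset.range (m * 2), f j =
      ∑ j ∈ Finset.range m, (f (2 * j) + f (2 * j + 1)) := by
    intro m f
    induction m with
    | zero => simp
    | succ m ih =>
      rw [Finset.sum_range_succ, ← ih, Nat.succ_mul, Finset.sum_range_succ, Finset.sum_range_succ,
        mul_comm m 2]; abel
  rw [pow_succ 2 n, key, pow_succ, mul_smul, mul_smul, ← smul_sub, Finset.smul_sum (r := (1 / 2 : ℝ)),
    Finset.smul_sum (r := (1 / 2 : ℝ)), ← Finset.sum_sub_distrib]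
  congr 1
  refine Finset.sum_congr rfl fun j _ => ?_
  have h1 : ((2 * j : ℕ) : ℝ) / (2 ^ n * 2) = (j : ℝ) / 2 ^ n := by push_cast; field_simp
  have h2 : ((2 * j + 1 : ℕ) : ℝ) / (2 ^ n * 2) = (j : ℝ) / 2 ^ n + 1 / (2 ^ n * 2) := by
    push_cast; field_simp
  simp only [pow_succ (2 : ℝ) n, h1, h2]
  module

theorem nK_sq {k : A} (h : NR k) : k * k + 1 = (2 : ℝ) • (k * (k - nK k)) := by
  have hk2 : k * Ring.inverse k = 1 := Ring.mul_inverse_cancel _ h.unit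
  simp only [nK, mul_sub, mul_smul_comm, hk2]
  module

end
end S6

set_option linter.unusedSectionVars false
set_option linter.unusedVariables false
set_option linter.deprecated false

namespace S6
open Set Topology Module Matrix
open scoped unitInterval

section
variable {A : Type} [Ring A] [Algebra ℝ A] [StarRing A] [TopologicalSpace A] [GA A]
variable {X : Type} [TopologicalSpace X] [CompactSpace X] [T2Space X]

/-- admissible pencils -/
def Pen (G : Set A) (e : A) (ψ : C(X, A)) (N : Set X) : Set C(X, A) :=
  {b | ∀ x, b x ∈ Lsub G ∧ (x ∈ N → b x = ψ x) ∧ NR (e * b x)}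

theorem pen_adm {G : Set A} {e : A} {ψ : C(X, A)} {U : A} (h : SD G e ψ U) {N : Set X} {b : C(X, A)}
    (hb : b ∈ Pen G e ψ N) : pencil e b ∈ Adm G e ψ N := by
  have eu : IsUnit e := ⟨⟨e, e, h.e2, h.e2⟩, rfl⟩
  refine ⟨fun z => ⟨?_, ?_⟩, fun x => by simp [pencil_apply], fun x => by simp [pencil_apply],
    fun x hx t => by simp [pencil_apply, (hb x).2.1 hx]⟩
  · exact (Lsub G).add_mem ((Lsub G).smul_mem _ h.eL) ((Lsub G).smul_mem _ (hb _).1)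
  · have := eu.mul ((hb z.1).2.2.lin (cs_ne (Real.pi * z.2)))
    convert this using 1
    rw [mul_add, mul_smul_comm, mul_smul_comm, mul_one, ← mul_assoc, h.e2, one_mul]
    rfl

theorem pen_joined {G : Set A} {e : A} {ψ : C(X, A)} {U : A} (h : SD G e ψ U) {N : Set X}
    {b b' : C(X, A)} (hb : JoinedIn (Pen G e ψ N) b b') :
    JoinedIn (Adm G e ψ N) (pencil e b) (pencil e b') := by
  obtain ⟨H, h0, h1, h2⟩ := homotopy_of_joinedIn hb
  refine joinedIn_of_homotopy ⟨fun w : I × (X × I) => Real.cos (Real.pi * w.2.2) • e +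
    Real.sin (Real.pi * w.2.2) • H (w.1, w.2.1), by fun_prop⟩ ?_ ?_ ?_
  · rintro ⟨x, t⟩; simp [h0, pencil_apply]
  · rintro ⟨x, t⟩; simp [h1, pencil_apply]
  · intro t; exact pen_adm h (h2 t)

theorem NR_of_adm {G : Set A} {e : A} {ψ : C(X, A)} {U : A} (h : SD G e ψ U) {N : Set X} {b : C(X, A)}
    (hb : pencil e b ∈ Adm G e ψ N) (x : X) : NR (e * b x) := by
  have eu : IsUnit e := ⟨⟨e, e, h.e2, h.e2⟩, rfl⟩
  intro l
  set d := Real.sqrt (1 + l ^ 2) with hd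
  have hd2 : d ^ 2 = 1 + l ^ 2 := Real.sq_sqrt (by positivity)
  have hd0 : 0 < d := Real.sqrt_pos.2 (by positivity)
  have hl : |l / d| ≤ 1 := by
    rw [← sq_le_one_iff_abs_le_one, div_pow, hd2, div_le_one (by positivity)]; linarith
  rw [abs_le] at hl
  set θ := Real.arccos (l / d)
  have hc : Real.cos θ = l / d := Real.cos_arccos hl.1 hl.2
  have hs : Real.sin θ = 1 / d := by
    rw [Real.sin_arccos, Real.sqrt_eq_iff_mul_self_eq] <;> try positivity
    · field_simp; linarith
    · rw [div_pow, hd2, sub_nonneg, div_le_one (by positivity)]; linarith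
  have hpi := Real.pi_pos
  have ht : θ / Real.pi ∈ Icc (0 : ℝ) 1 :=
    ⟨div_nonneg (Real.arccos_nonneg _) hpi.le, (div_le_one hpi).2 (Real.arccos_le_pi _)⟩
  have hu := (hb.1 (x, ⟨θ / Real.pi, ht⟩)).2
  rw [pencil_apply] at hu
  have : Real.pi * (θ / Real.pi) = θ := by field_simp
  simp only [this, hc, hs] at hu
  have h2 := eu.mul (smul_isUnit hd0.ne' hu)
  convert h2 using 1
  rw [smul_add, smul_smul, smul_smul, mul_add, mul_smul_comm, mul_smul_comm, h.e2]
  have h3 : d * (l / d) = l := by field_simp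
  have h4 : d * (1 / d) = 1 := by field_simp
  rw [h3, h4, one_smul]

theorem Lsub_sandwich {G : Set A} {e a : A} (he : e ∈ Lsub G) (ha : a ∈ Lsub G) :
    e * a * e ∈ Lsub G := by
  refine ⟨by simp [he.1, ha.1, mul_assoc], fun g hg => ?_⟩
  rw [← mul_assoc, ← mul_assoc, he.2 g hg, neg_mul, neg_mul, mul_assoc e g a, ha.2 g hg, mul_neg,
    neg_mul, neg_neg, mul_assoc, mul_assoc, he.2 g hg, mul_neg, mul_neg, ← mul_assoc, ← mul_assoc]

theorem Lsub_inverse {G : Set A} {a : A} (ha : a ∈ Lsub G) (hu : IsUnit a) :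
    Ring.inverse a ∈ Lsub G := by
  have h1 := Ring.inverse_mul_cancel _ hu
  have h2 := Ring.mul_inverse_cancel _ hu
  refine ⟨?_, fun g hg => ?_⟩
  · have : star (Ring.inverse a) * a = 1 := by
      rw [← ha.1, ← star_mul, ha.1, h2, star_one]
    calc star (Ring.inverse a) = star (Ring.inverse a) * (a * Ring.inverse a) := by rw [h2, mul_one]
      _ = _ := by rw [← mul_assoc, this, one_mul]
  · calc g * Ring.inverse a = Ring.inverse a * (a * g) * Ring.inverse a := by
          rw [← mul_assoc, h1, one_mul]
      _ = Ring.inverse a * (-(g * a)) * Ring.inverse a := by rw [ha.2 g hg, neg_neg]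
      _ = _ := by simp only [mul_neg, neg_mul, mul_assoc, h2, mul_one]

theorem newton_step {G : Set A} {e : A} {ψ : C(X, A)} {U : A} (h : SD G e ψ U) {N : Set X}
    {b : C(X, A)} (hb : b ∈ Pen G e ψ N) : ∃ b' : C(X, A), JoinedIn (Pen G e ψ N) b b' ∧
      ∀ x, e * b' x = nK (e * b x) := by
  have eu : IsUnit e := ⟨⟨e, e, h.e2, h.e2⟩, rfl⟩
  have bu : ∀ x, IsUnit (b x) := by
    intro x
    have := eu.mul (hb x).2.2.unit
    rwa [← mul_assoc, h.e2, one_mul] at this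
  have hic : Continuous fun x => Ring.inverse (b x) :=
    continuousOn_inverse.comp_continuous b.continuous bu
  have hinv : ∀ x, Ring.inverse (e * b x) = Ring.inverse (b x) * e := by
    intro x
    have e1 : (e * b x) * (Ring.inverse (b x) * e) = 1 := by
      rw [mul_assoc, ← mul_assoc (b x), Ring.mul_inverse_cancel _ (bu x), one_mul, h.e2]
    calc _ = Ring.inverse (e * b x) * ((e * b x) * (Ring.inverse (b x) * e)) := by rw [e1, mul_one]
      _ = _ := by rw [← mul_assoc, Ring.inverse_mul_cancel _ (eu.mul (bu x)), one_mul]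
  have key : ∀ (u : ℝ) x, e * ((1 - u) • b x - u • (e * Ring.inverse (b x) * e)) =
      (1 - u) • (e * b x) - u • Ring.inverse (e * b x) := by
    intro u x
    rw [hinv, mul_sub, mul_smul_comm, mul_smul_comm, ← mul_assoc, ← mul_assoc, h.e2, one_mul]
  refine ⟨⟨fun x => (1 - (1 / 2 : ℝ)) • b x - (1 / 2 : ℝ) • (e * Ring.inverse (b x) * e), by fun_prop⟩,
    ?_, fun x => ?_⟩
  · refine joinedIn_of_homotopy ⟨fun w : I × X => (1 - (w.1 : ℝ) / 2) • b w.2 -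
      ((w.1 : ℝ) / 2) • (e * Ring.inverse (b w.2) * e), ?_⟩ ?_ ?_ ?_
    · have := hic.comp (continuous_snd (X := I))
      simp only [Function.comp_def] at this
      fun_prop
    · intro x; simp
    · intro x; simp
    · intro t x
      have t0 := t.2.1
      have t1 := t.2.2
      refine ⟨?_, fun hx => ?_, ?_⟩
      · exact (Lsub G).sub_mem ((Lsub G).smul_mem _ (hb x).1) ((Lsub G).smul_mem _
          (Lsub_sandwich h.eL (Lsub_inverse (hb x).1 (bu x))))
      · have hbx := (hb x).2.1 hx
        have hi : Ring.inverse (b x) = ψ x := by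
          have := Ring.mul_inverse_cancel _ (bu x)
          rw [hbx] at this
          calc Ring.inverse (b x) = ψ x * (ψ x * Ring.inverse (b x)) := by
                rw [← mul_assoc, h.p2, one_mul]
            _ = ψ x := by rw [hbx, this, mul_one]
        have : e * ψ x * e = -ψ x := by rw [h.ep, neg_mul, mul_assoc, h.e2, mul_one]
        change (1 - (t : ℝ) / 2) • b x - ((t : ℝ) / 2) • (e * Ring.inverse (b x) * e) = ψ x
        rw [hi, this, hbx]; module
      · change NR (e * ((1 - (t : ℝ) / 2) • b x - ((t : ℝ) / 2) • (e * Ring.inverse (b x) * e)))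
        rw [key]
        exact (hb x).2.2.path (by linarith) (by linarith)
  · change e * ((1 - (1 / 2 : ℝ)) • b x - (1 / 2 : ℝ) • (e * Ring.inverse (b x) * e)) = _
    rw [key, nK]; module

theorem newton_iter {G : Set A} {e : A} {ψ : C(X, A)} {U : A} (h : SD G e ψ U) {N : Set X}
    {b : C(X, A)} (hb : b ∈ Pen G e ψ N) (n : ℕ) : ∃ b' : C(X, A), JoinedIn (Pen G e ψ N) b b' ∧
      ∀ x, e * b' x = nK^[n] (e * b x) := by
  induction n with
  | zero => exact ⟨b, JoinedIn.refl hb, fun x => rfl⟩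
  | succ n ih =>
    obtain ⟨b1, h1, h2⟩ := ih
    obtain ⟨b2, h3, h4⟩ := newton_step h h1.target_mem
    refine ⟨b2, h1.trans h3, fun x => ?_⟩
    rw [h4, h2, Function.iterate_succ_apply']

theorem newton_conv (k : C(X, A)) (hk : ∀ x, NR (k x)) {ε : ℝ} (hε : 0 < ε) :
    ∃ n, ∀ x, ‖reg A (nK^[n] (k x) * nK^[n] (k x) + 1)‖ < ε := by
  have hun : ∀ (x : X) (t : ℝ), IsUnit (Real.cos (Real.pi * t) • (1 : A) +
      Real.sin (Real.pi * t) • k x) := fun x t => (hk x).lin (cs_ne _)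
  have hOm : Continuous fun z : I × X => om (z.1 : ℝ) (k z.2) := by
    unfold om
    have h1 : Continuous fun z : I × X => Real.cos (Real.pi * z.1) • (1 : A) +
      Real.sin (Real.pi * z.1) • k z.2 := by fun_prop
    have h2 := continuousOn_inverse.comp_continuous h1 (fun z => hun z.2 z.1)
    have h3 : Continuous fun z : I × X => Real.cos (Real.pi * z.1) • k z.2 -
      Real.sin (Real.pi * z.1) • (1 : A) := by fun_prop
    exact h3.mul h2
  let Om : C(I, C(X, VA A →L[ℝ] VA A)) := ContinuousMap.curry
    ⟨fun z : I × X => reg A (om (z.1 : ℝ) (k z.2)), (reg_cont (A := A)).comp hOm⟩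
  have hOma : ∀ t x, Om t x = reg A (om (t : ℝ) (k x)) := fun t x => rfl
  obtain ⟨D, hD⟩ : ∃ D, ∀ t, ‖Om t‖ ≤ D := by
    obtain ⟨D, hD⟩ := isCompact_univ.exists_bound_of_continuousOn (f := Om) Om.continuous.continuousOn
    exact ⟨D, fun t => hD t trivial⟩
  have hD0 : 0 ≤ D := (norm_nonneg (Om 0)).trans (hD 0)
  have huc : UniformContinuous Om := CompactSpace.uniformContinuous_of_continuous Om.continuous
  obtain ⟨δ, hδ, hδ'⟩ := (Metric.uniformContinuous_iff (α := I) (β := C(X, VA A →L[ℝ] VA A)) (f := Om)).1 huc (ε / (2 * (D + 1))) (by positivity)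
  obtain ⟨n, hn⟩ := exists_pow_lt_of_lt_one hδ (show (1 / 2 : ℝ) < 1 by norm_num)
  refine ⟨n, fun x => ?_⟩
  have hmem : ∀ j ∈ Finset.range (2 ^ n), (j : ℝ) / 2 ^ n ∈ I ∧
      (j : ℝ) / 2 ^ n + 1 / 2 ^ (n + 1) ∈ I := by
    intro j hj
    have hj' : (j : ℝ) + 1 ≤ 2 ^ n := by
      have : j + 1 ≤ 2 ^ n := by simpa using hj
      exact_mod_cast this
    have hp : (0 : ℝ) < 2 ^ n := by positivity
    refine ⟨⟨by positivity, ?_⟩, ⟨by positivity, ?_⟩⟩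
    · rw [div_le_one hp]; linarith
    · rw [pow_succ]
      have : (j : ℝ) / 2 ^ n + 1 / (2 ^ n * 2) = (j + 1 / 2) / 2 ^ n := by field_simp
      rw [this, div_le_one hp]; linarith
  have nrn : ∀ n, NR (nK^[n] (k x)) := by
    intro n
    induction n with
    | zero => exact hk x
    | succ n ih => rw [Function.iterate_succ_apply']; exact ih.nK
  have b1 : ‖reg A (nK^[n] (k x))‖ ≤ D := by
    rw [newton_avg n (hk x), map_smul, map_sum, norm_smul]
    have : ‖∑ j ∈ Finset.range (2 ^ n), reg A (om ((j : ℝ) / 2 ^ n) (k x))‖ ≤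
        ∑ j ∈ Finset.range (2 ^ n), D := by
      refine norm_sum_le_of_le _ fun j hj => ?_
      have := (Om ⟨_, (hmem j hj).1⟩).norm_coe_le_norm x
      rw [hOma] at this
      exact this.trans (hD _)
    rw [Finset.sum_const, Finset.card_range, nsmul_eq_mul] at this
    rw [norm_pow, Real.norm_of_nonneg (by norm_num : (0 : ℝ) ≤ 1 / 2)]
    calc (1 / 2 : ℝ) ^ n * _ ≤ (1 / 2 : ℝ) ^ n * (((2 ^ n : ℕ) : ℝ) * D) := by gcongr
      _ = D := by push_cast; rw [← mul_assoc, ← mul_pow]; norm_num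
  have b2 : ‖reg A (nK^[n] (k x) - nK^[n + 1] (k x))‖ ≤ 1 / 2 * (ε / (2 * (D + 1))) := by
    rw [nK_diff n (hk x), map_smul, map_sum, norm_smul]
    have : ‖∑ j ∈ Finset.range (2 ^ n), reg A (om ((j : ℝ) / 2 ^ n) (k x) -
        om ((j : ℝ) / 2 ^ n + 1 / 2 ^ (n + 1)) (k x))‖ ≤
        ∑ j ∈ Finset.range (2 ^ n), (ε / (2 * (D + 1))) := by
      refine norm_sum_le_of_le _ fun j hj => ?_
      have h5 := (Om ⟨_, (hmem j hj).1⟩ - Om ⟨_, (hmem j hj).2⟩).norm_coe_le_norm x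
      rw [ContinuousMap.sub_apply, hOma, hOma, ← map_sub] at h5
      refine h5.trans ?_
      rw [← dist_eq_norm]
      refine (hδ' ?_).le
      rw [Subtype.dist_eq, Real.dist_eq]
      have : |(j : ℝ) / 2 ^ n - ((j : ℝ) / 2 ^ n + 1 / 2 ^ (n + 1))| = (1 / 2) ^ n * (1 / 2) := by
        rw [sub_add_cancel_left, abs_neg, abs_of_pos (by positivity), pow_succ, _root_.one_div_pow]
        field_simp
      change |(j : ℝ) / 2 ^ n - ((j : ℝ) / 2 ^ n + 1 / 2 ^ (n + 1))| < δ
      rw [this]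
      have : (0 : ℝ) < (1 / 2) ^ n := by positivity
      linarith
    rw [Finset.sum_const, Finset.card_range, nsmul_eq_mul] at this
    rw [norm_pow, Real.norm_of_nonneg (by norm_num : (0 : ℝ) ≤ 1 / 2)]
    calc (1 / 2 : ℝ) ^ (n + 1) * _ ≤ (1 / 2 : ℝ) ^ (n + 1) * (((2 ^ n : ℕ) : ℝ) * (ε / (2 * (D + 1)))) := by
          gcongr
      _ = 1 / 2 * (ε / (2 * (D + 1))) := by
        have h2 : (1 / 2 : ℝ) ^ n * 2 ^ n = 1 := by rw [← mul_pow]; norm_num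
        push_cast; rw [pow_succ]; linear_combination (1 / 2 * (ε / (2 * (D + 1)))) * h2
  rw [nK_sq (nrn n), ← Function.iterate_succ_apply' nK, map_smul, map_mul, norm_smul,
    Real.norm_of_nonneg (by norm_num : (0 : ℝ) ≤ 2)]
  calc 2 * ‖reg A (nK^[n] (k x)) * reg A (nK^[n] (k x) - nK^[n + 1] (k x))‖
      ≤ 2 * (D * (1 / 2 * (ε / (2 * (D + 1))))) := by
        gcongr
        exact (norm_mul_le _ _).trans (mul_le_mul b1 b2 (norm_nonneg _) hD0)
    _ = (D / (D + 1)) * (ε / 2) := by field_simp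
    _ ≤ 1 * (ε / 2) := by
      gcongr
      rw [div_le_one (by positivity)]; linarith
    _ < ε := by linarith

theorem split_step {G : Set A} {e : A} {ψ : C(X, A)} {U : A} (h : SD G e ψ U) {N : Set X} :
    ∃ ε > 0, ∀ b : C(X, A), b ∈ Pen G e ψ N →
      (∀ x, ‖reg A ((e * b x) * (e * b x) + 1)‖ < ε) →
      ∃ H : C(X, A), JoinedIn (Pen G e ψ N) b H ∧ ∀ x, H x ∈ Lsub (insert e G) := by
  obtain ⟨τ, hτ⟩ := GA.good (A := A)
  obtain ⟨ε, hε, hpos⟩ := unif_pos τ hτ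
  have eu : IsUnit e := ⟨⟨e, e, h.e2, h.e2⟩, rfl⟩
  refine ⟨ε / (1 + ‖reg A e‖ * ‖reg A e‖), by positivity, fun b hb hE => ?_⟩
  have hden : 1 ≤ 1 + ‖reg A e‖ * ‖reg A e‖ := by
    have := mul_nonneg (norm_nonneg (reg A e)) (norm_nonneg (reg A e)); linarith
  have hle : ε / (1 + ‖reg A e‖ * ‖reg A e‖) ≤ ε := div_le_self hε.le hden
  let bl : ℝ → X → A := fun l x =>
    (1 / 2 : ℝ) • (b x - e * b x * e) + l • ((1 / 2 : ℝ) • (b x + e * b x * e))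
  have hcont : Continuous fun w : I × X => bl (1 - w.1) w.2 := by fun_prop
  refine ⟨⟨fun x => bl 0 x, by fun_prop⟩, joinedIn_of_homotopy ⟨fun w => bl (1 - w.1) w.2, hcont⟩
    (fun x => ?_) (fun x => ?_) (fun t x => ⟨?_, fun hx => ?_, ?_⟩), fun x => ?_⟩
  · simp only [ContinuousMap.coe_mk, bl, Icc.coe_zero]; module
  · simp [bl]
  · have h1 := (hb x).1
    have h2 := Lsub_sandwich h.eL h1
    exact (Lsub G).add_mem ((Lsub G).smul_mem _ ((Lsub G).sub_mem h1 h2))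
      ((Lsub G).smul_mem _ ((Lsub G).smul_mem _ ((Lsub G).add_mem h1 h2)))
  · have hbx := (hb x).2.1 hx
    have : e * ψ x * e = -ψ x := by rw [h.ep, neg_mul, mul_assoc, h.e2, mul_one]
    change bl (1 - t) x = ψ x
    simp only [bl]
    rw [hbx, this]; module
  · change NR (e * bl (1 - t) x)
    have l0 : 0 ≤ 1 - (t : ℝ) := by linarith [t.2.2]
    have l1 : 1 - (t : ℝ) ≤ 1 := by linarith [t.2.1]
    generalize (1 - (t : ℝ)) = l at l0 l1
    set β := b x with hβ
    intro m
    apply isUnit_of_ker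
    intro v hv
    by_contra hv0
    have he2 : ∀ a, e * (e * a) = a := fun a => by rw [← mul_assoc, h.e2, one_mul]
    have hes : star e = e := h.eL.1
    have hbs : star β = β := (hb x).1.1
    set E := (e * β) * (e * β) + 1 with hEd
    set a := (1 / 2 : ℝ) • (e * β + β * e) with had
    have has : star a = a := by
      rw [had, star_smul, star_add, star_mul, star_mul, hes, hbs, star_trivial, add_comm]
    set k := e * bl l x with hkd
    have hk : k = (1 / 2 : ℝ) • (e * β - β * e) + l • a := by
      simp only [hkd, bl, had, mul_add, mul_sub, mul_smul_comm, mul_assoc, he2, ← hβ]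
    have hk2 : k * k = -1 + (1 / 2 : ℝ) • (E + e * E * e) - (1 - l ^ 2) • (a * a) +
        (l / 2) • (E - e * E * e) := by
      rw [hk, hEd, had]
      simp only [mul_add, add_mul, mul_sub, sub_mul, smul_mul_assoc, mul_smul_comm, mul_assoc, he2,
        h.e2, smul_add, smul_sub, mul_one]
      module
    have hkv : k * v = (-m) • v := by
      have : (m • (1 : A) + k) * v = m • v + k * v := by rw [add_mul, smul_mul_assoc, one_mul]
      rw [this] at hv
      rw [neg_smul]; exact eq_neg_of_add_eq_zero_right hv
    have hkkv : (k * k) * v = m ^ 2 • v := by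
      rw [mul_assoc, hkv, mul_smul_comm, hkv, smul_smul]; congr 1; ring
    have hEn : ‖reg A E‖ < ε := (hE x).trans_le hle
    have hEn' : ‖reg A (e * E * e)‖ < ε := by
      rw [map_mul, map_mul]
      calc _ ≤ ‖reg A e * reg A E‖ * ‖reg A e‖ := norm_mul_le _ _
        _ ≤ (‖reg A e‖ * ‖reg A E‖) * ‖reg A e‖ := by gcongr; exact norm_mul_le _ _
        _ = (‖reg A e‖ * ‖reg A e‖) * ‖reg A E‖ := by ring
        _ ≤ (‖reg A e‖ * ‖reg A e‖) * (ε / (1 + ‖reg A e‖ * ‖reg A e‖)) := by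
            gcongr; exact (hE x).le
        _ = ε * ((‖reg A e‖ * ‖reg A e‖) / (1 + ‖reg A e‖ * ‖reg A e‖)) := by ring
        _ < ε * 1 := by
            gcongr
            rw [div_lt_one (by linarith)]; linarith
        _ = ε := mul_one _
    have q1 := abs_le.1 (hpos E hEn v)
    have q2 := abs_le.1 (hpos _ hEn' v)
    have q0 := hτ v hv0
    have qa : 0 ≤ τ (star v * ((a * a) * v)) := by
      have : star v * ((a * a) * v) = star (a * v) * (a * v) := by
        rw [star_mul, has]; simp [mul_assoc]
      rw [this]
      by_cases h0 : a * v = 0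
      · simp [h0]
      · exact (hτ _ h0).le
    have hfin : τ (star v * ((k * k) * v)) = m ^ 2 * τ (star v * v) := by
      rw [hkkv, mul_smul_comm, map_smul, smul_eq_mul]
    have hfin2 : τ (star v * ((k * k) * v)) = -τ (star v * v) + 1 / 2 * (τ (star v * (E * v)) +
        τ (star v * ((e * E * e) * v))) - (1 - l ^ 2) * τ (star v * ((a * a) * v)) +
        (l / 2) * (τ (star v * (E * v)) - τ (star v * ((e * E * e) * v))) := by
      rw [hk2]
      simp only [add_mul, sub_mul, smul_mul_assoc, mul_add, mul_sub, mul_smul_comm, map_add, map_sub,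
        map_smul, smul_eq_mul, neg_mul, one_mul, mul_neg, map_neg]
    set qv := τ (star v * v)
    set x1 := τ (star v * (E * v))
    set x2 := τ (star v * ((e * E * e) * v))
    have hm : 0 ≤ m ^ 2 * qv := by positivity
    have hl2 : 0 ≤ (1 - l ^ 2) * τ (star v * ((a * a) * v)) := by
      apply mul_nonneg _ qa; nlinarith
    have hx : (l / 2) * (x1 - x2) ≤ 1 / 4 * qv := by
      have : x1 - x2 ≤ 1 / 2 * qv := by linarith [q1.2, q2.1]
      nlinarith [mul_nonneg l0 (sub_nonneg.2 this), mul_nonneg (sub_nonneg.2 l1) q0.le]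
    rw [hfin] at hfin2
    linarith [q1.2, q2.2]
  · refine ⟨?_, ?_⟩
    · have h1 := (hb x).1
      have h2 := Lsub_sandwich h.eL h1
      have h3 : bl 0 x ∈ Lsub G := (Lsub G).add_mem ((Lsub G).smul_mem _ ((Lsub G).sub_mem h1 h2))
        ((Lsub G).smul_mem _ ((Lsub G).smul_mem _ ((Lsub G).add_mem h1 h2)))
      exact h3.1
    · intro g hg
      rcases hg with rfl | hg
      · change g * bl 0 x = -(bl 0 x * g)
        simp only [bl, zero_smul, add_zero, mul_smul_comm, smul_mul_assoc, mul_sub, sub_mul]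
        rw [← mul_assoc, ← mul_assoc, h.e2, one_mul, mul_assoc (g * b x), h.e2, mul_one, ← smul_neg,
          neg_sub]
      · have h1 := (hb x).1
        have h2 := Lsub_sandwich h.eL h1
        have h3 : bl 0 x ∈ Lsub G := (Lsub G).add_mem ((Lsub G).smul_mem _ ((Lsub G).sub_mem h1 h2))
          ((Lsub G).smul_mem _ ((Lsub G).smul_mem _ ((Lsub G).add_mem h1 h2)))
        exact h3.2 g hg

theorem base_concl {G : Set A} {e : A} {ψ : C(X, A)} {U : A} (h : SD G e ψ U) {K N : Set X}
    (hN : IsOpen N) (hK : K ⊆ N) {F : C(X × I, A)} (hF : F ∈ Adm G e ψ N)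
    (hP : PP 1 (Lsub G) N (fun z => F z - pencil e ψ z)) : Concl G e ψ K F := by
  obtain ⟨a, ha, hr⟩ := hP
  set b : C(X, A) := ψ + a 0 with hbd
  have hFb : F = pencil e b := by
    ext ⟨x, t⟩
    have := hr x t
    simp only [Finset.sum_range_one] at this
    rw [sub_eq_iff_eq_add] at this
    rw [this, pencil_apply, pencil_apply, hbd]
    simp [ss]
    abel
  have hb : b ∈ Pen G e ψ N := by
    intro x
    refine ⟨(Lsub G).add_mem (h.pL x) (ha 0 x).1, fun hx => by simp [hbd, (ha 0 x).2 hx], ?_⟩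
    exact NR_of_adm h (hFb ▸ hF) x
  obtain ⟨ε, hε, hsp⟩ := split_step h (N := N)
  obtain ⟨n, hn⟩ := newton_conv (⟨fun x => e * b x, by fun_prop⟩ : C(X, A)) (fun x => (hb x).2.2) hε
  obtain ⟨b', hj, hb'⟩ := newton_iter h hb n
  obtain ⟨H, hj', hH⟩ := hsp b' hj.target_mem (fun x => by rw [hb']; exact hn x)
  have hJ := joined_map (sc Unit) (pen_joined h (hj.trans hj'))
  rw [pencil_map (sc Unit) e H, ← hFb] at hJ
  refine ⟨Unit, inferInstance, inferInstance, (), N, (sahC (sc Unit)).comp H, hN, hK,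
    fun x => ⟨Lsub_map _ (hH x), ?_⟩, fun x hx => ?_, ?_⟩
  · have eu : IsUnit e := ⟨⟨e, e, h.e2, h.e2⟩, rfl⟩
    have := eu.mul (hj'.target_mem x).2.2.unit
    rw [← mul_assoc, h.e2, one_mul] at this
    exact this.map (sc Unit)
  · change sc Unit (H x) = _
    rw [(hj'.target_mem x).2.1 hx]
  · convert hJ using 1
    ext z : 1
    simp [stab_apply, sahC_apply, sc_apply]

theorem poly_concl (k : ℕ) : ∀ {A : Type} [Ring A] [Algebra ℝ A] [StarRing A] [TopologicalSpace A]
    [GA A] {G : Set A} {e : A} {ψ : C(X, A)} {U : A} (h : SD G e ψ U) {K N : Set X}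
    (hKc : IsClosed K) (hN : IsOpen N) (hK : K ⊆ N) {F : C(X × I, A)} (hF : F ∈ Adm G e ψ N)
    (hP : PP (2 * k + 1) (Lsub G) N (fun z => F z - pencil e ψ z)), Concl G e ψ K F := by
  induction k with
  | zero =>
    intro A _ _ _ _ _ G e ψ U h K N hKc hN hK F hF hP
    exact base_concl h hN hK hF hP
  | succ k ih =>
    intro A _ _ _ _ _ G e ψ U h K N hKc hN hK F hF hP
    obtain ⟨N', F', h1, h2, h3, h4⟩ := PP.red h hKc hN hK hF hP
    have h' := h.map (sc (Fin 4))
    exact Concl.of_mat 0 (Concl.of_joined h' h1 h2 h3 (ih h' hKc h1 h2 h3.target_mem h4))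

end
end S6

set_option linter.unusedSectionVars false
set_option linter.unusedVariables false
set_option linter.deprecated false

namespace S6
open Set Topology Module Matrix
open scoped unitInterval

section
variable {A : Type} [Ring A] [Algebra ℝ A] [StarRing A] [TopologicalSpace A] [GA A]
variable {X : Type} [TopologicalSpace X] [CompactSpace X] [T2Space X]

/-- half of the angle -/
noncomputable def tw : C(I, I) :=
  ⟨fun w => ⟨Real.arcsin (Real.sqrt w) / Real.pi, by
    have h1 : 0 ≤ Real.arcsin (Real.sqrt w) := Real.arcsin_nonneg.2 (Real.sqrt_nonneg _)
    have h2 := Real.arcsin_le_pi_div_two (Real.sqrt w)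
    have := Real.pi_pos
    exact ⟨by positivity, by rw [div_le_one this]; linarith⟩⟩, by
    refine Continuous.subtype_mk ?_ _
    exact (Real.continuous_arcsin.comp (Real.continuous_sqrt.comp continuous_subtype_val)).div_const _⟩

theorem ss_nonneg (t : I) : 0 ≤ ss t := by
  refine Real.sin_nonneg_of_nonneg_of_le_pi (mul_nonneg Real.pi_pos.le t.2.1) ?_
  have := Real.pi_pos
  nlinarith [t.2.2]

theorem ss_le_one (t : I) : ss t ≤ 1 := Real.sin_le_one _

/-- sine squared -/
noncomputable def s2 (t : I) : I := ⟨ss t ^ 2, ⟨sq_nonneg _, by nlinarith [cs1 t, sq_nonneg (cc t)]⟩⟩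

theorem tw_s2 (t : I) : tw (s2 t) = t ∨ tw (s2 t) = unitInterval.symm t := by
  have hp := Real.pi_pos
  have h : (tw (s2 t) : ℝ) = Real.arcsin (ss t) / Real.pi := by
    change Real.arcsin (Real.sqrt (ss t ^ 2)) / Real.pi = _
    rw [Real.sqrt_sq (ss_nonneg t)]
  rcases le_total (t : ℝ) (1 / 2) with h1 | h1
  · left
    apply Subtype.ext
    rw [h, ss, Real.arcsin_sin]
    · field_simp
    · nlinarith [t.2.1]
    · nlinarith
  · right
    apply Subtype.ext
    rw [h, ss, ← Real.sin_pi_sub, Real.arcsin_sin]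
    · rw [unitInterval.coe_symm_eq]; field_simp
    · nlinarith [t.2.2]
    · nlinarith

theorem ss_symm (t : I) : ss (unitInterval.symm t) = ss t := by
  rw [ss, unitInterval.coe_symm_eq, mul_sub, mul_one, Real.sin_pi_sub]; rfl
theorem cc_symm (t : I) : cc (unitInterval.symm t) = - cc t := by
  rw [cc, unitInterval.coe_symm_eq, mul_sub, mul_one, Real.cos_pi_sub]; rfl

theorem approx_sym (g : C(X × I, A)) (hg : ∀ x t, g (x, unitInterval.symm t) = g (x, t))
    {ε : ℝ} (hε : 0 < ε) : ∃ (n : ℕ) (τ : ℕ → I), ∀ x t,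
      ‖coordA A (g (x, t) - ∑ j ∈ Finset.range (n + 1),
        ((n.choose j : ℝ) * (ss t ^ 2) ^ j * (cc t ^ 2) ^ (n - j)) • g (x, τ j))‖ < ε := by
  let f : C(I, C(X, VA A)) := ContinuousMap.curry
    ⟨fun z : I × X => coordA A (g (z.2, tw z.1)), (coordA_cont (A := A)).comp (by fun_prop)⟩
  have hf : ∀ w x, f w x = coordA A (g (x, tw w)) := fun _ _ => rfl
  have hfs : ∀ t x, f (s2 t) x = coordA A (g (x, t)) := by
    intro t x
    rw [hf]
    rcases tw_s2 t with h | h <;> rw [h]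
    rw [hg]
  have hB := bernsteinApproximation_uniform f
  obtain ⟨n, hn⟩ := ((Metric.tendsto_nhds (α := C(I, C(X, VA A))) (a := f)).1 hB ε hε).exists
  refine ⟨n, fun j => tw (if h : j < n + 1 then bernstein.z (⟨j, h⟩ : Fin (n + 1)) else 0), fun x t => ?_⟩
  have h1 : dist (bernsteinApproximation n f (s2 t)) (f (s2 t)) < ε :=
    (ContinuousMap.dist_apply_le_dist (s2 t)).trans_lt hn
  have h2 : dist (bernsteinApproximation n f (s2 t) x) (f (s2 t) x) < ε :=
    (ContinuousMap.dist_apply_le_dist x).trans_lt h1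
  rw [dist_comm, dist_eq_norm, hfs, bernsteinApproximation.apply] at h2
  refine lt_of_eq_of_lt (congrArg norm ?_) h2
  rw [map_sub]
  congr 1
  rw [map_sum, ContinuousMap.sum_apply, Finset.sum_range]
  refine Finset.sum_congr rfl fun k _ => ?_
  rw [map_smul, ContinuousMap.smul_apply, hf, bernstein_apply]
  have : (1 - (s2 t : ℝ)) = cc t ^ 2 := by
    change 1 - ss t ^ 2 = _
    linarith [cs1 t]
  rw [this]
  simp only [k.2, dif_pos]
  rfl

theorem approx_mul (g : C(X × I, A)) (u : C(I, ℝ)) (hg : ∀ x t, u t = 0 → g (x, t) = 0)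
    {ε : ℝ} (hε : 0 < ε) : ∃ μ : C(ℝ, ℝ), (∀ y, μ (-y) = - μ y) ∧ ∀ x t,
      ‖coordA A (g (x, t) - u t • μ (u t) • g (x, t))‖ < ε := by
  let S : Set (X × I) := {z | ε ≤ ‖coordA A (g z)‖}
  have hc : Continuous fun z => ‖coordA A (g z)‖ := ((coordA_cont (A := A)).comp g.continuous).norm
  have hS : IsCompact S := (isClosed_le continuous_const hc).isCompact
  obtain ⟨δ, hδ, hδS⟩ : ∃ δ > 0, ∀ z ∈ S, δ ≤ (u z.2) ^ 2 := by
    rcases S.eq_empty_or_nonempty with h | h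
    · exact ⟨1, one_pos, by simp [h]⟩
    · obtain ⟨z, hz, hm⟩ := hS.exists_isMinOn h
        (f := fun z => (u z.2) ^ 2) (by fun_prop)
      refine ⟨(u z.2) ^ 2, ?_, fun w hw => hm hw⟩
      have : u z.2 ≠ 0 := by
        intro h0
        have h1 : ε ≤ ‖coordA A (g (z.1, z.2))‖ := hz
        rw [hg z.1 z.2 h0] at h1
        simp at h1; linarith
      positivity
  have hpos : ∀ y : ℝ, max (y ^ 2) δ ≠ 0 := fun y => (lt_max_of_lt_right hδ).ne'
  refine ⟨⟨fun y => y / max (y ^ 2) δ, by fun_prop (disch := exact hpos _)⟩, fun y => ?_, fun x t => ?_⟩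
  · simp [neg_div]
  · have : g (x, t) - u t • (u t / max (u t ^ 2) δ) • g (x, t) =
        (1 - u t ^ 2 / max (u t ^ 2) δ) • g (x, t) := by
      rw [smul_smul, sub_smul, one_smul]; congr 2; ring
    simp only [ContinuousMap.coe_mk]
    rw [this, map_smul, norm_smul]
    by_cases hz : (x, t) ∈ S
    · have := hδS _ hz
      have h2 : u t ^ 2 ≠ 0 := (hδ.trans_le this).ne'
      rw [max_eq_left this, div_self h2]; simpa using hε
    · have hz' : ‖coordA A (g (x, t))‖ < ε := not_le.1 hz
      refine lt_of_le_of_lt ?_ hz'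
      refine mul_le_of_le_one_left (norm_nonneg _) ?_
      rw [Real.norm_eq_abs, abs_le]
      have h3 : u t ^ 2 / max (u t ^ 2) δ ≤ 1 :=
        div_le_one_of_le₀ (le_max_left _ _) (le_max_of_le_right hδ.le)
      have h4 : 0 ≤ u t ^ 2 / max (u t ^ 2) δ := div_nonneg (sq_nonneg _) (le_max_of_le_right hδ.le)
      constructor <;> linarith

theorem approx_both (g : C(X × I, A)) (u : C(I, ℝ)) (hu : ∀ t, |u t| ≤ 1)
    (hg : ∀ x t, u t = 0 → g (x, t) = 0)
    (hs : (∀ x t, g (x, unitInterval.symm t) = g (x, t)) ∧ (∀ t, u (unitInterval.symm t) = u t) ∨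
      (∀ x t, g (x, unitInterval.symm t) = - g (x, t)) ∧ (∀ t, u (unitInterval.symm t) = - u t))
    {ε : ℝ} (hε : 0 < ε) : ∃ (n : ℕ) (a : ℕ → C(X, A)),
      (∀ j, ∃ (c : ℝ) (t : I), ∀ x, a j x = c • g (x, t)) ∧ ∀ x t,
      ‖coordA A (g (x, t) - ∑ j ∈ Finset.range (n + 1),
        (u t * (ss t ^ 2) ^ j * (cc t ^ 2) ^ (n - j)) • a j x)‖ < ε := by
  obtain ⟨μ, hμ, h1⟩ := approx_mul g u hg (half_pos hε)
  obtain ⟨n, τ, h2⟩ := approx_sym (A := A) ⟨fun z : X × I => μ (u z.2) • g z, by fun_prop⟩ (by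
    intro x t
    rcases hs with ⟨h3, h4⟩ | ⟨h3, h4⟩
    · simp only [ContinuousMap.coe_mk, h3, h4]
    · simp only [ContinuousMap.coe_mk, h3, h4, hμ, neg_smul, smul_neg, neg_neg]) (half_pos hε)
  refine ⟨n, fun j => ⟨fun x => ((n.choose j : ℝ) * μ (u (τ j))) • g (x, τ j), by fun_prop⟩,
    fun j => ⟨_, _, fun x => rfl⟩, fun x t => ?_⟩
  specialize h1 x t
  specialize h2 x t
  simp only [ContinuousMap.coe_mk] at h2 ⊢
  have : g (x, t) - ∑ j ∈ Finset.range (n + 1),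
        (u t * (ss t ^ 2) ^ j * (cc t ^ 2) ^ (n - j)) • ((n.choose j : ℝ) * μ (u (τ j))) • g (x, τ j)
      = (g (x, t) - u t • μ (u t) • g (x, t)) + u t • (μ (u t) • g (x, t) -
        ∑ j ∈ Finset.range (n + 1), ((n.choose j : ℝ) * (ss t ^ 2) ^ j * (cc t ^ 2) ^ (n - j)) •
          μ (u (τ j)) • g (x, τ j)) := by
    rw [smul_sub, Finset.smul_sum, sub_add_sub_cancel]
    congr 1
    refine Finset.sum_congr rfl fun j _ => ?_
    simp only [smul_smul]
    congr 1; ring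
  rw [this, map_add, map_smul]
  refine (norm_add_le _ _).trans_lt ?_
  have h3 : ‖u t • coordA A (μ (u t) • g (x, t) -
        ∑ j ∈ Finset.range (n + 1), ((n.choose j : ℝ) * (ss t ^ 2) ^ j * (cc t ^ 2) ^ (n - j)) •
          μ (u (τ j)) • g (x, τ j))‖ < ε / 2 := by
    refine lt_of_le_of_lt ?_ h2
    rw [norm_smul]
    exact mul_le_of_le_one_left (norm_nonneg _) (hu t)
  linarith

theorem approx_joined {G : Set A} {e : A} {ψ : C(X, A)} {U : A} (h : SD G e ψ U) {N : Set X}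
    {F : C(X × I, A)} (hF : F ∈ Adm G e ψ N) : ∃ (k : ℕ) (F' : C(X × I, A)),
      JoinedIn (Adm G e ψ N) F F' ∧ PP (2 * k + 1) (Lsub G) N (fun z => F' z - pencil e ψ z) := by
  obtain ⟨ε, hε, hu⟩ := unif_unit F (fun z => (hF.1 z).2)
  have hp := pencil_mem h N
  have hpL := pencil_L h
  let D : X × I → A := fun z => F z - pencil e ψ z
  have hDc : Continuous D := by fun_prop
  have hDL : ∀ z, D z ∈ Lsub G := fun z => (Lsub G).sub_mem (hF.1 z).1 (hpL z)
  have hDN : ∀ x ∈ N, ∀ t, D (x, t) = 0 := fun x hx t => sub_eq_zero.2 (hF.2.2.2 x hx t)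
  have hD0 : ∀ x, D (x, 0) = 0 := fun x => sub_eq_zero.2 ((hF.2.1 x).trans (hp.2.1 x).symm)
  have hD1 : ∀ x, D (x, 1) = 0 := fun x => sub_eq_zero.2 ((hF.2.2.1 x).trans (hp.2.2.1 x).symm)
  let gs : C(X × I, A) := ⟨fun z => (1 / 2 : ℝ) • (D z + D (z.1, unitInterval.symm z.2)), by fun_prop⟩
  let ga : C(X × I, A) := ⟨fun z => (1 / 2 : ℝ) • (D z - D (z.1, unitInterval.symm z.2)), by fun_prop⟩
  have hgs : ∀ x t, gs (x, t) = (1 / 2 : ℝ) • (D (x, t) + D (x, unitInterval.symm t)) := fun _ _ => rfl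
  have hga : ∀ x t, ga (x, t) = (1 / 2 : ℝ) • (D (x, t) - D (x, unitInterval.symm t)) := fun _ _ => rfl
  have hsum : ∀ x t, D (x, t) = gs (x, t) + ga (x, t) := by
    intro x t; rw [hgs, hga]; module
  have hgsL : ∀ x t, gs (x, t) ∈ Lsub G := fun x t =>
    (Lsub G).smul_mem _ ((Lsub G).add_mem (hDL _) (hDL _))
  have hgaL : ∀ x t, ga (x, t) ∈ Lsub G := fun x t =>
    (Lsub G).smul_mem _ ((Lsub G).sub_mem (hDL _) (hDL _))
  have hgsN : ∀ x ∈ N, ∀ t, gs (x, t) = 0 := fun x hx t => by rw [hgs, hDN x hx, hDN x hx]; simp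
  have hgaN : ∀ x ∈ N, ∀ t, ga (x, t) = 0 := fun x hx t => by rw [hga, hDN x hx, hDN x hx]; simp
  have hss0 : ∀ t : I, ss t = 0 → t = 0 ∨ t = 1 := by
    intro t ht
    by_contra hcon
    push Not at hcon
    have h0 : (0 : ℝ) < t := lt_of_le_of_ne t.2.1 (fun hh => hcon.1 (Subtype.ext hh.symm))
    have h1 : (t : ℝ) < 1 := lt_of_le_of_ne t.2.2 (fun hh => hcon.2 (Subtype.ext hh))
    have hpi := Real.pi_pos
    have := Real.sin_pos_of_pos_of_lt_pi (mul_pos hpi h0) (by nlinarith)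
    exact this.ne' ht
  have hD01 : ∀ x t, ss t = 0 → D (x, t) = 0 ∧ D (x, unitInterval.symm t) = 0 := by
    intro x t ht
    rcases hss0 t ht with rfl | rfl
    · rw [unitInterval.symm_zero]; exact ⟨hD0 x, hD1 x⟩
    · rw [unitInterval.symm_one]; exact ⟨hD1 x, hD0 x⟩
  obtain ⟨n, a, ha, hn⟩ := approx_both gs ⟨ss, ss_cont⟩
    (fun t => abs_le.2 ⟨by linarith [ss_nonneg t, show (⟨ss, ss_cont⟩ : C(I, ℝ)) t = ss t from rfl], ss_le_one t⟩)
    (fun x t ht => by rw [hgs, (hD01 x t ht).1, (hD01 x t ht).2]; simp)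
    (Or.inl ⟨fun x t => by rw [hgs, hgs, unitInterval.symm_symm, add_comm], ss_symm⟩) (half_pos hε)
  have hcc1 : ∀ t, |cc t| ≤ 1 := fun t => Real.abs_cos_le_one _
  obtain ⟨n', a', ha', hn'⟩ := approx_both ga ⟨fun t => ss t ^ 2 * cc t, by
      have := ss_cont; have := cc_cont; fun_prop⟩
    (fun t => by
      change |ss t ^ 2 * cc t| ≤ 1
      rw [abs_mul, abs_of_nonneg (sq_nonneg _)]
      exact mul_le_one₀ (s2 t).2.2 (abs_nonneg _) (hcc1 t))
    (fun x t ht => by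
      have ht : ss t ^ 2 * cc t = 0 := ht
      rcases mul_eq_zero.1 ht with h1 | h1
      · have h1 : ss t = 0 := by simpa using h1
        rw [hga, (hD01 x t h1).1, (hD01 x t h1).2]; simp
      · have hpi := Real.pi_pos
        have h2 : unitInterval.symm t = t := by
          apply Subtype.ext
          rw [unitInterval.coe_symm_eq]
          have h3 : Real.pi * t = Real.pi / 2 := by
            apply Real.injOn_cos ⟨mul_nonneg hpi.le t.2.1, by nlinarith [t.2.2]⟩
              ⟨by linarith, by linarith⟩
            rw [Real.cos_pi_div_two]; exact h1
          have : (t : ℝ) = 1 / 2 := by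
            apply mul_left_cancel₀ hpi.ne'; rw [h3]; ring
          linarith
        rw [hga, h2]; simp)
    (Or.inr ⟨fun x t => by rw [hga, hga, unitInterval.symm_symm]; module, fun t => by
      change ss _ ^ 2 * cc _ = -(ss t ^ 2 * cc t)
      rw [ss_symm, cc_symm]; ring⟩) (half_pos hε)
  simp only [ContinuousMap.coe_mk] at hn hn'
  have P1 : PP (2 * n + 1 + 2 * (n' + 1)) (Lsub G) N (fun z => ∑ j ∈ Finset.range (n + 1),
      (ss z.2 * (ss z.2 ^ 2) ^ j * (cc z.2 ^ 2) ^ (n - j)) • a j z.1) := by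
    refine PP.raises _ (PP.sum _ _ fun j hj => ?_)
    obtain ⟨c, t, hc⟩ := ha j
    have hj' : j < n + 1 := by simpa using hj
    refine (PP.single (2 * j) (by omega) (a j) (fun x => ?_) (fun x hx => ?_)).congr fun z => ?_
    · rw [hc]; exact (Lsub G).smul_mem _ (hgsL _ _)
    · rw [hc, hgsN x hx, smul_zero]
    · congr 1
      rw [show 2 * n + 1 - 1 - 2 * j = 2 * (n - j) by omega]; ring
  have P2 : PP (2 * n' + 3 + 2 * n) (Lsub G) N (fun z => ∑ j ∈ Finset.range (n' + 1),
      (ss z.2 ^ 2 * cc z.2 * (ss z.2 ^ 2) ^ j * (cc z.2 ^ 2) ^ (n' - j)) • a' j z.1) := by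
    refine PP.raises _ (PP.sum _ _ fun j hj => ?_)
    obtain ⟨c, t, hc⟩ := ha' j
    have hj' : j < n' + 1 := by simpa using hj
    refine (PP.single (2 * j + 1) (by omega) (a' j) (fun x => ?_) (fun x hx => ?_)).congr fun z => ?_
    · rw [hc]; exact (Lsub G).smul_mem _ (hgaL _ _)
    · rw [hc, hgaN x hx, smul_zero]
    · congr 1
      rw [show 2 * n' + 3 - 1 - (2 * j + 1) = 2 * (n' - j) + 1 by omega]; ring
  rw [show 2 * n + 1 + 2 * (n' + 1) = 2 * (n + n' + 1) + 1 by ring] at P1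
  rw [show 2 * n' + 3 + 2 * n = 2 * (n + n' + 1) + 1 by ring] at P2
  have P3 := P1.add P2
  set r : X × I → A := _ with hr
  change PP _ _ _ r at P3
  have hrc : Continuous r := by
    have := ss_cont; have := cc_cont
    rw [hr]; fun_prop
  have happ : ∀ x t, ‖coordA A (r (x, t) - D (x, t))‖ < ε := by
    intro x t
    have h1 := hn x t
    have h2 := hn' x t
    rw [← norm_neg, ← map_neg, neg_sub, hsum, hr, add_sub_add_comm, map_add]
    exact (norm_add_le _ _).trans_lt (by linarith)
  obtain ⟨b, hb, hrb⟩ := P3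
  have hrL : ∀ z, r z ∈ Lsub G := by
    rintro ⟨x, t⟩
    rw [hrb]
    exact (Lsub G).sum_mem fun i _ => (Lsub G).smul_mem _ (hb i x).1
  have hrs : ∀ x t, ss t = 0 → r (x, t) = 0 := by
    intro x t ht
    rw [hrb]
    exact Finset.sum_eq_zero fun i _ => by rw [ht]; simp
  have hrN : ∀ x ∈ N, ∀ t, r (x, t) = 0 := by
    intro x hx t
    rw [hrb]
    exact Finset.sum_eq_zero fun i _ => by rw [(hb i x).2 hx]; simp
  refine ⟨n + n' + 1, ⟨fun z => pencil e ψ z + r z, by fun_prop⟩, ?_, ⟨b, hb, fun x t => ?_⟩⟩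
  · refine joinedIn_of_homotopy
      ⟨fun z : I × (X × I) => F z.2 + (z.1 : ℝ) • (r z.2 - D z.2), by fun_prop⟩ ?_ ?_ ?_
    · intro z; simp
    · intro z
      simp only [ContinuousMap.coe_mk, Icc.coe_one, one_smul]
      change F z + (r z - (F z - pencil e ψ z)) = _
      abel
    · intro s
      refine ⟨fun z => ⟨?_, ?_⟩, fun x => ?_, fun x => ?_, fun x hx t => ?_⟩
      · exact (Lsub G).add_mem (hF.1 z).1 ((Lsub G).smul_mem _ ((Lsub G).sub_mem (hrL z) (hDL z)))
      · refine hu z _ ?_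
        rw [map_smul, norm_smul]
        refine lt_of_le_of_lt ?_ (happ z.1 z.2)
        refine mul_le_of_le_one_left (norm_nonneg _) ?_
        rw [Real.norm_of_nonneg s.2.1]; exact s.2.2
      · change F (x, 0) + (s : ℝ) • (r (x, 0) - D (x, 0)) = e
        rw [hrs x 0 ss_zero, hD0, hF.2.1]; simp
      · change F (x, 1) + (s : ℝ) • (r (x, 1) - D (x, 1)) = -e
        rw [hrs x 1 ss_one, hD1, hF.2.2.1]; simp
      · change F (x, t) + (s : ℝ) • (r (x, t) - D (x, t)) = _
        rw [hrN x hx, hDN x hx, hF.2.2.2 x hx]; simp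
  · simp only [ContinuousMap.coe_mk, add_sub_cancel_left]; exact hrb x t

theorem step_thm {G : Set A} {e : A} {ψ : C(X, A)} {U : A} (h : SD G e ψ U) {K N : Set X}
    (hKc : IsClosed K) (hN : IsOpen N) (hK : K ⊆ N) {F : C(X × I, A)} (hF : F ∈ Adm G e ψ N) :
    Concl G e ψ K F := by
  obtain ⟨k, F', h1, h2⟩ := approx_joined h hF
  exact Concl.of_joined h hN hK h1 (poly_concl k h hKc hN hK h1.target_mem h2)

end
end S6

set_option linter.unusedSectionVars false
set_option linter.unusedVariables false
set_option linter.deprecated false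

namespace S6
open Set Topology Module Matrix
open scoped unitInterval

section
variable {A : Type} [Ring A] [Algebra ℝ A] [StarRing A] [TopologicalSpace A] [GA A]
variable {B : Type} [Ring B] [Algebra ℝ B] [StarRing B] [TopologicalSpace B] [GA B]
variable {X : Type} [TopologicalSpace X] [CompactSpace X] [T2Space X]

/-- Clifford data -/
structure CD (e : ℕ → A) (ω : A) : Prop where
  sa : ∀ i ∈ Icc 1 6, star (e i) = e i
  sq : ∀ i ∈ Icc 1 6, e i * e i = 1
  ac : ∀ i ∈ Icc 1 6, ∀ j ∈ Icc 1 6, i ≠ j → e i * e j = -(e j * e i)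
  u1 : star ω * ω = 1
  u2 : ω * star ω = 1
  ua : ∀ i ∈ Icc 1 6, ω * e i = -(e i * ω)

theorem CD.map {e : ℕ → A} {ω : A} (h : CD e ω) (θ : A →⋆ₐ[ℝ] B) :
    CD (fun i => θ (e i)) (θ ω) where
  sa i hi := by rw [← map_star, h.sa i hi]
  sq i hi := by rw [← map_mul, h.sq i hi, map_one]
  ac i hi j hj hij := by rw [← map_mul, h.ac i hi j hj hij, map_neg, map_mul]
  u1 := by rw [← map_star, ← map_mul, h.u1, map_one]
  u2 := by rw [← map_star, ← map_mul, h.u2, map_one]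
  ua i hi := by rw [← map_mul, h.ua i hi, map_neg, map_mul]

/-- coefficient data -/
structure Dat (X : Type) [TopologicalSpace X] where
  p : C(X, I)
  c : ℕ → C(X, ℝ)
  s : C(X, ℝ)

/-- the iterated pencil -/
noncomputable def Phi (d : Dat X) (e : ℕ → A) (h : C(I, A)) : C(X, A) :=
  ⟨fun x => ∑ i ∈ Finset.range 6, d.c i x • e i + d.s x • h (d.p x), by fun_prop⟩

theorem Phi_apply (d : Dat X) (e : ℕ → A) (h : C(I, A)) (x : X) : Phi d e h x =
  ∑ i ∈ Finset.range 6, d.c i x • e i + d.s x • h (d.p x) := rfl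

theorem Phi_map (d : Dat X) (e : ℕ → A) (h : C(I, A)) (θ : A →⋆ₐ[ℝ] B) :
    (sahC θ).comp (Phi d e h) = Phi d (fun i => θ (e i)) ((sahC θ).comp h) := by
  ext x
  simp [Phi_apply, sahC_apply]

/-- suspension of data -/
noncomputable def Dat.up (d : Dat X) (n : ℕ) : Dat (X × I) where
  p := d.p.comp ContinuousMap.fst
  c i := ⟨fun z => Real.sin (Real.pi * z.2) * d.c i z.1 +
    (if i = n then 1 else 0) * Real.cos (Real.pi * z.2), by fun_prop⟩
  s := ⟨fun z => Real.sin (Real.pi * z.2) * d.s z.1, by fun_prop⟩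

theorem Phi_up (d : Dat X) (n : ℕ) (hn : n < 6) (e : ℕ → A) (h : C(I, A)) :
    Phi (d.up n) e h = pencil (e n) (Phi d e h) := by
  ext ⟨x, t⟩
  rw [Phi_apply, pencil_apply, Phi_apply]
  simp only [Dat.up, ContinuousMap.coe_mk, ContinuousMap.comp_apply, ContinuousMap.fst_apply, add_smul,
    Finset.sum_add_distrib, smul_add, Finset.smul_sum, smul_smul]
  have : ∑ i ∈ Finset.range 6, ((if i = n then 1 else 0) * Real.cos (Real.pi * t)) • e i =
      Real.cos (Real.pi * t) • e n := by
    rw [Finset.sum_eq_single n]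
    · simp
    · intro j _ hj; simp [hj]
    · intro h; simp at h; omega
  rw [this]
  abel

/-- model map -/
noncomputable def psi (d : Dat X) (e : ℕ → A) : C(X, A) := Phi d e (ContinuousMap.const I (e 6))

theorem psi_map (d : Dat X) (e : ℕ → A) (θ : A →⋆ₐ[ℝ] B) :
    (sahC θ).comp (psi d e) = psi d (fun i => θ (e i)) := by
  rw [psi, Phi_map]; rfl

theorem psi_up (d : Dat X) (n : ℕ) (hn : n < 6) (e : ℕ → A) :
    psi (d.up n) e = pencil (e n) (psi d e) := Phi_up d n hn e _

/-- the model map is an involution -/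
def DW (d : Dat X) (n : ℕ) : Prop :=
  ∀ (A : Type) [Ring A] [Algebra ℝ A] [StarRing A] [TopologicalSpace A] [GA A] (e : ℕ → A) (ω : A),
    CD e ω → ∀ x, psi d e x * psi d e x = 1 ∧ psi d e x ∈ Lsub (e '' Icc 1 n) ∧
      ω * psi d e x = -(psi d e x * ω)

theorem Lsub_mono {G G' : Set A} (h : G ⊆ G') {a : A} (ha : a ∈ Lsub G') : a ∈ Lsub G :=
  ⟨ha.1, fun g hg => ha.2 g (h hg)⟩

theorem img_succ (e : ℕ → A) (n : ℕ) : insert (e (n + 1)) (e '' Icc 1 n) = e '' Icc 1 (n + 1) := by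
  rw [← image_insert_eq]
  congr 1
  ext i; simp; omega

theorem DW.sd {d : Dat X} {n : ℕ} (h : DW d (n + 1)) (hn : n + 1 ≤ 5) {e : ℕ → A} {ω : A}
    (hc : CD e ω) : SD (e '' Icc 1 n) (e (n + 1)) (psi d e) (ω * e (n + 1)) := by
  have hm : n + 1 ∈ Icc 1 6 := ⟨by omega, by omega⟩
  have hp := h A e ω hc
  have hep : ∀ x, e (n + 1) * psi d e x = -(psi d e x * e (n + 1)) := fun x =>
    (hp x).2.1.2 _ ⟨n + 1, ⟨by omega, le_rfl⟩, rfl⟩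
  refine ⟨hc.sq _ hm, ⟨hc.sa _ hm, ?_⟩, fun x => (hp x).1, fun x => Lsub_mono
    (image_mono (Icc_subset_Icc_right (by omega))) (hp x).2.1, hep, ?_, ?_, ?_, fun x => ?_, ?_⟩
  · rintro _ ⟨i, hi, rfl⟩
    have h1 := hi.1; have h2 := hi.2
    exact hc.ac i ⟨by omega, by omega⟩ _ hm (by omega)
  · rw [star_mul, hc.sa _ hm, mul_assoc, ← mul_assoc (star ω), hc.u1, one_mul, hc.sq _ hm]
  · rw [star_mul, hc.sa _ hm, mul_assoc, ← mul_assoc (e (n + 1)), hc.sq _ hm, one_mul, hc.u2]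
  · rw [hc.ua _ hm, neg_mul, mul_neg]; simp only [mul_assoc]; rw [hc.ua _ hm, mul_neg]
  · rw [mul_assoc, hep, mul_neg, ← mul_assoc, (hp x).2.2, neg_mul, neg_neg, mul_assoc]
  · rintro _ ⟨i, hi, rfl⟩
    have h1 := hi.1; have h2 := hi.2
    have hi' : i ∈ Icc 1 6 := ⟨by omega, by omega⟩
    rw [mul_assoc, hc.ac _ hm i hi' (by omega), mul_neg, ← mul_assoc, hc.ua i hi', neg_mul, neg_neg,
      mul_assoc]

theorem DW.up {d : Dat X} {n : ℕ} (h : DW d (n + 1)) (hn : n + 1 ≤ 5) : DW (d.up (n + 1)) n := by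
  intro A _ _ _ _ _ e ω hc z
  have hs := h.sd hn hc
  rw [psi_up _ _ (by omega)]
  refine ⟨pencil_sq hs z, pencil_L hs z, ?_⟩
  obtain ⟨x, t⟩ := z
  rw [pencil_apply, mul_add, add_mul, mul_smul_comm, mul_smul_comm, (h A e ω hc x).2.2,
    hc.ua _ ⟨by omega, by omega⟩]
  simp only [smul_neg, smul_mul_assoc, neg_add]

/-- relative invertible maps -/
def RS (G : Set A) (K : Set X) (ψ : C(X, A)) : Set C(X, A) :=
  {F | ∀ x, F x ∈ Lsub G ∧ IsUnit (F x) ∧ (x ∈ K → F x = ψ x)}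

/-- stabilization -/
noncomputable def stabX (J : Type) [Fintype J] [DecidableEq J] (j0 : J) (ψ F : C(X, A)) :
    C(X, Matrix J J A) :=
  ⟨fun z => Matrix.diagonal (fun j => if j = j0 then F z else ψ z), by
    refine Continuous.matrix_diagonal (continuous_pi fun j => ?_)
    by_cases h : j = j0
    · simp only [h, if_true]; fun_prop
    · simp only [h, if_false]; fun_prop⟩

theorem stabX_apply {J : Type} [Fintype J] [DecidableEq J] (j0 : J) (ψ F : C(X, A)) (x : X) :
    stabX J j0 ψ F x = Matrix.diagonal (fun j => if j = j0 then F x else ψ x) := rfl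

/-- the reduction statement -/
def BB (d : Dat X) (K : Set X) (n : ℕ) : Prop :=
  ∀ (A : Type) [Ring A] [Algebra ℝ A] [StarRing A] [TopologicalSpace A] [GA A] (e : ℕ → A) (ω : A),
    CD e ω → ∀ (F : C(X, A)) (N : Set X), IsOpen N → K ⊆ N → F ∈ RS (e '' Icc 1 n) N (psi d e) →
    ∃ (J : Type) (_ : Fintype J) (_ : DecidableEq J) (j0 j1 : J) (h : C(I, Matrix J J A)),
      j0 ≠ j1 ∧ (∀ t, h t ∈ Lsub (sc J '' (e '' Icc 1 5)) ∧ IsUnit (h t)) ∧ h 0 = sc J (e 6) ∧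
      h 1 = sc J (e 6) ∧ JoinedIn (RS (sc J '' (e '' Icc 1 n)) K ((sahC (sc J)).comp (psi d e)))
        (stabX J j0 (psi d e) F) (Phi d (fun i => sc J (e i)) h)

/-- base data -/
noncomputable def d0 : Dat I := ⟨ContinuousMap.id I, fun _ => 0, 1⟩

theorem Phi_d0 (e : ℕ → A) (h : C(I, A)) : Phi d0 e h = h := by
  ext x; simp [Phi_apply, d0]

theorem psi_d0 (e : ℕ → A) : psi d0 e = ContinuousMap.const I (e 6) := Phi_d0 _ _

theorem DW_d0 : DW d0 5 := by
  intro A _ _ _ _ _ e ω hc x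
  rw [psi_d0]
  have h6 : 6 ∈ Icc 1 6 := ⟨by norm_num, le_rfl⟩
  refine ⟨hc.sq 6 h6, ⟨hc.sa 6 h6, ?_⟩, hc.ua 6 h6⟩
  rintro _ ⟨i, hi, rfl⟩
  have h1 := hi.1; have h2 := hi.2
  exact hc.ac i ⟨by omega, by omega⟩ 6 h6 (by omega)

theorem stabX_mem {J : Type} [Fintype J] [DecidableEq J] (j0 : J) {G : Set A} {K : Set X}
    {ψ F : C(X, A)} (hψ : ∀ x, ψ x ∈ Lsub G ∧ IsUnit (ψ x)) (hF : F ∈ RS G K ψ) :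
    stabX J j0 ψ F ∈ RS (sc J '' G) K ((sahC (sc J)).comp ψ) := by
  intro x
  refine ⟨diagonal_L fun j => ?_, isUnit_diagonal fun j => ?_, fun hx => ?_⟩
  · by_cases h : j = j0
    · simp only [h, if_true]; exact (hF x).1
    · simp only [h, if_false]; exact (hψ x).1
  · by_cases h : j = j0
    · simp only [h, if_true]; exact (hF x).2.1
    · simp only [h, if_false]; exact (hψ x).2
  · rw [stabX_apply, (hF x).2.2 hx]
    simp [sahC_apply, sc_apply]

theorem BB_d0 : BB d0 ({0, 1} : Set I) 5 := by
  intro A _ _ _ _ _ e ω hc F N hN hK hF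
  have hψ : ∀ x, psi d0 e x ∈ Lsub (e '' Icc 1 5) ∧ IsUnit (psi d0 e x) := fun x =>
    ⟨(DW_d0 A e ω hc x).2.1, ⟨⟨_, _, (DW_d0 A e ω hc x).1, (DW_d0 A e ω hc x).1⟩, rfl⟩⟩
  have hm := stabX_mem (J := Fin 2) 0 hψ hF
  refine ⟨Fin 2, inferInstance, inferInstance, 0, 1, stabX (Fin 2) 0 (psi d0 e) F, by simp,
    fun t => ⟨(hm t).1, (hm t).2.1⟩, ?_, ?_, ?_⟩
  · rw [(hm 0).2.2 (hK (by simp)), psi_d0]; rfl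
  · rw [(hm 1).2.2 (hK (by simp)), psi_d0]; rfl
  · rw [Phi_d0]
    exact JoinedIn.refl fun x => ⟨(hm x).1, (hm x).2.1, fun hx => (hm x).2.2 (hK hx)⟩

/-- boundary of a cylinder -/
def bdy (K : Set X) : Set (X × I) := {z | z.1 ∈ K ∨ z.2 = 0 ∨ z.2 = 1}

theorem bdy_closed {K : Set X} (hK : IsClosed K) : IsClosed (bdy K) :=
  (hK.preimage continuous_fst).union ((isClosed_singleton.preimage continuous_snd).union
    (isClosed_singleton.preimage continuous_snd))

theorem pencil_unit {e k : A} (he : star e = e) (he2 : e * e = 1) (hk : star k = k) (hku : IsUnit k)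
    (hek : e * k = -(k * e)) (θ : ℝ) : IsUnit (Real.cos θ • e + Real.sin θ • k) := by
  apply isUnit_of_ker
  intro v hv
  obtain ⟨τ, hτ⟩ := GA.good (A := A)
  have h1 : (Real.cos θ • e + Real.sin θ • k) * ((Real.cos θ • e + Real.sin θ • k) * v) =
      Real.cos θ ^ 2 • v + Real.sin θ ^ 2 • (k * (k * v)) := by
    simp only [← mul_assoc]
    have : (Real.cos θ • e + Real.sin θ • k) * (Real.cos θ • e + Real.sin θ • k) =
        Real.cos θ ^ 2 • 1 + Real.sin θ ^ 2 • (k * k) := by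
      simp only [add_mul, mul_add, smul_mul_assoc, mul_smul_comm, he2, hek, smul_smul]
      module
    rw [this, add_mul, smul_mul_assoc, one_mul, smul_mul_assoc]
  rw [hv, mul_zero] at h1
  have h2 : Real.cos θ ^ 2 * τ (star v * v) + Real.sin θ ^ 2 * τ (star (k * v) * (k * v)) = 0 := by
    have := congrArg (fun a => τ (star v * a)) h1
    simp only [mul_zero, map_zero, mul_add, mul_smul_comm, map_add, map_smul, smul_eq_mul] at this
    rw [this, star_mul, hk, mul_assoc]
  by_contra hv0
  have hkv : k * v ≠ 0 := fun h => hv0 (by simpa using (hku.mul_right_eq_zero).1 h)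
  have h3 := hτ v hv0
  have h4 := hτ _ hkv
  have h5 := Real.cos_sq_add_sin_sq θ
  rcases (sq_nonneg (Real.cos θ)).eq_or_lt with h6 | h6
  · have : Real.sin θ ^ 2 = 1 := by linarith
    rw [← h6, this] at h2; linarith
  · nlinarith [mul_pos h6 h3, mul_nonneg (sq_nonneg (Real.sin θ)) h4.le]

theorem stab_pencil {J : Type} [Fintype J] [DecidableEq J] (k0 : J) (e : A) (ψ H : C(X, A)) :
    stab J k0 e ψ (pencil e H) = pencil (sc J e) (stabX J k0 ψ H) := by
  ext1 ⟨x, t⟩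
  rw [stab_apply, pencil_apply, pencil_apply, pencil_apply, stabX_apply,
    sc_apply, ← Matrix.diagonal_smul, ← Matrix.diagonal_smul, Matrix.diagonal_add]
  congr 1
  funext j
  by_cases hj : j = k0 <;> simp [hj]

theorem pen_RS {G : Set A} {e : A} {ψ : C(X, A)} {U : A} (hs2 : SD G e ψ U) {K : Set X} {b b' : C(X, A)}
    (hb : JoinedIn (RS (insert e G) K ψ) b b') :
    JoinedIn (Adm G e ψ K) (pencil e b) (pencil e b') := by
  obtain ⟨HH, h0, h1, h2⟩ := homotopy_of_joinedIn hb
  refine joinedIn_of_homotopy ⟨fun w : I × (X × I) =>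
    Real.cos (Real.pi * w.2.2) • e +
    Real.sin (Real.pi * w.2.2) • HH (w.1, w.2.1), by fun_prop⟩ ?_ ?_ ?_
  · rintro ⟨x, t⟩; simp [h0, pencil_apply]
  · rintro ⟨x, t⟩; simp [h1, pencil_apply]
  · intro t
    have h3 := h2 t
    refine ⟨fun z => ⟨?_, ?_⟩, fun x => ?_, fun x => ?_, fun x hx u => ?_⟩
    · exact (Lsub _).add_mem ((Lsub _).smul_mem _ hs2.eL) ((Lsub _).smul_mem _
        (Lsub_mono (subset_insert _ _) (h3 z.1).1))
    · exact pencil_unit hs2.eL.1 hs2.e2 (h3 z.1).1.1 (h3 z.1).2.1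
        ((h3 z.1).1.2 _ (mem_insert _ _)) _
    · simp
    · simp
    · have := (h3 x).2.2 hx
      change _ + _ • (HH.curry t) x = _
      rw [this, pencil_apply]

theorem BB_paths {J : Type} [Fintype J] [DecidableEq J] (k0 : J) {G : Set A} {e : A} {ψ : C(X, A)}
    {U : A} (hs : SD G e ψ U) {K N : Set X} (hKN : K ⊆ N) {F : C(X × I, A)} {H : C(X, A)}
    (hj : JoinedIn (Adm G e ψ N) F (pencil e H)) {P : C(X, Matrix J J A)}
    (hb : JoinedIn (RS (insert (sc J e) (sc J '' G)) K ((sahC (sc J)).comp ψ)) (stabX J k0 ψ H) P)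
    (θ : Matrix J J A →⋆ₐ[ℝ] B) :
    JoinedIn (Adm (θ '' (sc J '' G)) (θ (sc J e)) ((sahC θ).comp ((sahC (sc J)).comp ψ)) K)
      ((sahC θ).comp (stab J k0 e ψ F)) ((sahC θ).comp (pencil (sc J e) P)) := by
  have p1 := (joined_stab k0 hs hj).mono (Adm_mono hKN)
  rw [stab_pencil] at p1
  exact joined_map θ (p1.trans (pen_RS (hs.map (sc J)) hb))

theorem BB_up {d : Dat X} {K : Set X} {n : ℕ} (hK : IsClosed K) (hn : n + 1 ≤ 5) (hD : DW d (n + 1))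
    (hB : BB d K (n + 1)) : BB (d.up (n + 1)) (bdy K) n := by
  intro A _ _ _ _ _ e ω hc F N hN hKN hF
  have hs := hD.sd hn hc
  have hup := psi_up d (n + 1) (by omega) e
  obtain ⟨N1, V, hN1, hV, hKN1, hVI, hNV⟩ := generalized_tube_lemma (s := K) hK.isCompact
    (t := (univ : Set I)) isCompact_univ hN (by
      rintro ⟨x, t⟩ ⟨hx, -⟩; exact hKN (Or.inl hx))
  have hN1N : ∀ x ∈ N1, ∀ t : I, (x, t) ∈ N := fun x hx t => hNV ⟨hx, hVI trivial⟩
  have hFA : F ∈ Adm (e '' Icc 1 n) (e (n + 1)) (psi d e) N1 := by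
    refine ⟨fun z => ⟨(hF z).1, (hF z).2.1⟩, fun x => ?_, fun x => ?_, fun x hx t => ?_⟩
    · rw [(hF (x, 0)).2.2 (hKN (Or.inr (Or.inl rfl))), hup]; simp [pencil_apply]
    · rw [(hF (x, 1)).2.2 (hKN (Or.inr (Or.inr rfl))), hup]; simp [pencil_apply]
    · rw [(hF (x, t)).2.2 (hN1N x hx t), hup]
  obtain ⟨J1, _, _, j0, N2, H, hN2, hKN2, hH, hHN, hj⟩ := step_thm hs hK hN1 hKN1 hFA
  rw [img_succ] at hH
  have hc1 := hc.map (sc J1 : A →⋆ₐ[ℝ] Matrix J1 J1 A)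
  have him1 : ∀ m, (fun i => sc J1 (e i)) '' Icc 1 m = sc J1 '' (e '' Icc 1 m) := fun m =>
    (image_image _ _ _).symm
  have hpm : (sahC (sc J1)).comp (psi d e) = psi d (fun i => sc J1 (e i)) := psi_map d e (sc J1)
  obtain ⟨J2, _, _, k0, k1, h, hk, hh, hh0, hh1, hhj⟩ := hB _ (fun i => sc J1 (e i)) _ hc1 H N2 hN2 hKN2 (by
    intro x
    refine ⟨by rw [him1]; exact (hH x).1, (hH x).2, fun hx => ?_⟩
    rw [hHN x hx, ← hpm]; rfl)
  rw [him1] at hhj hh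
  have him2 : ∀ S : Set A, cmp J2 J1 '' (sc J2 '' (sc J1 '' S)) = sc (J2 × J1) '' S := by
    intro S
    rw [image_image, image_image]
    exact image_congr fun a _ => cmp_sc a
  have hhj' : JoinedIn (RS (insert (sc J2 (sc J1 (e (n + 1)))) (sc J2 '' (sc J1 '' (e '' Icc 1 n)))) K
      ((sahC (sc J2)).comp ((sahC (sc J1)).comp (psi d e))))
      (stabX J2 k0 ((sahC (sc J1)).comp (psi d e)) H) (Phi d (fun i => sc J2 (sc J1 (e i))) h) := by
    rw [← image_insert_eq, ← image_insert_eq, img_succ, hpm]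
    exact hhj
  have p := BB_paths k0 (hs.map (sc J1)) hKN2 hj hhj' (cmp J2 J1)
  rw [him2, cmp_sc] at p
  refine ⟨J2 × J1, inferInstance, inferInstance, (k0, j0), (k1, j0), (sahC (cmp J2 J1)).comp h,
    by simp [hk], fun t => ⟨?_, ?_⟩, ?_, ?_, ?_⟩
  · have := Lsub_map (cmp J2 J1) (hh t).1
    rw [him2] at this
    exact this
  · exact (hh t).2.map (cmp J2 J1)
  · change cmp J2 J1 (h 0) = _
    rw [hh0]; exact cmp_sc _
  · change cmp J2 J1 (h 1) = _
    rw [hh1]; exact cmp_sc _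
  · have hψ : (sahC (cmp J2 J1)).comp ((sahC (sc J2)).comp ((sahC (sc J1)).comp (psi d e))) =
        (sahC (sc (J2 × J1))).comp (psi d e) := by
      ext x : 1
      exact cmp_sc _
    rw [hψ] at p
    have hsub : Adm (sc (J2 × J1) '' (e '' Icc 1 n)) (sc (J2 × J1) (e (n + 1)))
        ((sahC (sc (J2 × J1))).comp (psi d e)) K ⊆ RS (sc (J2 × J1) '' (e '' Icc 1 n)) (bdy K)
          ((sahC (sc (J2 × J1))).comp (psi (d.up (n + 1)) e)) := by
      intro k hk z
      refine ⟨(hk.1 z).1, (hk.1 z).2, fun hz => ?_⟩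
      rw [hup, pencil_map]
      obtain ⟨x, t⟩ := z
      rcases hz with hz | hz | hz
      · exact hk.2.2.2 x hz t
      · have hz : t = 0 := hz
        rw [hz, hk.2.1]; simp [pencil_apply]
      · have hz : t = 1 := hz
        rw [hz, hk.2.2.1]; simp [pencil_apply]
    convert p.mono hsub using 1
    · ext z : 1
      simp only [ContinuousMap.comp_apply, sahC_apply, stab_apply]
      have hp : pencil (sc J1 (e (n + 1))) ((sahC (sc J1)).comp (psi d e)) z =
          Matrix.diagonal (fun _ => pencil (e (n + 1)) (psi d e) z) := by
        rw [← pencil_map]; rfl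
      rw [hp]
      have : (fun j => if j = k0 then Matrix.diagonal fun j => if j = j0 then F z else
          pencil (e (n + 1)) (psi d e) z
        else Matrix.diagonal fun _ => pencil (e (n + 1)) (psi d e) z) = fun j => Matrix.diagonal
          (fun j' : J1 => if (j, j') = (k0, j0) then F z else pencil (e (n + 1)) (psi d e) z) := by
        funext j
        by_cases hj : j = k0 <;> simp [hj]
      rw [this, cmp_diag, stabX_apply, hup]
    · rw [Phi_up _ _ (by omega), pencil_map, Phi_map]
      congr 1
      · exact (cmp_sc _).symm
      · congr 1
        funext i
        exact (cmp_sc _).symm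

/-- the iterated data -/
noncomputable def d4 : Dat ((((I × I) × I) × I) × I) := (((d0.up 5).up 4).up 3).up 2
/-- boundary of the cube -/
def K4 : Set ((((I × I) × I) × I) × I) := bdy (bdy (bdy (bdy ({0, 1} : Set I))))

theorem DW_d4 : DW d4 1 :=
  (((DW_d0.up (by norm_num)).up (by norm_num)).up (by norm_num)).up (by norm_num)

theorem BB_d4 : BB d4 K4 1 := by
  have k0 : IsClosed ({0, 1} : Set I) := (toFinite _).isClosed
  have k1 := bdy_closed k0
  have k2 := bdy_closed k1
  have k3 := bdy_closed k2
  have D1 := DW_d0.up (n := 4) (by norm_num)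
  have D2 := D1.up (n := 3) (by norm_num)
  have D3 := D2.up (n := 2) (by norm_num)
  exact BB_up k3 (by norm_num) D3 (BB_up k2 (by norm_num) D2 (BB_up k1 (by norm_num) D1
    (BB_up k0 (by norm_num) DW_d0 BB_d0)))

end
end S6

set_option linter.unusedSectionVars false
set_option linter.unusedVariables false
set_option linter.deprecated false

namespace S6
open Set Topology Module Matrix
open scoped unitInterval

section emb
variable {m n R : Type} [Fintype m] [DecidableEq m] [Fintype n] [DecidableEq n] [Ring R]

/-- inclusion matrix -/
def incM (R : Type) [Ring R] (ι : m → n) : Matrix n m R := Matrix.of fun i a => if i = ι a then 1 else 0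

theorem incM_tr {ι : m → n} (hι : Function.Injective ι) : (incM R ι)ᵀ * incM R ι = 1 := by
  ext a b
  rw [Matrix.mul_apply]
  simp [incM, Matrix.one_apply, hι.eq_iff, eq_comm]

/-- block embedding -/
def embM (ι : m → n) (M : Matrix m m R) : Matrix n n R := 1 + incM R ι * (M - 1) * (incM R ι)ᵀ

theorem embM_one (ι : m → n) : embM ι (1 : Matrix m m R) = 1 := by simp [embM]

theorem embM_inc {ι : m → n} (hι : Function.Injective ι) (M : Matrix m m R) :
    embM ι M * incM R ι = incM R ι * M := by
  rw [embM, Matrix.add_mul, Matrix.mul_assoc, incM_tr hι]; simp [Matrix.mul_sub]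

theorem embM_inc' {ι : m → n} (hι : Function.Injective ι) (M : Matrix m m R) :
    (incM R ι)ᵀ * embM ι M = M * (incM R ι)ᵀ := by
  rw [embM, Matrix.mul_add, ← Matrix.mul_assoc, ← Matrix.mul_assoc, incM_tr hι]; simp [Matrix.sub_mul]

theorem embM_mul {ι : m → n} (hι : Function.Injective ι) (M N : Matrix m m R) :
    embM ι (M * N) = embM ι M * embM ι N := by
  have h : embM ι M * embM ι N = embM ι M + (embM ι M * incM R ι) * (N - 1) * (incM R ι)ᵀ := by
    conv_lhs => rw [embM.eq_1 ι N]
    simp only [Matrix.mul_add, Matrix.mul_one, Matrix.mul_assoc]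
  rw [h, embM_inc hι, embM, embM]
  simp only [Matrix.mul_sub, Matrix.sub_mul, Matrix.mul_one, Matrix.mul_assoc]
  abel

theorem embM_isUnit {ι : m → n} (hι : Function.Injective ι) {M : Matrix m m R} :
    IsUnit (embM ι M) ↔ IsUnit M := by
  constructor
  · rintro ⟨u, hu⟩
    have h1 : embM ι M * (↑u⁻¹ : Matrix n n R) = 1 := by rw [← hu]; simp
    have h2 : (↑u⁻¹ : Matrix n n R) * embM ι M = 1 := by rw [← hu]; simp
    refine ⟨⟨M, (incM R ι)ᵀ * (↑u⁻¹ : Matrix n n R) * incM R ι, ?_, ?_⟩, rfl⟩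
    · rw [← Matrix.mul_assoc, ← Matrix.mul_assoc, ← embM_inc' hι, Matrix.mul_assoc (incM R ι)ᵀ, h1,
        Matrix.mul_one, incM_tr hι]
    · rw [Matrix.mul_assoc, ← embM_inc hι, Matrix.mul_assoc, ← Matrix.mul_assoc _ (embM ι M), h2,
        Matrix.one_mul, incM_tr hι]
  · rintro ⟨u, hu⟩
    refine ⟨⟨embM ι M, embM ι (↑u⁻¹ : Matrix m m R), ?_, ?_⟩, rfl⟩
    · rw [← embM_mul hι, ← hu]; simp [embM_one]
    · rw [← embM_mul hι, ← hu]; simp [embM_one]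

theorem incM_mul_apply (ι : m → n) (M : Matrix m m R) (i j : n) :
    (incM R ι * M * (incM R ι)ᵀ) i j = ∑ a, ∑ b, (if i = ι a then 1 else 0) * M a b *
      (if j = ι b then 1 else 0) := by
  simp only [Matrix.mul_apply, incM, Matrix.of_apply, Matrix.transpose_apply, Finset.sum_mul]
  rw [Finset.sum_comm]

theorem embM_apply {ι : m → n} (hι : Function.Injective ι) (M : Matrix m m R) (a b : m) :
    embM ι M (ι a) (ι b) = M a b := by
  rw [embM, Matrix.add_apply, incM_mul_apply, Finset.sum_eq_single a, Finset.sum_eq_single b]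
  · simp [Matrix.one_apply, hι.eq_iff]
  · intro c _ hc; simp [hι.eq_iff, Ne.symm hc]
  · simp
  · intro c _ hc; simp [hι.eq_iff, Ne.symm hc]
  · simp

theorem embM_apply_ne {ι : m → n} (M : Matrix m m R) (i j : n)
    (h : (∀ a, i ≠ ι a) ∨ (∀ a, j ≠ ι a)) : embM ι M i j = (1 : Matrix n n R) i j := by
  rw [embM, Matrix.add_apply, incM_mul_apply, add_eq_left]
  refine Finset.sum_eq_zero fun a _ => Finset.sum_eq_zero fun b _ => ?_
  rcases h with h | h
  · simp [h a]
  · simp [h b]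

theorem embM_sub {ι : m → n} (hι : Function.Injective ι) {g : Matrix n n R}
    (hg : ∀ i j, (i ∉ range ι ∨ j ∉ range ι) → g i j = (1 : Matrix n n R) i j) :
    embM ι (g.submatrix ι ι) = g := by
  ext i j
  by_cases hi : i ∈ range ι
  · by_cases hj : j ∈ range ι
    · obtain ⟨a, rfl⟩ := hi
      obtain ⟨b, rfl⟩ := hj
      rw [embM_apply hι]; rfl
    · rw [embM_apply_ne _ _ _ (Or.inr fun a h => hj ⟨a, h.symm⟩), hg _ _ (Or.inr hj)]
  · rw [embM_apply_ne _ _ _ (Or.inl fun a h => hi ⟨a, h.symm⟩), hg _ _ (Or.inl hi)]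

theorem embM_continuous [TopologicalSpace R] [IsTopologicalRing R] (ι : m → n) :
    Continuous (embM ι : Matrix m m R → Matrix n n R) := by
  unfold embM
  fun_prop

end emb

/-- relative units -/
def RU {X R : Type} [TopologicalSpace X] [TopologicalSpace R] [Monoid R] (K : Set X) : Set C(X, R) :=
  {h | ∀ x, IsUnit (h x) ∧ (x ∈ K → h x = 1)}

/-- scaled rotation -/
noncomputable def rotM (z : ℂ) : Matrix (Fin 2) (Fin 2) ℝ := !![z.re, -z.im; z.im, z.re]

theorem rotM_continuous : Continuous rotM := by
  unfold rotM
  refine continuous_matrix fun i j => ?_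
  fin_cases i <;> fin_cases j <;> simp <;> fun_prop

theorem rotM_one : rotM 1 = 1 := by
  ext i j; fin_cases i <;> fin_cases j <;> simp [rotM]

/-- angle -/
noncomputable def ang (k : ℤ) (t : ℝ) : ℂ := ((2 * Real.pi * k * t : ℝ) : ℂ) * Complex.I

/-- standard loop -/
noncomputable def rotL (k : ℤ) : C(I, Matrix (Fin 2) (Fin 2) ℝ) :=
  ⟨fun t => rotM (Complex.exp (ang k t)), rotM_continuous.comp (by unfold ang; fun_prop)⟩

theorem exp_ang_int (k : ℤ) : Complex.exp (ang k 1) = 1 := by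
  rw [Complex.exp_eq_one_iff]
  exact ⟨k, by unfold ang; push_cast; ring⟩

theorem ang_zero (k : ℤ) : ang k 0 = 0 := by simp [ang]

theorem GL2_loop (g : C(I, Matrix (Fin 2) (Fin 2) ℝ)) (hg : g ∈ RU ({0, 1} : Set I)) :
    ∃ k : ℤ, JoinedIn (RU ({0, 1} : Set I)) g (rotL k) := by
  have h0 : g 0 = 1 := (hg 0).2 (by simp)
  have h1 : g 1 = 1 := (hg 1).2 (by simp)
  have hc : ∀ i j, Continuous fun t => g t i j := fun i j => by fun_prop
  have hdet : ∀ t, (g t).det ≠ 0 := fun t =>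
    isUnit_iff_ne_zero.1 ((Matrix.isUnit_iff_isUnit_det _).1 (hg t).1)
  have hdc : Continuous fun t => (g t).det := by fun_prop
  have hpos : ∀ t, 0 < (g t).det := by
    intro t
    by_contra hn
    have hlt : (g t).det < 0 := lt_of_le_of_ne (not_lt.1 hn) (hdet t)
    have : (0 : ℝ) ∈ range fun t => (g t).det :=
      mem_range_of_exists_le_of_exists_ge hdc ⟨t, hlt.le⟩ ⟨0, by simp [h0]⟩
    obtain ⟨u, hu⟩ := this
    exact hdet u hu
  have hd2 : ∀ t, (g t).det = g t 0 0 * g t 1 1 - g t 0 1 * g t 1 0 := fun t => Matrix.det_fin_two _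
  have hn2 : ∀ t, 0 < g t 0 0 ^ 2 + g t 1 0 ^ 2 := by
    intro t
    have := hpos t
    rw [hd2] at this
    by_contra hn
    have h00 : g t 0 0 = 0 := by nlinarith [sq_nonneg (g t 0 0), sq_nonneg (g t 1 0)]
    have h10 : g t 1 0 = 0 := by nlinarith [sq_nonneg (g t 0 0), sq_nonneg (g t 1 0)]
    rw [h00, h10] at this; simp at this
  let z : C(I, {z : ℂ // z ≠ 0}) := ⟨fun t => ⟨⟨g t 0 0, g t 1 0⟩, fun h => by
      have e1 := congrArg Complex.re h
      have e2 := congrArg Complex.im h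
      simp at e1 e2
      have := hn2 t
      rw [e1, e2] at this; simp at this⟩, by
    refine Continuous.subtype_mk ?_ _
    have : (fun t => (⟨g t 0 0, g t 1 0⟩ : ℂ)) = fun t => (g t 0 0 : ℂ) + (g t 1 0 : ℂ) * Complex.I := by
      funext t; apply Complex.ext <;> simp
    rw [this]
    have := hc 0 0; have := hc 1 0
    fun_prop⟩
  obtain ⟨w, hw, hw0⟩ := Complex.isCoveringMap_exp.exists_path_lifts z 0 (by
    apply Subtype.ext; apply Complex.ext <;> simp [z, h0])
  have hwz : ∀ t, Complex.exp (w t) = ⟨g t 0 0, g t 1 0⟩ := fun t => congrArg Subtype.val (congrFun hw t)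
  have hw1 : Complex.exp (w 1) = 1 := by
    rw [hwz, h1]; apply Complex.ext <;> simp
  obtain ⟨k, hk⟩ := Complex.exp_eq_one_iff.1 hw1
  have hk' : w 1 = ang k 1 := by rw [hk]; unfold ang; push_cast; ring
  refine ⟨k, ?_⟩
  obtain ⟨x, hx⟩ : ∃ x : C(I, ℝ), ∀ t, x t = (g t 0 0 * g t 0 1 + g t 1 0 * g t 1 1) /
      (g t 0 0 ^ 2 + g t 1 0 ^ 2) := ⟨⟨fun t => _, Continuous.div (by fun_prop) (by fun_prop)
        fun t => (hn2 t).ne'⟩, fun t => rfl⟩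
  obtain ⟨y, hy⟩ : ∃ x : C(I, ℝ), ∀ t, x t = (g t).det /
      (g t 0 0 ^ 2 + g t 1 0 ^ 2) := ⟨⟨fun t => _, Continuous.div (by fun_prop) (by fun_prop)
        fun t => (hn2 t).ne'⟩, fun t => rfl⟩
  have hypos : ∀ t, 0 < y t := fun t => by rw [hy]; exact div_pos (hpos t) (hn2 t)
  have hcw : Continuous fun w' : I × I => rotM (Complex.exp ((1 - (w'.1 : ℝ) : ℝ) * w w'.2 +
      (w'.1 : ℝ) * ang k w'.2)) := rotM_continuous.comp (by unfold ang; fun_prop)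
  have hcT : Continuous fun w' : I × I => (!![1, (1 - (w'.1 : ℝ)) * x w'.2; 0, (1 - (w'.1 : ℝ)) * y w'.2 + w'.1] :
      Matrix (Fin 2) (Fin 2) ℝ) := by
    refine continuous_matrix fun i j => ?_
    fin_cases i <;> fin_cases j <;> simp <;> fun_prop
  refine joinedIn_of_homotopy ⟨fun w' => rotM (Complex.exp ((1 - (w'.1 : ℝ) : ℝ) * w w'.2 +
      (w'.1 : ℝ) * ang k w'.2)) * (!![1, (1 - (w'.1 : ℝ)) * x w'.2; 0, (1 - (w'.1 : ℝ)) * y w'.2 + w'.1] :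
      Matrix (Fin 2) (Fin 2) ℝ), hcw.mul hcT⟩ ?_ ?_ ?_
  · intro t
    have := (hn2 t).ne'
    have hh : Complex.exp (((1 - ((0 : I) : ℝ) : ℝ) : ℂ) * w t + (((0 : I) : ℝ) : ℂ) * ang k t) =
      ⟨g t 0 0, g t 1 0⟩ := by rw [← hwz]; simp
    simp only [ContinuousMap.coe_mk]
    rw [hh, hx, hy, hd2]
    ext i j
    fin_cases i <;> fin_cases j <;> simp [rotM, Matrix.mul_apply, Fin.sum_univ_two] <;> field_simp <;> ring
  · intro t
    simp only [ContinuousMap.coe_mk, rotL]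
    have : (!![1, (1 - ((1 : I) : ℝ)) * x t; 0, (1 - ((1 : I) : ℝ)) * y t + ((1 : I) : ℝ)] :
      Matrix (Fin 2) (Fin 2) ℝ) = 1 := by
      ext i j; fin_cases i <;> fin_cases j <;> simp
    rw [this, mul_one]
    simp
  · intro s t
    refine ⟨?_, fun ht => ?_⟩
    · change IsUnit (rotM (Complex.exp ((1 - (s : ℝ) : ℝ) * w t + (s : ℝ) * ang k t)) *
        (!![1, (1 - (s : ℝ)) * x t; 0, (1 - (s : ℝ)) * y t + s] : Matrix (Fin 2) (Fin 2) ℝ))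
      refine IsUnit.mul ?_ ?_
      · rw [Matrix.isUnit_iff_isUnit_det, isUnit_iff_ne_zero]
        generalize hq : Complex.exp _ = q
        have hq0 : q ≠ 0 := hq ▸ Complex.exp_ne_zero _
        rw [Matrix.det_fin_two]
        simp only [rotM, Matrix.of_apply, Matrix.cons_val', Matrix.cons_val_zero, Matrix.cons_val_one]
        have := Complex.normSq_pos.2 hq0
        rw [Complex.normSq_apply] at this
        simp
        nlinarith
      · rw [Matrix.isUnit_iff_isUnit_det, isUnit_iff_ne_zero, Matrix.det_fin_two]
        have a1 := s.2.1; have a2 := s.2.2; have a3 := hypos t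
        have : 0 < (1 - (s : ℝ)) * y t + s := by
          rcases a1.eq_or_lt with h | h
          · rw [← h]; simpa using a3
          · nlinarith
        simp
        exact this.ne'
    · change rotM (Complex.exp ((1 - (s : ℝ) : ℝ) * w t + (s : ℝ) * ang k t)) *
        (!![1, (1 - (s : ℝ)) * x t; 0, (1 - (s : ℝ)) * y t + s] : Matrix (Fin 2) (Fin 2) ℝ) = 1
      have hgt : g t = 1 := (hg t).2 ht
      have hxt : x t = 0 := by rw [hx, hgt]; simp
      have hyt : y t = 1 := by rw [hy, hgt]; simp
      have e2 : (!![1, (1 - (s : ℝ)) * x t; 0, (1 - (s : ℝ)) * y t + s] : Matrix (Fin 2) (Fin 2) ℝ) = 1 := by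
        ext i j; fin_cases i <;> fin_cases j <;> simp [hxt, hyt]
      rw [e2, mul_one]
      rcases ht with ht | ht
      · rw [ht, hw0]; simp [ang_zero, rotM_one]
      · have ht : t = 1 := ht
        rw [ht, hk', Icc.coe_one, ← add_mul]; simp [exp_ang_int, rotM_one]

theorem RU_comp {X R S : Type} [TopologicalSpace X] [TopologicalSpace R] [TopologicalSpace S] [Monoid R]
    [Monoid S] {K : Set X} {f g : C(X, R)} (θ : C(R, S)) (h1 : θ 1 = 1) (hu : ∀ a, IsUnit a → IsUnit (θ a))
    (h : JoinedIn (RU K) f g) : JoinedIn (RU K) (θ.comp f) (θ.comp g) := by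
  obtain ⟨γ, hγ⟩ := h
  refine ⟨γ.map (ContinuousMap.continuous_postcomp θ), fun t x => ⟨hu _ (hγ t x).1, fun hx => ?_⟩⟩
  change θ (γ t x) = 1
  rw [(hγ t x).2 hx, h1]

theorem GLJ_loop {J : Type} [Fintype J] [DecidableEq J] {j0 j1 : J} (hj : j0 ≠ j1)
    (g : C(I, Matrix J J ℝ)) (hg : g ∈ RU ({0, 1} : Set I)) :
    ∃ k : ℤ, JoinedIn (RU ({0, 1} : Set I)) g
      ((⟨embM ![j0, j1], embM_continuous _⟩ : C(Matrix (Fin 2) (Fin 2) ℝ, Matrix J J ℝ)).comp (rotL k)) := by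
  obtain ⟨g1, hg1, hs⟩ := compress (K := ℝ) (by intro a; simp [pow_two]) cubeLike_I {j0, j1}
    (by rw [Finset.card_pair hj]; simp) g fun x => (hg x).1
  have p1 : JoinedIn (RU ({0, 1} : Set I)) g g1 := by
    refine hg1.mono fun k hk x => ⟨(hk x).1, fun hx => ?_⟩
    rw [(hk x).2 (by rw [(hg x).2 hx]; exact Supp.one _), (hg x).2 hx]
  have hι : Function.Injective ![j0, j1] := by
    intro a b; fin_cases a <;> fin_cases b <;> simp [hj, hj.symm]
  let θ : C(Matrix (Fin 2) (Fin 2) ℝ, Matrix J J ℝ) := ⟨embM ![j0, j1], embM_continuous _⟩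
  let g2 : C(I, Matrix (Fin 2) (Fin 2) ℝ) := ⟨fun t => (g1 t).submatrix ![j0, j1] ![j0, j1], by fun_prop⟩
  have hg2 : ∀ t, embM ![j0, j1] (g2 t) = g1 t := fun t => embM_sub hι fun i j hij => hs t i j (by
    simp only [Finset.mem_insert, Finset.mem_singleton]
    refine hij.imp ?_ ?_
    · rintro h1 (h2 | h2)
      · exact h1 ⟨0, h2.symm⟩
      · exact h1 ⟨1, h2.symm⟩
    · rintro h1 (h2 | h2)
      · exact h1 ⟨0, h2.symm⟩
      · exact h1 ⟨1, h2.symm⟩)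
  have hg1m := p1.target_mem
  obtain ⟨k, hk⟩ := GL2_loop g2 (by
    intro t
    refine ⟨(embM_isUnit hι).1 (by rw [hg2]; exact (hg1m t).1), fun ht => ?_⟩
    have : g1 t = 1 := (hg1m t).2 ht
    ext a b
    change g1 t _ _ = _
    rw [this, Matrix.one_apply, Matrix.one_apply]
    simp [hι.eq_iff])
  refine ⟨k, p1.trans ?_⟩
  have e : θ.comp g2 = g1 := ContinuousMap.ext hg2
  rw [← e]
  exact RU_comp θ (embM_one _) (fun a ha => (embM_isUnit hι).2 ha) hk

end S6

set_option linter.unusedSectionVars false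
set_option linter.unusedVariables false
set_option linter.deprecated false

namespace S6
open Set Topology Module Matrix
open scoped unitInterval

section
variable {A : Type} [Ring A] [Algebra ℝ A] [StarRing A] [TopologicalSpace A] [GA A]
variable {X : Type} [TopologicalSpace X] [CompactSpace X] [T2Space X]

/-- the pencil stays invertible -/
def PR (d : Dat X) (K : Set X) (n : ℕ) : Prop :=
  ∀ (A : Type) [Ring A] [Algebra ℝ A] [StarRing A] [TopologicalSpace A] [GA A] (e : ℕ → A) (ω : A),
    CD e ω → ∀ h : C(I, A), (∀ t, h t ∈ Lsub (e '' Icc 1 5) ∧ IsUnit (h t)) → h 0 = e 6 → h 1 = e 6 →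
    Phi d e h ∈ RS (e '' Icc 1 n) K (psi d e)

theorem PR_d0 : PR d0 ({0, 1} : Set I) 5 := by
  intro A _ _ _ _ _ e ω hc h hh h0 h1 x
  rw [Phi_d0, psi_d0]
  refine ⟨(hh x).1, (hh x).2, ?_⟩
  rintro (hx | hx)
  · rw [hx, h0]; rfl
  · have hx : x = 1 := hx
    rw [hx, h1]; rfl

theorem PR.up {d : Dat X} {K : Set X} {n : ℕ} (hn : n + 1 ≤ 5) (hP : PR d K (n + 1)) :
    PR (d.up (n + 1)) (bdy K) n := by
  intro A _ _ _ _ _ e ω hc h hh h0 h1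
  have h2 := hP A e ω hc h hh h0 h1
  rintro ⟨x, t⟩
  rw [Phi_up _ _ (by omega), psi_up _ _ (by omega), pencil_apply, pencil_apply]
  have hm : n + 1 ∈ Icc 1 6 := ⟨by omega, by omega⟩
  have h3 := h2 x
  refine ⟨?_, ?_, ?_⟩
  · refine (Lsub _).add_mem ((Lsub _).smul_mem _ ⟨hc.sa _ hm, ?_⟩) ((Lsub _).smul_mem _
      (Lsub_mono (image_mono (Icc_subset_Icc_right (by omega))) h3.1))
    rintro _ ⟨i, hi, rfl⟩
    have h1 := hi.1; have h2 := hi.2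
    exact hc.ac i ⟨by omega, by omega⟩ _ hm (by omega)
  · exact pencil_unit (hc.sa _ hm) (hc.sq _ hm) h3.1.1 h3.2.1
      (h3.1.2 _ ⟨n + 1, ⟨by omega, le_rfl⟩, rfl⟩) _
  · rintro (hz | hz | hz)
    · rw [h3.2.2 hz]
    · have hz : t = 0 := hz
      simp [hz]
    · have hz : t = 1 := hz
      simp [hz]

theorem PR_d4 : PR d4 K4 1 :=
  (((PR_d0.up (by norm_num)).up (by norm_num)).up (by norm_num)).up (by norm_num)

/-- matrix units data -/
structure CE (e : ℕ → A) (E E' : A) : Prop where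
  st : star E = E'
  st' : star E' = E
  sq : E * E = 0
  sq' : E' * E' = 0
  sum : E * E' + E' * E = 1
  e6 : e 6 = E + E'
  ac : ∀ i ∈ Icc 1 5, e i * E = -(E * e i)
  ac' : ∀ i ∈ Icc 1 5, e i * E' = -(E' * e i)
  span : ∃ φ : A →ₗ[ℝ] ℝ, φ E = 1 ∧ φ E' = 0 ∧
    ∀ x, (∀ i ∈ Icc 1 5, e i * x = -(x * e i)) → ∃ r t : ℝ, x = r • E + t • E'

variable {J : Type} [Fintype J] [DecidableEq J]

/-- the model of real matrices -/
def hm (E E' : A) (α : Matrix J J ℝ) : Matrix J J A := Matrix.of fun i j => α i j • E + α j i • E'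

theorem hm_apply (E E' : A) (α : Matrix J J ℝ) (i j : J) : hm E E' α i j = α i j • E + α j i • E' := rfl

theorem hm_cont (E E' : A) : Continuous (hm E E' : Matrix J J ℝ → Matrix J J A) := by
  refine continuous_matrix fun i j => ?_
  simp only [hm_apply]
  fun_prop

variable {e : ℕ → A} {E E' : A} {ω : A}

theorem hm_one (h : CE e E E') : hm E E' (1 : Matrix J J ℝ) = sc J (e 6) := by
  ext i j
  rw [hm_apply, sc_apply, h.e6, Matrix.diagonal_apply, Matrix.one_apply, Matrix.one_apply]
  by_cases hij : i = j
  · simp [hij]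
  · simp [hij, Ne.symm hij]

theorem hm_mul (h : CE e E E') {α β : Matrix J J ℝ} (h1 : α * βᵀ = 1) (h2 : αᵀ * β = 1) :
    hm E E' α * hm E E' β = 1 := by
  ext i j
  rw [Matrix.mul_apply]
  have : ∀ k, hm E E' α i k * hm E E' β k j = (α i k * β j k) • (E * E') + (α k i * β k j) • (E' * E) := by
    intro k
    simp only [hm_apply, add_mul, mul_add, smul_mul_assoc, mul_smul_comm, h.sq, h.sq']
    module
  simp only [this, Finset.sum_add_distrib, ← Finset.sum_smul]
  have e1 : ∑ k, α i k * β j k = (1 : Matrix J J ℝ) i j := by rw [← h1]; simp [Matrix.mul_apply]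
  have e2 : ∑ k, α k i * β k j = (1 : Matrix J J ℝ) i j := by rw [← h2]; simp [Matrix.mul_apply]
  rw [e1, e2, ← smul_add, h.sum, Matrix.one_apply, Matrix.one_apply]
  split_ifs <;> simp

theorem hm_unit (h : CE e E E') {α : Matrix J J ℝ} (hα : IsUnit α) : IsUnit (hm E E' α) := by
  obtain ⟨u, rfl⟩ := hα
  have h1 : (u : Matrix J J ℝ) * (↑u⁻¹ : Matrix J J ℝ) = 1 := by simp
  have h2 : (↑u⁻¹ : Matrix J J ℝ) * (u : Matrix J J ℝ) = 1 := by simp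
  refine ⟨⟨_, hm E E' ((↑u⁻¹ : Matrix J J ℝ)ᵀ), hm_mul h ?_ ?_, hm_mul h ?_ ?_⟩, rfl⟩
  · simp
  · rw [← Matrix.transpose_mul, h2]; simp
  · rw [← Matrix.transpose_mul, h1]; simp
  · simp

theorem CE.ne (h : CE e E E') : E' ≠ 0 := by
  intro h0
  obtain ⟨φ, h1, -⟩ := h.span
  have : E = 0 := by rw [← h.st', h0, star_zero]
  rw [this] at h1; simp at h1

theorem hm_unit' (h : CE e E E') {α : Matrix J J ℝ} (hα : IsUnit (hm E E' α)) : IsUnit α := by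
  rw [← Matrix.mulVec_injective_iff_isUnit]
  refine (injective_iff_map_eq_zero (α.mulVecLin.toAddMonoidHom)).2 ?_
  intro v hv
  have hv' : ∀ i, ∑ k, α i k * v k = 0 := fun i => congrFun hv i
  have : hm E E' α * (Matrix.of fun i (_ : J) => v i • E') = 0 := by
    ext i j
    rw [Matrix.mul_apply]
    have : ∀ k, hm E E' α i k * (Matrix.of fun i (_ : J) => v i • E') k j = (α i k * v k) • (E * E') := by
      intro k
      simp only [hm_apply, Matrix.of_apply, add_mul, smul_mul_assoc, mul_smul_comm, h.sq']
      module
    simp only [this, ← Finset.sum_smul, hv']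
    simp
  rw [hα.mul_right_eq_zero] at this
  ext i
  have h2 := congrFun (congrFun this i) i
  simp only [Matrix.of_apply, Matrix.zero_apply, smul_eq_zero, h.ne, or_false] at h2
  exact h2

theorem anti_entry {g : A} {M : Matrix J J A} (h : sc J g * M = -(M * sc J g)) (i j : J) :
    g * M i j = -(M i j * g) := by
  have := congrFun (congrFun h i) j
  rw [sc_apply, Matrix.diagonal_mul, Matrix.neg_apply, Matrix.mul_diagonal] at this
  exact this

theorem hm_L (h : CE e E E') (α : Matrix J J ℝ) : hm E E' α ∈ Lsub (sc J '' (e '' Icc 1 5)) := by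
  refine ⟨?_, ?_⟩
  · ext i j
    rw [Matrix.star_apply, hm_apply, hm_apply, star_add, star_smul, star_smul, h.st, h.st']
    simp [add_comm]
  · rintro _ ⟨_, ⟨i, hi, rfl⟩, rfl⟩
    ext a b
    rw [sc_apply, Matrix.diagonal_mul, Matrix.neg_apply, Matrix.mul_diagonal, hm_apply, mul_add, add_mul,
      mul_smul_comm, mul_smul_comm, h.ac i hi, h.ac' i hi, smul_mul_assoc, smul_mul_assoc]
    simp only [smul_neg]; abel

theorem hm_of_L (h : CE e E E') (g : C(I, Matrix J J A))
    (hg : ∀ t, g t ∈ Lsub (sc J '' (e '' Icc 1 5))) : ∃ α : C(I, Matrix J J ℝ), ∀ t, g t = hm E E' (α t) := by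
  obtain ⟨φ, h1, h2, h3⟩ := h.span
  have hφ : Continuous φ := LinearMap.continuous_of_finiteDimensional φ
  refine ⟨⟨fun t => Matrix.of fun i j => φ (g t i j), ?_⟩, fun t => ?_⟩
  · refine continuous_matrix fun i j => ?_
    simp only [Matrix.of_apply]
    exact hφ.comp (by fun_prop)
  · ext i j
    rw [hm_apply]
    simp only [ContinuousMap.coe_mk, Matrix.of_apply]
    obtain ⟨r, s, hr⟩ := h3 (g t i j) fun n hn => anti_entry ((hg t).2 _ ⟨_, ⟨n, hn, rfl⟩, rfl⟩) i j
    have hs : g t j i = r • E' + s • E := by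
      have : star (g t) j i = g t j i := by rw [(hg t).1]
      rw [← this, Matrix.star_apply, hr, star_add, star_smul, star_smul, h.st, h.st']
      simp
    rw [hs, hr]
    simp [h1, h2]

/-- path of pencils -/
theorem Phi_path (hc : CD e ω) {h h' : C(I, A)}
    (hj : JoinedIn {k : C(I, A) | (∀ t, k t ∈ Lsub (e '' Icc 1 5) ∧ IsUnit (k t)) ∧ k 0 = e 6 ∧ k 1 = e 6} h h') :
    JoinedIn (RS (e '' Icc 1 1) K4 (psi d4 e)) (Phi d4 e h) (Phi d4 e h') := by
  obtain ⟨H, h0, h1, h2⟩ := homotopy_of_joinedIn hj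
  refine joinedIn_of_homotopy ⟨fun w => ∑ i ∈ Finset.range 6, d4.c i w.2 • e i + d4.s w.2 • H (w.1, d4.p w.2),
    by fun_prop⟩ ?_ ?_ ?_
  · intro x; simp [Phi_apply, h0]
  · intro x; simp [Phi_apply, h1]
  · intro t
    exact PR_d4 A e ω hc (H.curry t) (h2 t).1 (h2 t).2.1 (h2 t).2.2

/-- the model -/
noncomputable def rotH (E E' : A) (j0 j1 : J) (k : ℤ) : C(I, Matrix J J A) :=
  ⟨fun t => hm E E' (embM ![j0, j1] (rotL k t)), (hm_cont E E').comp ((embM_continuous _).comp (by fun_prop))⟩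

theorem BB_rot (hc : CD e ω) (hE : CE e E E') (F : C((((I × I) × I) × I) × I, A)) (N : Set ((((I × I) × I) × I) × I))
    (hN : IsOpen N) (hKN : K4 ⊆ N) (hF : F ∈ RS (e '' Icc 1 1) N (psi d4 e)) :
    ∃ (J : Type) (_ : Fintype J) (_ : DecidableEq J) (j0 j1 : J) (k : ℤ),
      j0 ≠ j1 ∧ JoinedIn (RS (sc J '' (e '' Icc 1 1)) K4 ((sahC (sc J)).comp (psi d4 e)))
        (stabX J j0 (psi d4 e) F) (Phi d4 (fun i => sc J (e i)) (rotH E E' j0 j1 k)) := by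
  obtain ⟨J, _, _, j0, j1, h, hj, hh, h0, h1, hJ⟩ := BB_d4 A e ω hc F N hN hKN hF
  obtain ⟨α, hα⟩ := hm_of_L hE h fun t => (hh t).1
  have hαu : ∀ t, IsUnit (α t) := fun t => hm_unit' hE (by rw [← hα]; exact (hh t).2)
  have hinj : ∀ β : Matrix J J ℝ, hm E E' β = sc J (e 6) → β = 1 := by
    intro β hβ
    obtain ⟨φ, f1, f2, f3⟩ := hE.span
    rw [← hm_one hE] at hβ
    ext i j
    have := congrArg φ (congrFun (congrFun hβ i) j)
    simpa [hm_apply, f1, f2] using this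
  obtain ⟨k, hk⟩ := GLJ_loop hj α (by
    intro t
    refine ⟨hαu t, ?_⟩
    rintro (ht | ht)
    · rw [ht]; apply hinj; rw [← hα, h0]
    · have ht : t = 1 := ht
      rw [ht]; apply hinj; rw [← hα, h1])
  refine ⟨J, inferInstance, inferInstance, j0, j1, k, hj, hJ.trans ?_⟩
  have him : (fun i => sc J (e i)) '' Icc 1 5 = sc J '' (e '' Icc 1 5) := (image_image _ _ _).symm
  have him1 : (fun i => sc J (e i)) '' Icc 1 1 = sc J '' (e '' Icc 1 1) := (image_image _ _ _).symm
  have hp := Phi_path (hc.map (sc J)) (h := h) (h' := rotH E E' j0 j1 k) (by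
    obtain ⟨γ, hγ⟩ := hk
    rw [him]
    let θ : C(Matrix J J ℝ, Matrix J J A) := ⟨hm E E', hm_cont E E'⟩
    have e1 : h = θ.comp α := ContinuousMap.ext hα
    rw [e1]
    refine ⟨γ.map (ContinuousMap.continuous_postcomp θ), fun t => ⟨fun x => ⟨hm_L hE _, hm_unit hE (hγ t x).1⟩, ?_, ?_⟩⟩
    · change hm E E' (γ t 0) = _
      rw [(hγ t 0).2 (by simp), hm_one hE]
    · change hm E E' (γ t 1) = _
      rw [(hγ t 1).2 (by simp), hm_one hE])
  rw [him1] at hp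
  rw [psi_map]
  exact hp

end
end S6

set_option linter.unusedSectionVars false
set_option linter.unusedVariables false
set_option linter.deprecated false

namespace S6
open Set Topology Module Matrix
open scoped unitInterval Quaternion

/-- cube -/
abbrev Q : Type := (((I × I) × I) × I) × I
/-- two by two quaternion matrices -/
abbrev A1 : Type := Matrix (Fin 2) (Fin 2) ℍ[ℝ]
/-- two by two blocks -/
abbrev A2 : Type := Matrix (Fin 2) (Fin 2) A1

noncomputable instance : GA ℍ[ℝ] where
  star_smul r a := by ext <;> simp
  good := by
    refine ⟨{ toFun := fun a => a.re, map_add' := fun a b => by simp, map_smul' := fun r a => by simp }, fun a ha => ?_⟩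
    have : 0 < Quaternion.normSq a := lt_of_le_of_ne Quaternion.normSq_nonneg (Ne.symm (by simpa using ha))
    have h2 : (star a * a).re = Quaternion.normSq a := by
      rw [Quaternion.star_mul_self]; simp
    change 0 < (star a * a).re
    rw [h2]; exact this

/-- i -/
def qi : ℍ[ℝ] := ⟨0, 1, 0, 0⟩
/-- j -/
def qj : ℍ[ℝ] := ⟨0, 0, 1, 0⟩
/-- k -/
def qk : ℍ[ℝ] := ⟨0, 0, 0, 1⟩

@[simp] theorem qi_re : qi.re = 0 := rfl
@[simp] theorem qi_imI : qi.imI = 1 := rfl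
@[simp] theorem qi_imJ : qi.imJ = 0 := rfl
@[simp] theorem qi_imK : qi.imK = 0 := rfl
@[simp] theorem qj_re : qj.re = 0 := rfl
@[simp] theorem qj_imI : qj.imI = 0 := rfl
@[simp] theorem qj_imJ : qj.imJ = 1 := rfl
@[simp] theorem qj_imK : qj.imK = 0 := rfl
@[simp] theorem qk_re : qk.re = 0 := rfl
@[simp] theorem qk_imI : qk.imI = 0 := rfl
@[simp] theorem qk_imJ : qk.imJ = 0 := rfl
@[simp] theorem qk_imK : qk.imK = 1 := rfl

theorem qii : qi * qi = -1 := by ext <;> simp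
theorem qjj : qj * qj = -1 := by ext <;> simp
theorem qkk : qk * qk = -1 := by ext <;> simp
theorem qij : qj * qi = -(qi * qj) := by ext <;> simp
theorem qik : qk * qi = -(qi * qk) := by ext <;> simp
theorem qjk : qk * qj = -(qj * qk) := by ext <;> simp
theorem qsi : star qi = -qi := by ext <;> simp
theorem qsj : star qj = -qj := by ext <;> simp
theorem qsk : star qk = -qk := by ext <;> simp

/-- real matrix times quaternion -/
def kr (q : ℍ[ℝ]) (M : Matrix (Fin 2) (Fin 2) ℝ) : A1 := M.map fun r => r • q

theorem kr_mul (q q' : ℍ[ℝ]) (M M' : Matrix (Fin 2) (Fin 2) ℝ) : kr q M * kr q' M' = kr (q * q') (M * M') := by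
  ext1 i j
  simp [kr, Matrix.mul_apply, Fin.sum_univ_two, add_smul, smul_smul, mul_comm]

theorem kr_star (q : ℍ[ℝ]) (M : Matrix (Fin 2) (Fin 2) ℝ) : star (kr q M) = kr (star q) Mᵀ := by
  ext1 i j
  rw [Matrix.star_apply]
  simp [kr, star_smul]

theorem kr_neg (q : ℍ[ℝ]) (M : Matrix (Fin 2) (Fin 2) ℝ) : kr (-q) M = -kr q M := by
  ext1 i j; simp [kr]

theorem kr_neg' (q : ℍ[ℝ]) (M : Matrix (Fin 2) (Fin 2) ℝ) : kr q (-M) = -kr q M := by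
  ext1 i j; simp [kr]

theorem kr_one : kr 1 1 = 1 := by
  ext1 i j
  by_cases h : i = j <;> simp [kr, Matrix.one_apply, h]

section blocks
variable {R : Type} [Ring R] [StarRing R]

/-- off diagonal block -/
def offd (u : R) : Matrix (Fin 2) (Fin 2) R := !![0, -u; u, 0]
/-- grading -/
def gr (R : Type) [Ring R] : Matrix (Fin 2) (Fin 2) R := !![1, 0; 0, -1]
/-- swap -/
def sw (R : Type) [Ring R] : Matrix (Fin 2) (Fin 2) R := !![0, 1; 1, 0]

theorem offd_mul (u v : R) : offd u * offd v = -Matrix.diagonal (fun _ => u * v) := by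
  ext i j; fin_cases i <;> fin_cases j <;> simp [offd, Matrix.mul_apply, Fin.sum_univ_two]
theorem offd_star (u : R) : star (offd u) = offd (-star u) := by
  ext i j; rw [Matrix.star_apply]; fin_cases i <;> fin_cases j <;> simp [offd]
theorem offd_add (u v : R) : offd (u + v) = offd u + offd v := by
  ext i j; fin_cases i <;> fin_cases j <;> simp [offd, add_comm]
theorem gr_offd (u : R) : gr R * offd u = -(offd u * gr R) := by
  ext i j; fin_cases i <;> fin_cases j <;> simp [offd, gr, Matrix.mul_apply, Fin.sum_univ_two]
theorem sw_offd (u : R) : sw R * offd u = -(offd u * sw R) := by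
  ext i j; fin_cases i <;> fin_cases j <;> simp [offd, sw, Matrix.mul_apply, Fin.sum_univ_two]
theorem gr_sw : gr R * sw R = -(sw R * gr R) := by
  ext i j; fin_cases i <;> fin_cases j <;> simp [sw, gr, Matrix.mul_apply, Fin.sum_univ_two]
theorem gr_gr : gr R * gr R = 1 := by
  ext i j; fin_cases i <;> fin_cases j <;> simp [gr, Matrix.mul_apply, Fin.sum_univ_two]
theorem sw_sw : sw R * sw R = 1 := by
  ext i j; fin_cases i <;> fin_cases j <;> simp [sw, Matrix.mul_apply, Fin.sum_univ_two]
theorem gr_star : star (gr R) = gr R := by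
  ext i j; rw [Matrix.star_apply]; fin_cases i <;> fin_cases j <;> simp [gr]
theorem sw_star : star (sw R) = sw R := by
  ext i j; rw [Matrix.star_apply]; fin_cases i <;> fin_cases j <;> simp [sw]

theorem offd_sq {u : R} (h : u * u = -1) : offd u * offd u = 1 := by
  rw [offd_mul, h, ← Matrix.diagonal_one, Matrix.diagonal_neg]; simp
theorem offd_ac {u v : R} (h : u * v = -(v * u)) : offd u * offd v = -(offd v * offd u) := by
  rw [offd_mul, offd_mul, h, ← Matrix.diagonal_neg]
theorem offd_sa {u : R} (h : star u = -u) : star (offd u) = offd u := by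
  rw [offd_star, h, neg_neg]

theorem eq_neg_zero [Module ℝ R] {x : R} (h : x = -x) : x = 0 := by
  have h1 : x = (1 / 2 : ℝ) • (x + x) := by module
  have h2 : x + x = 0 := by nth_rewrite 1 [h]; simp
  rw [h1, h2, smul_zero]

theorem anti_shape {x : Matrix (Fin 2) (Fin 2) R} [Module ℝ R] (h1 : gr R * x = -(x * gr R)) :
    x 0 0 = 0 ∧ x 1 1 = 0 := by
  have a := congrFun (congrFun h1 0) 0
  have b := congrFun (congrFun h1 1) 1
  simp [gr, Matrix.mul_apply, Fin.sum_univ_two] at a b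
  exact ⟨eq_neg_zero a, eq_neg_zero b.symm⟩

theorem sw_shape {x : Matrix (Fin 2) (Fin 2) R} (h1 : sw R * x = -(x * sw R)) : x 0 1 = - x 1 0 := by
  have a := congrFun (congrFun h1 1) 1
  simp [sw, Matrix.mul_apply, Fin.sum_univ_two] at a
  exact a

theorem offd_anti {u v : R} (h : offd u * offd v = -(offd v * offd u)) : u * v = -(v * u) := by
  rw [offd_mul, offd_mul] at h
  have := congrFun (congrFun h 0) 0
  simpa [neg_eq_iff_eq_neg] using this

end blocks

/-- Clifford generators at the level of A1 -/
noncomputable def uu : ℕ → A1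
  | 3 => kr qi 1
  | 4 => kr qj 1
  | 5 => kr qk !![1, 0; 0, -1]
  | _ => kr qk !![0, 1; 1, 0]

/-- Clifford generators -/
noncomputable def ee : ℕ → A2
  | 1 => gr A1
  | 2 => sw A1
  | n => offd (uu n)

theorem uu_star (n : ℕ) : star (uu n) = -uu n := by
  unfold uu
  split <;> rw [kr_star] <;> simp only [qsi, qsj, qsk, kr_neg] <;> congr 2
  · simp
  · simp
  · ext i j; fin_cases i <;> fin_cases j <;> simp
  · ext i j; fin_cases i <;> fin_cases j <;> simp

theorem uu_sq (n : ℕ) : uu n * uu n = -1 := by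
  unfold uu
  split <;> rw [kr_mul] <;> simp only [qii, qjj, qkk, kr_neg, ← kr_one] <;> congr 2
  · simp
  · simp
  · ext i j; fin_cases i <;> fin_cases j <;> simp
  · ext i j; fin_cases i <;> fin_cases j <;> simp

theorem uu34 : uu 3 * uu 4 = -(uu 4 * uu 3) := by
  simp only [uu, kr_mul, qij, kr_neg, neg_neg]
theorem uu3k (M : Matrix (Fin 2) (Fin 2) ℝ) : uu 3 * kr qk M = -(kr qk M * uu 3) := by
  simp only [uu, kr_mul, qik, kr_neg, neg_neg, mul_one, one_mul]
theorem uu4k (M : Matrix (Fin 2) (Fin 2) ℝ) : uu 4 * kr qk M = -(kr qk M * uu 4) := by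
  simp only [uu, kr_mul, qjk, kr_neg, neg_neg, mul_one, one_mul]
theorem uu5k {M : Matrix (Fin 2) (Fin 2) ℝ} (h0 : M 0 0 = 0) (h1 : M 1 1 = 0) :
    uu 5 * kr qk M = -(kr qk M * uu 5) := by
  simp only [uu, kr_mul]
  rw [← kr_neg']
  congr 1
  ext i j; fin_cases i <;> fin_cases j <;> simp [Matrix.mul_apply, Fin.sum_univ_two, h0, h1]

theorem uu_ac (i j : ℕ) (hi : 3 ≤ i) (hij : i < j) (hj : j ≤ 6) : uu i * uu j = -(uu j * uu i) := by
  have : (i = 3 ∧ j = 4) ∨ (i = 3 ∧ j = 5) ∨ (i = 3 ∧ j = 6) ∨ (i = 4 ∧ j = 5) ∨ (i = 4 ∧ j = 6) ∨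
    (i = 5 ∧ j = 6) := by omega
  rcases this with ⟨rfl, rfl⟩ | ⟨rfl, rfl⟩ | ⟨rfl, rfl⟩ | ⟨rfl, rfl⟩ | ⟨rfl, rfl⟩ | ⟨rfl, rfl⟩
  · exact uu34
  · exact uu3k _
  · exact uu3k _
  · exact uu4k _
  · exact uu4k _
  · exact uu5k (by simp) (by simp)

theorem ee_ge (n : ℕ) (hn : 3 ≤ n) : ee n = offd (uu n) := by
  obtain ⟨k, rfl⟩ : ∃ k, n = k + 3 := ⟨n - 3, by omega⟩
  rfl

/-- the commuting rotation -/
noncomputable def ww : A2 := offd (kr qk !![0, 1; -1, 0])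

theorem ww_uu (n : ℕ) (hn : 3 ≤ n) : kr qk !![0, 1; -1, 0] * uu n = -(uu n * kr qk !![0, 1; -1, 0]) := by
  have h : ∀ {a b : A1}, a * b = -(b * a) → b * a = -(a * b) := fun h => by rw [h, neg_neg]
  by_cases h3 : n = 3
  · rw [h3]; exact h (uu3k _)
  by_cases h4 : n = 4
  · rw [h4]; exact h (uu4k _)
  by_cases h5 : n = 5
  · rw [h5]; exact h (uu5k (by simp) (by simp))
  have : uu n = kr qk !![0, 1; 1, 0] := by unfold uu; split <;> simp_all
  rw [this, kr_mul, kr_mul, ← kr_neg']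
  congr 1
  ext i j; fin_cases i <;> fin_cases j <;> simp

theorem ee_lt (i j : ℕ) (hi : 1 ≤ i) (hij : i < j) (hj : j ≤ 6) : ee i * ee j = -(ee j * ee i) := by
  by_cases h1 : i = 1
  · subst h1
    by_cases h2 : j = 2
    · subst h2; exact gr_sw
    · rw [ee_ge j (by omega)]; exact gr_offd _
  by_cases h2 : i = 2
  · subst h2
    rw [ee_ge j (by omega)]; exact sw_offd _
  rw [ee_ge i (by omega), ee_ge j (by omega)]
  exact offd_ac (uu_ac i j (by omega) hij hj)

theorem CD_ee : CD ee ww where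
  sa i hi := by
    by_cases h1 : i = 1
    · subst h1; exact gr_star
    by_cases h2 : i = 2
    · subst h2; exact sw_star
    have := hi.1
    rw [ee_ge i (by omega)]; exact offd_sa (uu_star i)
  sq i hi := by
    by_cases h1 : i = 1
    · subst h1; exact gr_gr
    by_cases h2 : i = 2
    · subst h2; exact sw_sw
    have := hi.1
    rw [ee_ge i (by omega)]; exact offd_sq (uu_sq i)
  ac i hi j hj hij := by
    have := hi.1; have := hi.2; have := hj.1; have := hj.2
    rcases lt_or_gt_of_ne hij with h | h
    · exact ee_lt i j (by omega) h (by omega)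
    · rw [ee_lt j i (by omega) h (by omega), neg_neg]
  u1 := by
    rw [ww, offd_star, kr_star, qsk, kr_neg, neg_neg, offd_mul, kr_mul, qkk, kr_neg, Matrix.diagonal_neg]
    have : (!![0, 1; -1, 0] : Matrix (Fin 2) (Fin 2) ℝ)ᵀ * !![0, 1; -1, 0] = 1 := by
      ext i j; fin_cases i <;> fin_cases j <;> simp [Matrix.mul_apply, Fin.sum_univ_two]
    rw [this, kr_one]; simp
  u2 := by
    rw [ww, offd_star, kr_star, qsk, kr_neg, neg_neg, offd_mul, kr_mul, qkk, kr_neg, Matrix.diagonal_neg]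
    have : (!![0, 1; -1, 0] : Matrix (Fin 2) (Fin 2) ℝ) * (!![0, 1; -1, 0])ᵀ = 1 := by
      ext i j; fin_cases i <;> fin_cases j <;> simp [Matrix.mul_apply, Fin.sum_univ_two]
    rw [this, kr_one]; simp
  ua i hi := by
    by_cases h1 : i = 1
    · subst h1; change offd _ * gr A1 = -(gr A1 * offd _); rw [gr_offd, neg_neg]
    by_cases h2 : i = 2
    · subst h2; change offd _ * sw A1 = -(sw A1 * offd _); rw [sw_offd, neg_neg]
    have := hi.1
    rw [ee_ge i (by omega)]
    exact offd_ac (ww_uu i (by omega))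

/-- matrix unit -/
noncomputable def E0 : A2 := offd (kr qk !![0, 1; 0, 0])
/-- matrix unit -/
noncomputable def E1 : A2 := offd (kr qk !![0, 0; 1, 0])

theorem kr_add (q : ℍ[ℝ]) (M N : Matrix (Fin 2) (Fin 2) ℝ) : kr q (M + N) = kr q M + kr q N := by
  ext1 i j; simp [kr, add_smul]

theorem kr_zero (q : ℍ[ℝ]) : kr q 0 = 0 := by
  ext1 i j; simp [kr]

theorem ee_off {u : A1} (h3 : uu 3 * u = -(u * uu 3)) (h4 : uu 4 * u = -(u * uu 4))
    (h5 : uu 5 * u = -(u * uu 5)) : ∀ i ∈ Icc 1 5, ee i * offd u = -(offd u * ee i) := by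
  intro i hi
  have a := hi.1; have b := hi.2
  interval_cases i
  · exact gr_offd _
  · exact sw_offd _
  · exact offd_ac h3
  · exact offd_ac h4
  · exact offd_ac h5

theorem q_anti {q : ℍ[ℝ]} (h1 : qi * q = -(q * qi)) (h2 : qj * q = -(q * qj)) : q = q.imK • qk := by
  have a1 := congrArg (fun q : ℍ[ℝ] => q.re) h1
  have a2 := congrArg (fun q : ℍ[ℝ] => q.imI) h1
  have a4 := congrArg (fun q : ℍ[ℝ] => q.re) h2
  simp at a1 a2 a4
  ext <;> simp <;> linarith

theorem CE_ee : CE ee E0 E1 where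
  st := by
    rw [E0, E1, offd_star, kr_star, qsk, kr_neg, neg_neg]
    congr 2
    ext i j; fin_cases i <;> fin_cases j <;> simp
  st' := by
    rw [E0, E1, offd_star, kr_star, qsk, kr_neg, neg_neg]
    congr 2
    ext i j; fin_cases i <;> fin_cases j <;> simp
  sq := by
    have : (!![0, 1; 0, 0] : Matrix (Fin 2) (Fin 2) ℝ) * !![0, 1; 0, 0] = 0 := by
      ext i j; fin_cases i <;> fin_cases j <;> simp
    rw [E0, offd_mul, kr_mul, this, kr_zero]; simp
  sq' := by
    have : (!![0, 0; 1, 0] : Matrix (Fin 2) (Fin 2) ℝ) * !![0, 0; 1, 0] = 0 := by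
      ext i j; fin_cases i <;> fin_cases j <;> simp
    rw [E1, offd_mul, kr_mul, this, kr_zero]; simp
  sum := by
    rw [E0, E1, offd_mul, offd_mul, kr_mul, kr_mul, ← neg_add, Matrix.diagonal_add, ← kr_add, qkk, kr_neg,
      Matrix.diagonal_neg]
    have : (!![0, 1; 0, 0] : Matrix (Fin 2) (Fin 2) ℝ) * !![0, 0; 1, 0] + !![0, 0; 1, 0] * !![0, 1; 0, 0] = 1 := by
      ext i j; fin_cases i <;> fin_cases j <;> simp
    rw [this, kr_one]; simp
  e6 := by
    rw [E0, E1, ← offd_add, ← kr_add, ee_ge 6 (by norm_num)]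
    change offd (kr qk !![0, 1; 1, 0]) = _
    congr 2
    ext i j; fin_cases i <;> fin_cases j <;> simp
  ac := ee_off (uu3k _) (uu4k _) (uu5k (by simp) (by simp))
  ac' := ee_off (uu3k _) (uu4k _) (uu5k (by simp) (by simp))
  span := by
    refine ⟨⟨⟨fun x => (x 1 0 0 1).imK, fun a b => by simp⟩, fun r a => by simp⟩, ?_, ?_, ?_⟩
    · change (E0 1 0 0 1).imK = 1
      simp [E0, offd, kr]
    · change (E1 1 0 0 1).imK = 0
      simp [E1, offd, kr]
    · intro x hx
      obtain ⟨h00, h11⟩ := anti_shape (hx 1 (by simp))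
      have h01 := sw_shape (hx 2 (by simp))
      set u := x 1 0 with hu
      have hxu : x = offd u := by
        ext1 i j; fin_cases i <;> fin_cases j <;> simp [offd, h00, h11, h01, hu]
      rw [hxu] at hx
      have h3 : uu 3 * u = -(u * uu 3) := offd_anti (hx 3 (by simp))
      have h4 : uu 4 * u = -(u * uu 4) := offd_anti (hx 4 (by simp))
      have h5 : uu 5 * u = -(u * uu 5) := offd_anti (hx 5 (by simp))
      have e3 : uu 3 = Matrix.diagonal (fun _ => qi) := by
        ext1 i j; by_cases h : i = j <;> simp [uu, kr, h]
      have e4 : uu 4 = Matrix.diagonal (fun _ => qj) := by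
        ext1 i j; by_cases h : i = j <;> simp [uu, kr, h]
      rw [e3] at h3
      rw [e4] at h4
      have hq : ∀ a b, u a b = (u a b).imK • qk := fun a b => q_anti
        (by have := congrFun (congrFun h3 a) b
            rwa [Matrix.diagonal_mul, Matrix.neg_apply, Matrix.mul_diagonal] at this)
        (by have := congrFun (congrFun h4 a) b
            rwa [Matrix.diagonal_mul, Matrix.neg_apply, Matrix.mul_diagonal] at this)
      have z0 : (u 0 0).imK = 0 := by
        have := congrArg (fun q : ℍ[ℝ] => q.re) (congrFun (congrFun h5 0) 0)
        simp [uu, kr, Matrix.mul_apply, Fin.sum_univ_two] at this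
        linarith
      have z1 : (u 1 1).imK = 0 := by
        have := congrArg (fun q : ℍ[ℝ] => q.re) (congrFun (congrFun h5 1) 1)
        simp [uu, kr, Matrix.mul_apply, Fin.sum_univ_two] at this
        linarith
      have hkr : u = kr qk !![0, (u 0 1).imK; (u 1 0).imK, 0] := by
        ext1 a b
        rw [hq a b]
        fin_cases a <;> fin_cases b <;> simp [kr, z0, z1]
      refine ⟨(u 0 1).imK, (u 1 0).imK, ?_⟩
      conv_lhs => rw [hxu, hkr]
      generalize (u 0 1).imK = r
      generalize (u 1 0).imK = t
      ext1 i j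
      fin_cases i <;> fin_cases j <;> ext1 a b <;> fin_cases a <;> fin_cases b <;> simp [E0, E1, offd, kr]

end S6

set_option linter.unusedSectionVars false
set_option linter.unusedVariables false
set_option linter.deprecated false

namespace S6
open Set Topology Module Matrix
open scoped unitInterval Quaternion

section
variable {R : Type} [Ring R] [Algebra ℝ R] [StarRing R] [TopologicalSpace R] [GA R]
variable {X : Type} [TopologicalSpace X] [CompactSpace X] [T2Space X]
variable {J : Type} [Fintype J] [DecidableEq J]

/-- lower right corner -/
def p11 (M : Matrix J J (Matrix (Fin 2) (Fin 2) R)) : Matrix J J R := M.map fun x => x 1 1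

theorem p11_mul {M N : Matrix J J (Matrix (Fin 2) (Fin 2) R)} (h : ∀ i j, M i j 1 0 = 0) :
    p11 (M * N) = p11 M * p11 N := by
  ext i j
  simp only [p11, Matrix.map_apply, Matrix.mul_apply]
  rw [Matrix.sum_apply]
  refine Finset.sum_congr rfl fun k _ => ?_
  rw [Matrix.mul_apply, Fin.sum_univ_two, h, zero_mul, zero_add]

theorem p11_one : p11 (1 : Matrix J J (Matrix (Fin 2) (Fin 2) R)) = 1 := by
  ext i j
  rcases eq_or_ne i j with rfl | h
  · simp only [p11, Matrix.map_apply, Matrix.one_apply_eq]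
  · simp only [p11, Matrix.map_apply, Matrix.one_apply_ne h, Matrix.zero_apply]

theorem p11_cont : Continuous (p11 : Matrix J J (Matrix (Fin 2) (Fin 2) R) → Matrix J J R) := by
  refine continuous_matrix fun i j => ?_
  simp only [p11, Matrix.map_apply]
  fun_prop

theorem comm_shape {M : Matrix J J (Matrix (Fin 2) (Fin 2) R)} (h : sc J (gr R) * M = M * sc J (gr R)) (i j : J) :
    M i j 1 0 = 0 := by
  have h1 := congrFun (congrFun (congrFun (congrFun h i) j) 1) 0
  rw [sc_apply, Matrix.diagonal_mul, Matrix.mul_diagonal] at h1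
  simp [gr, Matrix.mul_apply, Fin.sum_univ_two] at h1
  exact eq_neg_zero h1.symm

theorem p11_unit {M : Matrix J J (Matrix (Fin 2) (Fin 2) R)} (h : sc J (gr R) * M = M * sc J (gr R))
    (hM : IsUnit M) : IsUnit (p11 M) := by
  obtain ⟨u, rfl⟩ := hM
  have hu : (↑u : Matrix J J (Matrix (Fin 2) (Fin 2) R)) * (↑u⁻¹ : Matrix J J (Matrix (Fin 2) (Fin 2) R)) = 1 := u.mul_inv
  have hu' : (↑u⁻¹ : Matrix J J (Matrix (Fin 2) (Fin 2) R)) * (↑u : Matrix J J (Matrix (Fin 2) (Fin 2) R)) = 1 := u.inv_mul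
  have h2 : sc J (gr R) * (↑u⁻¹ : Matrix J J (Matrix (Fin 2) (Fin 2) R)) = (↑u⁻¹ : Matrix J J (Matrix (Fin 2) (Fin 2) R)) * sc J (gr R) := by
    have : Commute (sc J (gr R)) (u : Matrix J J (Matrix (Fin 2) (Fin 2) R)) := h
    exact this.units_inv_right
  refine ⟨⟨p11 (↑u : Matrix J J (Matrix (Fin 2) (Fin 2) R)), p11 (↑u⁻¹ : Matrix J J (Matrix (Fin 2) (Fin 2) R)), ?_, ?_⟩, rfl⟩
  · rw [← p11_mul (comm_shape h), hu, p11_one]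
  · rw [← p11_mul (comm_shape h2), hu', p11_one]

/-- graded to ungraded -/
noncomputable def Xi (J : Type) [Fintype J] [DecidableEq J] (ψ : C(X, Matrix (Fin 2) (Fin 2) R)) :
    C(X × Matrix J J (Matrix (Fin 2) (Fin 2) R), Matrix J J R) :=
  ⟨fun w => p11 (w.2 * sahC (sc J) (ψ w.1)), p11_cont.comp (by fun_prop)⟩

theorem Xi_apply (ψ : C(X, Matrix (Fin 2) (Fin 2) R)) (x : X) (M : Matrix J J (Matrix (Fin 2) (Fin 2) R)) :
    Xi J ψ (x, M) = p11 (M * sc J (ψ x)) := rfl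

theorem Xi_path {ψ : C(X, Matrix (Fin 2) (Fin 2) R)} (hψ : ∀ x, ψ x * ψ x = 1)
    (ha : ∀ x, gr R * ψ x = -(ψ x * gr R)) {K : Set X} {f g : C(X, Matrix J J (Matrix (Fin 2) (Fin 2) R))}
    (h : JoinedIn (RS {sc J (gr R)} K ((sahC (sc J)).comp ψ)) f g) :
    JoinedIn (RU K) ((Xi J ψ).comp ((ContinuousMap.id X).prodMk f)) ((Xi J ψ).comp ((ContinuousMap.id X).prodMk g)) := by
  refine joinedIn_fib (Xi J ψ) h fun k hk x => ?_
  have h1 := hk x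
  have h2 : sc J (ψ x) * sc J (ψ x) = 1 := by rw [← map_mul, hψ, map_one]
  have h3 : sc J (gr R) * sc J (ψ x) = -(sc J (ψ x) * sc J (gr R)) := by
    rw [← map_mul, ha, map_neg, map_mul]
  have h4 : sc J (gr R) * k x = -(k x * sc J (gr R)) := h1.1.2 _ rfl
  change IsUnit (p11 (k x * sc J (ψ x))) ∧ (x ∈ K → p11 (k x * sc J (ψ x)) = 1)
  refine ⟨p11_unit ?_ (h1.2.1.mul ⟨⟨_, _, h2, h2⟩, rfl⟩), fun hx => ?_⟩
  · rw [← mul_assoc, h4, neg_mul, mul_assoc, h3, mul_neg, neg_neg, mul_assoc]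
  · rw [h1.2.2 hx]
    change p11 (sc J (ψ x) * sc J (ψ x)) = 1
    rw [h2, p11_one]

/-- twisted element -/
def dF (D : R) (ψ : Matrix (Fin 2) (Fin 2) R) : Matrix (Fin 2) (Fin 2) R :=
  !![1, 0; 0, D] * ψ * !![1, 0; 0, star D]

theorem dF_11 (D : R) {ψ : Matrix (Fin 2) (Fin 2) R} (hψ : ψ * ψ = 1) (ha : gr R * ψ = -(ψ * gr R)) :
    (dF D ψ * ψ) 1 1 = D := by
  obtain ⟨h0, h1⟩ := anti_shape ha
  have h2 := congrFun (congrFun hψ 1) 1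
  rw [Matrix.mul_apply, Fin.sum_univ_two, h1, zero_mul, add_zero, Matrix.one_apply_eq] at h2
  have h3 : dF D ψ 1 0 = D * ψ 1 0 := by
    rw [dF, Matrix.mul_apply, Fin.sum_univ_two, Matrix.mul_apply, Fin.sum_univ_two, Matrix.mul_apply, Fin.sum_univ_two]
    simp only [Matrix.of_apply, Matrix.cons_val_zero, Matrix.cons_val_one, zero_mul, zero_add, mul_one, mul_zero, add_zero]
  rw [Matrix.mul_apply, Fin.sum_univ_two, h1, mul_zero, add_zero, h3, mul_assoc, h2, mul_one]

theorem dF_one (ψ : Matrix (Fin 2) (Fin 2) R) : dF 1 ψ = ψ := by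
  have : (!![1, 0; 0, 1] : Matrix (Fin 2) (Fin 2) R) = 1 := by
    ext i j; fin_cases i <;> fin_cases j <;> simp
  rw [dF, star_one, this, one_mul, mul_one]

theorem gr_dg (D : R) : gr R * !![1, 0; 0, D] = !![1, 0; 0, D] * gr R := by
  ext i j; fin_cases i <;> fin_cases j <;> simp [gr, Matrix.mul_apply, Fin.sum_univ_two]

theorem dg_star (D : R) : star (!![1, 0; 0, D] : Matrix (Fin 2) (Fin 2) R) = !![1, 0; 0, star D] := by
  ext i j; rw [Matrix.star_apply]; fin_cases i <;> fin_cases j <;> simp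

theorem dg_mul (D D' : R) : (!![1, 0; 0, D] : Matrix (Fin 2) (Fin 2) R) * !![1, 0; 0, D'] = !![1, 0; 0, D * D'] := by
  ext i j; fin_cases i <;> fin_cases j <;> simp [Matrix.mul_apply, Fin.sum_univ_two]

theorem dg_one : (!![1, 0; 0, 1] : Matrix (Fin 2) (Fin 2) R) = 1 := by
  ext i j; fin_cases i <;> fin_cases j <;> simp

theorem dg_unit {D : R} (hD : IsUnit D) : IsUnit (!![1, 0; 0, D] : Matrix (Fin 2) (Fin 2) R) := by
  obtain ⟨u, rfl⟩ := hD
  exact ⟨⟨_, !![1, 0; 0, (↑u⁻¹ : R)], by rw [dg_mul]; simp [dg_one], by rw [dg_mul]; simp [dg_one]⟩, rfl⟩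

theorem dF_L (D : R) {ψ : Matrix (Fin 2) (Fin 2) R} (hs : star ψ = ψ) (ha : gr R * ψ = -(ψ * gr R)) :
    dF D ψ ∈ Lsub {gr R} := by
  constructor
  · rw [dF, star_mul, star_mul, hs, dg_star, dg_star, star_star, mul_assoc]
  · rintro g rfl
    rw [dF, ← mul_assoc, ← mul_assoc, gr_dg, mul_assoc _ _ ψ, ha, mul_assoc (_ * ψ), ← gr_dg]
    simp only [mul_neg, neg_mul, mul_assoc]

theorem dF_unit {D : R} {ψ : Matrix (Fin 2) (Fin 2) R} (hD : IsUnit D) (hψ : ψ * ψ = 1) : IsUnit (dF D ψ) :=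
  ((dg_unit hD).mul ⟨⟨_, _, hψ, hψ⟩, rfl⟩).mul (dg_unit hD.star)

/-- twisted map -/
noncomputable def dFC (D : C(X, R)) (ψ : C(X, Matrix (Fin 2) (Fin 2) R)) : C(X, Matrix (Fin 2) (Fin 2) R) :=
  ⟨fun x => dF (D x) (ψ x), by
    unfold dF
    refine Continuous.mul (Continuous.mul (continuous_matrix fun i j => ?_) (by fun_prop)) (continuous_matrix fun i j => ?_)
    · fin_cases i <;> fin_cases j <;> simp <;> fun_prop
    · fin_cases i <;> fin_cases j <;> simp <;> fun_prop⟩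

theorem dFC_RS {D : C(X, R)} (hD : ∀ x, IsUnit (D x)) {N : Set X} (hN : ∀ x ∈ N, D x = 1)
    {ψ : C(X, Matrix (Fin 2) (Fin 2) R)} (hψ : ∀ x, ψ x * ψ x = 1) (hs : ∀ x, star (ψ x) = ψ x)
    (ha : ∀ x, gr R * ψ x = -(ψ x * gr R)) : dFC D ψ ∈ RS {gr R} N ψ := by
  intro x
  refine ⟨dF_L _ (hs x) (ha x), dF_unit (hD x) (hψ x), fun hx => ?_⟩
  change dF _ _ = _
  rw [hN x hx, dF_one]

theorem Xi_stab {D : C(X, R)} {ψ : C(X, Matrix (Fin 2) (Fin 2) R)} (hψ : ∀ x, ψ x * ψ x = 1)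
    (ha : ∀ x, gr R * ψ x = -(ψ x * gr R)) (j0 : J) (x : X) :
    Xi J ψ (x, stabX J j0 ψ (dFC D ψ) x) = Matrix.diagonal (fun j => if j = j0 then D x else 1) := by
  rw [Xi_apply, stabX_apply, sc_apply, Matrix.diagonal_mul_diagonal]
  ext1 i j
  simp only [p11, Matrix.map_apply, Matrix.diagonal_apply]
  by_cases hij : i = j
  · simp only [hij, if_true]
    by_cases hj : j = j0
    · simp only [hj, if_true]
      exact dF_11 _ (hψ x) (ha x)
    · simp only [hj, if_false, hψ]
      simp
  · simp [hij]

theorem Xi_rot (d : Dat X) {e : ℕ → Matrix (Fin 2) (Fin 2) R} {E E' : Matrix (Fin 2) (Fin 2) R} (hE : CE e E E')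
    (hψ : ∀ x, psi d e x * psi d e x = 1) {j0 j1 : J} (hj : j0 ≠ j1) (k : ℤ) (x : X) :
    Xi J (psi d e) (x, Phi d (fun i => sc J (e i)) (rotH E E' j0 j1 k) x) =
      embM ![j0, j1] (Xi (Fin 2) (psi d e) (x, Phi d (fun i => sc (Fin 2) (e i)) (rotH E E' 0 1 k) x)) := by
  have hι : Function.Injective ![j0, j1] := by
    intro a b; fin_cases a <;> fin_cases b <;> simp [hj, hj.symm]
  have hι2 : Function.Injective (![0, 1] : Fin 2 → Fin 2) := by
    intro a b; fin_cases a <;> fin_cases b <;> simp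
  have h2 : ∀ a : Fin 2, (![0, 1] : Fin 2 → Fin 2) a = a := by intro a; fin_cases a <;> rfl
  have key : ∀ (L : Type) [Fintype L] [DecidableEq L] (h : C(I, Matrix L L (Matrix (Fin 2) (Fin 2) R))) (a b : L),
      Xi L (psi d e) (x, Phi d (fun i => sc L (e i)) h x) a b =
      ((∑ i ∈ Finset.range 6, d.c i x • (if a = b then e i else 0) + d.s x • h (d.p x) a b) * psi d e x) 1 1 := by
    intro L _ _ h a b
    rw [Xi_apply, sc_apply]
    simp only [p11, Matrix.map_apply]
    rw [Matrix.mul_diagonal, Phi_apply]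
    simp only [Matrix.add_apply, Matrix.smul_apply, Matrix.sum_apply, sc_apply, Matrix.diagonal_apply]
  rw [← embM_sub hι (g := Xi J (psi d e) (x, Phi d (fun i => sc J (e i)) (rotH E E' j0 j1 k) x))]
  · congr 1
    ext1 a b
    rw [Matrix.submatrix_apply, key, key]
    have : rotH E E' j0 j1 k (d.p x) (![j0, j1] a) (![j0, j1] b) = rotH E E' (0 : Fin 2) 1 k (d.p x) a b := by
      change hm _ _ _ _ _ = hm _ _ _ _ _
      rw [hm_apply, hm_apply, embM_apply hι, embM_apply hι]
      have e1 := embM_apply hι2 (rotL k (d.p x)) a b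
      have e2 := embM_apply hι2 (rotL k (d.p x)) b a
      rw [h2, h2] at e1 e2
      rw [e1, e2]
    rw [this]
    simp only [hι.eq_iff]
  · intro i j hij
    have hne : (∀ a, i ≠ ![j0, j1] a) ∨ (∀ a, j ≠ ![j0, j1] a) := by
      refine hij.imp (fun h a ha => h ⟨a, ha.symm⟩) (fun h a ha => h ⟨a, ha.symm⟩)
    rw [key]
    have : rotH E E' j0 j1 k (d.p x) i j = if i = j then e 6 else 0 := by
      change hm _ _ _ _ _ = _
      rw [hm_apply, embM_apply_ne _ _ _ hne, embM_apply_ne _ _ _ hne.symm, hE.e6]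
      by_cases hij' : i = j
      · subst hij'
        simp only [Matrix.one_apply_eq, one_smul, if_true]
      · simp [hij', Ne.symm hij']
    rw [this]
    by_cases hij' : i = j
    · subst hij'
      simp only [if_true]
      have h3 : ∑ i ∈ Finset.range 6, d.c i x • e i + d.s x • e 6 = psi d e x := rfl
      rw [h3, hψ, Matrix.one_apply_eq, Matrix.one_apply_eq]
    · simp [hij']

theorem cmp_embM {A : Type} [Ring A] [Algebra ℝ A] [StarRing A] [TopologicalSpace A] [GA A]
    {m n l : Type} [Fintype m] [DecidableEq m] [Fintype n] [DecidableEq n] [Fintype l] [DecidableEq l]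
    {ι : m → n} (hι : Function.Injective ι) (M : Matrix m m (Matrix l l A)) :
    cmp n l (embM ι M) = embM (Prod.map ι id) (cmp m l M) := by
  have hι' : Function.Injective (Prod.map ι (id : l → l)) := hι.prodMap Function.injective_id
  rw [← embM_sub hι' (g := cmp n l (embM ι M))]
  · congr 1
    ext1 ⟨a, b⟩ ⟨a', b'⟩
    change cmp n l (embM ι M) (ι a, b) (ι a', b') = _
    rw [cmp_apply, cmp_apply]
    simp only
    rw [embM_apply hι]
  · rintro ⟨i, b⟩ ⟨j, b'⟩ hij
    rw [cmp_apply]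
    simp only
    rw [embM_apply_ne]
    · rw [Matrix.one_apply, Matrix.one_apply]
      by_cases h : i = j <;> by_cases h' : b = b'
      · subst h; subst h'; simp only [if_true, Matrix.one_apply_eq]
      · simp [h, h']
      · simp [h, h']
      · simp [h, h']
    · refine hij.imp (fun h a ha => h ⟨(a, b), ?_⟩) (fun h a ha => h ⟨(a, b'), ?_⟩)
      · simp [ha]
      · simp [ha]

theorem cmp_Xi_rot {A : Type} [Ring A] [Algebra ℝ A] [StarRing A] [TopologicalSpace A] [GA A]
    (d : Dat X) {e : ℕ → Matrix (Fin 2) (Fin 2) (Matrix (Fin 2) (Fin 2) A)}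
    {E E' : Matrix (Fin 2) (Fin 2) (Matrix (Fin 2) (Fin 2) A)} (hE : CE e E E')
    (hψ : ∀ x, psi d e x * psi d e x = 1) {j0 j1 : J} (hj : j0 ≠ j1) (k : ℤ) :
    (sahC (cmp J (Fin 2))).comp ((Xi J (psi d e)).comp ((ContinuousMap.id X).prodMk
      (Phi d (fun i => sc J (e i)) (rotH E E' j0 j1 k)))) =
    (ContinuousMap.mk (embM (Prod.map ![j0, j1] id)) (embM_continuous _)).comp
      ((sahC (cmp (Fin 2) (Fin 2))).comp ((Xi (Fin 2) (psi d e)).comp ((ContinuousMap.id X).prodMk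
      (Phi d (fun i => sc (Fin 2) (e i)) (rotH E E' 0 1 k))))) := by
  ext1 x
  have hι : Function.Injective ![j0, j1] := by
    intro a b; fin_cases a <;> fin_cases b <;> simp [hj, hj.symm]
  exact (congrArg (cmp J (Fin 2)) (Xi_rot d hE hψ hj k x)).trans (cmp_embM hι _)

theorem cmp_RU {A : Type} [Ring A] [Algebra ℝ A] [StarRing A] [TopologicalSpace A] [GA A] {K : Set X}
    {f g : C(X, Matrix J J (Matrix (Fin 2) (Fin 2) A))} (h : JoinedIn (RU K) f g) :
    JoinedIn (RU K) ((sahC (cmp J (Fin 2))).comp f) ((sahC (cmp J (Fin 2))).comp g) :=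
  RU_comp (sahC (cmp J (Fin 2))) (by rw [sahC_apply]; exact map_one (cmp J (Fin 2)))
    (fun a ha => by rw [sahC_apply]; exact ha.map (cmp J (Fin 2))) h

end

/-- single diagonal entry -/
noncomputable def dgC {X n : Type} [TopologicalSpace X] [Fintype n] [DecidableEq n] (i0 : n) (f : C(X, ℍ[ℝ])) :
    C(X, Matrix n n ℍ[ℝ]) :=
  ⟨fun x => Matrix.diagonal (fun i => if i = i0 then f x else 1), by
    refine Continuous.matrix_diagonal (continuous_pi fun j => ?_)
    by_cases h : j = i0
    · simp only [h, if_true]; fun_prop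
    · simp only [h, if_false]; fun_prop⟩

/-- the universal model -/
noncomputable def G2 (k : ℤ) : C(Q, Matrix (Fin 2 × Fin 2) (Fin 2 × Fin 2) ℍ[ℝ]) :=
  (sahC (cmp (Fin 2) (Fin 2))).comp ((Xi (Fin 2) (psi d4 ee)).comp ((ContinuousMap.id Q).prodMk
    (Phi d4 (fun i => sc (Fin 2) (ee i)) (rotH E0 E1 0 1 k))))

/-- embedding as continuous map -/
noncomputable def embC {m n R : Type} [Fintype m] [DecidableEq m] [Fintype n] [DecidableEq n] [Ring R]
    [TopologicalSpace R] [IsTopologicalRing R] (ι : m → n) : C(Matrix m m R, Matrix n n R) :=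
  ⟨embM ι, embM_continuous ι⟩

theorem ee_psi (x : Q) : psi d4 ee x * psi d4 ee x = 1 ∧ star (psi d4 ee x) = psi d4 ee x ∧
    gr A1 * psi d4 ee x = -(psi d4 ee x * gr A1) := by
  have h := DW_d4 A2 ee ww CD_ee x
  exact ⟨h.1, h.2.1.1, h.2.1.2 _ ⟨1, by simp, rfl⟩⟩

theorem main_stable (f : C(Q, ℍ[ℝ])) (hf : ∀ x, IsUnit (f x)) (N : Set Q) (hN : IsOpen N) (hKN : K4 ⊆ N)
    (hfN : ∀ x ∈ N, f x = 1) : ∃ (J : Type) (_ : Fintype J) (_ : DecidableEq J) (j0 j1 : J) (k : ℤ),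
      j0 ≠ j1 ∧ JoinedIn (RU K4) (dgC (j0, (0 : Fin 2)) f) ((embC (Prod.map ![j0, j1] id)).comp (G2 k)) := by
  have hI : Icc 1 1 = ({1} : Set ℕ) := Icc_self 1
  let D : C(Q, A1) := ⟨fun x => Matrix.diagonal ![f x, 1], by
    refine Continuous.matrix_diagonal (continuous_pi fun j => ?_)
    fin_cases j <;> simp <;> fun_prop⟩
  have hDu : ∀ x, IsUnit (D x) := fun x => isUnit_diagonal fun j => by
    fin_cases j
    · exact hf x
    · exact isUnit_one
  have hDN : ∀ x ∈ N, D x = 1 := fun x hx => by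
    ext1 i j
    change Matrix.diagonal ![f x, 1] i j = _
    rw [hfN x hx]
    fin_cases i <;> fin_cases j <;> simp
  have hF := dFC_RS hDu hDN (fun x => (ee_psi x).1) (fun x => (ee_psi x).2.1) (fun x => (ee_psi x).2.2)
  have him : ee '' Icc 1 1 = {gr A1} := by rw [hI, image_singleton]; rfl
  obtain ⟨J, _, _, j0, j1, k, hj, hJ⟩ := BB_rot CD_ee CE_ee (dFC D (psi d4 ee)) N hN hKN (by rw [him]; exact hF)
  refine ⟨J, inferInstance, inferInstance, j0, j1, k, hj, ?_⟩
  rw [him, image_singleton] at hJ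
  have h1 := cmp_RU (Xi_path (fun x => (ee_psi x).1) (fun x => (ee_psi x).2.2) hJ)
  rw [cmp_Xi_rot d4 CE_ee (fun x => (ee_psi x).1) hj] at h1
  convert h1 using 1
  · ext1 x
    change _ = cmp J (Fin 2) (Xi J (psi d4 ee) (x, stabX J j0 (psi d4 ee) (dFC D (psi d4 ee)) x))
    rw [Xi_stab (fun x => (ee_psi x).1) (fun x => (ee_psi x).2.2)]
    have : (fun j => if j = j0 then D x else 1) = fun j => Matrix.diagonal (fun a : Fin 2 =>
        if (j, a) = (j0, 0) then f x else 1) := by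
      funext j
      change (if j = j0 then Matrix.diagonal ![f x, 1] else 1) = _
      by_cases hj : j = j0
      · simp only [hj, if_true]
        congr 1
        funext a; fin_cases a <;> simp
      · simp [hj]
    rw [this, cmp_diag]
    rfl
  · unfold embC G2; rfl

end S6

set_option linter.unusedSectionVars false
set_option linter.unusedVariables false
set_option linter.deprecated false

namespace S6
open Set Topology Module Matrix
open scoped unitInterval Quaternion

/-- fractional part reparametrization -/
noncomputable def fr (k : ℤ) (t : I) : I := ⟨Int.fract ((k : ℝ) * t), Int.fract_nonneg _, (Int.fract_lt_one _).le⟩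

/-- reparametrization of the innermost coordinate -/
noncomputable def frQ (k : ℤ) (q : Q) : Q := ((((fr k q.1.1.1.1, q.1.1.1.2), q.1.1.2), q.1.2), q.2)

theorem fr_mem {k : ℤ} {t : I} (h : t ∈ ({0, 1} : Set I)) : fr k t ∈ ({0, 1} : Set I) := by
  left
  rcases h with rfl | h
  · apply Subtype.ext; simp [fr]
  · rw [mem_singleton_iff.1 h]; apply Subtype.ext; simp [fr]

theorem frQ_K4 {k : ℤ} {q : Q} (h : q ∈ K4) : frQ k q ∈ K4 := by
  rcases h with (((h | h) | h) | h) | h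
  · exact Or.inl (Or.inl (Or.inl (Or.inl (fr_mem h))))
  · exact Or.inl (Or.inl (Or.inl (Or.inr h)))
  · exact Or.inl (Or.inl (Or.inr h))
  · exact Or.inl (Or.inr h)
  · exact Or.inr h

theorem frQ_cont {T Y : Type} [TopologicalSpace T] [TopologicalSpace Y] (k : ℤ) (F : C(T × Q, Y)) (y0 : Y)
    (h : ∀ t, ∀ q ∈ K4, F (t, q) = y0) : Continuous fun w : T × Q => F (w.1, frQ k w.2) := by
  have h1 := ContinuousOn.comp_fract (β := T × Q) (α := ℝ) (γ := Y) (s := fun w => (k : ℝ) * w.2.1.1.1.1)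
    (f := fun w a => F (w.1, ((((projIcc 0 1 zero_le_one a, w.2.1.1.1.2), w.2.1.1.2), w.2.1.2), w.2.2)))
    (Continuous.continuousOn (F.continuous.comp (by
      have := continuous_projIcc (a := (0 : ℝ)) (b := 1) (h := zero_le_one)
      fun_prop))) (by fun_prop) (by
      intro w
      rw [h, h]
      · refine Or.inl (Or.inl (Or.inl (Or.inl ?_))); right; simp
      · refine Or.inl (Or.inl (Or.inl (Or.inl ?_))); left; simp)
  refine h1.congr fun w => ?_
  congr 1
  simp only [frQ, fr]
  rw [projIcc_of_mem _ ⟨Int.fract_nonneg _, (Int.fract_lt_one _).le⟩]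

theorem rotL_fr (k : ℤ) (t : I) : rotL k t = rotL 1 (fr k t) := by
  change rotM _ = rotM _
  congr 1
  rw [Complex.exp_eq_exp_iff_exists_int]
  refine ⟨⌊(k : ℝ) * t⌋, ?_⟩
  have : (k : ℝ) * t = ⌊(k : ℝ) * t⌋ + Int.fract ((k : ℝ) * t) := (Int.floor_add_fract _).symm
  have h2 : ang k t = ((2 * Real.pi * (⌊(k : ℝ) * t⌋ + Int.fract ((k : ℝ) * t)) : ℝ) : ℂ) * Complex.I := by
    rw [← this]; unfold ang; congr 2; ring
  rw [h2]
  unfold ang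
  simp only [fr]
  push_cast
  ring

section
variable {A : Type} [Ring A] [Algebra ℝ A] [StarRing A] [TopologicalSpace A] [GA A]

theorem d4_c (i : ℕ) (k : ℤ) (q : Q) : d4.c i (frQ k q) = d4.c i q := rfl
theorem d4_s (k : ℤ) (q : Q) : d4.s (frQ k q) = d4.s q := rfl
theorem d4_p (k : ℤ) (q : Q) : d4.p (frQ k q) = fr k (d4.p q) := rfl

theorem Phi_fr (e : ℕ → A) (h h' : C(I, A)) (k : ℤ) (hh : ∀ t, h t = h' (fr k t)) (q : Q) :
    Phi d4 e h q = Phi d4 e h' (frQ k q) := by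
  rw [Phi_apply, Phi_apply, d4_s, d4_p, hh]
  simp only [d4_c]

theorem psi_fr (e : ℕ → A) (k : ℤ) (q : Q) : psi d4 e q = psi d4 e (frQ k q) :=
  Phi_fr e _ _ k (fun t => rfl) q

theorem Gfr {e : ℕ → Matrix (Fin 2) (Fin 2) (Matrix (Fin 2) (Fin 2) A)}
    {E E' : Matrix (Fin 2) (Fin 2) (Matrix (Fin 2) (Fin 2) A)} (k : ℤ) (q : Q) :
    (sahC (cmp (Fin 2) (Fin 2))).comp ((Xi (Fin 2) (psi d4 e)).comp ((ContinuousMap.id Q).prodMk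
      (Phi d4 (fun i => sc (Fin 2) (e i)) (rotH E E' 0 1 k)))) q =
    (sahC (cmp (Fin 2) (Fin 2))).comp ((Xi (Fin 2) (psi d4 e)).comp ((ContinuousMap.id Q).prodMk
      (Phi d4 (fun i => sc (Fin 2) (e i)) (rotH E E' 0 1 1)))) (frQ k q) := by
  have h1 := Phi_fr (fun i => sc (Fin 2) (e i)) (rotH E E' (0 : Fin 2) 1 k) (rotH E E' 0 1 1) k
    (fun t => by change hm _ _ _ = hm _ _ _; rw [rotL_fr]) q
  have h2 : Xi (Fin 2) (psi d4 e) (q, Phi d4 (fun i => sc (Fin 2) (e i)) (rotH E E' 0 1 k) q) =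
      Xi (Fin 2) (psi d4 e) (frQ k q, Phi d4 (fun i => sc (Fin 2) (e i)) (rotH E E' 0 1 1) (frQ k q)) := by
    rw [Xi_apply, Xi_apply, h1, psi_fr e k q]
  exact congrArg (cmp (Fin 2) (Fin 2)) h2

theorem rotL_unit (k : ℤ) (t : I) : IsUnit (rotL k t) := by
  change IsUnit (rotM _)
  rw [Matrix.isUnit_iff_isUnit_det]
  simp only [rotM, Matrix.det_fin_two_of]
  have : Complex.normSq (Complex.exp (ang k t)) ≠ 0 := by simp
  rw [Complex.normSq_apply] at this
  rw [isUnit_iff_ne_zero]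
  intro h; apply this; linarith

theorem rotL_zero (k : ℤ) : rotL k 0 = 1 := by
  change rotM _ = 1
  ext i j; fin_cases i <;> fin_cases j <;> simp [rotM, ang]

theorem rotL_one (k : ℤ) : rotL k 1 = 1 := by
  change rotM _ = 1
  have : Complex.exp (ang k ((1 : I) : ℝ)) = 1 := by rw [Icc.coe_one]; exact exp_ang_int k
  rw [this]
  ext i j; fin_cases i <;> fin_cases j <;> simp [rotM]

theorem rot_RS {e : ℕ → A} {ω : A} {E E' : A} (hc : CD e ω) (hE : CE e E E') (k : ℤ) :
    Phi d4 (fun i => sc (Fin 2) (e i)) (rotH E E' 0 1 k) ∈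
      RS (sc (Fin 2) '' (e '' Icc 1 1)) K4 ((sahC (sc (Fin 2))).comp (psi d4 e)) := by
  have him : (fun i => sc (Fin 2) (e i)) '' Icc 1 5 = sc (Fin 2) '' (e '' Icc 1 5) := (image_image _ _ _).symm
  have him1 : (fun i => sc (Fin 2) (e i)) '' Icc 1 1 = sc (Fin 2) '' (e '' Icc 1 1) := (image_image _ _ _).symm
  have hι2 : Function.Injective (![0, 1] : Fin 2 → Fin 2) := by
    intro a b; fin_cases a <;> fin_cases b <;> simp
  have hp := PR_d4 _ _ _ (hc.map (sc (Fin 2))) (rotH E E' 0 1 k) (by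
    intro t
    rw [him]
    exact ⟨hm_L hE _, hm_unit hE ((embM_isUnit hι2).2 (rotL_unit k t))⟩)
    (by change hm _ _ _ = _; rw [rotL_zero, embM_one, hm_one hE])
    (by change hm _ _ _ = _; rw [rotL_one, embM_one, hm_one hE])
  rw [him1] at hp
  rw [psi_map]
  exact hp

theorem G_RU {A : Type} [Ring A] [Algebra ℝ A] [StarRing A] [TopologicalSpace A] [GA A]
    {e : ℕ → Matrix (Fin 2) (Fin 2) (Matrix (Fin 2) (Fin 2) A)} {w : Matrix (Fin 2) (Fin 2) (Matrix (Fin 2) (Fin 2) A)}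
    {E E' : Matrix (Fin 2) (Fin 2) (Matrix (Fin 2) (Fin 2) A)} (hc : CD e w) (hE : CE e E E')
    (he1 : e 1 = gr (Matrix (Fin 2) (Fin 2) A))
    (hψ : ∀ x, psi d4 e x * psi d4 e x = 1)
    (ha : ∀ x, gr (Matrix (Fin 2) (Fin 2) A) * psi d4 e x = -(psi d4 e x * gr (Matrix (Fin 2) (Fin 2) A))) (k : ℤ) :
    (sahC (cmp (Fin 2) (Fin 2))).comp ((Xi (Fin 2) (psi d4 e)).comp ((ContinuousMap.id Q).prodMk
      (Phi d4 (fun i => sc (Fin 2) (e i)) (rotH E E' 0 1 k)))) ∈ RU K4 := by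
  have h := rot_RS hc hE k
  have hI : Icc 1 1 = ({1} : Set ℕ) := Icc_self 1
  rw [hI, image_singleton, image_singleton, he1] at h
  exact (cmp_RU (Xi_path hψ ha (JoinedIn.refl h))).source_mem

end

theorem G2_fr (k : ℤ) (q : Q) : G2 k q = G2 1 (frQ k q) := Gfr k q

theorem G2_RU (k : ℤ) : G2 k ∈ RU K4 :=
  G_RU CD_ee CE_ee rfl (fun x => (ee_psi x).1) (fun x => (ee_psi x).2.2) k

end S6

set_option linter.unusedSectionVars false
set_option linter.unusedVariables false
set_option linter.deprecated false

namespace S6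
open Set Topology Module Matrix
open scoped unitInterval Quaternion

/-- a pair admitting a clamping homotopy -/
def Clamp (X : Type) [TopologicalSpace X] (K : Set X) : Prop :=
  ∃ (κ : C(I × X, X)) (N : Set X), IsOpen N ∧ K ⊆ N ∧ (∀ x, κ (0, x) = x) ∧ (∀ s, ∀ x ∈ K, κ (s, x) ∈ K) ∧
    ∀ x ∈ N, κ (1, x) ∈ K

/-- clamping on the interval -/
noncomputable def cl1 : C(I × I, I) := ⟨fun w => projIcc 0 1 zero_le_one ((1 + (w.1 : ℝ)) * w.2 - w.1 / 2),
  continuous_projIcc.comp (by fun_prop)⟩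

theorem cl1_zero (t : I) : cl1 (0, t) = t := by simp [cl1]

theorem cl1_mem (s : I) {t : I} (h : t ∈ ({0, 1} : Set I)) : cl1 (s, t) ∈ ({0, 1} : Set I) := by
  have := s.2.1
  rcases h with rfl | h
  · left
    exact projIcc_of_le_left zero_le_one (by simp; linarith)
  · right
    rw [mem_singleton_iff.1 h]
    exact projIcc_of_right_le zero_le_one (by simp; linarith)

theorem cl1_one {t : I} (h : (t : ℝ) < 1 / 4 ∨ (3 / 4 : ℝ) < t) : cl1 (1, t) ∈ ({0, 1} : Set I) := by
  rcases h with h | h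
  · left
    exact projIcc_of_le_left zero_le_one (by simp; linarith)
  · right
    exact projIcc_of_right_le zero_le_one (by simp; linarith)

theorem cl1_open : IsOpen {t : I | (t : ℝ) < 1 / 4 ∨ (3 / 4 : ℝ) < t} :=
  (isOpen_lt continuous_subtype_val continuous_const).union (isOpen_lt continuous_const continuous_subtype_val)

theorem cl1_sub {t : I} (h : t ∈ ({0, 1} : Set I)) : (t : ℝ) < 1 / 4 ∨ (3 / 4 : ℝ) < t := by
  rcases h with rfl | h
  · left; norm_num
  · right; rw [mem_singleton_iff.1 h]; norm_num

theorem clamp_I : Clamp I {0, 1} :=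
  ⟨cl1, _, cl1_open, fun t h => cl1_sub h, cl1_zero, fun s t h => cl1_mem s h, fun t h => cl1_one h⟩

theorem Clamp.up {X : Type} [TopologicalSpace X] {K : Set X} (h : Clamp X K) : Clamp (X × I) (bdy K) := by
  obtain ⟨κ, N, hN, hK, h0, h1, h2⟩ := h
  refine ⟨⟨fun w => (κ (w.1, w.2.1), cl1 (w.1, w.2.2)), by fun_prop⟩,
    {z | z.1 ∈ N} ∪ {z | (z.2 : ℝ) < 1 / 4 ∨ (3 / 4 : ℝ) < z.2}, ?_, ?_, ?_, ?_, ?_⟩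
  · exact (hN.preimage continuous_fst).union (cl1_open.preimage continuous_snd)
  · rintro z (h | h)
    · exact Or.inl (hK h)
    · exact Or.inr (cl1_sub h)
  · rintro ⟨x, t⟩
    exact Prod.ext (h0 x) (cl1_zero t)
  · rintro s z (h | h)
    · exact Or.inl (h1 s _ h)
    · exact Or.inr (cl1_mem s h)
  · rintro z (h | h)
    · exact Or.inl (h2 _ h)
    · exact Or.inr (cl1_one h)

theorem clamp_K4 : Clamp Q K4 := clamp_I.up.up.up.up

theorem cubeQ : CubeLike 5 Q := (((cubeLike_I.prod cubeLike_I).prod cubeLike_I).prod cubeLike_I).prod cubeLike_I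

theorem quat_star (a : ℍ[ℝ]) : star a * a = algebraMap ℝ ℍ[ℝ] (‖a‖ ^ 2) := by
  rw [Quaternion.star_mul_self, Quaternion.normSq_eq_norm_mul_self, sq]; rfl

section
variable {n : Type} [Fintype n] [DecidableEq n] {X : Type} [TopologicalSpace X] [CompactSpace X] [T2Space X] {K : Set X}

theorem Supp.entry {i0 : n} {M : Matrix n n ℍ[ℝ]} (hs : Supp {i0} M) :
    M = Matrix.diagonal (fun i => if i = i0 then M i0 i0 else 1) := by
  ext1 i j
  rw [Matrix.diagonal_apply]
  by_cases hi : i = i0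
  · by_cases hj : j = i0
    · simp [hi, hj]
    · rw [hs i j (Or.inr (by simpa using hj)), Matrix.one_apply]
      by_cases hij : i = j
      · exact absurd (hij.symm.trans hi) hj
      · simp [hij]
  · rw [hs i j (Or.inl (by simpa using hi)), Matrix.one_apply]
    simp [hi]

theorem Supp.of_entry (i0 : n) (a : ℍ[ℝ]) : Supp {i0} (Matrix.diagonal (fun i => if i = i0 then a else 1)) := by
  intro i j h
  rw [Matrix.diagonal_apply, Matrix.one_apply]
  by_cases hij : i = j
  · subst hij
    have : i ≠ i0 := by simpa using h
    simp [this]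
  · simp [hij]

theorem Supp.entry_unit {i0 : n} {M : Matrix n n ℍ[ℝ]} (hs : Supp {i0} M) (hM : IsUnit M) : IsUnit (M i0 i0) := by
  rw [isUnit_iff_ne_zero]
  intro h0
  have h1 : M * Matrix.diagonal (fun i => if i = i0 then (1 : ℍ[ℝ]) else 0) = 0 := by
    rw [hs.entry, h0, Matrix.diagonal_mul_diagonal]
    ext1 i j
    rw [Matrix.diagonal_apply]
    by_cases h : i = i0 <;> simp [h]
  rw [hM.mul_right_eq_zero] at h1
  have := congrFun (congrFun h1 i0) i0
  rw [Matrix.diagonal_apply] at this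
  simp at this

theorem dgC_apply (i0 : n) (f : C(X, ℍ[ℝ])) (x : X) : dgC i0 f x = Matrix.diagonal (fun i => if i = i0 then f x else 1) := rfl

theorem dgC_diag (i0 : n) (f : C(X, ℍ[ℝ])) (x : X) : dgC i0 f x i0 i0 = f x := by
  rw [dgC_apply, Matrix.diagonal_apply]; simp

theorem destab1 {k : ℕ} (hX : CubeLike k X) (hk : k + 1 < 8) (i0 : n) {f : C(X, Matrix n n ℍ[ℝ])} (hf : f ∈ RU K) :
    ∃ g : C(X, ℍ[ℝ]), JoinedIn (RU K) f (dgC i0 g) := by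
  obtain ⟨g, hg, hs⟩ := compress quat_star hX {i0} (by rw [Quaternion.finrank_eq_four]; simpa using hk) f
    fun x => (hf x).1
  refine ⟨⟨fun x => g x i0 i0, by fun_prop⟩, ?_⟩
  have : dgC i0 ⟨fun x => g x i0 i0, by fun_prop⟩ = g := by
    ext1 x
    exact (hs x).entry.symm
  rw [this]
  refine hg.mono fun h hh x => ⟨(hh x).1, fun hx => ?_⟩
  have h1 := (hf x).2 hx
  rw [(hh x).2 (by rw [h1]; exact Supp.one _), h1]

theorem RU_dg {i0 : n} {f : C(X, ℍ[ℝ])} (h : dgC i0 f ∈ RU K) : f ∈ RU K := by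
  intro x
  refine ⟨?_, fun hx => ?_⟩
  · rw [← dgC_diag i0]
    exact (Supp.of_entry i0 (f x)).entry_unit (h x).1
  · rw [← dgC_diag i0, (h x).2 hx]; simp

theorem destab2 {k : ℕ} (hX : CubeLike k X) (hk : k + 2 < 8) (i0 : n) {f g : C(X, ℍ[ℝ])}
    (h : JoinedIn (RU K) (dgC i0 f) (dgC i0 g)) : JoinedIn (RU K) f g := by
  obtain ⟨H, h0, h1, hH⟩ := homotopy_of_joinedIn h
  obtain ⟨G, hG, hs⟩ := compress quat_star (cubeLike_I.prod hX) {i0}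
    (by rw [Quaternion.finrank_eq_four]; simp; omega) H fun x => (hH x.1 x.2).1
  have hG1 := hG.target_mem
  refine joinedIn_of_homotopy ⟨fun w => G w i0 i0, by fun_prop⟩ ?_ ?_ ?_
  · intro x
    change G (0, x) i0 i0 = _
    rw [(hG1 (0, x)).2 (by rw [h0]; exact Supp.of_entry _ _), h0, dgC_diag]
  · intro x
    change G (1, x) i0 i0 = _
    rw [(hG1 (1, x)).2 (by rw [h1]; exact Supp.of_entry _ _), h1, dgC_diag]
  · intro t x
    refine ⟨(hs (t, x)).entry_unit (hG1 (t, x)).1, fun hx => ?_⟩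
    change G (t, x) i0 i0 = 1
    have h2 : H (t, x) = 1 := (hH t x).2 hx
    rw [(hG1 (t, x)).2 (by rw [h2]; exact Supp.one _), h2]; simp

end

/-- precomposition with the fractional part -/
theorem RU_fr {R : Type} [TopologicalSpace R] [Monoid R] (k : ℤ) {f g f' g' : C(Q, R)} (h : JoinedIn (RU K4) f g)
    (hf : ∀ x, f' x = f (frQ k x)) (hg : ∀ x, g' x = g (frQ k x)) : JoinedIn (RU K4) f' g' := by
  obtain ⟨H, h0, h1, hH⟩ := homotopy_of_joinedIn h
  refine joinedIn_of_homotopy ⟨fun w => H (w.1, frQ k w.2), frQ_cont k H 1 fun t q hq => (hH t q).2 hq⟩ ?_ ?_ ?_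
  · intro x; exact (h0 _).trans (hf x).symm
  · intro x; exact (h1 _).trans (hg x).symm
  · intro t x
    exact ⟨(hH t _).1, fun hx => (hH t _).2 (frQ_K4 hx)⟩

theorem frC {R : Type} [TopologicalSpace R] [Monoid R] (k : ℤ) {f : C(Q, R)} (h : f ∈ RU K4) :
    ∃ f' : C(Q, R), ∀ x, f' x = f (frQ k x) := by
  have := frQ_cont (T := Unit) k (f.comp ContinuousMap.snd) 1 fun t q hq => (h q).2 hq
  exact ⟨⟨fun x => f (frQ k x), this.comp (by fun_prop : Continuous fun x : Q => ((), x))⟩, fun x => rfl⟩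

theorem embM_dg {m n : Type} [Fintype m] [DecidableEq m] [Fintype n] [DecidableEq n] {ι : m → n}
    (hι : Function.Injective ι) (i0 : m) (a : ℍ[ℝ]) :
    embM ι (Matrix.diagonal (fun i => if i = i0 then a else 1)) = Matrix.diagonal (fun i => if i = ι i0 then a else 1) := by
  rw [← embM_sub hι (g := Matrix.diagonal (fun i => if i = ι i0 then a else 1))]
  · congr 1
    ext1 i j
    rw [Matrix.submatrix_apply, Matrix.diagonal_apply, Matrix.diagonal_apply]
    simp only [hι.eq_iff]
  · intro i j h
    rw [Matrix.diagonal_apply, Matrix.one_apply]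
    by_cases hij : i = j
    · subst hij
      have : i ≠ ι i0 := by rintro rfl; simp at h
      simp [this]
    · simp [hij]

theorem clamp_RU {f : C(Q, ℍ[ℝ])} (hf : f ∈ RU K4) : ∃ (g : C(Q, ℍ[ℝ])) (N : Set Q), IsOpen N ∧ K4 ⊆ N ∧
    (∀ x ∈ N, g x = 1) ∧ JoinedIn (RU K4) f g := by
  obtain ⟨κ, N, hN, hK, h0, h1, h2⟩ := clamp_K4
  refine ⟨⟨fun x => f (κ (1, x)), by fun_prop⟩, N, hN, hK, fun x hx => (hf _).2 (h2 x hx), ?_⟩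
  refine joinedIn_of_homotopy ⟨fun w => f (κ w), by fun_prop⟩ ?_ ?_ ?_
  · intro x; exact congrArg f (h0 x)
  · intro x; rfl
  · intro t x
    exact ⟨(hf _).1, fun hx => (hf _).2 (h1 _ _ hx)⟩

theorem embC_RU {m n : Type} [Fintype m] [DecidableEq m] [Fintype n] [DecidableEq n] {ι : m → n}
    {R : Type} [Ring R] [TopologicalSpace R] [IsTopologicalRing R]
    (hι : Function.Injective ι) {G G' : C(Q, Matrix m m R)}
    (h : JoinedIn (RU K4) G G') : JoinedIn (RU K4) ((embC ι).comp G) ((embC ι).comp G') :=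
  RU_comp (embC ι) (embM_one ι) (fun a ha => (embM_isUnit hι).2 ha) h

theorem emb_dg_RU {m n : Type} [Fintype m] [DecidableEq m] [Fintype n] [DecidableEq n] {ι : m → n}
    (hι : Function.Injective ι) (i0 : m) (j0 : n) (hj : ι i0 = j0) {G : C(Q, Matrix m m ℍ[ℝ])} {gk : C(Q, ℍ[ℝ])}
    (h : JoinedIn (RU K4) G (dgC i0 gk)) : JoinedIn (RU K4) ((embC ι).comp G) (dgC j0 gk) := by
  have h2 := embC_RU hι h
  have h3 : dgC j0 gk = (embC ι).comp (dgC i0 gk) := by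
    ext1 x
    subst hj
    exact (embM_dg hι i0 (gk x)).symm
  rw [h3]
  exact h2

theorem MAIN_aux (G : ℤ → C(Q, Matrix (Fin 2 × Fin 2) (Fin 2 × Fin 2) ℍ[ℝ])) (hG2 : ∀ k, G k ∈ RU K4)
    (hfr : ∀ k q, G k q = G 1 (frQ k q))
    (hst : ∀ (f : C(Q, ℍ[ℝ])) (hf : ∀ x, IsUnit (f x)) (N : Set Q) (hN : IsOpen N) (hKN : K4 ⊆ N)
    (hfN : ∀ x ∈ N, f x = 1), ∃ (J : Type) (_ : Fintype J) (_ : DecidableEq J) (j0 j1 : J) (k : ℤ),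
      j0 ≠ j1 ∧ JoinedIn (RU K4) (dgC (j0, (0 : Fin 2)) f) ((embC (Prod.map ![j0, j1] id)).comp (G k))) :
    ∃ g : C(Q, ℍ[ℝ]), g ∈ RU K4 ∧ ∀ f : C(Q, ℍ[ℝ]), f ∈ RU K4 → ∃ (k : ℤ) (gk : C(Q, ℍ[ℝ])),
    (∀ x, gk x = g (frQ k x)) ∧ JoinedIn (RU K4) f gk := by
  obtain ⟨g, hg⟩ := destab1 cubeQ (by norm_num) ((0 : Fin 2), (0 : Fin 2)) (hG2 1)
  have hgR : g ∈ RU K4 := RU_dg hg.target_mem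
  refine ⟨g, hgR, fun f hf => ?_⟩
  obtain ⟨f1, N, hN, hK, hf1, hff⟩ := clamp_RU hf
  obtain ⟨J, _, _, j0, j1, k, hj, h⟩ := hst f1 (fun x => (hff.target_mem x).1) N hN hK hf1
  obtain ⟨gk, hgk⟩ := frC k hgR
  refine ⟨k, gk, hgk, hff.trans (destab2 cubeQ (by norm_num) (j0, (0 : Fin 2)) (h.trans ?_))⟩
  have h1 : JoinedIn (RU K4) (G k) (dgC ((0 : Fin 2), (0 : Fin 2)) gk) :=
    RU_fr k hg (hfr k) fun x => by rw [dgC_apply, dgC_apply, hgk]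
  have hι : Function.Injective ![j0, j1] := by
    intro a b; fin_cases a <;> fin_cases b <;> simp [hj, hj.symm]
  exact emb_dg_RU (hι.prodMap Function.injective_id) ((0 : Fin 2), (0 : Fin 2)) (j0, (0 : Fin 2)) rfl h1

theorem MAIN : ∃ g : C(Q, ℍ[ℝ]), g ∈ RU K4 ∧ ∀ f : C(Q, ℍ[ℝ]), f ∈ RU K4 → ∃ (k : ℤ) (gk : C(Q, ℍ[ℝ])),
    (∀ x, gk x = g (frQ k x)) ∧ JoinedIn (RU K4) f gk := MAIN_aux G2 G2_RU G2_fr main_stable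

end S6

set_option linter.unusedSectionVars false
set_option linter.unusedVariables false
set_option linter.deprecated false

namespace S6
open Set Topology Module Matrix
open scoped unitInterval Quaternion

section
variable {B : Type} [Ring B] [Algebra ℝ B] [StarRing B] [StarModule ℝ B]

/-- fiber condition -/
def Fib (P j : B) : Prop := star j = -j ∧ j * j = -P ∧ P * j = j

theorem Fib.right {P j : B} (hP : star P = P) (h : Fib P j) : j * P = j := by
  have := congrArg star h.2.2
  rw [star_mul, hP, h.1, neg_mul] at this
  exact neg_injective this

/-- partial isometries with initial projection `e` -/
def Un (e : B) : Set B := {u | star u * u = e ∧ u * e = u}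

theorem Un.star_mul_e {e u : B} (he : star e = e) (h : u ∈ Un e) : e * star u = star u := by
  have := congrArg star h.2
  rwa [star_mul, he] at this

theorem Un.fib_to {e u j : B} (he : star e = e) (h : u ∈ Un e) (hj : Fib (u * star u) j) :
    Fib e (star u * j * u) ∧ u * (star u * j * u) * star u = j := by
  have hs : star (u * star u) = u * star u := by simp
  have h1 := hj.right hs
  have h2 := Un.star_mul_e he h
  refine ⟨⟨?_, ?_, ?_⟩, ?_⟩
  · rw [star_mul, star_mul, star_star, hj.1]; noncomm_ring
  · have : star u * j * u * (star u * j * u) = star u * (j * (u * star u)) * j * u := by noncomm_ring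
    rw [this, h1, mul_assoc (star u), hj.2.1]
    have h3 : star u * -(u * star u) * u = -((star u * u) * star u * u) := by noncomm_ring
    rw [h3, h.1, h2, h.1]
  · rw [← mul_assoc, ← mul_assoc, h2]
  · have : u * (star u * j * u) * star u = ((u * star u) * j) * (u * star u) := by noncomm_ring
    rw [this, hj.2.2, h1]

theorem Un.fib_from {e u w : B} (he : star e = e) (h : u ∈ Un e) (hw : Fib e w) :
    Fib (u * star u) (u * w * star u) ∧ star u * (u * w * star u) * u = w := by
  have h1 := hw.right he
  have h2 := Un.star_mul_e he h
  refine ⟨⟨?_, ?_, ?_⟩, ?_⟩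
  · rw [star_mul, star_mul, star_star, hw.1]; noncomm_ring
  · have : u * w * star u * (u * w * star u) = u * (w * (star u * u)) * w * star u := by noncomm_ring
    rw [this, h.1, h1, mul_assoc u, hw.2.1]
    have : u * -e * star u = -((u * e) * star u) := by noncomm_ring
    rw [this, h.2]
  · have : u * star u * (u * w * star u) = u * ((star u * u) * w) * star u := by noncomm_ring
    rw [this, h.1, hw.2.2]
  · have : star u * (u * w * star u) * u = (star u * u) * w * (star u * u) := by noncomm_ring
    rw [this, h.1, hw.2.2, h1]

theorem fib_transport {P P' j : B} {t : ℝ} (ht : t ≠ 0) (hP : P * P' * P = t • P) (hP' : P' * P * P' = t • P')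
    (hPP : P' * P' = P') (hs : star P = P) (hs' : star P' = P') (hj : Fib P j) : Fib P' (t⁻¹ • (P' * j * P')) := by
  have h1 := hj.right hs
  refine ⟨?_, ?_, ?_⟩
  · rw [star_smul, star_mul, star_mul, hs', hj.1, star_trivial, neg_mul, mul_neg, smul_neg, mul_assoc]
  · have h3 : j * P' * j = -(t • P) := by
      have : j * P' * j = j * (P * P' * P) * j := by
        calc j * P' * j = (j * P) * P' * (P * j) := by rw [h1, hj.2.2]
          _ = _ := by noncomm_ring
      rw [this, hP, mul_smul_comm, smul_mul_assoc, h1, hj.2.1, smul_neg]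
    have : P' * j * P' * (P' * j * P') = P' * (j * (P' * P') * j) * P' := by noncomm_ring
    rw [smul_mul_smul_comm, this, hPP, h3, mul_neg, neg_mul, mul_smul_comm, smul_mul_assoc, hP', smul_neg, smul_smul, smul_smul]
    have : t⁻¹ * t⁻¹ * (t * t) = 1 := by field_simp
    rw [mul_assoc] at this
    rw [show t⁻¹ * t⁻¹ * t * t = 1 by rw [mul_assoc, mul_assoc]; exact this, one_smul] 
  · rw [mul_smul_comm, ← mul_assoc, ← mul_assoc, hPP]

end

/-- corner embedding -/
noncomputable def io (a : ℍ[ℝ]) : A1 := !![a, 0; 0, 0]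

/-- corner projection -/
noncomputable def e0 : A1 := io 1

theorem io_mul (a b : ℍ[ℝ]) : io a * io b = io (a * b) := by
  unfold io; ext1 i j; fin_cases i <;> fin_cases j <;> simp [Matrix.mul_apply, Fin.sum_univ_two]

theorem io_star (a : ℍ[ℝ]) : star (io a) = io (star a) := by
  ext1 i j; rw [Matrix.star_apply]; unfold io; fin_cases i <;> fin_cases j <;> simp

theorem io_smul (r : ℝ) (a : ℍ[ℝ]) : io (r • a) = r • io a := by
  unfold io; ext1 i j; rw [Matrix.smul_apply]; fin_cases i <;> fin_cases j <;> simp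

theorem io_neg (a : ℍ[ℝ]) : io (-a) = -io a := by
  unfold io; ext1 i j; rw [Matrix.neg_apply]; fin_cases i <;> fin_cases j <;> simp

theorem io_cont : Continuous io := by
  unfold io
  refine continuous_matrix fun i j => ?_
  fin_cases i <;> fin_cases j <;> simp <;> fun_prop

theorem io_apply (a : ℍ[ℝ]) : io a 0 0 = a := rfl

theorem io_inj : Function.Injective io := fun a b h => by rw [← io_apply a, h, io_apply]

theorem e0_star : star e0 = e0 := by rw [e0, io_star, star_one]
theorem e0_sq : e0 * e0 = e0 := by rw [e0, io_mul, one_mul]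

theorem io_of_corner {x : A1} (h1 : e0 * x = x) (h2 : x * e0 = x) : x = io (x 0 0) := by
  ext1 i j
  fin_cases i
  · fin_cases j
    · rfl
    · change x 0 1 = 0
      rw [← h2, Matrix.mul_apply, Fin.sum_univ_two]
      simp [e0, io]
  · have : ∀ j, x 1 j = 0 := by
      intro j
      rw [← h1, Matrix.mul_apply, Fin.sum_univ_two]
      simp [e0, io]
    rw [show x (⟨1, by norm_num⟩ : Fin 2) j = x 1 j from rfl, this j]
    fin_cases j <;> rfl

/-- real trace -/
def tau (x : A1) : ℝ := (x 0 0).re + (x 1 1).re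

theorem re_comm (a b : ℍ[ℝ]) : (a * b).re = (b * a).re := by
  simp only [Quaternion.re_mul]; ring

theorem tau_comm (x y : A1) : tau (x * y) = tau (y * x) := by
  simp only [tau, Matrix.mul_apply, Fin.sum_univ_two, Quaternion.re_add]
  rw [re_comm (x 0 0), re_comm (x 0 1), re_comm (x 1 0), re_comm (x 1 1)]
  ring

theorem tau_io (a : ℍ[ℝ]) : tau (io a) = a.re := by simp [tau, io]

theorem tau_cont : Continuous tau := by
  unfold tau
  have : Continuous fun q : ℍ[ℝ] => q.re := Quaternion.continuous_re
  exact (this.comp (by fun_prop)).add (this.comp (by fun_prop))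

theorem Un.corner {y z : A1} (hy : y ∈ Un e0) (hz : z ∈ Un e0) : star y * z = io ((star y * z) 0 0) :=
  io_of_corner (by rw [← mul_assoc, Un.star_mul_e e0_star hy]) (by rw [mul_assoc, hz.2])

/-- rank one projections: products -/
theorem Un.PPP {y z : A1} (hy : y ∈ Un e0) (hz : z ∈ Un e0) :
    (y * star y) * (z * star z) * (y * star y) = tau ((y * star y) * (z * star z)) • (y * star y) ∧
    tau ((y * star y) * (z * star z)) = Quaternion.normSq ((star y * z) 0 0) := by
  set a := (star y * z) 0 0 with ha
  have h1 : star y * z = io a := Un.corner hy hz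
  have h2 : star z * y = io (star a) := by rw [← io_star, ← h1, star_mul, star_star]
  have h3 : tau ((y * star y) * (z * star z)) = Quaternion.normSq a := by
    have : (y * star y) * (z * star z) = y * (star y * z * star z) := by noncomm_ring
    rw [this, tau_comm]
    have : star y * z * star z * y = (star y * z) * (star z * y) := by noncomm_ring
    rw [this, h1, h2, io_mul, tau_io, Quaternion.self_mul_star, Quaternion.re_coe]
  refine ⟨?_, h3⟩
  have : (y * star y) * (z * star z) * (y * star y) = y * ((star y * z) * (star z * y)) * star y := by noncomm_ring
  rw [h3, this, h1, h2, io_mul, Quaternion.self_mul_star]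
  have : ((Quaternion.normSq a : ℝ) : ℍ[ℝ]) = Quaternion.normSq a • (1 : ℍ[ℝ]) := by
    rw [← Quaternion.coe_mul_eq_smul, mul_one]
  rw [this, io_smul, mul_smul_comm, smul_mul_assoc]
  change _ • (y * e0 * star y) = _
  rw [hy.2]

theorem Un.idem {y : A1} (hy : y ∈ Un e0) : (y * star y) * (y * star y) = y * star y := by
  have : (y * star y) * (y * star y) = y * (star y * y) * star y := by noncomm_ring
  rw [this, hy.1, hy.2]

theorem Un.tau_self {y : A1} (hy : y ∈ Un e0) : tau ((y * star y) * (y * star y)) = 1 := by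
  rw [Un.idem hy, tau_comm, hy.1, e0, tau_io]; rfl

/-- local section -/
theorem Un.sec {y z : A1} (hy : y ∈ Un e0) (hz : z ∈ Un e0) (h : tau ((y * star y) * (z * star z)) ≠ 0) :
    (Real.sqrt (tau ((y * star y) * (z * star z))))⁻¹ • (y * star y * z) ∈ Un e0 ∧
    ((Real.sqrt (tau ((y * star y) * (z * star z))))⁻¹ • (y * star y * z)) *
      star ((Real.sqrt (tau ((y * star y) * (z * star z))))⁻¹ • (y * star y * z)) = y * star y := by
  have hn := (Un.PPP hy hz).2
  have hn' := (Un.PPP hz hy).1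
  have h1 := (Un.PPP hy hz).1
  set t := tau ((y * star y) * (z * star z)) with ht
  rw [tau_comm, ← ht] at hn'
  have hpos : 0 < t := lt_of_le_of_ne (hn ▸ Quaternion.normSq_nonneg) (Ne.symm h)
  have hr : (Real.sqrt t)⁻¹ * (Real.sqrt t)⁻¹ * t = 1 := by
    rw [← mul_inv, Real.mul_self_sqrt hpos.le, inv_mul_cancel₀ h]
  refine ⟨⟨?_, ?_⟩, ?_⟩
  · rw [star_smul, star_trivial, smul_mul_smul_comm, star_mul, star_mul, star_star]
    have : star z * (y * star y) * (y * star y * z) = star z * ((y * star y) * (y * star y)) * z := by noncomm_ring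
    rw [this, Un.idem hy]
    have : star z * (y * star y) * z = star z * ((z * star z) * (y * star y) * (z * star z)) * z := by
      have h2 : star z * (z * star z) = star z := by rw [← mul_assoc, hz.1, Un.star_mul_e e0_star hz]
      have h3 : z * star z * z = z := by rw [mul_assoc, hz.1, hz.2]
      calc _ = (star z * (z * star z)) * (y * star y) * ((z * star z) * z) := by rw [h2, h3]
        _ = _ := by noncomm_ring
    rw [this, hn', mul_smul_comm, smul_mul_assoc, smul_smul, hr, one_smul]
    have : star z * (z * star z) * z = (star z * z) * (star z * z) := by noncomm_ring
    rw [this, hz.1, e0_sq]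
  · rw [smul_mul_assoc, mul_assoc, hz.2]
  · rw [star_smul, star_trivial ((Real.sqrt t)⁻¹), smul_mul_smul_comm, star_mul (y * star y) z, star_mul y (star y), star_star y]
    have : y * star y * z * (star z * (y * star y)) = (y * star y) * (z * star z) * (y * star y) := by noncomm_ring
    rw [this, h1, smul_smul, hr, one_smul]

end S6

set_option linter.unusedSectionVars false
set_option linter.unusedVariables false
set_option linter.deprecated false

namespace S6
open Set Topology Module Matrix
open scoped unitInterval Quaternion

/-- imaginary quaternion from a vector -/
noncomputable def qS (x : EuclideanSpace ℝ (Fin 3)) : ℍ[ℝ] := ⟨0, x 0, x 1, x 2⟩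

/-- vector part of a quaternion -/
noncomputable def sQ (a : ℍ[ℝ]) : EuclideanSpace ℝ (Fin 3) := !₂[a.imI, a.imJ, a.imK]

@[simp] theorem qS_re (x) : (qS x).re = 0 := rfl
@[simp] theorem qS_imI (x) : (qS x).imI = x 0 := rfl
@[simp] theorem qS_imJ (x) : (qS x).imJ = x 1 := rfl
@[simp] theorem qS_imK (x) : (qS x).imK = x 2 := rfl

theorem qS_eq (x : EuclideanSpace ℝ (Fin 3)) : qS x = x 0 • qi + x 1 • qj + x 2 • qk := by
  ext <;> simp [qS]

theorem qS_cont : Continuous qS := by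
  have : qS = fun x => x 0 • qi + x 1 • qj + x 2 • qk := funext qS_eq
  rw [this]; fun_prop

theorem sQ_cont : Continuous sQ := by
  unfold sQ
  refine (PiLp.continuous_toLp 2 _).comp ?_
  refine continuous_pi fun i => ?_
  fin_cases i
  · exact Quaternion.continuous_imI
  · exact Quaternion.continuous_imJ
  · exact Quaternion.continuous_imK

theorem sQ_qS (x : EuclideanSpace ℝ (Fin 3)) : sQ (qS x) = x := by
  ext i; fin_cases i <;> simp [sQ, qS]

theorem qS_sQ {a : ℍ[ℝ]} (h : star a = -a) : qS (sQ a) = a := by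
  have := congrArg QuaternionAlgebra.re h
  simp at this
  ext <;> simp [qS, sQ]
  linarith

theorem norm_E3 (x : EuclideanSpace ℝ (Fin 3)) : ‖x‖ = 1 ↔ x 0 ^ 2 + x 1 ^ 2 + x 2 ^ 2 = 1 := by
  rw [EuclideanSpace.norm_eq, Fin.sum_univ_three, Real.sqrt_eq_one]
  simp

theorem qS_sq {x : EuclideanSpace ℝ (Fin 3)} (h : ‖x‖ = 1) : qS x * qS x = -1 := by
  rw [norm_E3] at h
  ext <;> simp [Quaternion.re_mul] <;> nlinarith

theorem qS_star (x : EuclideanSpace ℝ (Fin 3)) : star (qS x) = - qS x := by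
  ext <;> simp

theorem sQ_norm {a : ℍ[ℝ]} (h : star a = -a) (h2 : a * a = -1) : ‖sQ a‖ = 1 := by
  have := congrArg QuaternionAlgebra.re h
  simp at this
  have h3 := congrArg QuaternionAlgebra.re h2
  rw [Quaternion.re_mul] at h3
  simp at h3
  rw [norm_E3]
  simp [sQ]
  have : a.re = 0 := by linarith
  rw [this] at h3
  nlinarith

theorem fib_e0 {w : A1} (h : Fib e0 w) : w = io (w 0 0) ∧ star (w 0 0) = - w 0 0 ∧ w 0 0 * w 0 0 = -1 := by
  have h1 := io_of_corner h.2.2 (h.right e0_star)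
  refine ⟨h1, ?_, ?_⟩
  · apply io_inj; rw [io_neg, ← io_star, ← h1, h.1]
  · apply io_inj; rw [io_neg, ← io_mul, ← h1, h.2.1]; rfl

theorem fib_io {a : ℍ[ℝ]} (h : star a = -a) (h2 : a * a = -1) : Fib e0 (io a) :=
  ⟨by rw [io_star, h, io_neg], by rw [io_mul, h2, io_neg]; rfl, by rw [e0, io_mul, one_mul]⟩

/-- projection fields -/
def PF (P : C(unitSphere 6, A1)) : Prop := ∀ b, ∃ u ∈ Un e0, u * star u = P b

/-- twistor type space -/
abbrev ZP (P : C(unitSphere 6, A1)) : Type := {z : unitSphere 6 × A1 // Fib (P z.1) z.2}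

theorem PF.sec {P : C(unitSphere 6, A1)} (hP : PF P) (b0 : unitSphere 6) :
    ∃ U : Set (unitSphere 6), IsOpen U ∧ b0 ∈ U ∧ ∃ u : U → A1, Continuous u ∧
      ∀ b : U, u b ∈ Un e0 ∧ u b * star (u b) = P b := by
  obtain ⟨y0, hy0, hy0'⟩ := hP b0
  have hc : Continuous fun b => tau (P b * P b0) := tau_cont.comp (P.continuous.mul continuous_const)
  refine ⟨{b | tau (P b * P b0) ≠ 0}, isOpen_ne_fun hc continuous_const, ?_,
    fun b => (Real.sqrt (tau (P b * P b0)))⁻¹ • (P b * y0), ?_, ?_⟩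
  · change tau (P b0 * P b0) ≠ 0
    rw [← hy0', Un.tau_self hy0]; norm_num
  · have hc' : Continuous fun b : {b | tau (P b * P b0) ≠ 0} => (Real.sqrt (tau (P b * P b0)))⁻¹ := by
      refine Continuous.inv₀ (Real.continuous_sqrt.comp (hc.comp continuous_subtype_val)) ?_
      rintro ⟨b, hb⟩
      change tau (P b * P b0) ≠ 0 at hb
      change Real.sqrt (tau (P b * P b0)) ≠ 0
      obtain ⟨y, hy, hy'⟩ := hP b
      rw [← hy', ← hy0'] at hb ⊢
      rw [Real.sqrt_ne_zero']
      refine lt_of_le_of_ne ?_ hb.symm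
      rw [(Un.PPP hy hy0).2]; exact Quaternion.normSq_nonneg
    exact hc'.smul ((P.continuous.comp continuous_subtype_val).mul continuous_const)
  · rintro ⟨b, hb⟩
    change tau (P b * P b0) ≠ 0 at hb
    obtain ⟨y, hy, hy'⟩ := hP b
    have := Un.sec hy hy0 (by rwa [hy', hy0'])
    rw [hy', hy0'] at this
    exact this

theorem PF.bundle {P : C(unitSphere 6, A1)} (hP : PF P) :
    IsFiberBundleWithFiber (unitSphere 2) (fun z : ZP P => z.1.1) := by
  refine ⟨by fun_prop, fun b0 => ?_⟩
  obtain ⟨U, hU, hb, u, hu, hu'⟩ := hP.sec b0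
  refine ⟨U, hU, hb, ?_⟩
  have key : ∀ z : (fun z : ZP P => z.1.1) ⁻¹' U,
      Fib e0 (star (u ⟨z.1.1.1, z.2⟩) * z.1.1.2 * u ⟨z.1.1.1, z.2⟩) ∧
      u ⟨z.1.1.1, z.2⟩ * (star (u ⟨z.1.1.1, z.2⟩) * z.1.1.2 * u ⟨z.1.1.1, z.2⟩) * star (u ⟨z.1.1.1, z.2⟩) = z.1.1.2 :=
    fun z => Un.fib_to e0_star (hu' ⟨z.1.1.1, z.2⟩).1 (by
      rw [(hu' ⟨z.1.1.1, z.2⟩).2]; exact z.1.2)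
  have key2 : ∀ w : U × unitSphere 2, Fib (P w.1.1) (u w.1 * io (qS w.2.1) * star (u w.1)) ∧
      star (u w.1) * (u w.1 * io (qS w.2.1) * star (u w.1)) * u w.1 = io (qS w.2.1) := fun w => by
    have := Un.fib_from e0_star (hu' w.1).1 (fib_io (qS_star w.2.1) (qS_sq (by simpa using w.2.2)))
    rw [(hu' w.1).2] at this
    exact this
  let f : (fun z : ZP P => z.1.1) ⁻¹' U → U × unitSphere 2 := fun z =>
    (⟨z.1.1.1, z.2⟩, ⟨sQ ((star (u ⟨z.1.1.1, z.2⟩) * z.1.1.2 * u ⟨z.1.1.1, z.2⟩) 0 0), by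
      have := fib_e0 (key z).1
      simpa using sQ_norm this.2.1 this.2.2⟩)
  let g : U × unitSphere 2 → (fun z : ZP P => z.1.1) ⁻¹' U := fun w =>
    ⟨⟨(w.1.1, u w.1 * io (qS w.2.1) * star (u w.1)), (key2 w).1⟩, w.1.2⟩
  have huz : Continuous fun z : (fun z : ZP P => z.1.1) ⁻¹' U => u ⟨z.1.1.1, z.2⟩ :=
    hu.comp (by fun_prop)
  have hjz : Continuous fun z : (fun z : ZP P => z.1.1) ⁻¹' U => z.1.1.2 := by fun_prop
  have huw : Continuous fun w : U × unitSphere 2 => u w.1 := hu.comp (by fun_prop)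
  have hqw : Continuous fun w : U × unitSphere 2 => io (qS w.2.1) :=
    io_cont.comp (qS_cont.comp (by fun_prop))
  refine ⟨⟨⟨f, g, ?_, ?_⟩, ?_, ?_⟩, fun z => rfl⟩
  · intro z
    apply Subtype.ext; apply Subtype.ext
    refine Prod.ext rfl ?_
    change u ⟨z.1.1.1, z.2⟩ * io (qS (sQ _)) * star (u ⟨z.1.1.1, z.2⟩) = _
    have := fib_e0 (key z).1
    rw [qS_sQ this.2.1, ← this.1, (key z).2]
  · intro w
    refine Prod.ext rfl (Subtype.ext ?_)
    change sQ ((star (u w.1) * (u w.1 * io (qS w.2.1) * star (u w.1)) * u w.1) 0 0) = _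
    rw [(key2 w).2, io_apply, sQ_qS]
  · change Continuous f
    refine Continuous.prodMk (by fun_prop) (Continuous.subtype_mk (sQ_cont.comp ?_) _)
    exact ((huz.star.mul hjz).mul huz).matrix_elem 0 0
  · change Continuous g
    refine Continuous.subtype_mk (Continuous.subtype_mk ?_ _) _
    exact Continuous.prodMk (by fun_prop) ((huw.mul hqw).mul huw.star)

theorem tr_cont {α B' : Type} [TopologicalSpace α] [TopologicalSpace B'] (b : α → B') (p p' j : α → A1)
    (hb : Continuous b) (hp : Continuous p) (hp' : Continuous p') (hj : Continuous j) :
    ContinuousOn (fun w => (b w, (tau (p w * p' w))⁻¹ • (p' w * j w * p' w))) {w | tau (p w * p' w) ≠ 0} := by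
  have hc2 : Continuous fun w => tau (p w * p' w) := tau_cont.comp (hp.mul hp')
  exact hb.continuousOn.prodMk
    ((hc2.continuousOn.inv₀ fun w hw => hw).smul ((hp'.mul hj).mul hp').continuousOn)

/-- homotopy lifting for `ZP` -/
theorem PF.lift {P : C(unitSphere 6, A1)} (hP : PF P) {X : Type} [TopologicalSpace X] [CompactSpace X]
    (f : C(X, ZP P)) (H : C(I × X, unitSphere 6)) (h0 : ∀ x, H (0, x) = (f x).1.1) :
    ∃ L : C(I × X, ZP P), (∀ x, L (0, x) = f x) ∧ (∀ z, (L z).1.1 = H z) ∧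
      (∀ x, (∀ s, H (s, x) = H (0, x)) → ∀ s, L (s, x) = f x) ∧
      ∀ x y, f x = f y → (∀ s, H (s, x) = H (s, y)) → ∀ s, L (s, x) = L (s, y) := by
  classical
  have hst : ∀ b, star (P b) = P b := fun b => by
    obtain ⟨y, hy, hy'⟩ := hP b
    rw [← hy']; simp
  have hid : ∀ b, P b * P b = P b := fun b => by
    obtain ⟨y, hy, hy'⟩ := hP b
    rw [← hy', Un.idem hy]
  have hppp : ∀ b b', P b * P b' * P b = tau (P b * P b') • P b := fun b b' => by
    obtain ⟨y, hy, hy'⟩ := hP b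
    obtain ⟨z, hz, hz'⟩ := hP b'
    rw [← hy', ← hz', (Un.PPP hy hz).1]
  have hself : ∀ b, tau (P b * P b) = 1 := fun b => by
    obtain ⟨y, hy, hy'⟩ := hP b
    rw [← hy', Un.tau_self hy]
  have tr : ∀ (z : ZP P) (b : unitSphere 6), tau (P z.1.1 * P b) ≠ 0 →
      Fib (P b) ((tau (P z.1.1 * P b))⁻¹ • (P b * z.1.2 * P b)) := fun z b ht =>
    fib_transport ht (hppp _ _) (by rw [hppp, tau_comm]) (hid b) (hst _) (hst _) z.2
  let T : ZP P × unitSphere 6 → ZP P := fun w => if h : tau (P w.1.1.1 * P w.2) ≠ 0 then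
    ⟨(w.2, (tau (P w.1.1.1 * P w.2))⁻¹ • (P w.2 * w.1.1.2 * P w.2)), tr w.1 w.2 h⟩ else w.1
  have hTv : ∀ w, tau (P w.1.1.1 * P w.2) ≠ 0 →
    (T w).1 = (w.2, (tau (P w.1.1.1 * P w.2))⁻¹ • (P w.2 * w.1.1.2 * P w.2)) := fun w h => by
    simp only [T]; rw [dif_pos h]
  have hcP : Continuous fun w : unitSphere 6 × unitSphere 6 => tau (P w.1 * P w.2) :=
    tau_cont.comp ((P.continuous.comp continuous_fst).mul (P.continuous.comp continuous_snd))
  refine hlp (fun z : ZP P => z.1.1) (by fun_prop) {w | tau (P w.1 * P w.2) ≠ 0}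
    (isOpen_ne_fun hcP continuous_const) (fun b => ?_) T ?_ ?_ ?_ f H h0
  · change tau (P b * P b) ≠ 0
    rw [hself]; norm_num
  · refine (IsInducing.subtypeVal (t := {z : unitSphere 6 × A1 | Fib (P z.1) z.2})).continuousOn_iff.2 ?_
    have : ContinuousOn (fun w : ZP P × unitSphere 6 =>
        (w.2, (tau (P w.1.1.1 * P w.2))⁻¹ • (P w.2 * w.1.1.2 * P w.2)))
        {w | tau (P w.1.1.1 * P w.2) ≠ 0} :=
      tr_cont (α := ZP P × unitSphere 6) (B' := unitSphere 6) (fun w => w.2) (fun w => P w.1.1.1) (fun w => P w.2) (fun w => w.1.1.2)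
        continuous_snd (P.continuous.comp (by fun_prop)) (P.continuous.comp (by fun_prop)) (by fun_prop)
    exact this.congr fun w hw => hTv w hw
  · intro e b h
    change (T (e, b)).1.1 = b
    rw [hTv (e, b) h]
  · intro e
    apply Subtype.ext
    rw [hTv (e, e.1.1) (by change tau (P e.1.1 * P e.1.1) ≠ 0; rw [hself]; norm_num)]
    refine Prod.ext rfl ?_
    change (tau (P e.1.1 * P e.1.1))⁻¹ • (P e.1.1 * e.1.2 * P e.1.1) = e.1.2
    rw [hself, inv_one, one_smul, e.2.2.2, e.2.right (hst _)]

end S6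

set_option linter.unusedSectionVars false
set_option linter.unusedVariables false
set_option linter.deprecated false

namespace S6
open Set Topology Module Matrix
open scoped unitInterval Quaternion

theorem sphere_contr {k n : ℕ} {X : Type} [TopologicalSpace X] [CompactSpace X] (hX : CubeLike k X) (hk : k < n)
    (v : C(X, unitSphere n)) (w : unitSphere n) :
    ∃ H : C(I × X, unitSphere n), (∀ x, H (0, x) = v x) ∧ (∀ x, H (1, x) = w) ∧
      ∀ x, v x = w → ∀ s, H (s, x) = w := by
  have hne : ∀ z : unitSphere n, (z : EuclideanSpace ℝ (Fin (n + 1))) ≠ 0 := fun z => by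
    have := z.2
    intro h
    simp [h] at this
  have hn : ∀ z : unitSphere n, ‖(z : EuclideanSpace ℝ (Fin (n + 1)))‖ = 1 := fun z => by simpa using z.2
  obtain ⟨H, h, h0, h1, h2⟩ := sphere_lemma (E := EuclideanSpace ℝ (Fin (n + 1))) hX (by simpa using hk)
    ⟨fun x => (v x).1, by fun_prop⟩ (fun x => hne _) w.1 (hne _)
  refine ⟨⟨fun z => ⟨‖H z‖⁻¹ • H z, ?_⟩, ?_⟩, ?_, ?_, ?_⟩
  · rw [mem_sphere_zero_iff_norm, norm_smul, norm_inv, norm_norm, inv_mul_cancel₀ (norm_ne_zero_iff.2 (h z))]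
  · refine Continuous.subtype_mk ?_ _
    exact (H.continuous.norm.inv₀ fun z => norm_ne_zero_iff.2 (h z)).smul H.continuous
  · intro x
    apply Subtype.ext
    change ‖H (0, x)‖⁻¹ • H (0, x) = (v x).1
    rw [h0]; change ‖(v x).1‖⁻¹ • (v x).1 = _
    rw [hn, inv_one, one_smul]
  · intro x
    apply Subtype.ext
    change ‖H (1, x)‖⁻¹ • H (1, x) = w.1
    rw [h1, hn, inv_one, one_smul]
  · intro x hx s
    apply Subtype.ext
    change ‖H (s, x)‖⁻¹ • H (s, x) = w.1
    rw [h2 x (congrArg Subtype.val hx), hn, inv_one, one_smul]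

theorem PF.toFiber {P : C(unitSphere 6, A1)} (hP : PF P) {k : ℕ} {X : Type} [TopologicalSpace X] [CompactSpace X]
    (hX : CubeLike k X) (hk : k < 6) (f : C(X, ZP P)) (b : unitSphere 6) :
    ∃ L : C(I × X, ZP P), (∀ x, L (0, x) = f x) ∧ (∀ x, (L (1, x)).1.1 = b) ∧
      ∀ x, (f x).1.1 = b → ∀ s, L (s, x) = f x := by
  obtain ⟨H, h0, h1, h2⟩ := sphere_contr hX hk ⟨fun x => (f x).1.1, by fun_prop⟩ b
  obtain ⟨L, l0, l1, l2, -⟩ := hP.lift f H h0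
  exact ⟨L, l0, fun x => by rw [l1, h1], fun x hx => l2 x fun s => by rw [h2 x hx, h2 x hx]⟩

theorem PF.inFiber {P : C(unitSphere 6, A1)} (hP : PF P) {k : ℕ} {X : Type} [TopologicalSpace X] [CompactSpace X]
    (hX : CubeLike k X) (hk : k < 2) (f : C(X, ZP P)) (z : ZP P) (hf : ∀ x, (f x).1.1 = z.1.1) :
    ∃ L : C(I × X, ZP P), (∀ x, L (0, x) = f x) ∧ (∀ x, L (1, x) = z) ∧
      ∀ x, f x = z → ∀ s, L (s, x) = z := by
  obtain ⟨u, hu, hu'⟩ := hP z.1.1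
  have key : ∀ j, Fib (P z.1.1) j → Fib e0 (star u * j * u) ∧ u * (star u * j * u) * star u = j :=
    fun j hj => Un.fib_to e0_star hu (by rw [hu']; exact hj)
  have key2 : ∀ x : unitSphere 2, Fib (P z.1.1) (u * io (qS x.1) * star u) := fun x => by
    have := Un.fib_from e0_star hu (fib_io (qS_star x.1) (qS_sq (by simpa using x.2)))
    rw [hu'] at this
    exact this.1
  have nn : ∀ j, Fib (P z.1.1) j → sQ ((star u * j * u) 0 0) ∈ Metric.sphere (0 : EuclideanSpace ℝ (Fin 3)) 1 := by
    intro j hj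
    have := fib_e0 (key j hj).1
    simpa using sQ_norm this.2.1 this.2.2
  have back : ∀ j, Fib (P z.1.1) j → u * io (qS (sQ ((star u * j * u) 0 0))) * star u = j := by
    intro j hj
    have := fib_e0 (key j hj).1
    rw [qS_sQ this.2.1, ← this.1, (key j hj).2]
  have hff : ∀ x, Fib (P z.1.1) (f x).1.2 := fun x => hf x ▸ (f x).2
  have hc : Continuous fun j : A1 => sQ ((star u * j * u) 0 0) :=
    sQ_cont.comp (((continuous_const.mul continuous_id).mul continuous_const).matrix_elem 0 0)
  obtain ⟨H, h0, h1, h2⟩ := sphere_contr hX hk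
    ⟨fun x => ⟨sQ ((star u * (f x).1.2 * u) 0 0), nn _ (hff x)⟩, Continuous.subtype_mk (hc.comp (by fun_prop)) _⟩
    ⟨sQ ((star u * z.1.2 * u) 0 0), nn _ z.2⟩
  refine ⟨⟨fun w => ⟨(z.1.1, u * io (qS (H w).1) * star u), key2 _⟩, ?_⟩, ?_, ?_, ?_⟩
  · refine Continuous.subtype_mk (continuous_const.prodMk ?_) _
    exact (continuous_const.mul (io_cont.comp (qS_cont.comp (by fun_prop)))).mul continuous_const
  · intro x
    refine Subtype.ext (Prod.ext (hf x).symm ?_)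
    change u * io (qS (H (0, x)).1) * star u = _
    rw [h0]; exact back _ (hff x)
  · intro x
    refine Subtype.ext (Prod.ext rfl ?_)
    change u * io (qS (H (1, x)).1) * star u = _
    rw [h1]; exact back _ z.2
  · intro x hx s
    refine Subtype.ext (Prod.ext rfl ?_)
    change u * io (qS (H (s, x)).1) * star u = _
    rw [h2 x (by apply Subtype.ext; change sQ _ = sQ _; rw [hx])]; exact back _ z.2

theorem PF.contr {P : C(unitSphere 6, A1)} (hP : PF P) {k : ℕ} {X : Type} [TopologicalSpace X] [CompactSpace X]
    (hX : CubeLike k X) (hk : k < 2) (f : C(X, ZP P)) (z : ZP P) :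
    JoinedIn {h : C(X, ZP P) | ∀ x, f x = z → h x = z} f (ContinuousMap.const X z) := by
  obtain ⟨L, l0, l1, l2⟩ := hP.toFiber hX (by omega) f z.1.1
  obtain ⟨M, m0, m1, m2⟩ := hP.inFiber hX hk (L.curry 1) z l1
  refine (joinedIn_of_homotopy L l0 (g := L.curry 1) (fun x => rfl) ?_).trans
    (joinedIn_of_homotopy M m0 m1 ?_)
  · intro t x hx
    change L (t, x) = z
    rw [l2 x (by rw [hx]), hx]
  · intro t x hx
    change M (t, x) = z
    exact m2 x (by change L (1, x) = z; rw [l2 x (by rw [hx]), hx]) t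

theorem cubeLike_unit : CubeLike 0 (Fin 0 → I) := cubeLike_pi 0

theorem PF.joined {P : C(unitSphere 6, A1)} (hP : PF P) (z w : ZP P) : Joined z w := by
  obtain ⟨H, h0, h1, -⟩ := homotopy_of_joinedIn (hP.contr cubeLike_unit (by norm_num) (ContinuousMap.const _ z) w)
  exact ⟨⟨⟨fun t => H (t, fun _ => 0), by fun_prop⟩, h0 _, h1 _⟩⟩

theorem PF.sc {P : C(unitSphere 6, A1)} (hP : PF P) : SimplyConnectedSpace (ZP P) := by
  rw [simply_connected_iff_loops_nullhomotopic]
  refine ⟨⟨?_, fun z w => hP.joined z w⟩, ?_⟩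
  · obtain ⟨b⟩ : Nonempty (unitSphere 6) := ⟨⟨EuclideanSpace.single 0 1, by simp⟩⟩
    obtain ⟨u, hu, hu'⟩ := hP b
    have := Un.fib_from e0_star hu (fib_io (a := qi) qsi qii)
    rw [hu'] at this
    exact ⟨⟨(b, _), this.1⟩⟩
  · intro z γ
    obtain ⟨H, h0, h1, h2⟩ := homotopy_of_joinedIn (hP.contr cubeLike_I (by norm_num) (γ : C(I, ZP P)) z)
    refine ⟨⟨⟨H, h0, h1⟩, ?_⟩⟩
    intro t x hx
    have : γ x = z := by
      rcases hx with rfl | rfl <;> simp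
    change H (t, x) = γ x
    rw [this]; exact h2 t x this

end S6

set_option linter.unusedSectionVars false
set_option linter.unusedVariables false
set_option linter.deprecated false

namespace S6
open Set Topology Module Matrix
open scoped unitInterval Quaternion

/-- nonzero complex numbers -/
abbrev CC0 : Type := {c : ℂ // c ≠ 0}
/-- nonzero quaternions -/
abbrev HH0 : Type := {q : ℍ[ℝ] // q ≠ 0}
/-- imaginary units -/
abbrev SS2 : Type := {a : ℍ[ℝ] // star a = -a ∧ a * a = -1}

/-- logarithm of a map trivial on the boundary -/
theorem exp_lift {X : Type} [TopologicalSpace X] [CompactSpace X] [PreconnectedSpace X] {K : Set X} (hK : K.Nonempty)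
    (ζ : C(X × I, ℂ)) (h0 : ∀ z, ζ z ≠ 0) (h1 : ∀ z ∈ bdy K, ζ z = 1) :
    ∃ a : C(X × I, ℂ), (∀ z, Complex.exp (a z) = ζ z) ∧ ∀ z ∈ bdy K, a z = 0 := by
  let p : ℂ → CC0 := fun z => ⟨Complex.exp z, Complex.exp_ne_zero z⟩
  let U : Set (CC0 × CC0) := {w | w.2.1 / w.1.1 ∈ Complex.slitPlane}
  have hdiv : Continuous fun w : CC0 × CC0 => w.2.1 / w.1.1 :=
    Continuous.div₀ (by fun_prop) (by fun_prop) fun w => w.1.2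
  obtain ⟨L, l0, l1, l2, -⟩ := hlp (X := X) p (Continuous.subtype_mk Complex.continuous_exp _) U
    (Complex.isOpen_slitPlane.preimage hdiv)
    (fun b => by change b.1 / b.1 ∈ Complex.slitPlane; rw [div_self b.2]; exact Complex.one_mem_slitPlane)
    (fun w : ℂ × CC0 => w.1 + Complex.log (w.2.1 / Complex.exp w.1))
    (by
      refine continuous_fst.continuousOn.add (ContinuousOn.clog ?_ ?_)
      · exact (Continuous.div₀ (by fun_prop) (by fun_prop) fun w => Complex.exp_ne_zero _).continuousOn
      · exact fun w hw => hw)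
    (fun e b h => by
      apply Subtype.ext
      change Complex.exp (e + Complex.log (b.1 / Complex.exp e)) = b.1
      rw [Complex.exp_add, Complex.exp_log (div_ne_zero b.2 (Complex.exp_ne_zero _))]
      field_simp [Complex.exp_ne_zero])
    (fun e => by
      change e + Complex.log (Complex.exp e / Complex.exp e) = e
      rw [div_self (Complex.exp_ne_zero _), Complex.log_one, add_zero])
    (ContinuousMap.const X 0) ⟨fun w => ⟨ζ (w.2, w.1), h0 _⟩, by fun_prop⟩
    (fun x => by
      apply Subtype.ext
      change ζ (x, 0) = Complex.exp 0
      rw [h1 (x, 0) (Or.inr (Or.inl rfl)), Complex.exp_zero])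
  have hs : ∀ x ∈ K, ∀ s, L (s, x) = 0 := fun x hx s => l2 x (fun s => by
    apply Subtype.ext
    change ζ (x, s) = ζ (x, 0)
    rw [h1 (x, s) (Or.inl hx), h1 (x, 0) (Or.inl hx)]) s
  have hv : ∀ w, Complex.exp (L w) = ζ (w.2, w.1) := fun w => congrArg Subtype.val (l1 w)
  have hone : ∀ x, L (1, x) = 0 := by
    have hex : ∀ x, Complex.exp (L (1, x)) = 1 := fun x => by rw [hv, h1 (x, 1) (Or.inr (Or.inr rfl))]
    have he : {x | L (1, x) = 0} = {x | ‖L (1, x)‖ < 1} := by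
      ext x
      change L (1, x) = 0 ↔ ‖L (1, x)‖ < 1
      constructor
      · intro h; rw [h]; simp
      · intro h
        obtain ⟨n, hn⟩ := Complex.exp_eq_one_iff.1 (hex x)
        rw [hn] at h ⊢
        have : n = 0 := by
          by_contra hne
          have h3 : (1 : ℝ) ≤ |(n : ℝ)| := by exact_mod_cast Int.one_le_abs hne
          simp at h
          rw [abs_of_pos Real.pi_pos] at h
          nlinarith [Real.pi_gt_three]
        rw [this]; simp
    have hcl : IsClopen {x | L (1, x) = 0} := by
      refine ⟨isClosed_eq (by fun_prop) continuous_const, ?_⟩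
      rw [he]; exact isOpen_lt (by fun_prop) continuous_const
    have := hcl.eq_univ (by obtain ⟨x, hx⟩ := hK; exact ⟨x, hs x hx 1⟩)
    intro x
    have hx : x ∈ {x | L (1, x) = 0} := by rw [this]; trivial
    exact hx
  refine ⟨⟨fun z => L (z.2, z.1), by fun_prop⟩, fun z => hv _, ?_⟩
  rintro ⟨x, t⟩ (h | h | h)
  · exact hs x h t
  · change t = 0 at h; subst h; exact l0 x
  · change t = 1 at h; subst h; exact hone x

theorem conj_im {q a : ℍ[ℝ]} (hq : q ≠ 0) (h : star a = -a) (h2 : a * a = -1) :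
    star (q * a * q⁻¹) = -(q * a * q⁻¹) ∧ (q * a * q⁻¹) * (q * a * q⁻¹) = -1 := by
  constructor
  · have hn : Quaternion.normSq q ≠ 0 := by simpa using hq
    have h3 : star q = Quaternion.normSq q • q⁻¹ := by
      rw [← Quaternion.coe_mul_eq_smul, ← Quaternion.star_mul_self, mul_assoc, mul_inv_cancel₀ hq, mul_one]
    have h4 : star (q⁻¹) = (Quaternion.normSq q)⁻¹ • q := by
      have : q⁻¹ = (Quaternion.normSq q)⁻¹ • star q := by rw [h3, smul_smul, inv_mul_cancel₀ hn, one_smul]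
      rw [this, star_smul, star_star, star_trivial (R := ℝ)]
    rw [star_mul, star_mul, h3, h4, h, smul_mul_assoc, mul_smul_comm, mul_smul_comm, smul_smul, inv_mul_cancel₀ hn,
      one_smul, neg_mul, mul_neg, mul_assoc]
  · have : (q * a * q⁻¹) * (q * a * q⁻¹) = q * (a * (q⁻¹ * q) * a) * q⁻¹ := by noncomm_ring
    rw [this, inv_mul_cancel₀ hq, mul_one, h2, mul_neg_one, neg_mul, mul_inv_cancel₀ hq]

theorem comm_i {q : ℍ[ℝ]} (h : q * qi = qi * q) : q = ((⟨q.re, q.imI⟩ : ℂ) : ℍ[ℝ]) := by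
  have h1 := congrArg QuaternionAlgebra.imJ h
  have h2 := congrArg QuaternionAlgebra.imK h
  simp at h1 h2
  ext <;> simp <;> linarith

theorem coeC_comm (c : ℂ) : (c : ℍ[ℝ]) * qi = qi * (c : ℍ[ℝ]) := by
  ext <;> simp

theorem T_alg {a b e i : ℍ[ℝ]} (h1 : e * i = a * e) (ha : a * a = -1) (hb : b * b = -1) :
    (1 - b * a) * e * i = b * ((1 - b * a) * e) := by
  rw [mul_assoc, h1, ← mul_assoc, ← mul_assoc]
  refine congrArg (· * e) ?_
  have : (1 - b * a) * a = a - b * (a * a) := by noncomm_ring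
  rw [this, ha]
  have : b * (1 - b * a) = b - (b * b) * a := by noncomm_ring
  rw [this, hb]
  noncomm_ring

/-- Hopf lifting -/
theorem hopf_lift {X : Type} [TopologicalSpace X] [CompactSpace X] [PreconnectedSpace X] {K : Set X} (hK : K.Nonempty)
    (w : C((X × I) × I, ℍ[ℝ])) (hw : ∀ z, star (w z) = - w z ∧ w z * w z = -1)
    (hb : ∀ z ∈ bdy (bdy K), w z = qi) :
    ∃ f : C((X × I) × I, ℍ[ℝ]), (∀ z, f z ≠ 0) ∧ (∀ z, f z * qi * (f z)⁻¹ = w z) ∧ ∀ z ∈ bdy (bdy K), f z = 1 := by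
  classical
  let p : HH0 → SS2 := fun q => ⟨q.1 * qi * q.1⁻¹, conj_im q.2 qsi qii⟩
  have hinv : Continuous fun q : HH0 => q.1⁻¹ := continuous_subtype_val.inv₀ fun q => q.2
  have hp : Continuous p := Continuous.subtype_mk
    ((continuous_subtype_val.mul continuous_const).mul hinv) _
  let T : HH0 × SS2 → HH0 := fun u => if h : 1 - u.2.1 * (p u.1).1 ≠ 0 then
    ⟨(2⁻¹ : ℝ) • ((1 - u.2.1 * (p u.1).1) * u.1.1), smul_ne_zero (by norm_num) (mul_ne_zero h u.1.2)⟩ else u.1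
  have hT : ∀ u, 1 - u.2.1 * (p u.1).1 ≠ 0 → (T u).1 = (2⁻¹ : ℝ) • ((1 - u.2.1 * (p u.1).1) * u.1.1) := by
    intro u h
    simp only [T]; rw [dif_pos h]
  have hself : ∀ a : SS2, 1 - a.1 * a.1 ≠ 0 := fun a => by
    rw [a.2.2, sub_neg_eq_add]; intro h; have := congrArg QuaternionAlgebra.re h; simp at this
  obtain ⟨L, l0, l1, l2, -⟩ := hlp (X := X × I) p hp {u : SS2 × SS2 | 1 - u.2.1 * u.1.1 ≠ 0}
    (isOpen_ne_fun (by fun_prop) continuous_const) (fun b => hself b) T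
    (by
      refine (IsInducing.subtypeVal (t := {q : ℍ[ℝ] | q ≠ 0})).continuousOn_iff.2 ?_
      have hc : Continuous fun u : HH0 × SS2 => (2⁻¹ : ℝ) • ((1 - u.2.1 * (p u.1).1) * u.1.1) := by fun_prop
      exact hc.continuousOn.congr fun u hu => hT u hu)
    (by
      intro e b h
      change 1 - b.1 * (p e).1 ≠ 0 at h
      apply Subtype.ext
      change (T (e, b)).1 * qi * ((T (e, b)).1)⁻¹ = b.1
      have hne := (T (e, b)).2
      rw [mul_inv_eq_iff_eq_mul₀ hne, hT (e, b) h, smul_mul_assoc, mul_smul_comm]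
      congr 1
      have h1 : e.1 * qi = (p e).1 * e.1 := by
        change _ = e.1 * qi * e.1⁻¹ * e.1
        rw [mul_assoc _ _ e.1, inv_mul_cancel₀ e.2, mul_one]
      exact T_alg h1 (p e).2.2 b.2.2)
    (by
      intro e
      apply Subtype.ext
      rw [hT (e, p e) (hself _)]
      change (2⁻¹ : ℝ) • ((1 - (p e).1 * (p e).1) * e.1) = e.1
      rw [(p e).2.2, sub_neg_eq_add, add_mul, one_mul, ← two_smul ℝ, smul_smul]
      norm_num)
    (ContinuousMap.const _ ⟨1, one_ne_zero⟩) ⟨fun u => ⟨w (u.2, u.1), hw _⟩, by fun_prop⟩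
    (fun x => by
      apply Subtype.ext
      change w (x, 0) = 1 * qi * 1⁻¹
      rw [hb (x, 0) (Or.inr (Or.inl rfl))]; simp)
  have hs : ∀ x ∈ bdy K, ∀ s, (L (s, x)).1 = 1 := fun x hx s => congrArg Subtype.val (l2 x (fun s => by
    apply Subtype.ext
    change w (x, s) = w (x, 0)
    rw [hb (x, s) (Or.inl hx), hb (x, 0) (Or.inl hx)]) s)
  have hv : ∀ u, (L u).1 * qi * ((L u).1)⁻¹ = w (u.2, u.1) := fun u => congrArg Subtype.val (l1 u)
  have hcm : ∀ x, (L (1, x)).1 = ((⟨(L (1, x)).1.re, (L (1, x)).1.imI⟩ : ℂ) : ℍ[ℝ]) := fun x => comm_i (by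
    have := hv (1, x)
    rw [hb (x, 1) (Or.inr (Or.inr rfl)), mul_inv_eq_iff_eq_mul₀ (L (1, x)).2] at this
    exact this)
  have hL : Continuous fun u => (L u).1 := by fun_prop
  have hL1 : Continuous fun x => (L (1, x)).1 := hL.comp (by fun_prop)
  obtain ⟨a, a1, a2⟩ := exp_lift hK ⟨fun x => (⟨(L (1, x)).1.re, (L (1, x)).1.imI⟩ : ℂ),
      by
        have h1 := Quaternion.continuous_re.comp hL1
        have h2 := Quaternion.continuous_imI.comp hL1
        exact Complex.equivRealProdCLM.symm.continuous.comp (h1.prodMk h2)⟩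
    (fun x h => (L (1, x)).2 (by
      rw [hcm x]
      change (⟨(L (1, x)).1.re, (L (1, x)).1.imI⟩ : ℂ) = 0 at h
      rw [h]; ext <;> simp))
    (fun x hx => by
      change (⟨(L (1, x)).1.re, (L (1, x)).1.imI⟩ : ℂ) = 1
      rw [hs x hx]; apply Complex.ext <;> simp)
  have hco : Continuous fun c : ℂ => (c : ℍ[ℝ]) := by
    have : (fun c : ℂ => (c : ℍ[ℝ])) = fun c => c.re • (1 : ℍ[ℝ]) + c.im • qi := by
      funext c; ext <;> simp
    rw [this]; fun_prop
  have hE : ∀ c : ℂ, ((Complex.exp c : ℂ) : ℍ[ℝ]) ≠ 0 := fun c h => Complex.exp_ne_zero c (by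
    have h1 := congrArg QuaternionAlgebra.re h
    have h2 := congrArg QuaternionAlgebra.imI h
    apply Complex.ext <;> simpa using ‹_›)
  have hmul : ∀ c d : ℂ, ((c * d : ℂ) : ℍ[ℝ]) = c * d := fun c d => by
    ext <;> simp
  have hsplit : ∀ c : ℂ, ((Complex.exp c : ℂ) : ℍ[ℝ]) * ((Complex.exp (-c) : ℂ) : ℍ[ℝ]) = 1 := fun c => by
    rw [← hmul, ← Complex.exp_add, add_neg_cancel, Complex.exp_zero]; ext <;> simp
  refine ⟨⟨fun z => (L (z.2, z.1)).1 * ((Complex.exp (-((z.2 : ℝ) * a z.1)) : ℂ) : ℍ[ℝ]), ?_⟩, ?_, ?_, ?_⟩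
  · exact (hL.comp (by fun_prop)).mul (hco.comp (by fun_prop))
  · exact fun z => mul_ne_zero (L _).2 (hE _)
  · intro z
    change (L (z.2, z.1)).1 * ((Complex.exp (-((z.2 : ℝ) * a z.1)) : ℂ) : ℍ[ℝ]) * qi *
      ((L (z.2, z.1)).1 * ((Complex.exp (-((z.2 : ℝ) * a z.1)) : ℂ) : ℍ[ℝ]))⁻¹ = w z
    rw [mul_assoc (L _).1, coeC_comm, _root_.mul_inv_rev, ← hv (z.2, z.1)]
    set e := ((Complex.exp (-((z.2 : ℝ) * a z.1)) : ℂ) : ℍ[ℝ])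
    have he : e * e⁻¹ = 1 := mul_inv_cancel₀ (hE _)
    calc (L (z.2, z.1)).1 * (qi * e) * (e⁻¹ * ((L (z.2, z.1)).1)⁻¹) = (L (z.2, z.1)).1 * qi * (e * e⁻¹) * ((L (z.2, z.1)).1)⁻¹ := by noncomm_ring
      _ = _ := by rw [he, mul_one]
  · rintro ⟨x, t⟩ hz
    change (L (t, x)).1 * ((Complex.exp (-((t : ℝ) * a x)) : ℂ) : ℍ[ℝ]) = 1
    rcases hz with h | h | h
    · rw [hs x h, a2 x h]; simp
    · change t = 0 at h; subst h
      rw [l0]; simp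
    · change t = 1 at h; subst h
      rw [hcm x]
      have := a1 x
      change Complex.exp (a x) = (⟨(L (1, x)).1.re, (L (1, x)).1.imI⟩ : ℂ) at this
      rw [← this]
      have := hsplit (a x)
      simpa using this

end S6

set_option linter.unusedSectionVars false
set_option linter.unusedVariables false
set_option linter.deprecated false

namespace S6
open Set Topology Module Matrix
open scoped unitInterval Quaternion

/-- maps constant on `K` -/
def SK {X Z : Type} [TopologicalSpace X] [TopologicalSpace Z] (K : Set X) : Set C(X, Z) :=
  {h | ∀ q ∈ K, ∀ q' ∈ K, h q = h q'}

theorem based_null {X Z : Type} [TopologicalSpace X] [CompactSpace X] [T2Space X] [TopologicalSpace Z] {K : Set X}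
    (hK : IsClosed K) (hne : K.Nonempty) (hc : Clamp X K) {f : C(X, Z)} {c z : Z} (hf : ∀ x ∈ K, f x = z)
    (h : JoinedIn (SK K) f (ContinuousMap.const X c)) :
    JoinedIn {h : C(X, Z) | ∀ x ∈ K, h x = z} f (ContinuousMap.const X z) := by
  obtain ⟨κ, N, hN, hKN, k0, k1, k2⟩ := hc
  obtain ⟨H, h0, h1, h2⟩ := homotopy_of_joinedIn h
  obtain ⟨lm, m0, m1, m2⟩ := exists_continuous_zero_one_of_isClosed hN.isClosed_compl hK
    (disjoint_compl_left_iff_subset.2 hKN)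
  obtain ⟨x0, hx0⟩ := hne
  let ν : X → I := fun x => ⟨1 - lm x, by have := (m2 x).2; linarith, by have := (m2 x).1; linarith⟩
  have hν : Continuous ν := Continuous.subtype_mk (by fun_prop) _
  have ν0 : ∀ x ∈ K, ν x = 0 := fun x hx => by
    apply Subtype.ext; change 1 - lm x = 0; rw [m1 hx]; simp
  have hmul : ∀ t x, H (t * ν x, κ (1, x)) = H (t * ν x, κ (1, x)) := fun _ _ => rfl
  refine (joinedIn_of_homotopy (f := f) (g := ⟨fun x => f (κ (1, x)), by fun_prop⟩)
    ⟨fun w => f (κ w), by fun_prop⟩ (fun x => by change f (κ (0, x)) = f x; rw [k0]) (fun x => rfl) ?_).trans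
    ((joinedIn_of_homotopy (g := ⟨fun x => H (ν x, κ (1, x)), by fun_prop⟩)
      ⟨fun w => H (w.1 * ν w.2, κ (1, w.2)), by fun_prop⟩ ?_ ?_ ?_).trans
      (joinedIn_of_homotopy ⟨fun w => H (unitInterval.symm w.1 * ν w.2, x0), by fun_prop⟩ ?_ ?_ ?_))
  · intro s x hx
    exact hf _ (k1 s x hx)
  · intro x
    change H (0 * ν x, κ (1, x)) = f (κ (1, x))
    rw [zero_mul, h0]
  · intro x
    change H (1 * ν x, κ (1, x)) = H (ν x, κ (1, x))
    rw [one_mul]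
  · intro s x hx
    change H (s * ν x, κ (1, x)) = z
    rw [ν0 x hx, mul_zero, h0]
    exact hf _ (k1 1 x hx)
  · intro x
    change H (unitInterval.symm 0 * ν x, x0) = H (ν x, κ (1, x))
    rw [unitInterval.symm_zero, one_mul]
    by_cases hx : x ∈ N
    · exact h2 (ν x) x0 hx0 _ (k2 x hx)
    · have : ν x = 1 := by apply Subtype.ext; change 1 - lm x = 1; rw [m0 hx]; simp
      rw [this, h1, h1]; rfl
  · intro x
    change H (unitInterval.symm 1 * ν x, x0) = z
    rw [unitInterval.symm_one, zero_mul, h0, hf x0 hx0]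
  · intro s x hx
    change H (unitInterval.symm s * ν x, x0) = z
    rw [ν0 x hx, mul_zero, h0, hf x0 hx0]

theorem K4_ne : K4.Nonempty := ⟨((((0, 0), 0), 0), 0), Or.inr (Or.inl rfl)⟩

theorem K4_closed : IsClosed K4 := by
  unfold K4
  exact bdy_closed (bdy_closed (bdy_closed (bdy_closed (Set.toFinite _).isClosed)))

variable {P : C(unitSphere 6, A1)} {b0 : unitSphere 6}

theorem fib_at (h0 : P b0 = e0) {a : ℍ[ℝ]} (h : star a = -a ∧ a * a = -1) : Fib (P b0) (io a) := by
  rw [h0]; exact fib_io h.1 h.2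

/-- map into a fiber -/
noncomputable def cZ (h0 : P b0 = e0) {X : Type} [TopologicalSpace X] (w : C(X, ℍ[ℝ])) (hw : ∀ x, star (w x) = - w x ∧ w x * w x = -1) :
    C(X, ZP P) :=
  ⟨fun x => ⟨(b0, io (w x)), fib_at h0 (hw x)⟩,
    Continuous.subtype_mk (continuous_const.prodMk (io_cont.comp w.continuous)) _⟩

/-- conjugates of `i` -/
noncomputable def cj1 {X : Type} [TopologicalSpace X] (h : C(X, ℍ[ℝ])) (hh : ∀ x, h x ≠ 0) : C(X, ℍ[ℝ]) :=
  ⟨fun x => h x * qi * (h x)⁻¹, (h.continuous.mul continuous_const).mul (h.continuous.inv₀ hh)⟩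

theorem cj1_im {X : Type} [TopologicalSpace X] (h : C(X, ℍ[ℝ])) (hh : ∀ x, h x ≠ 0) :
    ∀ x, star (cj1 h hh x) = - cj1 h hh x ∧ cj1 h hh x * cj1 h hh x = -1 :=
  fun x => conj_im (hh x) qsi qii

theorem RU_ne {h : C(Q, ℍ[ℝ])} (hh : h ∈ RU K4) : ∀ x, h x ≠ 0 := fun x => (hh x).1.ne_zero

theorem cZ_joined (h0 : P b0 = e0) {h h' : C(Q, ℍ[ℝ])} (hh : h ∈ RU K4) (hh' : h' ∈ RU K4)
    (hj : JoinedIn (RU K4) h h') :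
    JoinedIn (SK K4) (cZ h0 (cj1 h (RU_ne hh)) (cj1_im _ _)) (cZ h0 (cj1 h' (RU_ne hh')) (cj1_im _ _)) := by
  obtain ⟨H, H0, H1, H2⟩ := homotopy_of_joinedIn hj
  have hne : ∀ w, H w ≠ 0 := fun w => (H2 w.1 w.2).1.ne_zero
  refine joinedIn_of_homotopy (cZ h0 (cj1 H hne) (cj1_im _ _)) ?_ ?_ ?_
  · intro x
    refine Subtype.ext (Prod.ext rfl ?_)
    change io (H (0, x) * qi * (H (0, x))⁻¹) = io (h x * qi * (h x)⁻¹)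
    rw [H0]
  · intro x
    refine Subtype.ext (Prod.ext rfl ?_)
    change io (H (1, x) * qi * (H (1, x))⁻¹) = io (h' x * qi * (h' x)⁻¹)
    rw [H1]
  · intro t q hq q' hq'
    refine Subtype.ext (Prod.ext rfl ?_)
    change io (H (t, q) * qi * (H (t, q))⁻¹) = io (H (t, q') * qi * (H (t, q'))⁻¹)
    have e1 : H (t, q) = 1 := (H2 t q).2 hq
    have e2 : H (t, q') = 1 := (H2 t q').2 hq'
    rw [e1, e2]

theorem to_i {a : ℍ[ℝ]} (h : a * a = -1) : ∃ q : ℍ[ℝ], q ≠ 0 ∧ q * a * q⁻¹ = qi := by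
  by_cases ha : 1 - qi * a = 0
  · have : a = -qi := by
      have h1 : qi * (1 - qi * a) = qi - (qi * qi) * a := by noncomm_ring
      rw [ha, qii, mul_zero] at h1
      rw [eq_neg_iff_add_eq_zero, h1]; noncomm_ring
    have hj : qj ≠ 0 := fun h => by have := congrArg QuaternionAlgebra.imJ h; simp at this
    refine ⟨qj, hj, ?_⟩
    rw [mul_inv_eq_iff_eq_mul₀ hj, this, mul_neg, qij, neg_neg]
  · refine ⟨_, ha, ?_⟩
    rw [mul_inv_eq_iff_eq_mul₀ ha]
    have h1 : qi * (1 - qi * a) = qi - (qi * qi) * a := by noncomm_ring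
    have h2 : (1 - qi * a) * a = a - qi * (a * a) := by noncomm_ring
    rw [h1, h2, h, qii]; noncomm_ring

theorem path_one {q : ℍ[ℝ]} (hq : q ≠ 0) : ∃ γ : C(I, ℍ[ℝ]), (∀ t, γ t ≠ 0) ∧ γ 0 = 1 ∧ γ 1 = q := by
  have hr : 1 < Module.rank ℝ ℍ[ℝ] := by rw [Quaternion.rank_eq_four]; norm_num
  obtain ⟨γ, hγ⟩ := (isPathConnected_compl_singleton_of_one_lt_rank hr 0).joinedIn 1 one_ne_zero q hq
  exact ⟨γ, fun t => hγ t, γ.source, γ.target⟩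

theorem reduce (hP : PF P) (h0 : P b0 = e0)
    (hyp : ∀ (h : C(Q, ℍ[ℝ])) (hh : h ∈ RU K4), ∃ c, JoinedIn (SK K4) (cZ h0 (cj1 h (RU_ne hh)) (cj1_im _ _)) (ContinuousMap.const Q c))
    (f : C(Q, ZP P)) (z : ZP P) (hf : ∀ q ∈ K4, f q = z) :
    JoinedIn {h : C(Q, ZP P) | ∀ x ∈ K4, h x = z} f (ContinuousMap.const Q z) := by
  -- move over a single point
  obtain ⟨L, l0, l1, l2⟩ := hP.toFiber cubeQ (by norm_num) f z.1.1
  have hLK : ∀ s, ∀ q ∈ K4, L (s, q) = z := fun s q hq => by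
    rw [l2 q (by rw [hf q hq]), hf q hq]
  have j1 : JoinedIn (SK K4) f (L.curry 1) := joinedIn_of_homotopy L l0 (fun x => rfl) (by
    intro t q hq q' hq'
    change L (t, q) = L (t, q')
    rw [hLK t q hq, hLK t q' hq'])
  obtain ⟨G, G0, G1, -⟩ := sphere_contr (n := 6) cubeLike_unit (by norm_num) (ContinuousMap.const _ z.1.1) b0
  obtain ⟨M, M0, M1, -, M3⟩ := hP.lift (L.curry 1) ⟨fun w => G (w.1, fun _ => 0), by fun_prop⟩ (fun x => by
    change G (0, fun _ => 0) = (L (1, x)).1.1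
    rw [G0, l1]; rfl)
  have j2 : JoinedIn (SK K4) (L.curry 1) (M.curry 1) := joinedIn_of_homotopy M M0 (fun x => rfl) (by
    intro t q hq q' hq'
    exact M3 q q' (by change L (1, q) = L (1, q'); rw [hLK 1 q hq, hLK 1 q' hq']) (fun s => rfl) t)
  have hMb : ∀ q, (M (1, q)).1.1 = b0 := fun q => by rw [M1]; exact G1 _
  have hMF : ∀ q, Fib e0 (M (1, q)).1.2 := fun q => by
    rw [← h0, ← hMb q]; exact (M (1, q)).2
  have hMc : Continuous fun q => (M (1, q)).1.2 := by fun_prop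
  let w : C(Q, ℍ[ℝ]) := ⟨fun q => (M (1, q)).1.2 0 0, hMc.matrix_elem 0 0⟩
  have hw : ∀ q, (M (1, q)).1.2 = io (w q) ∧ star (w q) = - w q ∧ w q * w q = -1 := fun q => fib_e0 (hMF q)
  obtain ⟨x0, hx0⟩ := K4_ne
  have hwK : ∀ q ∈ K4, w q = w x0 := fun q hq => by
    have := j2.target_mem q hq x0 hx0
    change M (1, q) = M (1, x0) at this
    change (M (1, q)).1.2 0 0 = (M (1, x0)).1.2 0 0
    rw [this]
  obtain ⟨q0, hq0, hq1⟩ := to_i (hw x0).2.2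
  obtain ⟨γ, γn, γ0, γ1⟩ := path_one hq0
  have hγi : Continuous fun t => (γ t)⁻¹ := γ.continuous.inv₀ γn
  let W : C(I × Q, ℍ[ℝ]) := ⟨fun u => γ u.1 * w u.2 * (γ u.1)⁻¹,
    ((γ.continuous.comp continuous_fst).mul (w.continuous.comp continuous_snd)).mul (hγi.comp continuous_fst)⟩
  have hW : ∀ u, star (W u) = -W u ∧ W u * W u = -1 := fun u => conj_im (γn _) (hw _).2.1 (hw _).2.2
  have hWK : ∀ q ∈ K4, W (1, q) = qi := fun q hq => by
    change γ 1 * w q * (γ 1)⁻¹ = qi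
    rw [γ1, hwK q hq, hq1]
  obtain ⟨h, hne, hi, hb⟩ := hopf_lift (X := (I × I) × I) (K := bdy (bdy {0, 1}))
    ⟨((0, 0), 0), Or.inr (Or.inl rfl)⟩ (W.curry 1) (fun q => hW (1, q)) hWK
  have hh : h ∈ RU K4 := fun x => ⟨isUnit_iff_ne_zero.2 (hne x), hb x⟩
  obtain ⟨c, hc⟩ := hyp h hh
  have j3 : JoinedIn (SK K4) (M.curry 1) (cZ h0 (cj1 h (RU_ne hh)) (cj1_im _ _)) := by
    refine joinedIn_of_homotopy (cZ h0 W hW) ?_ ?_ ?_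
    · intro q
      refine Subtype.ext (Prod.ext (hMb q).symm ?_)
      change io (γ 0 * w q * (γ 0)⁻¹) = (M (1, q)).1.2
      rw [γ0, one_mul, inv_one, mul_one, ← (hw q).1]
    · intro q
      refine Subtype.ext (Prod.ext rfl ?_)
      change io (W (1, q)) = io (h q * qi * (h q)⁻¹)
      rw [hi]; rfl
    · intro t q hq q' hq'
      refine Subtype.ext (Prod.ext rfl ?_)
      change io (γ t * w q * (γ t)⁻¹) = io (γ t * w q' * (γ t)⁻¹)
      rw [hwK q hq, hwK q' hq']
  exact based_null K4_closed K4_ne clamp_K4 hf (((j1.trans j2).trans j3).trans hc)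

end S6

set_option linter.unusedSectionVars false
set_option linter.unusedVariables false
set_option linter.deprecated false

namespace S6
open Set Topology Module Matrix
open scoped unitInterval Quaternion

/-- column matrices -/
noncomputable def col (a b : ℍ[ℝ]) : A1 := !![a, 0; b, 0]

theorem col_star_mul (a b : ℍ[ℝ]) : star (col a b) * col a b = (Quaternion.normSq a + Quaternion.normSq b) • e0 := by
  have h : ∀ q : ℍ[ℝ], star q * q = Quaternion.normSq q • (1 : ℍ[ℝ]) := fun q => by
    rw [Quaternion.star_mul_self, ← Quaternion.coe_mul_eq_smul, mul_one]
  ext1 i j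
  rw [Matrix.mul_apply, Fin.sum_univ_two, Matrix.smul_apply, Matrix.star_apply, Matrix.star_apply]
  unfold col e0 io
  fin_cases i <;> fin_cases j <;> simp [h, add_smul]

theorem col_mul_e0 (a b : ℍ[ℝ]) : col a b * e0 = col a b := by
  ext1 i j
  rw [Matrix.mul_apply, Fin.sum_univ_two]
  unfold col e0 io
  fin_cases i <;> fin_cases j <;> simp

theorem col_zero (a : ℍ[ℝ]) : col a 0 = io a := rfl

/-- normalized columns -/
noncomputable def Yc (p : ℍ[ℝ] × ℍ[ℝ]) : A1 := (Real.sqrt (Quaternion.normSq p.1 + Quaternion.normSq p.2))⁻¹ • col p.1 p.2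

theorem nsq2_pos {p : ℍ[ℝ] × ℍ[ℝ]} (h : p ≠ 0) : 0 < Quaternion.normSq p.1 + Quaternion.normSq p.2 := by
  have h1 : 0 ≤ Quaternion.normSq p.1 := Quaternion.normSq_nonneg
  have h2 : 0 ≤ Quaternion.normSq p.2 := Quaternion.normSq_nonneg
  refine lt_of_le_of_ne (by positivity) fun h3 => h ?_
  refine Prod.ext ?_ ?_
  · exact Quaternion.normSq_eq_zero.1 (by linarith)
  · exact Quaternion.normSq_eq_zero.1 (by linarith)

theorem inv_sqrt_sq {t : ℝ} (h : 0 < t) : (Real.sqrt t)⁻¹ * (Real.sqrt t)⁻¹ * t = 1 := by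
  rw [← mul_inv, Real.mul_self_sqrt h.le, inv_mul_cancel₀ h.ne']

theorem Yc_Un {p : ℍ[ℝ] × ℍ[ℝ]} (h : p ≠ 0) : Yc p ∈ Un e0 := by
  refine ⟨?_, ?_⟩
  · unfold Yc
    rw [star_smul, star_trivial (R := ℝ), smul_mul_smul_comm, col_star_mul, smul_smul, inv_sqrt_sq (nsq2_pos h), one_smul]
  · unfold Yc; rw [smul_mul_assoc, col_mul_e0]

theorem Yc_conj {a w : ℍ[ℝ]} (h : a ≠ 0) : Yc (a, 0) * io w * star (Yc (a, 0)) = io (a * w * a⁻¹) := by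
  have hn : 0 < Quaternion.normSq a := lt_of_le_of_ne Quaternion.normSq_nonneg (fun h' => h (Quaternion.normSq_eq_zero.1 h'.symm))
  have h3 : star a = Quaternion.normSq a • a⁻¹ := by
    rw [← Quaternion.coe_mul_eq_smul, ← Quaternion.star_mul_self, mul_assoc, mul_inv_cancel₀ h, mul_one]
  unfold Yc
  simp only [map_zero, add_zero]
  rw [col_zero, star_smul, star_trivial (R := ℝ), smul_mul_assoc, smul_mul_smul_comm, io_star, io_mul, io_mul, h3, mul_smul_comm,
    io_smul, smul_smul, inv_sqrt_sq hn, one_smul]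

theorem Yc_star {a : ℍ[ℝ]} (h : a ≠ 0) : Yc (a, 0) * star (Yc (a, 0)) = e0 := by
  have := Yc_conj (w := 1) h
  rw [mul_one, mul_inv_cancel₀ h] at this
  have h2 := (Yc_Un (p := (a, 0)) (by simpa using h)).2
  change _ * e0 * _ = e0 at this
  rwa [h2] at this

theorem Yc_cont {X : Type} [TopologicalSpace X] (H : C(X, ℍ[ℝ] × ℍ[ℝ])) (hH : ∀ x, H x ≠ 0) : Continuous fun x => Yc (H x) := by
  unfold Yc
  have h1 : Continuous fun x => (H x).1 := by fun_prop
  have h2 : Continuous fun x => (H x).2 := by fun_prop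
  have a : Continuous fun x => (Real.sqrt (Quaternion.normSq (H x).1 + Quaternion.normSq (H x).2))⁻¹ := by
    refine Continuous.inv₀ (Real.continuous_sqrt.comp ?_) fun x => (Real.sqrt_pos.2 (nsq2_pos (hH x))).ne'
    exact (Quaternion.continuous_normSq.comp h1).add (Quaternion.continuous_normSq.comp h2)
  have b : Continuous fun x => col (H x).1 (H x).2 := by
    unfold col
    refine continuous_matrix fun i j => ?_
    fin_cases i <;> fin_cases j <;> simp <;> first | assumption | exact continuous_const
  exact a.smul b

/-- coordinates -/
noncomputable def xs (z : Q × I) : Fin 6 → ℝ := ![z.1.1.1.1.1, z.1.1.1.1.2, z.1.1.1.2, z.1.1.2, z.1.2, z.2]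

/-- projection to the cube -/
noncomputable def pr (x : Fin 6 → ℝ) : Q × I :=
  (((((projIcc 0 1 zero_le_one (x 0), projIcc 0 1 zero_le_one (x 1)), projIcc 0 1 zero_le_one (x 2)),
    projIcc 0 1 zero_le_one (x 3)), projIcc 0 1 zero_le_one (x 4)), projIcc 0 1 zero_le_one (x 5))

theorem pr_cont : Continuous pr := by
  unfold pr
  have := continuous_projIcc (a := (0 : ℝ)) (b := 1) (h := zero_le_one)
  fun_prop

theorem xs_cont : Continuous xs := by
  unfold xs
  refine continuous_pi fun i => ?_
  fin_cases i <;> simp <;> fun_prop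

theorem pr_xs (z : Q × I) : pr (xs z) = z := by
  obtain ⟨⟨⟨⟨⟨a, b⟩, c⟩, d⟩, e⟩, t⟩ := z
  simp [pr, xs]

theorem pr_mem {x : Fin 6 → ℝ} (h : ∃ i, x i ≤ 0 ∨ 1 ≤ x i) : pr x ∈ bdy K4 := by
  obtain ⟨i, h⟩ := h
  have key : projIcc 0 1 zero_le_one (x i) = 0 ∨ projIcc 0 1 zero_le_one (x i) = 1 := by
    rcases h with h | h
    · left; exact projIcc_of_le_left zero_le_one h
    · right; exact projIcc_of_right_le zero_le_one h
  fin_cases i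
  · exact Or.inl (Or.inl (Or.inl (Or.inl (Or.inl key))))
  · exact Or.inl (Or.inl (Or.inl (Or.inl (Or.inr key))))
  · exact Or.inl (Or.inl (Or.inl (Or.inr key)))
  · exact Or.inl (Or.inl (Or.inr key))
  · exact Or.inl (Or.inr key)
  · exact Or.inr key

theorem xs_mem {z : Q × I} (h : z ∈ bdy K4) : ∃ i, xs z i = 0 ∨ xs z i = 1 := by
  have key : ∀ t : I, (t = 0 ∨ t = 1) → (t : ℝ) = 0 ∨ (t : ℝ) = 1 := by
    rintro t (rfl | rfl) <;> simp
  rcases h with ((((h | h) | h) | h) | h) | h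
  · exact ⟨0, key _ h⟩
  · exact ⟨1, key _ h⟩
  · exact ⟨2, key _ h⟩
  · exact ⟨3, key _ h⟩
  · exact ⟨4, key _ h⟩
  · exact ⟨5, key _ h⟩

theorem xs_bd (z : Q × I) (i : Fin 6) : 0 ≤ xs z i ∧ xs z i ≤ 1 := by
  fin_cases i
  exacts [z.1.1.1.1.1.2, z.1.1.1.1.2.2, z.1.1.1.2.2, z.1.1.2.2, z.1.2.2, z.2.2]

end S6

set_option linter.unusedSectionVars false
set_option linter.unusedVariables false
set_option linter.deprecated false

namespace S6
open Set Topology Module Matrix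
open scoped unitInterval Quaternion

theorem us_sum (b : unitSphere 6) : ∑ i : Fin 6, (b.1 i.castSucc) ^ 2 + (b.1 (Fin.last 6)) ^ 2 = 1 := by
  have h : ‖b.1‖ = 1 := by simpa using b.2
  have h2 := EuclideanSpace.real_norm_sq_eq b.1
  rw [h, Fin.sum_univ_castSucc] at h2
  rw [← h2]; norm_num

/-- cube coordinates of a point of the sphere -/
noncomputable def xP (b : unitSphere 6) : Fin 6 → ℝ := fun i => 1 / 2 + b.1 i.castSucc / max (b.1 (Fin.last 6)) (1 / 10)

theorem xP_cont : Continuous xP := by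
  have h : ∀ j, Continuous fun b : unitSphere 6 => b.1 j := fun j => (PiLp.continuous_apply 2 _ j).comp continuous_subtype_val
  refine continuous_pi fun i => continuous_const.add (Continuous.div (h _) ((h _).max continuous_const) fun b => ?_)
  have : (1 / 10 : ℝ) ≤ max (b.1 (Fin.last 6)) (1 / 10) := le_max_right _ _
  exact ne_of_gt (by linarith)

theorem xP_bdy {b : unitSphere 6} (h : 1 / 10 = b.1 (Fin.last 6)) : pr (xP b) ∈ bdy K4 := by
  apply pr_mem
  by_contra hc
  push Not at hc
  have hs := us_sum b
  have : ∀ i : Fin 6, (b.1 i.castSucc) ^ 2 ≤ 1 / 400 := fun i => by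
    obtain ⟨h1, h2⟩ := hc i
    simp only [xP, ← h, max_self] at h1 h2
    have h3 : b.1 i.castSucc / (1 / 10) = 10 * b.1 i.castSucc := by ring
    rw [h3] at h1 h2
    nlinarith
  have h4 := Finset.sum_le_sum (s := Finset.univ) fun i _ => this i
  simp at h4
  rw [← h] at hs
  norm_num at h4 hs
  linarith

theorem geo {Y : Type} [TopologicalSpace Y] (S : C(Q × I, Y)) (e : Y) (hS : ∀ z ∈ bdy K4, S z = e)
    (κ : C(Q × I, Q × I)) (N : Set (Q × I)) (hN : IsOpen N) (hKN : bdy K4 ⊆ N) (hκ : ∀ z ∈ N, κ z ∈ bdy K4) :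
    ∃ (P : C(unitSphere 6, Y)) (b0 : unitSphere 6) (c : C(Q × I, unitSphere 6)), (∀ b, ∃ z, P b = S z) ∧ P b0 = e ∧
      (∀ z, P (c z) = S (κ z)) ∧ ∀ z ∈ bdy K4, c z = b0 := by
  have hlast : Continuous fun b : unitSphere 6 => b.1 (Fin.last 6) :=
    (PiLp.continuous_apply 2 _ _).comp continuous_subtype_val
  let P : C(unitSphere 6, Y) := ⟨fun b => if 1 / 10 ≤ b.1 (Fin.last 6) then S (pr (xP b)) else e,
    Continuous.if_le (S.continuous.comp (pr_cont.comp xP_cont)) continuous_const continuous_const hlast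
      fun b hb => hS _ (xP_bdy hb)⟩
  have hP : ∀ b, P b = if 1 / 10 ≤ b.1 (Fin.last 6) then S (pr (xP b)) else e := fun _ => rfl
  have hcl : IsClosed (bdy K4) := bdy_closed K4_closed
  obtain ⟨lm, m0, m1, m2⟩ := exists_continuous_zero_one_of_isClosed hN.isClosed_compl hcl
    (disjoint_compl_left_iff_subset.2 hKN)
  have hlm : ∀ z, lm z ≠ 0 → κ z ∈ bdy K4 := fun z hz => by
    by_contra h
    exact hz (m0 fun h' => h (hκ z h'))
  let V : Q × I → EuclideanSpace ℝ (Fin 7) := fun z =>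
    WithLp.toLp 2 (Fin.snoc (α := fun _ => ℝ) (fun i : Fin 6 => (1 - lm z) * (xs (κ z) i - 1 / 2)) (1 - 2 * lm z))
  have V1 : ∀ z (i : Fin 6), V z i.castSucc = (1 - lm z) * (xs (κ z) i - 1 / 2) := fun z i => by simp [V]
  have V2 : ∀ z, V z (Fin.last 6) = 1 - 2 * lm z := fun z => Fin.snoc_last (n := 6) (α := fun _ => ℝ) (1 - 2 * lm z) (fun i : Fin 6 => (1 - lm z) * (xs (κ z) i - 1 / 2))
  have hxk : Continuous fun z => xs (κ z) := xs_cont.comp κ.continuous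
  have Vc : Continuous V := by
    refine (PiLp.continuous_toLp 2 _).comp (continuous_pi fun i => ?_)
    refine Fin.lastCases ?_ (fun i => ?_) i
    · simp only [Fin.snoc_last]; fun_prop
    · simp only [Fin.snoc_castSucc]
      have : Continuous fun z => xs (κ z) i := (continuous_apply i).comp hxk
      fun_prop
  have V0 : ∀ z, V z ≠ 0 := fun z hz => by
    have h1 : 1 - 2 * lm z = 0 := by rw [← V2, hz]; rfl
    obtain ⟨i, hi⟩ := xs_mem (hlm z (by intro h; rw [h] at h1; norm_num at h1))
    have h2 : (1 - lm z) * (xs (κ z) i - 1 / 2) = 0 := by rw [← V1, hz]; rfl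
    have h3 : lm z = 1 / 2 := by linarith
    rw [h3] at h2
    rcases hi with hi | hi <;> rw [hi] at h2 <;> norm_num at h2
  have Vp : ∀ z, 0 < ‖V z‖ := fun z => norm_pos_iff.2 (V0 z)
  have Vs : ∀ z, ‖V z‖⁻¹ • V z ∈ Metric.sphere (0 : EuclideanSpace ℝ (Fin 7)) 1 := fun z => by
    rw [mem_sphere_zero_iff_norm, norm_smul, norm_inv, norm_norm, inv_mul_cancel₀ (Vp z).ne']
  have Vsc : Continuous fun z => ‖V z‖⁻¹ • V z := (Vc.norm.inv₀ fun z => (Vp z).ne').smul Vc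
  let c : C(Q × I, unitSphere 6) := ⟨fun z => ⟨‖V z‖⁻¹ • V z, Vs z⟩, Continuous.subtype_mk Vsc Vs⟩
  have c1 : ∀ z j, (c z).1 j = ‖V z‖⁻¹ * V z j := fun z j => rfl
  let b0 : unitSphere 6 := ⟨EuclideanSpace.single (Fin.last 6) (-1 : ℝ), by simp⟩
  refine ⟨P, b0, c, ?_, ?_, ?_, ?_⟩
  · intro b
    by_cases h : 1 / 10 ≤ b.1 (Fin.last 6)
    · exact ⟨_, by rw [hP, if_pos h]⟩
    · refine ⟨(((((0, 0), 0), 0), 0), 0), ?_⟩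
      rw [hP, if_neg h, hS]
      exact Or.inr (Or.inl rfl)
  · rw [hP, if_neg]
    simp [b0]; norm_num
  · intro z
    have hVp := Vp z
    have hip : 0 < ‖V z‖⁻¹ := inv_pos.2 hVp
    have ratio : 1 / 10 ≤ (c z).1 (Fin.last 6) → ∀ i, xP (c z) i = 1 / 2 + V z i.castSucc / V z (Fin.last 6) := by
      intro h i
      unfold xP
      rw [max_eq_left h, c1, c1, mul_div_mul_left _ _ hip.ne']
    by_cases hl : lm z = 0
    · have hn := EuclideanSpace.real_norm_sq_eq (V z)
      rw [Fin.sum_univ_castSucc] at hn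
      simp only [V1, V2, hl] at hn
      have hb : ∀ i : Fin 6, ((1 - 0) * (xs (κ z) i - 1 / 2)) ^ 2 ≤ 1 / 4 := fun i => by
        obtain ⟨h1, h2⟩ := xs_bd (κ z) i
        nlinarith
      have h4 := Finset.sum_le_sum (s := Finset.univ) fun i _ => hb i
      rw [Finset.sum_const, Finset.card_univ, Fintype.card_fin, nsmul_eq_mul] at h4
      have hle : ‖V z‖ ≤ 10 := by
        by_contra hc
        push Not at hc
        norm_num at h4 hn
        nlinarith
      have h5 : 1 / 10 ≤ (c z).1 (Fin.last 6) := by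
        rw [c1, V2, hl, mul_zero, sub_zero, mul_one, ← one_div]
        exact one_div_le_one_div_of_le hVp hle
      rw [hP, if_pos h5]
      have : xP (c z) = xs (κ z) := by
        funext i
        rw [ratio h5, V1, V2, hl]; ring
      rw [this, pr_xs]
    · have hk := hlm z hl
      rw [hS _ hk, hP]
      split_ifs with h5
      · apply hS
        apply pr_mem
        obtain ⟨i, hi⟩ := xs_mem hk
        refine ⟨i, ?_⟩
        rw [ratio h5, V1, V2]
        have h6 : 0 < 1 - 2 * lm z := by
          rw [c1, V2] at h5
          by_contra hc
          push Not at hc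
          have := mul_nonneg hip.le (by linarith : 0 ≤ -(1 - 2 * lm z))
          linarith
        have h7 := (m2 z).1
        rcases hi with hi | hi <;> rw [hi]
        · left
          have : (1 - lm z) * (0 - 1 / 2) / (1 - 2 * lm z) ≤ -1 / 2 := by
            rw [div_le_iff₀ h6]; linarith
          linarith
        · right
          have : 1 / 2 ≤ (1 - lm z) * (1 - 1 / 2) / (1 - 2 * lm z) := by
            rw [le_div_iff₀ h6]; linarith
          linarith
      · rfl
  · intro z hz
    have hl : lm z = 1 := m1 hz
    have hV : V z = EuclideanSpace.single (Fin.last 6) (-1 : ℝ) := by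
      ext j
      refine Fin.lastCases ?_ (fun i => ?_) j
      · rw [V2, hl]; simp; norm_num
      · rw [V1, hl, EuclideanSpace.single_apply, if_neg (Fin.castSucc_lt_last i).ne]; ring
    apply Subtype.ext
    change ‖V z‖⁻¹ • V z = EuclideanSpace.single (Fin.last 6) (-1 : ℝ)
    rw [hV]; simp

end S6

set_option linter.unusedSectionVars false
set_option linter.unusedVariables false
set_option linter.deprecated false

namespace S6
open Set Topology Module Matrix
open scoped unitInterval Quaternion

theorem star_qi_im : star qi = -qi ∧ qi * qi = -1 := ⟨qsi, qii⟩

theorem final_Q : ∃ P : C(unitSphere 6, A1), PF P ∧ ∀ (f : C(Q, ZP P)) (z : ZP P), (∀ q ∈ K4, f q = z) →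
    JoinedIn {h : C(Q, ZP P) | ∀ x ∈ K4, h x = z} f (ContinuousMap.const Q z) := by
  obtain ⟨g, hg, hmain⟩ := MAIN
  have hfr : finrank ℝ (ℍ[ℝ] × ℍ[ℝ]) = 8 := by
    rw [Module.finrank_prod, Quaternion.finrank_eq_four]
  obtain ⟨H, H0, H1, H2, H3⟩ := sphere_lemma (E := ℍ[ℝ] × ℍ[ℝ]) cubeQ (by rw [hfr]; norm_num)
    ⟨fun q => (g q, 0), by fun_prop⟩ (fun q h => RU_ne hg q (congrArg Prod.fst h)) (1, 0)
    (fun h => one_ne_zero (congrArg Prod.fst h))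
  let R : C(Q × I, A1) := ⟨fun z => Yc (H (z.2, z.1)),
    Yc_cont ⟨fun z : Q × I => H (z.2, z.1), by fun_prop⟩ fun z => H0 _⟩
  have hRU : ∀ z, R z ∈ Un e0 := fun z => Yc_Un (H0 _)
  have hR0 : ∀ q, R (q, 0) = Yc (g q, 0) := fun q => by change Yc (H (0, q)) = _; rw [H1]; rfl
  have hR1 : ∀ q, R (q, 1) = Yc (1, 0) := fun q => by change Yc (H (1, q)) = _; rw [H2]
  have hRK : ∀ q ∈ K4, ∀ t, R (q, t) = Yc (1, 0) := fun q hq t => by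
    change Yc (H (t, q)) = _
    rw [H3]
    change (g q, (0 : ℍ[ℝ])) = _
    rw [show g q = 1 from (hg q).2 hq]
  let S : C(Q × I, A1) := ⟨fun z => R z * star (R z), R.continuous.mul (continuous_star.comp R.continuous)⟩
  have hS : ∀ z ∈ bdy K4, S z = e0 := by
    rintro ⟨q, t⟩ (h | h)
    · change R (q, t) * star (R (q, t)) = e0
      rw [hRK q h, Yc_star one_ne_zero]
    · change R (q, t) * star (R (q, t)) = e0
      change t = 0 ∨ t = 1 at h
      rcases h with rfl | rfl
      · rw [hR0, Yc_star (RU_ne hg q)]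
      · rw [hR1, Yc_star one_ne_zero]
  obtain ⟨κ4, N, hN, hK, k0, k1, k2⟩ := clamp_K4
  let κ : C(Q × I, Q × I) := ⟨fun z => (κ4 (1, z.1), cl1 (1, z.2)), by fun_prop⟩
  obtain ⟨P, b0, c, hP1, hPb, hPc, hc⟩ := geo S e0 hS κ
    ({z | z.1 ∈ N} ∪ {z | (z.2 : ℝ) < 1 / 4 ∨ (3 / 4 : ℝ) < z.2})
    ((hN.preimage continuous_fst).union (cl1_open.preimage continuous_snd))
    (by
      rintro z (h | h)
      · exact Or.inl (hK h)
      · exact Or.inr (cl1_sub h))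
    (by
      rintro z (h | h)
      · exact Or.inl (k2 _ h)
      · exact Or.inr (cl1_one h))
  have hPF : PF P := fun b => by
    obtain ⟨z, hz⟩ := hP1 b
    exact ⟨R z, hRU z, hz.symm⟩
  refine ⟨P, hPF, fun f z hf => reduce hPF hPb (fun h hh => ?_) f z hf⟩
  -- the null homotopy of the generator
  have hfib : ∀ w : Q × I, Fib (P (c w)) (R (κ w) * io qi * star (R (κ w))) := fun w => by
    rw [hPc]
    exact (Un.fib_from e0_star (hRU _) (fib_io qsi qii)).1
  let F : C(I × Q, ZP P) := ⟨fun w => ⟨(c (w.2, w.1), R (κ (w.2, w.1)) * io qi * star (R (κ (w.2, w.1)))), hfib _⟩, by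
    have h1 : Continuous fun w : I × Q => R (κ (w.2, w.1)) := by fun_prop
    refine Continuous.subtype_mk (Continuous.prodMk (by fun_prop) ?_) _
    exact (h1.mul continuous_const).mul (continuous_star.comp h1)⟩
  let y0 : ZP P := ⟨(b0, io qi), fib_at hPb star_qi_im⟩
  have cl10 : cl1 (1, 0) = 0 := projIcc_of_le_left zero_le_one (by norm_num)
  have cl11 : cl1 (1, 1) = 1 := projIcc_of_right_le zero_le_one (by norm_num)
  have Y1 : Yc (1, 0) * io qi * star (Yc (1, 0)) = io qi := by
    rw [Yc_conj one_ne_zero, one_mul, inv_one, mul_one]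
  have F1 : ∀ q, F (1, q) = y0 := fun q => by
    refine Subtype.ext (Prod.ext (hc (q, 1) (Or.inr (Or.inr rfl))) ?_)
    change R (κ4 (1, q), cl1 (1, 1)) * io qi * star (R (κ4 (1, q), cl1 (1, 1))) = io qi
    rw [cl11, hR1, Y1]
  have FK : ∀ t, ∀ q ∈ K4, F (t, q) = y0 := fun t q hq => by
    refine Subtype.ext (Prod.ext (hc (q, t) (Or.inl hq)) ?_)
    change R (κ4 (1, q), cl1 (1, t)) * io qi * star (R (κ4 (1, q), cl1 (1, t))) = io qi
    rw [hRK _ (k1 1 q hq), Y1]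
  obtain ⟨k, gk, hgk, hj⟩ := hmain h hh
  let g' : C(Q, ℍ[ℝ]) := ⟨fun x => g (κ4 (1, x)), by fun_prop⟩
  have hgg' : JoinedIn (RU K4) g g' := by
    refine joinedIn_of_homotopy ⟨fun w => g (κ4 w), by fun_prop⟩ ?_ ?_ ?_
    · intro x; exact congrArg g (k0 x)
    · intro x; rfl
    · intro t x
      exact ⟨(hg _).1, fun hx => (hg _).2 (k1 _ _ hx)⟩
  have hg' : g' ∈ RU K4 := hgg'.target_mem
  obtain ⟨gk', hgk'⟩ := frC k hg'
  have hj2 : JoinedIn (RU K4) h gk' := hj.trans (RU_fr k hgg' hgk hgk')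
  refine ⟨y0, (cZ_joined hPb hh hj2.target_mem hj2).trans ?_⟩
  refine joinedIn_of_homotopy ⟨fun w => F (w.1, frQ k w.2), frQ_cont k F y0 FK⟩ ?_ ?_ ?_
  · intro x
    refine Subtype.ext (Prod.ext (hc (frQ k x, 0) (Or.inr (Or.inl rfl))) ?_)
    change R (κ4 (1, frQ k x), cl1 (1, 0)) * io qi * star (R (κ4 (1, frQ k x), cl1 (1, 0))) =
      io (gk' x * qi * (gk' x)⁻¹)
    rw [cl10, hR0, Yc_conj (RU_ne hg _), hgk']
    rfl
  · intro x; exact F1 _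
  · intro t q hq r hr
    change F (t, frQ k q) = F (t, frQ k r)
    rw [FK _ _ (frQ_K4 hq), FK _ _ (frQ_K4 hr)]

/-- the cube as an iterated product -/
def toQ (y : Fin 5 → I) : Q := ((((y 0, y 1), y 2), y 3), y 4)

/-- inverse of `toQ` -/
def ofQ (q : Q) : Fin 5 → I := ![q.1.1.1.1, q.1.1.1.2, q.1.1.2, q.1.2, q.2]

theorem toQ_cont : Continuous toQ := by unfold toQ; fun_prop

theorem ofQ_cont : Continuous ofQ := by
  unfold ofQ
  refine continuous_pi fun i => ?_
  fin_cases i <;> simp <;> fun_prop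

theorem ofQ_toQ (y : Fin 5 → I) : ofQ (toQ y) = y := by
  funext i; fin_cases i <;> rfl

theorem toQ_mem {y : Fin 5 → I} (h : y ∈ Cube.boundary (Fin 5)) : toQ y ∈ K4 := by
  obtain ⟨i, h⟩ := h
  fin_cases i
  · exact Or.inl (Or.inl (Or.inl (Or.inl h)))
  · exact Or.inl (Or.inl (Or.inl (Or.inr h)))
  · exact Or.inl (Or.inl (Or.inr h))
  · exact Or.inl (Or.inr h)
  · exact Or.inr h

theorem ofQ_mem {q : Q} (h : q ∈ K4) : ofQ q ∈ Cube.boundary (Fin 5) := by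
  rcases h with (((h | h) | h) | h) | h
  · exact ⟨0, h⟩
  · exact ⟨1, h⟩
  · exact ⟨2, h⟩
  · exact ⟨3, h⟩
  · exact ⟨4, h⟩

theorem pi5_sub {Z : Type} [TopologicalSpace Z] (z : Z) (h : ∀ (f : C(Q, Z)), (∀ q ∈ K4, f q = z) →
    JoinedIn {h : C(Q, Z) | ∀ x ∈ K4, h x = z} f (ContinuousMap.const Q z)) :
    Subsingleton (HomotopyGroup (Fin 5) Z z) := by
  have key : ∀ f : GenLoop (Fin 5) Z z, GenLoop.Homotopic f GenLoop.const := fun f => by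
    obtain ⟨H, H0, H1, H2⟩ := homotopy_of_joinedIn (h ⟨fun q => f (ofQ q), f.1.continuous.comp ofQ_cont⟩
      fun q hq => f.2 _ (ofQ_mem hq))
    refine ⟨⟨⟨⟨fun w => H (w.1, toQ w.2), H.continuous.comp (continuous_fst.prodMk (toQ_cont.comp continuous_snd))⟩, ?_, ?_⟩, ?_⟩⟩
    · intro y
      change H (0, toQ y) = f y
      rw [H0]
      change f (ofQ (toQ y)) = f y
      rw [ofQ_toQ]
    · intro y
      change H (1, toQ y) = z
      rw [H1]; rfl
    · intro t y hy
      change H (t, toQ y) = f y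
      exact (H2 t _ (toQ_mem hy)).trans (f.2 y hy).symm
  refine ⟨fun a b => ?_⟩
  induction a using Quotient.inductionOn with | _ a =>
  induction b using Quotient.inductionOn with | _ b =>
  exact Quotient.sound ((key a).trans (key b).symm)

end S6

/-- There exists a fiber bundle over `S⁶` with fiber `S²` whose total space `Z` is simply
connected and has trivial fifth homotopy group at every basepoint. -/
theorem exists_sphere_bundle_over_S6_simplyConnected_trivial_pi5 :
    ∃ (Z : Type) (_ : TopologicalSpace Z) (p : Z → unitSphere 6),
      IsFiberBundleWithFiber (unitSphere 2) p ∧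
        SimplyConnectedSpace Z ∧
        ∀ z : Z, Subsingleton (HomotopyGroup (Fin 5) Z z) := by
  obtain ⟨P, hP, h⟩ := S6.final_Q
  exact ⟨S6.ZP P, inferInstance, fun z => z.1.1, hP.bundle, hP.sc, fun z => S6.pi5_sub z fun f hf => h f z hf⟩
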